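/- Let φ_1,…,φ_m ∈ ℚ(X) be non-zero multiplicatively independent rational functions. There exist effectively computable constants c_1 and C depending only on φ_1,…,φ_m such that for all integers K, L ≥ 1 and every prime p > exp(c_1·K·L), the number of α in the algebraic closure of 𝔽_p for which there exist linearly independent vectors (k_1,…,k_m), (ℓ_1,…,ℓ_m) ∈ ℤ^m with max|k_i| ≤ K, max|ℓ_i| ≤ L and ∏_i φ_i(α)^{k_i} = ∏_i φ_i(α)^{ℓ_i} = 1 (in the reduction of the φ_i mod p) is at most C. -/

import Mathlib

open Polynomial

/-- The set `𝒜_φ(p, K, L)` of elements `α ∈ 𝔽̄_p` (not a zero or pole of any reduced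
`φᵢ = fᵢ/gᵢ`) such that the values `φᵢ(α)` satisfy two linearly independent multiplicative
relations with exponents bounded by `K` and `L` respectively. -/
def depSet (m : ℕ) (f g : Fin m → Polynomial ℤ) (K L : ℕ) (p : ℕ) [Fact p.Prime] :
    Set (AlgebraicClosure (ZMod p)) :=
  {α : AlgebraicClosure (ZMod p) |
    (∀ i, Polynomial.eval₂ (Int.castRingHom (AlgebraicClosure (ZMod p))) α (f i) ≠ 0 ∧
      Polynomial.eval₂ (Int.castRingHom (AlgebraicClosure (ZMod p))) α (g i) ≠ 0) ∧
    ∃ k l : Fin m → ℤ, LinearIndependent ℤ ![k, l] ∧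
      (∀ i, |k i| ≤ (K : ℤ)) ∧ (∀ i, |l i| ≤ (L : ℤ)) ∧
      (∏ i, (Polynomial.eval₂ (Int.castRingHom (AlgebraicClosure (ZMod p))) α (f i) /
        Polynomial.eval₂ (Int.castRingHom (AlgebraicClosure (ZMod p))) α (g i)) ^ (k i)) = 1 ∧
      (∏ i, (Polynomial.eval₂ (Int.castRingHom (AlgebraicClosure (ZMod p))) α (f i) /
        Polynomial.eval₂ (Int.castRingHom (AlgebraicClosure (ZMod p))) α (g i)) ^ (l i)) = 1}

section
open Polynomial NumberField
open Polynomial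

namespace MZ
open NumberField

abbrev Wp (K : Type) [Field K] [NumberField K] (F : Finset (FinitePlace K)) : Type :=
  (K →+* ℂ) ⊕ {v : FinitePlace K // v ∈ F}

section
variable {K : Type} [Field K] [NumberField K] {F : Finset (FinitePlace K)}

noncomputable instance instFintypeWp : Fintype (Wp K F) := inferInstance

noncomputable def ab : Wp K F → AbsoluteValue K ℝ
  | .inl σ => place σ
  | .inr v => v.1.1

def dd : Wp K F → ℕ
  | .inl _ => 1
  | .inr _ => 0

@[simp] lemma ab_inl (σ : K →+* ℂ) (x : K) : ab (F := F) (.inl σ) x = ‖σ x‖ := rfl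
@[simp] lemma ab_inr (v : {v : FinitePlace K // v ∈ F}) (x : K) : ab (F := F) (.inr v) x = v.1 x := rfl
@[simp] lemma dd_inl (σ : K →+* ℂ) : dd (F := F) (.inl σ) = 1 := rfl
@[simp] lemma dd_inr (v : {v : FinitePlace K // v ∈ F}) : dd (F := F) (.inr v) = 0 := rfl

lemma sum_dd : ∑ w : Wp K F, dd w = Module.finrank ℚ K := by
  rw [Fintype.sum_sum_type]
  simp [NumberField.Embeddings.card]

lemma ab_sum_le {ι : Type*} (w : Wp K F) (s : Finset ι) (x : ι → K) (B : ℝ) (hB : 0 ≤ B)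
    (h : ∀ i ∈ s, ab w (x i) ≤ B) : ab w (∑ i ∈ s, x i) ≤ (s.card : ℝ) ^ dd w * B := by
  classical
  rcases w with σ | v
  · simp only [ab_inl, dd_inl, pow_one] at *
    rw [map_sum]
    calc _ ≤ ∑ i ∈ s, ‖σ (x i)‖ := norm_sum_le _ _
      _ ≤ _ := by
        have := Finset.sum_le_card_nsmul s (fun i => ‖σ (x i)‖) B h
        simpa using this
  · simp only [ab_inr, dd_inr, pow_zero, one_mul] at *
    induction s using Finset.induction_on with
    | empty => simpa using hB
    | insert a s ha ih =>
      rw [Finset.sum_insert ha]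
      refine (FinitePlace.add_le v.1 _ _).trans (max_le (h a (by simp)) (ih fun i hi => h i (by simp [hi])))

lemma ab_add_le (w : Wp K F) (x y : K) (B : ℝ) (hx : ab w x ≤ B) (hy : ab w y ≤ B) :
    ab w (x + y) ≤ 2 ^ dd w * B := by
  rcases w with σ | v
  · simp only [ab_inl, dd_inl, pow_one, map_add] at *
    linarith [norm_add_le (σ x) (σ y)]
  · simp only [ab_inr, dd_inr, pow_zero, one_mul] at *
    exact (FinitePlace.add_le v.1 _ _).trans (max_le hx hy)

lemma fp_int_le (v : FinitePlace K) (n : ℤ) : v (n : K) ≤ 1 := by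
  have := FinitePlace.norm_le_one (K := K) v.maximalIdeal (n : 𝓞 K)
  rw [FinitePlace.norm_embedding_eq] at this
  simpa using this

lemma ab_int_le (w : Wp K F) (n : ℤ) : ab w (n : K) ≤ |(n : ℝ)| ^ dd w := by
  rcases w with σ | v
  · simp
  · simpa using fp_int_le v.1 n

lemma ab_int_inl (σ : K →+* ℂ) (n : ℤ) : ab (F := F) (.inl σ) (n : K) = |(n : ℝ)| := by simp

lemma prod_emb (x : K) : ∏ σ : K →+* ℂ, ‖σ x‖ = |(Algebra.norm ℚ x : ℝ)| := by
  have h := Algebra.norm_eq_prod_embeddings ℚ ℂ x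
  rw [← norm_prod, ← Real.norm_eq_abs]
  have h2 : ∏ σ : K →+* ℂ, σ x = ∏ σ : K →ₐ[ℚ] ℂ, σ x :=
    Fintype.prod_equiv (RingHom.equivRatAlgHom K ℂ) _ _ (fun σ => rfl)
  rw [h2, ← h]
  simp only [eq_ratCast, Complex.norm_ratCast, Real.norm_eq_abs]

def Good (F : Finset (FinitePlace K)) (x : K) : Prop := x ≠ 0 ∧ ∀ v : FinitePlace K, v ∉ F → v x = 1

lemma exists_good (S : Finset K) : ∃ F : Finset (FinitePlace K), ∀ x ∈ S, x ≠ 0 → Good F x := by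
  classical
  have : ∀ x : K, ∃ F : Finset (FinitePlace K), x ≠ 0 → Good F x := by
    intro x
    by_cases hx : x = 0
    · exact ⟨∅, fun h => absurd hx h⟩
    · have : (Function.mulSupport fun v : FinitePlace K => v x).Finite := FinitePlace.hasFiniteMulSupport hx
      refine ⟨this.toFinset, fun _ => ⟨hx, fun v hv => ?_⟩⟩
      simpa using hv
  choose f hf using this
  refine ⟨S.biUnion f, fun x hx h0 => ⟨h0, fun v hv => (hf x h0).2 v fun hv' => hv ?_⟩⟩
  exact Finset.mem_biUnion.2 ⟨x, hx, hv'⟩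

lemma PF_ineq (x : K) (hx : x ≠ 0) (h : ∀ v : FinitePlace K, v ∉ F → v x ≤ 1) :
    0 ≤ ∑ w : Wp K F, Real.log (ab w x) := by
  classical
  have hfin : (Function.mulSupport fun v : FinitePlace K => v x).Finite := FinitePlace.hasFiniteMulSupport hx
  have hN : (Algebra.norm ℚ x : ℝ) ≠ 0 := by
    have : Algebra.norm ℚ x ≠ 0 := by rwa [Ne, Algebra.norm_eq_zero_iff]
    exact_mod_cast this
  have h1 := FinitePlace.prod_eq_inv_abs_norm hx
  rw [finprod_eq_prod_of_mulSupport_subset (s := F ∪ hfin.toFinset) _ (by intro v hv; simpa using Or.inr hv)] at h1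
  rw [Fintype.sum_sum_type, ← Real.log_prod, ← Real.log_prod]
  rotate_left
  · intro v _; simp [hx]
  · intro v _; simp [hx]
  simp only [ab_inl, ab_inr]
  rw [prod_emb]
  have h2 : ∏ v : {v : FinitePlace K // v ∈ F}, v.1 x = ∏ v ∈ F, v x := by
    rw [← Finset.prod_coe_sort F (fun v => v x)]
  rw [h2]
  have hpos : ∀ v : FinitePlace K, 0 < v x := fun v => FinitePlace.pos_iff.2 hx
  have h3 : (|(Algebra.norm ℚ x : ℝ)|)⁻¹ ≤ ∏ v ∈ F, v x := by
    have h4 : ∏ v ∈ F ∪ hfin.toFinset, v x ≤ ∏ v ∈ F, v x := by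
      rw [← Finset.prod_sdiff (Finset.subset_union_left (s₁ := F) (s₂ := hfin.toFinset))]
      refine mul_le_of_le_one_left (Finset.prod_nonneg fun v _ => (hpos v).le) ?_
      refine Finset.prod_le_one (fun v _ => (hpos v).le) fun v hv => h v ?_
      simp at hv; exact hv.2
    refine le_trans (le_of_eq ?_) h4
    rw [h1]; simp
  have h5 := Real.log_le_log (by positivity) h3
  rw [Real.log_inv] at h5
  linarith

lemma PF (x : K) (hx : Good F x) : ∑ w : Wp K F, Real.log (ab w x) = 0 := by
  apply le_antisymm
  · have := PF_ineq (F := F) (x⁻¹) (inv_ne_zero hx.1) (fun v hv => by simp [hx.2 v hv])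
    simp only [map_inv₀, Real.log_inv, Finset.sum_neg_distrib] at this
    linarith
  · exact PF_ineq x hx.1 (fun v hv => by simp [hx.2 v hv])

lemma int_PF (n : ℤ) (hn : n ≠ 0) : 0 ≤ ∑ w : Wp K F, Real.log (ab w (n : K)) :=
  PF_ineq _ (by exact_mod_cast hn) (fun v _ => fp_int_le v n)

end
end MZ
end

section
open Polynomial NumberField
open Polynomial

namespace MZ
open NumberField

section
variable {K : Type} [Field K] [NumberField K]

lemma trace_emb (x : 𝓞 K) : ((Algebra.trace ℤ (𝓞 K) x : ℤ) : ℂ) = ∑ σ : K →+* ℂ, σ (x : K) := by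
  have h := trace_eq_sum_embeddings (K := ℚ) (L := K) ℂ (x := (x : K))
  have h2 : ∑ σ : K →+* ℂ, σ (x : K) = ∑ σ : K →ₐ[ℚ] ℂ, σ (x : K) :=
    Fintype.sum_equiv (RingHom.equivRatAlgHom K ℂ) _ _ (fun σ => rfl)
  rw [h2, ← h, ← Algebra.coe_trace_int]
  simp

lemma trace_frob (p : ℕ) [Fact p.Prime] (x : 𝓞 K) :
    (p : ℤ) ∣ Algebra.trace ℤ (𝓞 K) (x ^ p) - Algebra.trace ℤ (𝓞 K) x := by
  classical
  rw [← ZMod.intCast_zmod_eq_zero_iff_dvd]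
  let b := RingOfIntegers.basis K
  rw [Algebra.trace_eq_matrix_trace b, Algebra.trace_eq_matrix_trace b, map_pow]
  set M := Algebra.leftMulMatrix b x
  have h1 : ∀ N : Matrix (Module.Free.ChooseBasisIndex ℤ (𝓞 K)) (Module.Free.ChooseBasisIndex ℤ (𝓞 K)) ℤ, ((Matrix.trace N : ℤ) : ZMod p) = Matrix.trace (N.map (Int.castRingHom (ZMod p))) := by
    intro N; simp [Matrix.trace]
  push_cast
  rw [h1, h1]
  have h2 : (M ^ p).map (Int.castRingHom (ZMod p)) = (M.map (Int.castRingHom (ZMod p))) ^ p :=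
    map_pow (Int.castRingHom (ZMod p)).mapMatrix M p
  rw [h2, ZMod.trace_pow_card, ZMod.pow_card, sub_self]

lemma finrank_pos' : 0 < Module.finrank ℚ K := Module.finrank_pos

lemma lehmer_int (x : 𝓞 K) (hx : x ≠ 0)
    (h : ∀ σ : K →+* ℂ, ‖σ (x : K)‖ ^ (16 * (Module.finrank ℚ K) ^ 2) < 2) :
    ∃ n : ℕ, 0 < n ∧ x ^ n = 1 := by
  classical
  set D := Module.finrank ℚ K with hD
  have hD0 : 0 < D := finrank_pos'
  obtain ⟨p, hp, hp1, hp2⟩ := Nat.exists_prime_lt_and_le_two_mul (4 * D) (by omega)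
  have := Fact.mk hp
  have hcard : Fintype.card (K →+* ℂ) = D := NumberField.Embeddings.card K ℂ
  have hpow : ∀ m : ℕ, m ≤ 16 * D ^ 2 → ∀ σ : K →+* ℂ, ‖σ (x : K)‖ ^ m < 2 := by
    intro m hm σ
    rcases le_total ‖σ (x : K)‖ 1 with h1 | h1
    · exact (pow_le_one₀ (norm_nonneg _) h1).trans_lt one_lt_two
    · exact (pow_le_pow_right₀ h1 hm).trans_lt (h σ)
  let T : ℕ → ℤ := fun m => Algebra.trace ℤ (𝓞 K) (x ^ m)
  have hT : ∀ m, ((T m : ℤ) : ℂ) = ∑ σ : K →+* ℂ, σ (x : K) ^ m := by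
    intro m; simp only [T]; rw [trace_emb]; simp
  have hTb : ∀ m, m ≤ 16 * D ^ 2 → |T m| < 2 * D := by
    intro m hm
    have : ‖((T m : ℤ) : ℂ)‖ < 2 * D := by
      rw [hT]
      refine (norm_sum_le _ _).trans_lt ?_
      calc _ < ∑ σ : K →+* ℂ, (2 : ℝ) := by
            apply Finset.sum_lt_sum_of_nonempty
            · rw [Finset.univ_nonempty_iff, ← Fintype.card_pos_iff, hcard]; exact hD0
            · intro σ _; rw [norm_pow]; exact hpow m hm σ
        _ = _ := by simp [hcard, mul_comm]
    rw [Complex.norm_intCast] at this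
    exact_mod_cast this
  have hTeq : ∀ k, k ≤ 2 * D → T (p * k) = T k := by
    intro k hk
    have h1 : p * k ≤ 16 * D ^ 2 := by
      calc p * k ≤ (2 * (4 * D)) * (2 * D) := Nat.mul_le_mul hp2 hk
        _ = _ := by ring
    have h2 : k ≤ 16 * D ^ 2 := (Nat.le_mul_of_pos_left k hp.pos).trans h1
    have h3 : (p : ℤ) ∣ T (p * k) - T k := by
      have := trace_frob p (x ^ k)
      simpa only [T, ← pow_mul, mul_comm k p] using this
    have h4 : |T (p * k) - T k| < p := by
      have a1 := hTb _ h1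
      have a2 := hTb _ h2
      have := abs_sub (T (p * k)) (T k)
      have : (4 * D : ℤ) < p := by exact_mod_cast hp1
      linarith
    have := Int.eq_zero_of_abs_lt_dvd h3 h4
    linarith
  have hpoly : ∀ g : ℂ[X], g.natDegree ≤ 2 * D →
      ∑ σ : K →+* ℂ, g.eval (σ (x : K) ^ p) = ∑ σ : K →+* ℂ, g.eval (σ (x : K)) := by
    intro g hg
    simp_rw [Polynomial.eval_eq_sum_range' (Nat.lt_succ_of_le hg)]
    rw [Finset.sum_comm, Finset.sum_comm (s := Finset.univ)]
    apply Finset.sum_congr rfl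
    intro k hk
    rw [← Finset.mul_sum, ← Finset.mul_sum]
    congr 1
    simp_rw [← pow_mul]
    rw [← hT, ← hT, hTeq k (by simpa [Nat.lt_succ_iff] using hk)]
  let S : Finset ℂ := Finset.univ.image (fun σ : K →+* ℂ => σ (x : K)) ∪
    Finset.univ.image (fun σ : K →+* ℂ => σ (x : K) ^ p)
  have hScard : S.card ≤ 2 * D := by
    refine (Finset.card_union_le _ _).trans ?_
    have a := Finset.card_image_le (s := Finset.univ) (f := fun σ : K →+* ℂ => σ (x : K))
    have b := Finset.card_image_le (s := Finset.univ) (f := fun σ : K →+* ℂ => σ (x : K) ^ p)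
    rw [Finset.card_univ, hcard] at a b
    omega
  have hclosed : ∀ σ₀ : K →+* ℂ, ∃ σ : K →+* ℂ, σ (x : K) = σ₀ (x : K) ^ p := by
    intro σ₀
    by_contra hcon
    push Not at hcon
    set y := σ₀ (x : K) ^ p with hy
    let g : ℂ[X] := ∏ z ∈ S.erase y, (X - C z)
    have hg := hpoly g (by
      simp only [g]
      rw [natDegree_prod_of_monic _ _ (fun z _ => monic_X_sub_C z)]
      simp only [natDegree_X_sub_C, Finset.sum_const, smul_eq_mul, mul_one]
      exact (Finset.card_erase_le).trans hScard)
    have hg0 : ∀ z ∈ S, z ≠ y → g.eval z = 0 := by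
      intro z hz hzy
      simp only [g, eval_prod]
      exact Finset.prod_eq_zero (Finset.mem_erase.2 ⟨hzy, hz⟩) (by simp)
    have hgy : g.eval y ≠ 0 := by
      simp only [g, eval_prod]
      refine Finset.prod_ne_zero_iff.2 fun z hz => ?_
      have := (Finset.mem_erase.1 hz).1
      simp [sub_ne_zero, this.symm]
    have hR : ∑ σ : K →+* ℂ, g.eval (σ (x : K)) = 0 :=
      Finset.sum_eq_zero fun σ _ => hg0 _ (by simp [S]) (hcon σ)
    rw [hR] at hg
    have hL : ∑ σ : K →+* ℂ, g.eval (σ (x : K) ^ p) =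
        ((Finset.univ.filter fun σ : K →+* ℂ => σ (x : K) ^ p = y).card : ℂ) * g.eval y := by
      rw [Finset.card_filter]
      push_cast
      rw [Finset.sum_mul]
      apply Finset.sum_congr rfl
      intro σ _
      split_ifs with hh
      · rw [hh, one_mul]
      · rw [zero_mul]; exact hg0 _ (by simp [S]) hh
    rw [hL] at hg
    rcases mul_eq_zero.1 hg with h1 | h1
    · have h2 : (Finset.univ.filter fun σ : K →+* ℂ => σ (x : K) ^ p = y).card = 0 := by exact_mod_cast h1
      rw [Finset.card_eq_zero, Finset.filter_eq_empty_iff] at h2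
      exact h2 (Finset.mem_univ σ₀) rfl
    · exact hgy h1
  obtain ⟨σ₀⟩ : Nonempty (K →+* ℂ) := by
    rw [← Fintype.card_pos_iff, hcard]; exact hD0
  have hit : ∀ k : ℕ, ∃ σ : K →+* ℂ, σ (x : K) = σ₀ (x : K) ^ (p ^ k) := by
    intro k
    induction k with
    | zero => exact ⟨σ₀, by simp⟩
    | succ k ih =>
      obtain ⟨σ, hσ⟩ := ih
      obtain ⟨τ, hτ⟩ := hclosed σ
      exact ⟨τ, by rw [hτ, hσ, ← pow_mul, pow_succ]⟩
  choose f hf using hit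
  obtain ⟨a, b, hab, heq⟩ := Finite.exists_ne_map_eq_of_infinite f
  wlog hlt : a < b generalizing a b
  · exact this b a hab.symm heq.symm (by omega)
  have hx0 : σ₀ (x : K) ≠ 0 := by simpa using hx
  have h1 : σ₀ (x : K) ^ (p ^ a) = σ₀ (x : K) ^ (p ^ b) := by rw [← hf, ← hf, heq]
  have hlt' : p ^ a < p ^ b := Nat.pow_lt_pow_right hp.one_lt hlt
  refine ⟨p ^ b - p ^ a, by omega, ?_⟩
  have h2 : σ₀ (x : K) ^ (p ^ b - p ^ a) = 1 := by
    have := pow_sub₀ _ hx0 hlt'.le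
    rw [this, ← h1, mul_inv_cancel₀ (pow_ne_zero _ hx0)]
  have h3 : σ₀ ((x ^ (p ^ b - p ^ a) : 𝓞 K) : K) = σ₀ 1 := by simpa using h2
  exact_mod_cast σ₀.injective h3

lemma totient_lower (n : ℕ) (hn : 0 < n) : n ≤ 2 * (Nat.totient n) ^ 2 ∧ (Odd n → n ≤ (Nat.totient n)^2) := by
  induction n using Nat.recOnPosPrimePosCoprime with
  | prime_pow p k hp hk =>
    have key : p ≠ 2 ∨ 2 ≤ k → p ^ k ≤ (Nat.totient (p ^ k)) ^ 2 := by
      intro hc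
      rw [Nat.totient_prime_pow hp hk]
      obtain ⟨j, rfl⟩ : ∃ j, k = j + 1 := ⟨k - 1, by omega⟩
      simp only [Nat.add_sub_cancel]
      have hp2 := hp.two_le
      obtain ⟨q, rfl⟩ : ∃ q, p = q + 2 := ⟨p - 2, by omega⟩
      have e : q + 2 - 1 = q + 1 := by omega
      rw [e]
      by_cases hq : q = 0
      · subst hq
        have hj : 1 ≤ j := by omega
        obtain ⟨i, rfl⟩ : ∃ i, j = i + 1 := ⟨j - 1, by omega⟩
        have := Nat.one_le_two_pow (n := i)
        simp only [zero_add, mul_one]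
        have e2 : 2 ^ (i + 1 + 1) = 4 * 2 ^ i := by ring
        have e3 : (2 ^ (i + 1)) ^ 2 = 4 * 2 ^ i * 2 ^ i := by ring
        rw [e2, e3]
        nlinarith
      · have h1 : 1 ≤ (q + 2) ^ j := Nat.one_le_pow _ _ (by omega)
        have h2 : q + 2 ≤ (q + 1) ^ 2 := by nlinarith [Nat.pos_of_ne_zero hq]
        calc (q + 2) ^ (j + 1) = (q + 2) ^ j * (q + 2) := pow_succ _ _
          _ ≤ ((q + 2) ^ j * (q + 2) ^ j) * (q + 1) ^ 2 := by
            apply Nat.mul_le_mul _ h2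
            exact Nat.le_mul_of_pos_left _ (by omega)
          _ = _ := by ring
    constructor
    · by_cases hc : p ≠ 2 ∨ 2 ≤ k
      · linarith [key hc]
      · push Not at hc
        obtain ⟨rfl, hk2⟩ := hc
        obtain rfl : k = 1 := by omega
        simp
    · intro ho
      apply key
      left
      rintro rfl
      rw [Nat.odd_pow_iff (by omega)] at ho
      exact absurd ho (by decide)
  | zero => omega
  | one => simp
  | coprime a b ha hb hab iha ihb =>
    obtain ⟨ha1, ha2⟩ := iha (by omega)
    obtain ⟨hb1, hb2⟩ := ihb (by omega)
    rw [Nat.totient_mul hab]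
    constructor
    · rcases Nat.even_or_odd a with he | ho
      · have hbo : Odd b := by
          rw [← Nat.not_even_iff_odd]
          intro hbe
          have := Nat.dvd_gcd he.two_dvd hbe.two_dvd
          rw [hab] at this
          omega
        calc a * b ≤ (2 * a.totient ^ 2) * (b.totient ^ 2) := Nat.mul_le_mul ha1 (hb2 hbo)
          _ = _ := by ring
      · calc a * b ≤ (a.totient ^ 2) * (2 * b.totient ^ 2) := Nat.mul_le_mul (ha2 ho) hb1
          _ = _ := by ring
    · intro ho
      rw [Nat.odd_mul] at ho
      calc a * b ≤ (a.totient ^ 2) * (b.totient ^ 2) := Nat.mul_le_mul (ha2 ho.1) (hb2 ho.2)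
          _ = _ := by ring

lemma rootOfUnity_order (x : K) (n : ℕ) (hn : 0 < n) (h : x ^ n = 1) :
    ∃ m : ℕ, 0 < m ∧ m ≤ 2 * (Module.finrank ℚ K) ^ 2 ∧ x ^ m = 1 := by
  have ho : 0 < orderOf x := orderOf_pos_iff.2 (isOfFinOrder_iff_pow_eq_one.2 ⟨n, hn, h⟩)
  refine ⟨orderOf x, ho, ?_, pow_orderOf_eq_one x⟩
  refine (totient_lower _ ho).1.trans ?_
  have hprim := IsPrimitiveRoot.orderOf x
  have : NeZero ((orderOf x : ℕ) : ℚ) := ⟨by exact_mod_cast ho.ne'⟩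
  have h1 := hprim.minpoly_eq_cyclotomic_of_irreducible (K := ℚ) (Polynomial.cyclotomic.irreducible_rat ho)
  have h2 : (minpoly ℚ x).natDegree ≤ Module.finrank ℚ K := minpoly.natDegree_le x
  rw [← h1, natDegree_cyclotomic] at h2
  gcongr

lemma fp_zpow (v : FinitePlace K) (x : K) (hx : x ≠ 0) :
    ∃ (N : ℕ) (z : ℤ), 2 ≤ N ∧ v x = (N : ℝ) ^ z := by
  have h := FinitePlace.norm_embedding_eq v x
  rw [FinitePlace.norm_embedding, HeightOneSpectrum.adicAbv_def] at h
  rw [WithZeroMulInt.toNNReal_neg_apply _ ((Valuation.ne_zero_iff _).2 hx)] at h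
  exact ⟨Ideal.absNorm v.maximalIdeal.asIdeal, _, HeightOneSpectrum.one_lt_absNorm _, by
    rw [← h]; push_cast; rfl⟩

lemma fp_two_le (v : FinitePlace K) (x : K) (h : 1 < v x) : 2 ≤ v x := by
  have hx : x ≠ 0 := by rintro rfl; simp at h; linarith
  obtain ⟨N, z, hN, hz⟩ := fp_zpow v x hx
  have hN' : (2 : ℝ) ≤ N := by exact_mod_cast hN
  rw [hz] at h ⊢
  have hz1 : 1 ≤ z := by
    by_contra hc
    have : (N : ℝ) ^ z ≤ 1 := zpow_le_one_of_nonpos₀ (by linarith) (by omega)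
    linarith
  calc (2 : ℝ) ≤ N := hN'
    _ = (N : ℝ) ^ (1 : ℤ) := by simp
    _ ≤ _ := zpow_le_zpow_right₀ (by linarith) hz1

lemma integral_of_fp (x : K) (h : ∀ v : FinitePlace K, v x ≤ 1) : ∃ y : 𝓞 K, (y : K) = x := by
  apply IsDedekindDomain.HeightOneSpectrum.mem_integers_of_valuation_le_one K x
  intro v
  have := h (FinitePlace.mk v)
  rw [FinitePlace.mk_apply, FinitePlace.norm_embedding, HeightOneSpectrum.adicAbv_def] at this
  have h2 : WithZeroMulInt.toNNReal (HeightOneSpectrum.absNorm_ne_zero v) ((IsDedekindDomain.HeightOneSpectrum.valuation K v) x) ≤ 1 := by exact_mod_cast this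
  rwa [WithZeroMulInt.toNNReal_le_one_iff (HeightOneSpectrum.one_lt_absNorm_nnreal v)] at h2

lemma lehmer (F : Finset (FinitePlace K)) (x : K) (hx : Good F x)
    (h : ∑ w : Wp K F, Real.posLog (ab w x) < Real.log 2 / (16 * (Module.finrank ℚ K : ℝ) ^ 2)) :
    ∃ m : ℕ, 0 < m ∧ m ≤ 2 * (Module.finrank ℚ K) ^ 2 ∧ x ^ m = 1 := by
  have hD : 0 < Module.finrank ℚ K := finrank_pos'
  have hD' : (1 : ℝ) ≤ Module.finrank ℚ K := by exact_mod_cast hD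
  have hl2 : 0 < Real.log 2 := Real.log_pos one_lt_two
  have hw : ∀ w : Wp K F, Real.posLog (ab w x) < Real.log 2 / (16 * (Module.finrank ℚ K : ℝ) ^ 2) := by
    intro w
    refine lt_of_le_of_lt ?_ h
    exact Finset.single_le_sum (f := fun w : Wp K F => Real.posLog (ab w x))
      (fun w _ => Real.posLog_nonneg) (Finset.mem_univ w)
  have hfp : ∀ v : FinitePlace K, v x ≤ 1 := by
    intro v
    by_cases hv : v ∈ F
    · by_contra hc
      push Not at hc
      have h2 := fp_two_le v x hc
      have h3 := hw (.inr ⟨v, hv⟩)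
      simp only [ab_inr] at h3
      have h4 : Real.log 2 ≤ Real.posLog (v x) := by
        refine (Real.log_le_log (by norm_num) h2).trans ?_
        simp [Real.posLog]
      have h5 : Real.log 2 / (16 * (Module.finrank ℚ K : ℝ) ^ 2) ≤ Real.log 2 :=
        div_le_self hl2.le (by nlinarith)
      linarith
    · exact (hx.2 v hv).le
  obtain ⟨y, rfl⟩ := integral_of_fp x hfp
  have hy : y ≠ 0 := by rintro rfl; exact hx.1 (by simp)
  obtain ⟨n, hn, h1⟩ := lehmer_int y hy (by
    intro σ
    have h3 := hw (.inl σ)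
    simp only [ab_inl] at h3
    have hpos : 0 < ‖σ (y : K)‖ := by simpa using hy
    rw [← Real.log_lt_log_iff (by positivity) (by norm_num), Real.log_pow]
    have h4 : Real.log ‖σ (y : K)‖ ≤ Real.posLog ‖σ (y : K)‖ := by simp [Real.posLog]
    rw [lt_div_iff₀ (by positivity)] at h3
    push_cast
    nlinarith)
  exact rootOfUnity_order _ n hn (by exact_mod_cast congrArg (fun z : 𝓞 K => (z : K)) h1)

end
end MZ
end

section
open Polynomial NumberField
open Polynomial

namespace MZ
open Metric

lemma factor_zeros (U : Set ℂ) (hU : IsOpen U) (S : Finset ℂ) (hS : ∀ s ∈ S, s ∈ U) :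
    ∀ F : ℂ → ℂ, DifferentiableOn ℂ F U → (∀ s ∈ S, F s = 0) →
    ∃ G : ℂ → ℂ, DifferentiableOn ℂ G U ∧ ∀ z, F z = (∏ s ∈ S, (z - s)) * G z := by
  classical
  induction S using Finset.induction_on with
  | empty => intro F hF _; exact ⟨F, hF, by simp⟩
  | insert a S ha ih =>
    intro F hF h0
    have ha' : F a = 0 := h0 a (by simp)
    have h1 : DifferentiableOn ℂ (dslope F a) U :=
      (Complex.differentiableOn_dslope (hU.mem_nhds (hS a (by simp)))).2 hF
    have h2 : ∀ z, F z = (z - a) * dslope F a z := by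
      intro z
      have := sub_smul_dslope F a z
      rw [ha', sub_zero, smul_eq_mul] at this
      exact this.symm
    obtain ⟨G, hG, hG2⟩ := ih (fun s hs => hS s (by simp [hs])) (dslope F a) h1 (by
      intro s hs
      have hsa : s - a ≠ 0 := sub_ne_zero.2 (by rintro rfl; exact ha hs)
      have := h2 s
      rw [h0 s (by simp [hs])] at this
      exact (mul_eq_zero.1 this.symm).resolve_left hsa)
    refine ⟨G, hG, fun z => ?_⟩
    rw [h2, hG2, Finset.prod_insert ha, mul_assoc]

lemma schwarz_zeros (z₀ : ℂ) (ρ : ℝ) (hρ : 0 < ρ) (F : ℂ → ℂ) (hF : DifferentiableOn ℂ F (ball z₀ (8 * ρ)))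
    (M : ℝ) (hM : ∀ z ∈ closedBall z₀ (4 * ρ), ‖F z‖ ≤ M)
    (S : Finset ℂ) (hS : ∀ s ∈ S, s ∈ closedBall z₀ ρ) (h0 : ∀ s ∈ S, F s = 0)
    (z : ℂ) (hz : z ∈ closedBall z₀ ρ) : ‖F z‖ ≤ (2 / 3) ^ S.card * M := by
  obtain ⟨G, hG, hFG⟩ := factor_zeros (ball z₀ (8 * ρ)) isOpen_ball S
    (fun s hs => closedBall_subset_ball (by linarith) (hS s hs)) F hF h0
  have hsub : closedBall z₀ (4 * ρ) ⊆ ball z₀ (8 * ρ) := closedBall_subset_ball (by linarith)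
  have hdc : DiffContOnCl ℂ G (ball z₀ (4 * ρ)) := by
    apply DifferentiableOn.diffContOnCl
    rw [closure_ball _ (by positivity)]
    exact hG.mono hsub
  have hGb : ∀ z ∈ frontier (ball z₀ (4 * ρ)), ‖G z‖ ≤ M / (3 * ρ) ^ S.card := by
    intro w hw
    rw [frontier_ball _ (by positivity)] at hw
    rw [le_div_iff₀ (by positivity)]
    refine le_trans ?_ (hM w (sphere_subset_closedBall hw))
    rw [hFG w, norm_mul, norm_prod, mul_comm]
    gcongr
    rw [← Finset.prod_const]
    refine Finset.prod_le_prod (fun _ _ => by positivity) fun s hs => ?_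
    have h1 := hS s hs
    rw [mem_sphere, dist_eq_norm] at hw
    rw [mem_closedBall, dist_eq_norm] at h1
    have : ‖w - z₀‖ ≤ ‖w - s‖ + ‖s - z₀‖ := by
      simpa using norm_add_le (w - s) (s - z₀)
    linarith
  have hz4 : z ∈ closure (ball z₀ (4 * ρ)) := by
    rw [closure_ball _ (by positivity)]
    exact closedBall_subset_closedBall (by linarith) hz
  have hGz := Complex.norm_le_of_forall_mem_frontier_norm_le isBounded_ball hdc hGb hz4
  rw [hFG z, norm_mul, norm_prod]
  have h2 : ∏ s ∈ S, ‖z - s‖ ≤ (2 * ρ) ^ S.card := by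
    rw [← Finset.prod_const]
    refine Finset.prod_le_prod (fun _ _ => by positivity) fun s hs => ?_
    have h1 := hS s hs
    rw [mem_closedBall, dist_eq_norm] at h1 hz
    have : ‖z - s‖ ≤ ‖z - z₀‖ + ‖s - z₀‖ := by
      simpa using norm_sub_le (z - z₀) (s - z₀)
    linarith
  calc _ ≤ (2 * ρ) ^ S.card * (M / (3 * ρ) ^ S.card) := by gcongr
    _ = _ := by
      rw [← mul_div_assoc, mul_comm, mul_div_assoc, ← div_pow, mul_comm]
      congr 2
      field_simp

lemma zero_count {ι : Type*} [Fintype ι] (z₀ : ℂ) (ρ : ℝ) (hρ : 0 < ρ) (f : ι → ℂ → ℂ)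
    (hf : ∀ i, DifferentiableOn ℂ (f i) (ball z₀ (8 * ρ))) :
    ∃ Z : ℕ, ∀ x : ι → ℂ, (∃ z ∈ closedBall z₀ ρ, ∑ i, x i * f i z ≠ 0) →
      ∀ S : Finset ℂ, (∀ s ∈ S, s ∈ closedBall z₀ ρ ∧ ∑ i, x i * f i s = 0) → S.card ≤ Z := by
  have hsub1 : closedBall z₀ ρ ⊆ ball z₀ (8 * ρ) := closedBall_subset_ball (by linarith)
  have hsub4 : closedBall z₀ (4 * ρ) ⊆ ball z₀ (8 * ρ) := closedBall_subset_ball (by linarith)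
  have : CompactSpace (closedBall z₀ ρ) := isCompact_iff_compactSpace.1 (isCompact_closedBall _ _)
  let g : ι → C(closedBall z₀ ρ, ℂ) := fun i =>
    ⟨fun z => f i z, by
      have := ((hf i).continuousOn.mono hsub1)
      exact continuousOn_iff_continuous_domRestrict.1 this⟩
  let Φ : (ι → ℂ) →ₗ[ℂ] C(closedBall z₀ ρ, ℂ) := Fintype.linearCombination ℂ g
  have hΦ : ∀ x (z : closedBall z₀ ρ), Φ x z = ∑ i, x i * f i z := by
    intro x z
    simp only [Φ, Fintype.linearCombination_apply, ContinuousMap.sum_apply, ContinuousMap.smul_apply, smul_eq_mul]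
    rfl
  obtain ⟨U, hU⟩ := Submodule.exists_isCompl (LinearMap.ker Φ)
  have hker : LinearMap.ker (Φ.comp U.subtype) = ⊥ := by
    rw [LinearMap.ker_eq_bot']
    intro u hu
    have h1 : (u : ι → ℂ) ∈ LinearMap.ker Φ := hu
    have := (Submodule.disjoint_def.1 hU.disjoint) _ h1 u.2
    exact Subtype.ext this
  obtain ⟨K, hK0, hK⟩ := LinearMap.exists_antilipschitzWith _ hker
  have hb : ∀ i, ∃ B : ℝ, 0 ≤ B ∧ ∀ z ∈ closedBall z₀ (4 * ρ), ‖f i z‖ ≤ B := by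
    intro i
    obtain ⟨B, hB⟩ := (isCompact_closedBall z₀ (4 * ρ)).exists_bound_of_continuousOn ((hf i).continuousOn.mono hsub4)
    exact ⟨max B 0, le_max_right _ _, fun z hz => (hB z hz).trans (le_max_left _ _)⟩
  choose B hB0 hB using hb
  set BB := ∑ i, B i with hBB
  have hBB0 : 0 ≤ BB := Finset.sum_nonneg fun i _ => hB0 i
  obtain ⟨Z, hZ⟩ : ∃ Z : ℕ, (2 / 3 : ℝ) ^ Z < 1 / (K * BB + 1) :=
    exists_pow_lt_of_lt_one (by positivity) (by norm_num)
  refine ⟨Z, fun x ⟨z1, hz1, hz1'⟩ S hS => ?_⟩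
  by_contra hcon
  push Not at hcon
  obtain ⟨k, u, hk, hu⟩ : ∃ k ∈ LinearMap.ker Φ, ∃ u ∈ U, k + u = x := by
    have : x ∈ LinearMap.ker Φ ⊔ U := by rw [hU.sup_eq_top]; trivial
    exact Submodule.mem_sup.1 this
  obtain ⟨hu, hkx⟩ := hu
  have hΦx : Φ x = Φ hk := by
    rw [← hkx, map_add, LinearMap.mem_ker.1 u, zero_add]
  set y := hk
  have hsame : ∀ z ∈ closedBall z₀ ρ, ∑ i, x i * f i z = ∑ i, y i * f i z := by
    intro z hz
    rw [← hΦ x ⟨z, hz⟩, ← hΦ y ⟨z, hz⟩, hΦx]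
  have hy0 : y ≠ 0 := by
    intro h
    rw [hsame z1 hz1, h] at hz1'
    simp at hz1'
  have hFb : ∀ z ∈ closedBall z₀ (4 * ρ), ‖∑ i, y i * f i z‖ ≤ ‖y‖ * BB := by
    intro z hz
    refine (norm_sum_le _ _).trans ?_
    rw [hBB, Finset.mul_sum]
    refine Finset.sum_le_sum fun i _ => ?_
    rw [norm_mul]
    exact mul_le_mul (norm_le_pi_norm y i) (hB i z hz) (norm_nonneg _) (norm_nonneg _)
  have hsm : ‖Φ y‖ ≤ (2 / 3) ^ S.card * (‖y‖ * BB) := by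
    rw [ContinuousMap.norm_le _ (by positivity)]
    intro z
    rw [hΦ]
    apply schwarz_zeros z₀ ρ hρ (fun z => ∑ i, y i * f i z) _ _ hFb S (fun s hs => (hS s hs).1) _ _ z.2
    · exact DifferentiableOn.fun_sum fun i _ => (hf i).const_mul _
    · intro s hs
      have := (hS s hs).2
      rwa [hsame s (hS s hs).1] at this
  have hanti : ‖y‖ ≤ K * ‖Φ y‖ := by
    have := hK.le_mul_norm_sub ⟨y, hu⟩ 0
    simpa using this
  have hy : 0 < ‖y‖ := norm_pos_iff.2 hy0
  have h3 : (2 / 3 : ℝ) ^ S.card ≤ (2 / 3) ^ Z := pow_le_pow_of_le_one (by norm_num) (by norm_num) hcon.le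
  have h4 : ‖y‖ ≤ K * ((1 / (K * BB + 1)) * (‖y‖ * BB)) := by
    refine hanti.trans ?_
    gcongr
    refine hsm.trans ?_
    gcongr
    linarith
  have h5 : K * ((1 / (K * BB + 1)) * (‖y‖ * BB)) = ‖y‖ * ((K * BB) / (K * BB + 1)) := by
    field_simp
  rw [h5] at h4
  have h6 : ((K : ℝ) * BB) / (K * BB + 1) < 1 := by
    rw [div_lt_one (by positivity)]; linarith
  nlinarith
end MZ
end

section
open Polynomial NumberField
open Polynomial

namespace MZ
open Metric

lemma taylor_rem (z₀ : ℂ) (r R : ℝ) (hr : 0 < r) (hR : r < R) (L : ℕ) : ∀ (f : ℂ → ℂ) (B : ℝ),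
    DifferentiableOn ℂ f (ball z₀ R) → (∀ z ∈ closedBall z₀ r, ‖f z‖ ≤ B) →
    ∃ (c : ℕ → ℂ) (g : ℂ → ℂ), (∀ z, f z = ∑ l ∈ Finset.range L, c l * (z - z₀) ^ l + (z - z₀) ^ L * g z) ∧
      ∀ z ∈ closedBall z₀ r, ‖g z‖ ≤ B * (2 / r) ^ L := by
  induction L with
  | zero => intro f B hf hB; exact ⟨0, f, by simp, by simpa using hB⟩
  | succ L ih =>
    intro f B hf hB
    have hsub : closedBall z₀ r ⊆ ball z₀ R := closedBall_subset_ball hR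
    have h1 : DifferentiableOn ℂ (dslope f z₀) (ball z₀ R) :=
      (Complex.differentiableOn_dslope (ball_mem_nhds _ (by linarith))).2 hf
    have h2 : ∀ z, f z = f z₀ + (z - z₀) * dslope f z₀ z := by
      intro z
      have := sub_smul_dslope f z₀ z
      rw [smul_eq_mul] at this
      rw [this]; ring
    have hB1 : ∀ z ∈ closedBall z₀ r, ‖dslope f z₀ z‖ ≤ B * (2 / r) := by
      intro z hz
      have hdc : DiffContOnCl ℂ (dslope f z₀) (ball z₀ r) := by
        apply DifferentiableOn.diffContOnCl
        rw [closure_ball _ hr.ne']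
        exact h1.mono hsub
      refine Complex.norm_le_of_forall_mem_frontier_norm_le isBounded_ball hdc ?_ (by rwa [closure_ball _ hr.ne'])
      intro w hw
      rw [frontier_ball _ hr.ne'] at hw
      have hw' : ‖w - z₀‖ = r := by rwa [mem_sphere, dist_eq_norm] at hw
      have h3 : ‖(w - z₀) * dslope f z₀ w‖ ≤ 2 * B := by
        have : (w - z₀) * dslope f z₀ w = f w - f z₀ := by rw [h2 w]; ring
        rw [this]
        have := hB w (sphere_subset_closedBall hw)
        have := hB z₀ (mem_closedBall_self hr.le)
        linarith [norm_sub_le (f w) (f z₀)]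
      rw [norm_mul, hw'] at h3
      rw [← mul_div_assoc, le_div_iff₀ hr]
      linarith
    obtain ⟨c, g, hg1, hg2⟩ := ih _ _ h1 hB1
    refine ⟨fun l => if l = 0 then f z₀ else c (l - 1), g, ?_, ?_⟩
    · intro z
      rw [Finset.sum_range_succ', h2 z, hg1 z]
      simp only [Nat.add_eq_zero_iff, one_ne_zero, and_false, if_false, Nat.add_sub_cancel, if_true, pow_zero, mul_one]
      rw [mul_add, Finset.mul_sum, pow_succ]
      have : ∀ l, (z - z₀) * (c l * (z - z₀) ^ l) = c l * (z - z₀) ^ (l + 1) := fun l => by ring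
      simp_rw [this]
      ring
    · intro z hz
      refine (hg2 z hz).trans (le_of_eq ?_)
      ring

lemma det_row_bound {ι : Type*} [Fintype ι] [DecidableEq ι] (A : Matrix ι ι ℂ) (b : ι → ℝ)
    (h : ∀ i j, ‖A i j‖ ≤ b i) : ‖A.det‖ ≤ (Fintype.card ι).factorial * ∏ i, b i := by
  rw [← Matrix.det_transpose, Matrix.det_apply]
  refine (norm_sum_le _ _).trans ?_
  calc _ ≤ ∑ σ : Equiv.Perm ι, ∏ i, b i := by
        refine Finset.sum_le_sum fun σ _ => ?_
        rw [Units.smul_def, zsmul_eq_mul, norm_mul, norm_prod]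
        have : ‖((Equiv.Perm.sign σ : ℤ) : ℂ)‖ = 1 := by
          rcases Int.units_eq_one_or (Equiv.Perm.sign σ) with h | h <;> simp [h]
        rw [this, one_mul]
        have h2 : ∏ i, b i = ∏ i, b i := rfl
        exact Finset.prod_le_prod (fun _ _ => norm_nonneg _) fun i _ => h _ _
    _ = _ := by simp [Fintype.card_perm]

lemma det_small {ι : Type*} [Fintype ι] [DecidableEq ι] (T R : Matrix ι ι ℂ) (L : ℕ)
    (hL : L ≤ Fintype.card ι)
    (c : ι → ℕ → ℂ) (e : ℕ → ι → ℂ) (hT : ∀ i j, T i j = ∑ l ∈ Finset.range L, c i l * e l j)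
    (B ε : ℝ) (hB : 0 ≤ B) (hε : 0 ≤ ε) (hε1 : ε ≤ 1) (hTb : ∀ i j, ‖T i j‖ ≤ B) (hRb : ∀ i j, ‖R i j‖ ≤ B * ε) :
    ‖(T + R).det‖ ≤ 2 ^ (Fintype.card ι) * ((Fintype.card ι).factorial * (B ^ (Fintype.card ι) * ε ^ (Fintype.card ι - L))) := by
  have h1 : (T + R).det = ∑ s : Finset ι, Matrix.det (Matrix.of fun i j => if i ∈ s then T i j else R i j) := by
    have := (Matrix.detRowAlternating (R := ℂ) (n := ι)).toMultilinearMap.map_add_univ T R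
    refine Eq.trans this (Finset.sum_congr rfl fun s _ => ?_)
    change Matrix.det _ = _
    congr 1
    ext i j
    by_cases h : i ∈ s <;> simp [Finset.piecewise, h]
  rw [h1]
  refine (norm_sum_le _ _).trans ?_
  have hterm : ∀ s : Finset ι, ‖Matrix.det (Matrix.of fun i j => if i ∈ s then T i j else R i j)‖ ≤
      ((Fintype.card ι).factorial * (B ^ (Fintype.card ι) * ε ^ (Fintype.card ι - L))) := by
    intro s
    rcases lt_or_ge L s.card with hs | hs
    · have : Matrix.det (Matrix.of fun i j => if i ∈ s then T i j else R i j) = 0 := by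
        let v : s → (Fin L → ℂ) := fun i l => c i l
        have hdep : ¬ LinearIndependent ℂ v := by
          intro hli
          have := hli.fintype_card_le_finrank
          simp at this
          omega
        rw [Fintype.not_linearIndependent_iff] at hdep
        obtain ⟨a, ha, i₀, hi₀⟩ := hdep
        rw [← Matrix.exists_vecMul_eq_zero_iff]
        refine ⟨fun i => if h : i ∈ s then a ⟨i, h⟩ else 0, ?_, ?_⟩
        · intro h
          have := congrFun h i₀
          simp at this
          exact hi₀ this
        · ext j
          simp only [Matrix.vecMul, dotProduct, Pi.zero_apply]
          have h2 : ∀ i, (if h : i ∈ s then a ⟨i, h⟩ else 0) * (Matrix.of fun i j => if i ∈ s then T i j else R i j) i j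
              = if h : i ∈ s then a ⟨i, h⟩ * T i j else 0 := by
            intro i
            split_ifs with h
            · simp [h]
            · simp
          simp_rw [h2]
          have h3 : ∑ i, (if h : i ∈ s then a ⟨i, h⟩ * T i j else 0) = ∑ i : s, a i * T i j := by
            rw [← Finset.sum_subset (Finset.subset_univ s)]
            · rw [← Finset.sum_coe_sort]
              exact Finset.sum_congr rfl fun i _ => by simp
            · intro i _ hi; simp [hi]
          rw [h3]
          simp_rw [hT, Finset.mul_sum]
          rw [Finset.sum_comm]
          apply Finset.sum_eq_zero
          intro l hl
          have h4 := congrFun ha ⟨l, Finset.mem_range.1 hl⟩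
          simp only [Finset.sum_apply, Pi.smul_apply, smul_eq_mul, Pi.zero_apply, v] at h4
          simp_rw [← mul_assoc]
          rw [← Finset.sum_mul, h4, zero_mul]
      rw [this, norm_zero]; positivity
    · refine (det_row_bound _ (fun i => if i ∈ s then B else B * ε) ?_).trans ?_
      · intro i j
        by_cases h : i ∈ s
        · simpa [h] using hTb i j
        · simpa [h] using hRb i j
      · gcongr
        have h5 : ∀ i, (if i ∈ s then B else B * ε) = B * (if i ∈ s then 1 else ε) := by
          intro i; split_ifs <;> simp
        simp_rw [h5]
        rw [Finset.prod_mul_distrib, Finset.prod_const, Finset.card_univ]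
        gcongr
        rw [Finset.prod_ite]
        simp only [Finset.prod_const, one_pow, one_mul]
        apply pow_le_pow_of_le_one hε hε1
        have : (Finset.univ.filter (fun x => ¬ x ∈ s)).card = Fintype.card ι - s.card := by
          rw [← Finset.card_compl]; congr 1; ext; simp
        rw [this]
        omega
  calc _ ≤ ∑ s : Finset ι, ((Fintype.card ι).factorial * (B ^ (Fintype.card ι) * ε ^ (Fintype.card ι - L)) : ℝ) :=
        Finset.sum_le_sum fun s _ => hterm s
    _ = _ := by simp [Fintype.card_finset]

lemma interp_det {ι : Type*} [Fintype ι] [DecidableEq ι] (z₀ : ℂ) (r R s : ℝ) (hr : 0 < r) (hR : r < R)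
    (hs0 : 0 ≤ s) (hs : 2 * s ≤ r) (L : ℕ) (hL : L ≤ Fintype.card ι) (f : ι → ℂ → ℂ) (B : ℝ) (hB : 0 ≤ B)
    (hf : ∀ i, DifferentiableOn ℂ (f i) (ball z₀ R)) (hfB : ∀ i, ∀ z ∈ closedBall z₀ r, ‖f i z‖ ≤ B)
    (ζ : ι → ℂ) (hζ : ∀ j, ζ j ∈ closedBall z₀ s) :
    ‖(Matrix.of fun i j => f i (ζ j)).det‖ ≤ 2 ^ (Fintype.card ι) * ((Fintype.card ι).factorial *
      ((2 * B) ^ (Fintype.card ι) * ((2 * s / r) ^ L) ^ (Fintype.card ι - L))) := by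
  have ht := fun i => taylor_rem z₀ r R hr hR L (f i) B (hf i) (hfB i)
  choose c g h1 h2 using ht
  have hq : 0 ≤ 2 * s / r := by positivity
  have hq1 : 2 * s / r ≤ 1 := by rw [div_le_one hr]; exact hs
  have hsub : closedBall z₀ s ⊆ closedBall z₀ r := closedBall_subset_closedBall (by linarith)
  have hRb : ∀ i j, ‖(ζ j - z₀) ^ L * g i (ζ j)‖ ≤ B * (2 * s / r) ^ L := by
    intro i j
    have h3 := hζ j
    rw [mem_closedBall, dist_eq_norm] at h3
    rw [norm_mul, norm_pow]
    calc _ ≤ s ^ L * (B * (2 / r) ^ L) := by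
          gcongr
          exact h2 i _ (hsub (hζ j))
      _ = _ := by rw [div_pow, div_pow, mul_pow]; ring
  have hRb2 : B * (2 * s / r) ^ L ≤ B := mul_le_of_le_one_right hB (pow_le_one₀ hq hq1)
  have e : (Matrix.of fun i j => f i (ζ j)) =
      (Matrix.of fun i j => ∑ l ∈ Finset.range L, c i l * (ζ j - z₀) ^ l) +
      (Matrix.of fun i j => (ζ j - z₀) ^ L * g i (ζ j)) := by
    ext i j; simp [h1 i (ζ j)]
  rw [e]
  refine det_small _ _ L hL c (fun l j => (ζ j - z₀) ^ l) (fun i j => rfl) (2 * B) _ (by positivity)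
    (by positivity) (pow_le_one₀ hq hq1) ?_ ?_
  · intro i j
    have : ∑ l ∈ Finset.range L, c i l * (ζ j - z₀) ^ l
        = f i (ζ j) - (ζ j - z₀) ^ L * g i (ζ j) := by rw [h1 i (ζ j)]; simp
    rw [this]
    refine (norm_sub_le _ _).trans ?_
    have := hfB i _ (hsub (hζ j))
    linarith [hRb i j]
  · intro i j
    refine (hRb i j).trans ?_
    gcongr
    linarith
end MZ
end

section
open Polynomial NumberField
open Polynomial
namespace MZ

lemma residue_contra (ρ : ℂ) (π A B w : ℂ[X]) (hπ : π.eval ρ ≠ 0) (hA : A ≠ 0) (hw : w.eval ρ ≠ 0)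
    (h : (X - C ρ) * π * (A * derivative B - derivative A * B) + A ^ 2 * w = 0) : False := by
  have hw0 : w ≠ 0 := by rintro rfl; simp at hw
  by_cases hB : B = 0
  · subst hB
    simp [hA, hw0] at h
  obtain ⟨f, hf, hfr⟩ := Polynomial.exists_eq_pow_rootMultiplicity_mul_and_not_dvd A hA ρ
  obtain ⟨g, hg, hgr⟩ := Polynomial.exists_eq_pow_rootMultiplicity_mul_and_not_dvd B hB ρ
  set a := A.rootMultiplicity ρ
  set b := B.rootMultiplicity ρ
  rw [dvd_iff_isRoot, IsRoot] at hfr hgr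
  have hX : (X - C ρ : ℂ[X]) ≠ 0 := X_sub_C_ne_zero ρ
  have key : ∀ (n : ℕ) (q : ℂ[X]), (X - C ρ) * derivative ((X - C ρ) ^ n * q)
      = (X - C ρ) ^ n * ((n : ℂ[X]) * q + (X - C ρ) * derivative q) := by
    intro n q
    rw [derivative_mul, derivative_X_sub_C_pow]
    cases n with
    | zero => simp
    | succ n => simp only [Nat.add_sub_cancel, pow_succ, map_natCast]; ring
  have h2 : (X - C ρ) ^ (a + b) * (π * (((b : ℂ[X]) - (a : ℂ[X])) * (f * g) + (X - C ρ) * (f * derivative g - derivative f * g)))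
      + (X - C ρ) ^ (2 * a) * (f ^ 2 * w) = 0 := by
    rw [← h]
    have e1 : (X - C ρ) * π * (A * derivative B - derivative A * B)
      = π * (A * ((X - C ρ) * derivative B) - ((X - C ρ) * derivative A) * B) := by ring
    rw [e1]
    conv_rhs => rw [hf, hg]
    rw [key, key]; ring
  have fin : ∀ q : ℂ[X], q = 0 → q.eval ρ = 0 := by rintro q rfl; simp
  rcases lt_trichotomy a b with hab | hab | hab
  · obtain ⟨c, hc⟩ := Nat.exists_eq_add_of_lt hab
    have h3 : (X - C ρ) ^ (2 * a) * ((X - C ρ) ^ (c + 1) * (π * ((((a + c + 1 : ℕ) : ℂ[X]) - (a : ℂ[X])) * (f * g) + (X - C ρ) * (f * derivative g - derivative f * g))) + f ^ 2 * w) = 0 := by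
      rw [← h2]
      rw [show a + b = 2 * a + (c + 1) by omega]
      rw [hc]
      ring
    have h4 := fin _ ((mul_eq_zero.1 h3).resolve_left (pow_ne_zero _ hX))
    simp [hfr, hw] at h4
  · have h3 : (X - C ρ) ^ (2 * a) * (π * (((b : ℂ[X]) - (a : ℂ[X])) * (f * g) + (X - C ρ) * (f * derivative g - derivative f * g)) + f ^ 2 * w) = 0 := by
      rw [← h2, ← hab]; ring
    have h4 := fin _ ((mul_eq_zero.1 h3).resolve_left (pow_ne_zero _ hX))
    simp [hfr, hw, hab] at h4
  · have h3 : (X - C ρ) ^ (a + b) * (π * (((b : ℂ[X]) - (a : ℂ[X])) * (f * g) + (X - C ρ) * (f * derivative g - derivative f * g)) + (X - C ρ) ^ (a - b) * (f ^ 2 * w)) = 0 := by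
      rw [← h2, show 2 * a = (a + b) + (a - b) by omega]; ring
    have h4 := fin _ ((mul_eq_zero.1 h3).resolve_left (pow_ne_zero _ hX))
    have : a - b ≠ 0 := by omega
    simp [hfr, hgr, hπ, this, sub_eq_zero] at h4
    omega

lemma prop_of_wronskian (A B : ℂ[X]) (hA : A ≠ 0) (h : A * derivative B - derivative A * B = 0) :
    ∃ c : ℂ, B = C c * A := by
  obtain ⟨x₀, hx₀⟩ : ∃ x, A.eval x ≠ 0 := by
    by_contra hh; push Not at hh
    exact hA (Polynomial.funext (by simpa using hh))
  refine ⟨B.eval x₀ / A.eval x₀, ?_⟩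
  set B' := B - C (B.eval x₀ / A.eval x₀) * A with hB'
  have h1 : A * derivative B' - derivative A * B' = 0 := by
    rw [hB']; simp only [derivative_sub, derivative_C_mul]
    linear_combination h
  by_contra hne
  have hB0 : B' ≠ 0 := fun h => hne (sub_eq_zero.1 h)
  have hr : B'.eval x₀ = 0 := by rw [hB']; simp; field_simp; simp
  obtain ⟨g, hg, hgr⟩ := Polynomial.exists_eq_pow_rootMultiplicity_mul_and_not_dvd B' hB0 x₀
  have hb : 0 < B'.rootMultiplicity x₀ := (rootMultiplicity_pos hB0).2 hr
  obtain ⟨b, hb⟩ : ∃ b, B'.rootMultiplicity x₀ = b + 1 := ⟨_, (Nat.succ_pred_eq_of_pos hb).symm⟩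
  rw [hb] at hg
  rw [dvd_iff_isRoot, IsRoot] at hgr
  have h2 : (X - C x₀) ^ b * (A * (((b : ℂ[X]) + 1) * g + (X - C x₀) * derivative g) - derivative A * ((X - C x₀) * g)) = 0 := by
    rw [← h1]
    conv_rhs => rw [hg]
    rw [derivative_mul, derivative_X_sub_C_pow]
    simp only [Nat.add_sub_cancel, pow_succ, map_natCast, map_add, map_one, Nat.cast_add, Nat.cast_one]; ring
  have h3 := (mul_eq_zero.1 h2).resolve_left (pow_ne_zero _ (X_sub_C_ne_zero x₀))
  have h4 := congrArg (Polynomial.eval x₀) h3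
  simp [hx₀, hgr] at h4
  exact Nat.cast_add_one_ne_zero b h4

noncomputable def rel (n : ℕ) (A : ℕ → ℕ → ℂ[X]) (u v : ℂ → ℂ) (z : ℂ) : ℂ :=
  ∑ i ∈ Finset.range (n+1), ∑ j ∈ Finset.range (n+1), (A i j).eval z * u z ^ i * v z ^ j

noncomputable def dRel (Pp a b : ℂ[X]) (A : ℕ → ℕ → ℂ[X]) (i j : ℕ) : ℂ[X] :=
  Pp * derivative (A i j) + ((i : ℂ[X]) + 1) * A (i+1) j * a + ((j : ℂ[X]) + 1) * A i (j+1) * b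

lemma rel_deriv (U : Set ℂ) (hU : IsOpen U) (Pp a b : ℂ[X]) (u v u' v' : ℂ → ℂ)
    (hu : ∀ z ∈ U, HasDerivAt u (u' z) z) (hv : ∀ z ∈ U, HasDerivAt v (v' z) z)
    (hu' : ∀ z ∈ U, Pp.eval z * u' z = a.eval z) (hv' : ∀ z ∈ U, Pp.eval z * v' z = b.eval z)
    (n : ℕ) (A : ℕ → ℕ → ℂ[X]) (hA : ∀ i j, n < i + j → A i j = 0)
    (hrel : ∀ z ∈ U, rel n A u v z = 0) : ∀ z ∈ U, rel n (dRel Pp a b A) u v z = 0 := by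
  intro z hz
  have hd : HasDerivAt (rel n A u v) (∑ i ∈ Finset.range (n+1), ∑ j ∈ Finset.range (n+1),
      (((derivative (A i j)).eval z * u z ^ i + (A i j).eval z * (i * u z ^ (i-1) * u' z)) * v z ^ j
        + (A i j).eval z * u z ^ i * (j * v z ^ (j-1) * v' z))) z := by
    unfold rel
    apply HasDerivAt.fun_sum; intro i _
    apply HasDerivAt.fun_sum; intro j _
    exact ((Polynomial.hasDerivAt _ z).mul ((hu z hz).pow i)).mul ((hv z hz).pow j)
  have h0 : HasDerivAt (rel n A u v) 0 z := by
    refine (hasDerivAt_const z (0:ℂ)).congr_of_eventuallyEq ?_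
    filter_upwards [hU.mem_nhds hz] with y hy using hrel y hy
  have h1 := hd.unique h0
  have h2 : rel n (dRel Pp a b A) u v z = Pp.eval z * (∑ i ∈ Finset.range (n+1), ∑ j ∈ Finset.range (n+1),
      (((derivative (A i j)).eval z * u z ^ i + (A i j).eval z * (i * u z ^ (i-1) * u' z)) * v z ^ j
        + (A i j).eval z * u z ^ i * (j * v z ^ (j-1) * v' z))) := by
    have s1 : ∀ (f : ℕ → ℂ), f (n+1) = 0 → ∀ x : ℂ, ∑ i ∈ Finset.range (n+1), ((i:ℂ)+1) * f (i+1) * x ^ i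
        = ∑ i ∈ Finset.range (n+1), (i:ℂ) * f i * x ^ (i-1) := by
      intro f hf x
      rw [Finset.sum_range_succ, hf, Finset.sum_range_succ' (fun i => (i:ℂ) * f i * x ^ (i-1))]
      simp
    have t1 : ∑ i ∈ Finset.range (n+1), ∑ j ∈ Finset.range (n+1), ((i:ℂ)+1) * (A (i+1) j).eval z * u z ^ i * v z ^ j
       = ∑ i ∈ Finset.range (n+1), ∑ j ∈ Finset.range (n+1), (i:ℂ) * (A i j).eval z * u z ^ (i-1) * v z ^ j := by
      rw [Finset.sum_comm]
      conv_rhs => rw [Finset.sum_comm]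
      refine Finset.sum_congr rfl fun j _ => ?_
      rw [← Finset.sum_mul, ← Finset.sum_mul, s1 (fun i => (A i j).eval z)]
      rw [hA (n+1) j (by omega)]; simp
    have t2 : ∑ i ∈ Finset.range (n+1), ∑ j ∈ Finset.range (n+1), ((j:ℂ)+1) * (A i (j+1)).eval z * u z ^ i * v z ^ j
       = ∑ i ∈ Finset.range (n+1), ∑ j ∈ Finset.range (n+1), (j:ℂ) * (A i j).eval z * u z ^ i * v z ^ (j-1) := by
      refine Finset.sum_congr rfl fun i _ => ?_
      have := s1 (fun j => (A i j).eval z * u z ^ i) (by rw [hA i (n+1) (by omega)]; simp) (v z)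
      simpa only [mul_assoc] using this
    have e3 : rel n (dRel Pp a b A) u v z = ∑ i ∈ Finset.range (n+1), ∑ j ∈ Finset.range (n+1), Pp.eval z * ((derivative (A i j)).eval z * u z ^ i * v z ^ j)
        + a.eval z * (∑ i ∈ Finset.range (n+1), ∑ j ∈ Finset.range (n+1), ((i:ℂ)+1) * (A (i+1) j).eval z * u z ^ i * v z ^ j)
        + b.eval z * (∑ i ∈ Finset.range (n+1), ∑ j ∈ Finset.range (n+1), ((j:ℂ)+1) * (A i (j+1)).eval z * u z ^ i * v z ^ j) := by
      simp only [rel, dRel, Finset.mul_sum, ← Finset.sum_add_distrib]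
      refine Finset.sum_congr rfl fun i _ => Finset.sum_congr rfl fun j _ => ?_
      simp; ring
    rw [e3, t1, t2, ← hu' z hz, ← hv' z hz]
    simp only [Finset.mul_sum, ← Finset.sum_add_distrib]
    refine Finset.sum_congr rfl fun i _ => Finset.sum_congr rfl fun j _ => ?_
    ring
  rw [h2, h1, mul_zero]

lemma alg_indep (U : Set ℂ) (hU : IsOpen U) (hUi : U.Infinite) (Pp a b : ℂ[X]) (u v u' v' : ℂ → ℂ)
    (hu : ∀ z ∈ U, HasDerivAt u (u' z) z) (hv : ∀ z ∈ U, HasDerivAt v (v' z) z)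
    (hu' : ∀ z ∈ U, Pp.eval z * u' z = a.eval z) (hv' : ∀ z ∈ U, Pp.eval z * v' z = b.eval z)
    (hPp : Pp ≠ 0)
    (hres : ∀ x y : ℂ, (x ≠ 0 ∨ y ≠ 0) → ∃ ρ π, Pp = (X - C ρ) * π ∧ π.eval ρ ≠ 0 ∧ (C x * a + C y * b).eval ρ ≠ 0)
    (n : ℕ) : ∀ (A : ℕ → ℕ → ℂ[X]), (∀ i j, n < i + j → A i j = 0) →
    (∀ z ∈ U, rel n A u v z = 0) → ∀ i j, A i j = 0 := by
  induction n with
  | zero =>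
    intro A hA h i j
    by_cases hij : 0 < i + j
    · exact hA i j hij
    · obtain ⟨rfl, rfl⟩ : i = 0 ∧ j = 0 := by omega
      by_contra hne
      refine hUi ((A 0 0).roots.toFinset.finite_toSet.subset ?_)
      intro z hz
      have := h z hz
      simp [rel] at this
      simp [hne, this]
  | succ n ih =>
    suffices H : ∀ (c : ℕ) (A : ℕ → ℕ → ℂ[X]), (∀ i j, n + 1 < i + j → A i j = 0) →
        (∀ z ∈ U, rel (n+1) A u v z = 0) →
        ((Finset.HasAntidiagonal.antidiagonal (n+1)).filter (fun q => A q.1 q.2 ≠ 0)).card ≤ c → ∀ i j, A i j = 0 by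
      intro A hA h
      exact H _ A hA h le_rfl
    intro c
    induction c with
    | zero =>
      intro A hA h hc
      have hc : ((Finset.HasAntidiagonal.antidiagonal (n+1)).filter (fun q => A q.1 q.2 ≠ 0)) = ∅ := Finset.card_eq_zero.1 (by omega)
      have hA' : ∀ i j, n < i + j → A i j = 0 := by
        intro i j hij
        rcases Nat.lt_or_ge (n+1) (i+j) with h1 | h1
        · exact hA i j h1
        · by_contra hne
          have : (i, j) ∈ ((Finset.HasAntidiagonal.antidiagonal (n+1)).filter (fun q => A q.1 q.2 ≠ 0)) := by
            simp [hne]; omega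
          rw [hc] at this; simp at this
      refine ih A hA' fun z hz => ?_
      rw [← h z hz]
      unfold rel
      rw [Finset.sum_range_succ _ (n+1)]
      have e1 : ∑ j ∈ Finset.range (n+1+1), (A (n+1) j).eval z * u z ^ (n+1) * v z ^ j = 0 := by
        apply Finset.sum_eq_zero; intro j _; rw [hA' (n+1) j (by omega)]; simp
      rw [e1, add_zero]
      refine Finset.sum_congr rfl fun i _ => ?_
      rw [Finset.sum_range_succ _ (n+1), hA' i (n+1) (by omega)]; simp
    | succ c ihc =>
      intro A hA h hc
      by_cases hemp : ((Finset.HasAntidiagonal.antidiagonal (n+1)).filter (fun q => A q.1 q.2 ≠ 0)) = ∅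
      · exact ihc A hA h (by rw [hemp]; simp)
      obtain ⟨⟨i0, j0⟩, h0⟩ := Finset.nonempty_iff_ne_empty.2 hemp
      simp only [Finset.mem_filter, Finset.HasAntidiagonal.mem_antidiagonal] at h0
      obtain ⟨hij0, hA0⟩ := h0
      exfalso
      have hd := rel_deriv U hU Pp a b u v u' v' hu hv hu' hv' (n+1) A hA h
      set A0 := A i0 j0 with hA0def
      set B : ℕ → ℕ → ℂ[X] := fun i j => A0 * dRel Pp a b A i j - Pp * derivative A0 * A i j with hB
      have hBrel : ∀ z ∈ U, rel (n+1) B u v z = 0 := by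
        intro z hz
        have : rel (n+1) B u v z = A0.eval z * rel (n+1) (dRel Pp a b A) u v z
            - (Pp * derivative A0).eval z * rel (n+1) A u v z := by
          simp only [rel, hB, Finset.mul_sum, ← Finset.sum_sub_distrib]
          refine Finset.sum_congr rfl fun i _ => Finset.sum_congr rfl fun j _ => ?_
          simp; ring
        rw [this, hd z hz, h z hz]; simp
      have htop : ∀ i j, n + 1 ≤ i + j → B i j = Pp * (A0 * derivative (A i j) - derivative A0 * A i j) := by
        intro i j hij
        simp only [hB, dRel]
        rw [hA (i+1) j (by omega), hA i (j+1) (by omega)]; ring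
      have hBzero : ∀ i j, B i j = 0 := by
        refine ihc B ?_ hBrel ?_
        · intro i j hij
          rw [htop i j hij.le, hA i j hij]; simp
        · have hlt : ((Finset.HasAntidiagonal.antidiagonal (n+1)).filter (fun q => B q.1 q.2 ≠ 0)) ⊂
            ((Finset.HasAntidiagonal.antidiagonal (n+1)).filter (fun q => A q.1 q.2 ≠ 0)) := by
            rw [Finset.ssubset_iff_of_subset]
            · refine ⟨(i0, j0), by simp [hij0]; exact hA0, ?_⟩
              simp only [Finset.mem_filter, not_and, not_not]
              intro _
              rw [htop i0 j0 hij0.ge]; ring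
            · intro q hq
              simp only [Finset.mem_filter, Finset.HasAntidiagonal.mem_antidiagonal] at hq ⊢
              refine ⟨hq.1, fun hh => hq.2 ?_⟩
              rw [htop _ _ hq.1.ge, hh]; simp
          have := Finset.card_lt_card hlt
          omega
      have hprop : ∀ i j, i + j = n + 1 → ∃ x : ℂ, A i j = C x * A0 := by
        intro i j hij
        apply prop_of_wronskian A0 _ hA0
        have := hBzero i j
        rw [htop i j hij.ge] at this
        exact (mul_eq_zero.1 this).resolve_left hPp
      have key : ∀ i j, i + j = n → ((A (i+1) j ≠ 0) ∨ (A i (j+1) ≠ 0)) → False := by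
        intro i j hij hne
        obtain ⟨x, hx⟩ := hprop (i+1) j (by omega)
        obtain ⟨y, hy⟩ := hprop i (j+1) (by omega)
        have hxy : ((i+1 : ℂ) * x ≠ 0) ∨ ((j+1 : ℂ) * y ≠ 0) := by
          rcases hne with h1 | h1
          · left; refine mul_ne_zero (Nat.cast_add_one_ne_zero i) ?_
            rintro rfl; simp at hx; exact h1 hx
          · right; refine mul_ne_zero (Nat.cast_add_one_ne_zero j) ?_
            rintro rfl; simp at hy; exact h1 hy
        obtain ⟨ρ, π, h1, h2, h3⟩ := hres _ _ hxy
        refine residue_contra ρ π A0 (A i j) _ h2 hA0 h3 ?_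
        rw [← h1]
        have h4 := hBzero i j
        simp only [hB, dRel, hx, hy] at h4
        rw [← h4]
        simp only [map_mul, map_add, map_one, map_natCast]
        ring
      rcases Nat.eq_zero_or_pos i0 with h1 | h1
      · refine key 0 n (by omega) (Or.inr ?_)
        have : j0 = n + 1 := by omega
        rw [← this, ← h1]; exact hA0
      · refine key (i0 - 1) j0 (by omega) (Or.inl ?_)
        rw [Nat.sub_add_cancel h1]; exact hA0
end MZ
end

section
open Polynomial NumberField
open Polynomial
namespace MZ

lemma exists_poly_of_det {ι S : Type*} [Fintype ι] [DecidableEq ι] (w : S → ι → ℂ)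
    (h : ∀ ζ : ι → S, (Matrix.of fun i j => w (ζ j) i).det = 0) :
    ∃ P : ι → ℂ, P ≠ 0 ∧ ∀ s, ∑ i, P i * w s i = 0 := by
  have hlt : Submodule.span ℂ (Set.range w) < ⊤ := by
    rw [lt_top_iff_ne_top]
    intro htop
    obtain ⟨b, hb, hspan, hli⟩ := exists_linearIndependent ℂ (Set.range w)
    rw [htop] at hspan
    let B : Module.Basis b ℂ (ι → ℂ) := Module.Basis.mk hli (by simp [hspan])
    let e : ι ≃ b := (Pi.basisFun ℂ ι).indexEquiv B
    have hc : ∀ i, ∃ s, w s = (e i : ι → ℂ) := fun i => hb (e i).2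
    choose ζ hζ using hc
    have h1 : LinearIndependent ℂ (fun i => w (ζ i)) := by
      have : (fun i => w (ζ i)) = (fun x : b => (x : ι → ℂ)) ∘ e := by
        funext i; simp [hζ]
      rw [this]
      exact hli.comp e e.injective
    have h2 : LinearIndependent ℂ (Matrix.of fun i j => w (ζ j) i).col := h1
    rw [Matrix.linearIndependent_cols_iff_isUnit, Matrix.isUnit_iff_isUnit_det, h ζ] at h2
    simp at h2
  obtain ⟨f, hf, hker⟩ := Submodule.exists_le_ker_of_lt_top _ hlt
  refine ⟨fun i => f (Pi.single i 1), ?_, ?_⟩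
  · intro h0
    apply hf
    ext i
    simpa using congrFun h0 i
  · intro s
    have h1 : f (w s) = 0 := hker (Submodule.subset_span ⟨s, rfl⟩)
    rw [← h1]
    conv_rhs => rw [← Finset.univ_sum_single (w s), map_sum]
    refine Finset.sum_congr rfl fun i _ => ?_
    have : Pi.single i (w s i) = (w s i) • (Pi.single i (1:ℂ) : ι → ℂ) := by
      rw [← Pi.single_smul]; simp
    rw [this, map_smul, smul_eq_mul, mul_comm]

lemma int_det_zero {ι : Type*} [Fintype ι] [DecidableEq ι] (M : Matrix ι ι ℂ)
    (h : ∀ i j, ∃ n : ℤ, M i j = n) (hlt : ‖M.det‖ < 1) : M.det = 0 := by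
  choose N hN using h
  have : M = (Matrix.of N).map (Int.castRingHom ℂ) := by ext i j; simp [hN]
  rw [this, ← RingHom.mapMatrix_apply, ← RingHom.map_det] at hlt ⊢
  simp only [eq_intCast, Complex.norm_intCast] at hlt ⊢
  have : |(Matrix.of N).det| < 1 := by exact_mod_cast hlt
  rw [Int.abs_lt_one_iff] at this
  rw [this]; simp

section
variable {ι J : Type} [Fintype ι] [DecidableEq ι] [Fintype J]

def MRel (Q : ι → ℂ[X]) (p : J → ℕ) (k : ι → ℤ) (k' : J → ℤ) (z : ℂ) : Prop :=
  (∏ i, (Q i).eval z ^ k i) * ∏ j, (p j : ℂ) ^ k' j = 1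

noncomputable def lf (L : ι → ℂ → ℂ) (p : J → ℕ) (k : ι → ℤ) (k' : J → ℤ) (z : ℂ) : ℂ :=
  (∑ i, (k i : ℂ) * L i z + ∑ j, (k' j : ℂ) * Real.log (p j)) / (2 * Real.pi * Complex.I)

lemma lf_int (Q : ι → ℂ[X]) (p : J → ℕ) (hp : ∀ j, 0 < p j) (L : ι → ℂ → ℂ) (k : ι → ℤ) (k' : J → ℤ) (z : ℂ)
    (hL : ∀ i, Complex.exp (L i z) = (Q i).eval z) (h : MRel Q p k k' z) :
    ∃ n : ℤ, lf L p k k' z = n := by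
  have h1 : Complex.exp (∑ i, (k i : ℂ) * L i z + ∑ j, (k' j : ℂ) * Real.log (p j)) = 1 := by
    rw [Complex.exp_add, Complex.exp_sum, Complex.exp_sum]
    rw [← h]
    congr 1
    · refine Finset.prod_congr rfl fun i _ => ?_
      rw [Complex.exp_int_mul, hL]
    · refine Finset.prod_congr rfl fun j _ => ?_
      rw [Complex.exp_int_mul]
      congr 1
      rw [← Complex.ofReal_exp, Real.exp_log (by exact_mod_cast hp j)]; simp
  rw [Complex.exp_eq_one_iff] at h1
  obtain ⟨n, hn⟩ := h1
  refine ⟨n, ?_⟩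
  rw [lf, hn]
  have := Complex.two_pi_I_ne_zero
  field_simp

noncomputable def lfnum (Q : ι → ℂ[X]) (k : ι → ℤ) : ℂ[X] :=
  C (1 / (2 * Real.pi * Complex.I)) * ∑ i, (k i : ℂ[X]) * derivative (Q i) * ∏ j ∈ Finset.univ.erase i, Q j

lemma lf_indep (Q : ι → ℂ[X]) (hroot : ∀ i, ∃ ρ, (Q i).eval ρ = 0)
    (hsep : ∀ i ρ, (Q i).eval ρ = 0 → (derivative (Q i)).eval ρ ≠ 0 ∧ ∀ j, j ≠ i → (Q j).eval ρ ≠ 0)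
    (k l : ι → ℤ) (hkl : ∃ i j, k i * l j - k j * l i ≠ 0) (x y : ℂ) (hxy : x ≠ 0 ∨ y ≠ 0) :
    ∃ ρ π, (∏ i, Q i) = (X - C ρ) * π ∧ π.eval ρ ≠ 0 ∧ (C x * lfnum Q k + C y * lfnum Q l).eval ρ ≠ 0 := by
  obtain ⟨i, hi⟩ : ∃ i, x * k i + y * l i ≠ 0 := by
    by_contra hh
    push Not at hh
    obtain ⟨i, j, hij⟩ := hkl
    have hij' : (k i * l j - k j * l i : ℂ) ≠ 0 := by exact_mod_cast hij
    have h1 := hh i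
    have h2 := hh j
    have hx : x * (k i * l j - k j * l i : ℂ) = 0 := by linear_combination (l j : ℂ) * h1 - (l i : ℂ) * h2
    have hy : y * (k i * l j - k j * l i : ℂ) = 0 := by linear_combination (k i : ℂ) * h2 - (k j : ℂ) * h1
    rcases hxy with h | h
    · exact h ((mul_eq_zero.1 hx).resolve_right hij')
    · exact h ((mul_eq_zero.1 hy).resolve_right hij')
  obtain ⟨ρ, hρ⟩ := hroot i
  obtain ⟨h1, h2⟩ := hsep i ρ hρ
  obtain ⟨q, hq⟩ := dvd_iff_isRoot.2 hρ
  have hqρ : q.eval ρ = (derivative (Q i)).eval ρ := by rw [hq]; simp [derivative_mul]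
  have hE : (∏ j ∈ Finset.univ.erase i, Q j).eval ρ ≠ 0 := by
    rw [eval_prod, Finset.prod_ne_zero_iff]
    intro j hj
    exact h2 j (Finset.ne_of_mem_erase hj)
  refine ⟨ρ, q * ∏ j ∈ Finset.univ.erase i, Q j, ?_, ?_, ?_⟩
  · rw [← Finset.mul_prod_erase Finset.univ Q (Finset.mem_univ i), hq]
    simp only [mul_assoc]
  · rw [eval_mul, hqρ]; exact mul_ne_zero h1 hE
  · have key : ∀ k : ι → ℤ, (lfnum Q k).eval ρ = (1 / (2 * Real.pi * Complex.I)) * (k i * (derivative (Q i)).eval ρ * (∏ j ∈ Finset.univ.erase i, Q j).eval ρ) := by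
      intro k
      rw [lfnum, eval_mul, eval_C, eval_finsetSum, Finset.sum_eq_single i]
      · simp
      · intro b _ hb
        rw [eval_mul, eval_prod, Finset.prod_eq_zero (i := i)]
        · simp
        · simp [hb.symm]
        · exact hρ
      · simp
    rw [eval_add, eval_mul, eval_mul, eval_C, eval_C, key, key]
    have : x * (1 / (2 * Real.pi * Complex.I) * (k i * (derivative (Q i)).eval ρ * (∏ j ∈ Finset.univ.erase i, Q j).eval ρ))
       + y * (1 / (2 * Real.pi * Complex.I) * (l i * (derivative (Q i)).eval ρ * (∏ j ∈ Finset.univ.erase i, Q j).eval ρ))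
       = (x * k i + y * l i) * ((1 / (2 * Real.pi * Complex.I)) * ((derivative (Q i)).eval ρ * (∏ j ∈ Finset.univ.erase i, Q j).eval ρ)) := by ring
    rw [this]
    refine mul_ne_zero hi (mul_ne_zero ?_ (mul_ne_zero h1 hE))
    rw [one_div]; exact inv_ne_zero Complex.two_pi_I_ne_zero

lemma lf_hasDeriv (Q : ι → ℂ[X]) (p : J → ℕ) (L : ι → ℂ → ℂ) (k : ι → ℤ) (k' : J → ℤ) (z : ℂ)
    (hQ : ∀ i, (Q i).eval z ≠ 0)
    (hL : ∀ i, HasDerivAt (L i) ((derivative (Q i)).eval z / (Q i).eval z) z) :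
    HasDerivAt (lf L p k k') ((lfnum Q k).eval z / (∏ i, Q i).eval z) z := by
  have h1 : HasDerivAt (lf L p k k') ((∑ i, (k i : ℂ) * ((derivative (Q i)).eval z / (Q i).eval z)) / (2 * Real.pi * Complex.I)) z := by
    unfold lf
    apply HasDerivAt.div_const
    apply HasDerivAt.add_const
    apply HasDerivAt.fun_sum
    intro i _
    exact (hL i).const_mul _
  convert h1 using 1
  rw [lfnum, eval_mul, eval_C, eval_finsetSum, Finset.mul_sum, Finset.sum_div, Finset.sum_div]
  refine Finset.sum_congr rfl fun i _ => ?_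
  rw [← Finset.mul_prod_erase Finset.univ Q (Finset.mem_univ i)]
  simp only [eval_mul, eval_intCast]
  have hE : (∏ j ∈ Finset.univ.erase i, Q j).eval z ≠ 0 := by
    rw [eval_prod, Finset.prod_ne_zero_iff]
    intro j hj; exact hQ j
  have := Complex.two_pi_I_ne_zero
  have := hQ i
  field_simp
end
end MZ
end

section
open Polynomial NumberField
open Polynomial
namespace MZ
section
variable {ι J : Type} [Fintype ι] [DecidableEq ι] [Fintype J]

lemma mono_expand (L : ι → ℂ → ℂ) (d : ℕ) (c₁ c₂ : Option ι → ℂ) (a b : ℕ) (ha : a ≤ d) (hb : b ≤ d) :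
    ∃ x : ((Fin d ⊕ Fin d) → Option ι) → ℂ, ∀ z,
      (∑ o, c₁ o * (o.elim 1 (fun i => L i z))) ^ a * (∑ o, c₂ o * (o.elim 1 (fun i => L i z))) ^ b
       = ∑ g, x g * ∏ t, ((g t).elim 1 (fun i => L i z)) := by
  classical
  let cf : (Fin d ⊕ Fin d) → Option ι → ℂ := fun t o => Sum.elim
    (fun t : Fin d => if (t : ℕ) < a then c₁ o else (if o = none then 1 else 0))
    (fun t : Fin d => if (t : ℕ) < b then c₂ o else (if o = none then 1 else 0)) t
  refine ⟨fun g => ∏ t, cf t (g t), fun z => ?_⟩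
  have h1 : ∑ g : (Fin d ⊕ Fin d) → Option ι, (∏ t, cf t (g t)) * ∏ t, ((g t).elim 1 (fun i => L i z))
      = ∏ t, ∑ o, cf t o * (o.elim 1 (fun i => L i z)) := by
    rw [Finset.prod_univ_sum]
    simp only [Fintype.piFinset_univ]
    refine Finset.sum_congr rfl fun g _ => ?_
    rw [Finset.prod_mul_distrib]
  rw [h1, Fintype.prod_sum_type]
  have h2 : ∀ (c : Option ι → ℂ) (a : ℕ), a ≤ d → ∏ t : Fin d, ∑ o, (if (t : ℕ) < a then c o else (if o = none then 1 else 0)) * (o.elim 1 (fun i => L i z))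
     = (∑ o, c o * (o.elim 1 (fun i => L i z))) ^ a := by
    intro c a ha
    have : ∀ t : Fin d, ∑ o, (if (t : ℕ) < a then c o else (if o = none then 1 else 0)) * (o.elim 1 (fun i => L i z))
       = if (t : ℕ) < a then ∑ o, c o * (o.elim 1 (fun i => L i z)) else 1 := by
      intro t
      split_ifs
      · rfl
      · simp
    simp_rw [this]
    rw [Fin.prod_univ_eq_prod_range (fun t => if t < a then ∑ o, c o * (o.elim 1 (fun i => L i z)) else 1) d]
    rw [Finset.prod_ite]
    simp only [Finset.prod_const, one_pow, mul_one]
    congr 1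
    rw [show (Finset.range d).filter (fun t => t < a) = Finset.range a by ext t; simp; omega]
    simp
  simp only [cf, Sum.elim_inl, Sum.elim_inr]
  rw [h2 _ _ ha, h2 _ _ hb]

lemma lf_expand (L : ι → ℂ → ℂ) (p : J → ℕ) (k : ι → ℤ) (k' : J → ℤ) :
    ∃ c : Option ι → ℂ, ∀ z, lf L p k k' z = ∑ o, c o * (o.elim 1 (fun i => L i z)) := by
  refine ⟨fun o => o.elim ((∑ j, (k' j : ℂ) * Real.log (p j)) / (2 * Real.pi * Complex.I)) (fun i => k i / (2 * Real.pi * Complex.I)), fun z => ?_⟩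
  rw [Fintype.sum_option, lf, add_div, add_comm]
  simp only [Option.elim_none, mul_one, Option.elim_some]
  congr 1
  rw [Finset.sum_div]
  refine Finset.sum_congr rfl fun i _ => ?_
  ring

open Metric
lemma local_count (Q : ι → ℂ[X]) (hroot : ∀ i, ∃ ρ, (Q i).eval ρ = 0)
    (hsep : ∀ i ρ, (Q i).eval ρ = 0 → (derivative (Q i)).eval ρ ≠ 0 ∧ ∀ j, j ≠ i → (Q j).eval ρ ≠ 0)
    (p : J → ℕ) (hp : ∀ j, 0 < p j) (z₀ : ℂ) (ρ : ℝ) (hρ : 0 < ρ) (L : ι → ℂ → ℂ)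
    (hQ : ∀ z ∈ ball z₀ (8 * ρ), ∀ i, (Q i).eval z ≠ 0)
    (hLe : ∀ z ∈ ball z₀ (8 * ρ), ∀ i, Complex.exp (L i z) = (Q i).eval z)
    (hLd : ∀ z ∈ ball z₀ (8 * ρ), ∀ i, HasDerivAt (L i) ((derivative (Q i)).eval z / (Q i).eval z) z)
    (e : ℕ) (he : 1 ≤ e) :
    ∃ c : ℝ, 0 < c ∧ ∃ Z : ℕ, ∀ T : ℝ, 1 ≤ T → ∀ (k l : ι → ℤ) (k' l' : J → ℤ),
      (∃ i j, k i * l j - k j * l i ≠ 0) → (∀ i, |(k i : ℝ)| ≤ T) → (∀ i, |(l i : ℝ)| ≤ T) →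
      (∀ i, |(k' i : ℝ)| ≤ T) → (∀ i, |(l' i : ℝ)| ≤ T) →
      ∀ τ : ℝ, 1 ≤ τ → T ^ 4 ≤ τ ^ e → ∀ y ∈ closedBall z₀ ρ, ∀ S : Finset ℂ,
      (∀ s ∈ S, s ∈ closedBall z₀ ρ ∧ s ∈ closedBall y (c / τ) ∧ MRel Q p k k' s ∧ MRel Q p l l' s) →
      S.card ≤ Z := by
  classical
  set d := 2 * e with hd
  obtain ⟨M, hM⟩ : ∃ M : ℝ, ∀ i, ∀ z ∈ closedBall z₀ (3 * ρ), ‖L i z‖ ≤ M := by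
    have : ∀ i, ∃ M : ℝ, ∀ z ∈ closedBall z₀ (3 * ρ), ‖L i z‖ ≤ M := by
      intro i
      apply (isCompact_closedBall z₀ (3 * ρ)).exists_bound_of_continuousOn
      intro z hz
      exact (hLd z (closedBall_subset_ball (by linarith) hz) i).continuousAt.continuousWithinAt
    choose M hM using this
    refine ⟨∑ i, |M i|, fun i z hz => (hM i z hz).trans ((le_abs_self _).trans ?_)⟩
    exact Finset.single_le_sum (f := fun i => |M i|) (fun i _ => abs_nonneg _) (Finset.mem_univ i)
  set C1 : ℝ := 1 + ∑ _i : ι, |M| + ∑ j, |Real.log (p j)| with hC1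
  have hC1pos : 1 ≤ C1 := by
    have : 0 ≤ ∑ _i : ι, |M| := Finset.sum_nonneg fun _ _ => abs_nonneg _
    have : 0 ≤ ∑ j, |Real.log (p j)| := Finset.sum_nonneg fun _ _ => abs_nonneg _
    linarith
  have hlfb : ∀ T : ℝ, 1 ≤ T → ∀ (k : ι → ℤ) (k' : J → ℤ), (∀ i, |(k i : ℝ)| ≤ T) → (∀ i, |(k' i : ℝ)| ≤ T) →
      ∀ z ∈ closedBall z₀ (3 * ρ), ‖lf L p k k' z‖ ≤ C1 * T := by
    intro T hT k k' hk hk' z hz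
    rw [lf, norm_div]
    have h2pi : 1 ≤ ‖(2 * Real.pi * Complex.I : ℂ)‖ := by
      simp [abs_of_pos Real.pi_pos]
      linarith [Real.pi_gt_three]
    refine (div_le_self (norm_nonneg _) h2pi).trans ?_
    have h1 : ‖∑ i, (k i : ℂ) * L i z‖ ≤ (∑ _i : ι, |M|) * T := by
      refine (norm_sum_le _ _).trans ?_
      rw [Finset.sum_mul]
      refine Finset.sum_le_sum fun i _ => ?_
      rw [norm_mul, Complex.norm_intCast, mul_comm]
      exact mul_le_mul ((hM i z hz).trans (le_abs_self _)) (hk i) (abs_nonneg _) (abs_nonneg _)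
    have h2 : ‖∑ j, (k' j : ℂ) * (Real.log (p j) : ℂ)‖ ≤ (∑ j, |Real.log (p j)|) * T := by
      refine (norm_sum_le _ _).trans ?_
      rw [Finset.sum_mul]
      refine Finset.sum_le_sum fun i _ => ?_
      rw [norm_mul, Complex.norm_intCast, mul_comm, Complex.norm_real, Real.norm_eq_abs]
      exact mul_le_mul le_rfl (hk' i) (abs_nonneg _) (abs_nonneg _)
    refine (norm_add_le _ _).trans ?_
    rw [hC1]; nlinarith
  have hLdiff : ∀ i, DifferentiableOn ℂ (L i) (ball z₀ (8 * ρ)) := fun i z hz =>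
    (hLd z hz i).differentiableAt.differentiableWithinAt
  obtain ⟨Z, hZ⟩ := zero_count z₀ ρ hρ (fun (g : (Fin d ⊕ Fin d) → Option ι) (z : ℂ) => ∏ t, ((g t).elim 1 (fun i => L i z))) (by
    intro g
    apply DifferentiableOn.fun_finsetProd
    intro t _
    cases g t with
    | none => exact differentiableOn_const _
    | some i => exact hLdiff i)
  set N := Fintype.card (Fin d × Fin d) with hN
  have hN4 : N = 4 * e ^ 2 := by rw [hN]; simp [hd]; ring
  have hNpos : (1:ℝ) ≤ N := by rw [hN4]; push_cast; have : (1:ℝ) ≤ e := by exact_mod_cast he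
                               nlinarith
  set K0 : ℝ := 8 * N * C1 ^ 4 with hK0
  have hK0pos : 8 * N ≤ K0 := by rw [hK0]; exact le_mul_of_one_le_right (by positivity) (one_le_pow₀ hC1pos)
  have hK01 : 1 ≤ K0 := by linarith
  refine ⟨ρ / (2 * K0), by positivity, Z, ?_⟩
  intro T hT k l k' l' hkl hk hl hk' hl' τ hτ hTτ y hy S hS
  set u := lf L p k k' with hu
  set v := lf L p l l' with hv
  have hdet : ∀ ζ : Fin d × Fin d → S, (Matrix.of fun i j => (fun (s : S) (q : Fin d × Fin d) => u s ^ (q.1 : ℕ) * v s ^ (q.2 : ℕ)) (ζ j) i).det = 0 := by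
    intro ζ
    apply int_det_zero
    · intro i j
      obtain ⟨h1, -, h3, h4⟩ := hS (ζ j) (ζ j).2
      have hb : (ζ j : ℂ) ∈ ball z₀ (8 * ρ) := closedBall_subset_ball (by linarith) h1
      obtain ⟨n, hn⟩ := lf_int Q p hp L k k' (ζ j) (hLe _ hb) h3
      obtain ⟨m, hm⟩ := lf_int Q p hp L l l' (ζ j) (hLe _ hb) h4
      refine ⟨n ^ (i.1 : ℕ) * m ^ (i.2 : ℕ), ?_⟩
      simp [hu, hv, hn, hm]
    · have hT0 : 1 ≤ C1 * T := one_le_mul_of_one_le_of_one_le hC1pos hT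
      have hsub : closedBall y ρ ⊆ closedBall z₀ (3 * ρ) := by
        apply closedBall_subset_closedBall'
        rw [mem_closedBall] at hy; linarith
      have hsub2 : ball y (2 * ρ) ⊆ ball z₀ (8 * ρ) := by
        apply ball_subset_ball'
        rw [mem_closedBall] at hy; linarith
      have hdiff : ∀ (k : ι → ℤ) (k' : J → ℤ), DifferentiableOn ℂ (lf L p k k') (ball y (2 * ρ)) := fun k k' z hz =>
        (lf_hasDeriv Q p L k k' z (hQ z (hsub2 hz)) (hLd z (hsub2 hz))).differentiableAt.differentiableWithinAt
      have hτ0 : 0 < τ := by linarith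
      have hsmall : 2 * (ρ / (2 * K0) / τ) / ρ = 1 / (K0 * τ) := by field_simp
      have := interp_det y ρ (2 * ρ) (ρ / (2 * K0) / τ) hρ (by linarith) (by positivity)
        (by
          have : ρ / (2 * K0) / τ ≤ ρ / 2 / 1 := by gcongr; linarith
          linarith) (2 * e ^ 2) (by rw [← hN, hN4]; omega)
        (fun (q : Fin d × Fin d) z => u z ^ (q.1 : ℕ) * v z ^ (q.2 : ℕ)) ((C1 * T) ^ (2 * d)) (by positivity)
        (fun q => ((hdiff k k').pow _).mul ((hdiff l l').pow _))
        (by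
          intro q z hz
          rw [norm_mul, norm_pow, norm_pow, two_mul, pow_add]
          have a1 := hlfb T hT k k' hk hk' z (hsub hz)
          have a2 := hlfb T hT l l' hl hl' z (hsub hz)
          gcongr
          · exact (pow_le_pow_left₀ (norm_nonneg _) a1 _).trans (pow_le_pow_right₀ hT0 q.1.2.le)
          · exact (pow_le_pow_left₀ (norm_nonneg _) a2 _).trans (pow_le_pow_right₀ hT0 q.2.2.le))
        (fun j => ζ j) (fun j => (hS (ζ j) (ζ j).2).2.1)
      refine this.trans_lt ?_
      rw [← hN, hsmall]
      have hfac : (N.factorial : ℝ) ≤ (N : ℝ) ^ N := by exact_mod_cast Nat.factorial_le_pow N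
      have e1 : N - 2 * e ^ 2 = 2 * e ^ 2 := by omega
      have e2 : ((1 / (K0 * τ)) ^ (2 * e ^ 2)) ^ (N - 2 * e ^ 2) = ((1 / (K0 * τ)) ^ (e ^ 2)) ^ N := by
        rw [e1, ← pow_mul, ← pow_mul, hN4]; congr 1; ring
      rw [e2]
      have hx : 4 * N * (C1 * T) ^ (2 * d) * (1 / (K0 * τ)) ^ (e ^ 2) ≤ 1 / 2 := by
        have hh : (C1 * T) ^ (2 * d) * (1 / (K0 * τ)) ^ (e ^ 2) ≤ 1 / (8 * (N:ℝ)) := by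
          have h3 : (C1 * T) ^ 4 * (1 / (K0 * τ)) ^ e ≤ 1 / (8 * (N:ℝ)) := by
            have h4 : K0 ≤ K0 ^ e := le_self_pow₀ hK01 (by omega)
            rw [one_div, inv_pow, mul_pow, mul_pow, ← div_eq_mul_inv]
            calc (C1 ^ 4 * T ^ 4 / (K0 ^ e * τ ^ e) : ℝ) ≤ C1 ^ 4 * τ ^ e / (K0 * τ ^ e) := by gcongr
              _ = 1 / (8 * (N:ℝ)) := by rw [hK0]; field_simp
          have h5 : (C1 * T) ^ (2 * d) * (1 / (K0 * τ)) ^ (e ^ 2) = ((C1 * T) ^ 4 * (1 / (K0 * τ)) ^ e) ^ e := by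
            rw [mul_pow _ _ e, ← pow_mul, ← pow_mul, hd, pow_two]; congr 2; ring
          rw [h5]
          have h0 : 0 ≤ (C1 * T) ^ 4 * (1 / (K0 * τ)) ^ e := by positivity
          refine (pow_le_of_le_one h0 (h3.trans ?_) (by omega)).trans h3
          rw [div_le_one (by positivity)]; linarith
        calc _ = 4 * N * ((C1 * T) ^ (2 * d) * (1 / (K0 * τ)) ^ (e ^ 2)) := by ring
          _ ≤ 4 * N * (1 / (8 * (N:ℝ))) := by gcongr
          _ = 1 / 2 := by field_simp; norm_num
      calc _ ≤ 2 ^ N * ((N:ℝ) ^ N * ((2 * (C1 * T) ^ (2 * d)) ^ N * ((1 / (K0 * τ)) ^ (e ^ 2)) ^ N)) := by gcongr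
        _ = (4 * N * (C1 * T) ^ (2 * d) * (1 / (K0 * τ)) ^ (e ^ 2)) ^ N := by
            rw [← mul_pow, ← mul_pow, ← mul_pow]; congr 1; ring
        _ ≤ (1 / 2) ^ N := by gcongr
        _ < 1 := pow_lt_one₀ (by norm_num) (by norm_num) (by rw [hN4]; positivity)
  obtain ⟨P, hP, hPS⟩ := exists_poly_of_det (fun (s : S) (q : Fin d × Fin d) => u s ^ (q.1 : ℕ) * v s ^ (q.2 : ℕ)) hdet
  obtain ⟨c₁, hc₁⟩ := lf_expand L p k k'
  obtain ⟨c₂, hc₂⟩ := lf_expand L p l l'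
  have hx := fun q : Fin d × Fin d => mono_expand L d c₁ c₂ q.1 q.2 q.1.2.le q.2.2.le
  choose x hx using hx
  have hcomb : ∀ z, ∑ g, (∑ q, P q * x q g) * ∏ t, ((g t).elim 1 (fun i => L i z)) = ∑ q : Fin d × Fin d, P q * (u z ^ (q.1 : ℕ) * v z ^ (q.2 : ℕ)) := by
    intro z
    rw [hu, hv, hc₁, hc₂]
    simp_rw [hx, Finset.mul_sum, Finset.sum_mul]
    rw [Finset.sum_comm]
    refine Finset.sum_congr rfl fun i _ => Finset.sum_congr rfl fun j _ => by ring
  refine hZ (fun g => ∑ q, P q * x q g) ?_ S ?_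
  · by_contra hall
    push Not at hall
    apply hP
    let A : ℕ → ℕ → ℂ[X] := fun i j => if h : i < d ∧ j < d then C (P (⟨i, h.1⟩, ⟨j, h.2⟩)) else 0
    have hPp : (∏ i, Q i) ≠ 0 := by
      intro h0
      have := hQ z₀ (mem_ball_self (by positivity))
      have h1 : (∏ i, Q i).eval z₀ ≠ 0 := by
        rw [eval_prod, Finset.prod_ne_zero_iff]; exact fun i _ => this i
      rw [h0] at h1; simp at h1
    have hev : ∀ z ∈ ball z₀ ρ, (∏ i, Q i).eval z ≠ 0 := by
      intro z hz
      rw [eval_prod, Finset.prod_ne_zero_iff]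
      exact fun i _ => hQ z (ball_subset_ball (by linarith) hz) i
    have hin : (ball z₀ ρ).Infinite := by
      exact (infinite_of_mem_nhds z₀ (ball_mem_nhds z₀ hρ))
    have := alg_indep (ball z₀ ρ) isOpen_ball hin (∏ i, Q i) (lfnum Q k) (lfnum Q l) u v
      (fun z => (lfnum Q k).eval z / (∏ i, Q i).eval z) (fun z => (lfnum Q l).eval z / (∏ i, Q i).eval z)
      (fun z hz => lf_hasDeriv Q p L k k' z (hQ z (ball_subset_ball (by linarith) hz)) (hLd z (ball_subset_ball (by linarith) hz)))
      (fun z hz => lf_hasDeriv Q p L l l' z (hQ z (ball_subset_ball (by linarith) hz)) (hLd z (ball_subset_ball (by linarith) hz)))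
      (fun z hz => mul_div_cancel₀ _ (hev z hz)) (fun z hz => mul_div_cancel₀ _ (hev z hz)) hPp
      (lf_indep Q hroot hsep k l hkl) (2 * d) A
      (by
        intro i j hij
        simp only [A]
        rw [dif_neg]; omega)
      (by
        intro z hz
        have h1 := hall z (ball_subset_closedBall hz)
        rw [hcomb] at h1
        rw [← h1, Fintype.sum_prod_type]
        have hcut : ∀ f : ℕ → ℂ, (∀ i, d ≤ i → f i = 0) → ∑ i ∈ Finset.range (2 * d + 1), f i = ∑ i : Fin d, f i := by
          intro f hf
          rw [Fin.sum_univ_eq_sum_range]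
          symm
          apply Finset.sum_subset
          · intro i; simp; omega
          · intro i _ hi
            exact hf i (by simpa using hi)
        rw [rel, hcut]
        · refine Finset.sum_congr rfl fun i _ => ?_
          rw [hcut]
          · refine Finset.sum_congr rfl fun j _ => ?_
            simp only [A]
            rw [dif_pos ⟨i.2, j.2⟩]; simp [mul_assoc]
          · intro j hj
            simp only [A]
            rw [dif_neg (by omega)]; simp
        · intro i hi
          apply Finset.sum_eq_zero
          intro j _
          simp only [A]
          rw [dif_neg (by omega)]; simp)
    ext q
    have h2 := this q.1 q.2
    simp only [A] at h2
    rw [dif_pos ⟨q.1.2, q.2.2⟩] at h2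
    simpa using h2
  · intro s hs
    refine ⟨(hS s hs).1, ?_⟩
    rw [hcomb]
    exact hPS ⟨s, hs⟩
end
end MZ
end

section
open Polynomial NumberField
open Polynomial
namespace MZ
section
variable {ι J : Type} [Fintype ι] [DecidableEq ι] [Fintype J]
open Metric

lemma exists_logs (Q : ι → ℂ[X]) (z₀ : ℂ) (h0 : ∀ i, (Q i).eval z₀ ≠ 0) :
    ∃ ρ : ℝ, 0 < ρ ∧ ∃ L : ι → ℂ → ℂ, ∀ z ∈ ball z₀ (8 * ρ), ∀ i, (Q i).eval z ≠ 0 ∧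
      Complex.exp (L i z) = (Q i).eval z ∧ HasDerivAt (L i) ((derivative (Q i)).eval z / (Q i).eval z) z := by
  have h1 : ∀ᶠ z in nhds z₀, ∀ i, ((Q i).eval z / (Q i).eval z₀) ∈ Complex.slitPlane := by
    rw [Filter.eventually_all]
    intro i
    have hc : Filter.Tendsto (fun z => (Q i).eval z / (Q i).eval z₀) (nhds z₀) (nhds 1) := by
      have : ContinuousAt (fun z => (Q i).eval z / (Q i).eval z₀) z₀ := by fun_prop
      have h2 := this.tendsto
      rwa [div_self (h0 i)] at h2
    exact hc (Complex.isOpen_slitPlane.mem_nhds Complex.one_mem_slitPlane)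
  obtain ⟨ε, hε, hb⟩ := Metric.eventually_nhds_iff_ball.1 h1
  refine ⟨ε / 8, by positivity, fun i z => Complex.log ((Q i).eval z / (Q i).eval z₀) + Complex.log ((Q i).eval z₀), ?_⟩
  intro z hz i
  rw [show 8 * (ε / 8) = ε by ring] at hz
  have h2 := hb z hz i
  have hne : (Q i).eval z ≠ 0 := by
    intro h; rw [h] at h2; simp at h2
  refine ⟨hne, ?_, ?_⟩
  · rw [Complex.exp_add, Complex.exp_log (div_ne_zero hne (h0 i)), Complex.exp_log (h0 i)]
    field_simp [h0 i]
  · have h3 := ((((Q i).hasDerivAt z).div_const ((Q i).eval z₀)).clog h2).add_const (Complex.log ((Q i).eval z₀))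
    rw [div_div_div_cancel_right₀ (h0 i)] at h3
    exact h3

lemma cell_count (S : Finset ℂ) (R s : ℝ) (hs : 0 < s) (hR : 0 ≤ R) (hS : ∀ z ∈ S, ‖z‖ ≤ R) (Z : ℕ)
    (hZ : ∀ y ∈ S, ∀ S' ⊆ S, (∀ z ∈ S', z ∈ closedBall y (2 * s)) → S'.card ≤ Z) :
    (S.card : ℝ) ≤ Z * (2 * R / s + 3) ^ 2 := by
  classical
  set g : ℂ → ℤ × ℤ := fun z => (⌊z.re / s⌋, ⌊z.im / s⌋) with hg
  set W : Finset ℤ := Finset.Icc (-(⌊R / s⌋ + 1)) (⌊R / s⌋ + 1) with hW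
  have hfl : ∀ x : ℝ, |x| ≤ R → ⌊x / s⌋ ∈ W := by
    intro x hx
    rw [hW, Finset.mem_Icc]
    rw [abs_le] at hx
    have h1 : x / s ≤ R / s := by gcongr; exact hx.2
    have h2 : -(R / s) ≤ x / s := by rw [← neg_div]; gcongr; exact hx.1
    constructor
    · rw [Int.le_floor]; push_cast; linarith [Int.lt_floor_add_one (R / s)]
    · have := Int.floor_le_floor h1; omega
  have hmaps : ∀ z ∈ S, g z ∈ W ×ˢ W := by
    intro z hz
    rw [Finset.mem_product]
    exact ⟨hfl _ ((Complex.abs_re_le_norm z).trans (hS z hz)), hfl _ ((Complex.abs_im_le_norm z).trans (hS z hz))⟩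
  have hcard : S.card ≤ Z * (W ×ˢ W).card := by
    refine Finset.card_le_mul_card_image_of_maps_to hmaps Z ?_
    intro c hc
    rcases (S.filter (fun z => g z = c)).eq_empty_or_nonempty with h | ⟨y, hy⟩
    · rw [h]; simp
    · refine hZ y (Finset.mem_filter.1 hy).1 _ (Finset.filter_subset _ _) ?_
      intro z hz
      have e1 := (Finset.mem_filter.1 hy).2
      have e2 := (Finset.mem_filter.1 hz).2
      have e3 : g z = g y := e2.trans e1.symm
      simp only [hg, Prod.mk.injEq] at e3
      have key : ∀ a b : ℝ, ⌊a / s⌋ = ⌊b / s⌋ → |a - b| ≤ s := by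
        intro a b h
        have := Int.abs_sub_lt_one_of_floor_eq_floor h
        rw [← sub_div, abs_div, abs_of_pos hs, div_lt_one hs] at this
        exact this.le
      rw [mem_closedBall, dist_eq_norm]
      refine (Complex.norm_le_abs_re_add_abs_im _).trans ?_
      have := key _ _ e3.1
      have := key _ _ e3.2
      simp only [Complex.sub_re, Complex.sub_im]
      linarith
  have hWc : (W.card : ℝ) ≤ 2 * R / s + 3 := by
    rw [hW, Int.card_Icc]
    have h0 : 0 ≤ ⌊R / s⌋ := Int.floor_nonneg.2 (by positivity)
    have : (((⌊R / s⌋ + 1 + 1 - -(⌊R / s⌋ + 1)).toNat : ℤ) : ℝ) = 2 * ⌊R / s⌋ + 3 := by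
      rw [Int.toNat_of_nonneg (by omega)]; push_cast; ring
    have h2 : (((⌊R / s⌋ + 1 + 1 - -(⌊R / s⌋ + 1)).toNat : ℕ) : ℝ) = 2 * ⌊R / s⌋ + 3 := by exact_mod_cast this
    rw [h2]
    have := Int.floor_le (R / s)
    have e : 2 * R / s = 2 * (R / s) := by ring
    linarith
  calc (S.card : ℝ) ≤ Z * (W.card * W.card) := by
        rw [Finset.card_product] at hcard; exact_mod_cast hcard
    _ ≤ Z * ((2 * R / s + 3) * (2 * R / s + 3)) := by gcongr
    _ = _ := by ring

lemma compact_count (Q : ι → ℂ[X]) (hroot : ∀ i, ∃ ρ, (Q i).eval ρ = 0)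
    (hsep : ∀ i ρ, (Q i).eval ρ = 0 → (derivative (Q i)).eval ρ ≠ 0 ∧ ∀ j, j ≠ i → (Q j).eval ρ ≠ 0)
    (p : J → ℕ) (hp : ∀ j, 0 < p j) (Ω : Set ℂ) (hΩ : IsCompact Ω) (hΩQ : ∀ z ∈ Ω, ∀ i, (Q i).eval z ≠ 0)
    (e : ℕ) (he : 1 ≤ e) :
    ∃ C : ℝ, 0 < C ∧ ∀ T : ℝ, 1 ≤ T → ∀ (k l : ι → ℤ) (k' l' : J → ℤ),
      (∃ i j, k i * l j - k j * l i ≠ 0) → (∀ i, |(k i : ℝ)| ≤ T) → (∀ i, |(l i : ℝ)| ≤ T) →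
      (∀ i, |(k' i : ℝ)| ≤ T) → (∀ i, |(l' i : ℝ)| ≤ T) →
      ∀ τ : ℝ, 1 ≤ τ → T ^ 4 ≤ τ ^ e → ∀ S : Finset ℂ,
      (∀ s ∈ S, s ∈ Ω ∧ MRel Q p k k' s ∧ MRel Q p l l' s) → (S.card : ℝ) ≤ C * τ ^ 2 := by
  classical
  have h1 : ∀ z₀ : Ω, ∃ ρ : ℝ, 0 < ρ ∧ ∃ c : ℝ, 0 < c ∧ ∃ Z : ℕ, ∀ T : ℝ, 1 ≤ T → ∀ (k l : ι → ℤ) (k' l' : J → ℤ),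
      (∃ i j, k i * l j - k j * l i ≠ 0) → (∀ i, |(k i : ℝ)| ≤ T) → (∀ i, |(l i : ℝ)| ≤ T) →
      (∀ i, |(k' i : ℝ)| ≤ T) → (∀ i, |(l' i : ℝ)| ≤ T) →
      ∀ τ : ℝ, 1 ≤ τ → T ^ 4 ≤ τ ^ e → ∀ y ∈ closedBall (z₀ : ℂ) ρ, ∀ S : Finset ℂ,
      (∀ s ∈ S, s ∈ closedBall (z₀ : ℂ) ρ ∧ s ∈ closedBall y (c / τ) ∧ MRel Q p k k' s ∧ MRel Q p l l' s) →
      S.card ≤ Z := by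
    intro z₀
    obtain ⟨ρ, hρ, L, hL⟩ := exists_logs Q z₀ (hΩQ z₀ z₀.2)
    exact ⟨ρ, hρ, local_count Q hroot hsep p hp z₀ ρ hρ L (fun z hz i => (hL z hz i).1)
      (fun z hz i => (hL z hz i).2.1) (fun z hz i => (hL z hz i).2.2) e he⟩
  choose ρ hρ c hc Z hZ using h1
  obtain ⟨t, ht⟩ := hΩ.elim_finite_subcover (fun z₀ : Ω => ball (z₀ : ℂ) (ρ z₀)) (fun _ => isOpen_ball)
    (fun z hz => Set.mem_iUnion.2 ⟨⟨z, hz⟩, mem_ball_self (hρ _)⟩)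
  obtain ⟨R, hR⟩ := hΩ.isBounded.exists_norm_le
  set R' := max R 0 with hR'
  refine ⟨1 + ∑ m ∈ t, Z m * (4 * R' / c m + 3) ^ 2, ?_, ?_⟩
  · have : 0 ≤ ∑ m ∈ t, Z m * (4 * R' / c m + 3) ^ 2 := Finset.sum_nonneg fun m _ => by positivity
    linarith
  intro T hT k l k' l' hkl hk hl hk' hl' τ hτ hTτ S hS
  have hsub : S ⊆ t.biUnion (fun m => S.filter (fun z => z ∈ ball (m : ℂ) (ρ m))) := by
    intro z hz
    have := ht (hS z hz).1
    simp only [Set.mem_iUnion, exists_prop] at this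
    obtain ⟨m, hm, hzm⟩ := this
    exact Finset.mem_biUnion.2 ⟨m, hm, Finset.mem_filter.2 ⟨hz, hzm⟩⟩
  have hτ0 : 0 < τ := by linarith
  have h2 : ∀ m ∈ t, ((S.filter (fun z => z ∈ ball (m : ℂ) (ρ m))).card : ℝ) ≤ Z m * (4 * R' / c m + 3) ^ 2 * τ ^ 2 := by
    intro m _
    have := hc m
    have h3 := cell_count (S.filter (fun z => z ∈ ball (m : ℂ) (ρ m))) R' (c m / τ / 2) (by positivity) (le_max_right _ _)
      (fun z hz => (hR z (hS z (Finset.mem_filter.1 hz).1).1).trans (le_max_left _ _)) (Z m) (by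
        intro y hy S' hS' hS'y
        refine hZ m T hT k l k' l' hkl hk hl hk' hl' τ hτ hTτ y (ball_subset_closedBall (Finset.mem_filter.1 hy).2) S' ?_
        intro s hs
        have hs2 := Finset.mem_filter.1 (hS' hs)
        refine ⟨ball_subset_closedBall hs2.2, ?_, (hS s hs2.1).2⟩
        have := hS'y s hs
        rwa [show 2 * (c m / τ / 2) = c m / τ by ring] at this)
    refine h3.trans ?_
    rw [mul_assoc]
    have hR0 : 0 ≤ R' := le_max_right _ _
    gcongr
    rw [← mul_pow]
    have e1 : 2 * R' / (c m / τ / 2) = 4 * R' / c m * τ := by field_simp; ring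
    rw [e1]
    gcongr
    nlinarith
  calc (S.card : ℝ) ≤ ((t.biUnion (fun m => S.filter (fun z => z ∈ ball (m : ℂ) (ρ m)))).card : ℝ) := by
        exact_mod_cast Finset.card_le_card hsub
    _ ≤ ∑ m ∈ t, ((S.filter (fun z => z ∈ ball (m : ℂ) (ρ m))).card : ℝ) := by
        exact_mod_cast Finset.card_biUnion_le
    _ ≤ ∑ m ∈ t, Z m * (4 * R' / c m + 3) ^ 2 * τ ^ 2 := Finset.sum_le_sum h2
    _ = (∑ m ∈ t, Z m * (4 * R' / c m + 3) ^ 2) * τ ^ 2 := by rw [Finset.sum_mul]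
    _ ≤ _ := by gcongr; linarith
end
end MZ
end

section
open Polynomial NumberField
open Polynomial
namespace MZ

lemma base_expand (q : ℤ[X]) (hq : q.Monic) (n : ℕ) (hn : q.natDegree = n + 1) :
    ∃ H : ℤ, 1 ≤ H ∧ ∀ a : ℕ, ∃ ρ : ℕ → ℕ → ℤ, (∀ s e, |ρ s e| ≤ H ^ a) ∧ (∀ s e, a < s → ρ s e = 0) ∧
      ∀ d, a ≤ d → (X : ℤ[X]) ^ a = ∑ s ∈ Finset.range (d + 1), q ^ s * ∑ e ∈ Finset.range (n + 1), C (ρ s e) * X ^ e := by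
  set H0 : ℤ := ∑ e ∈ Finset.range (n+1), |q.coeff e| with hH0
  have hH0nn : 0 ≤ H0 := Finset.sum_nonneg fun _ _ => abs_nonneg _
  have hXn : (X : ℤ[X]) ^ (n+1) = q - ∑ e ∈ Finset.range (n+1), C (q.coeff e) * X ^ e := by
    have h1 := q.as_sum_range_C_mul_X_pow
    rw [hn, Finset.sum_range_succ] at h1
    have h2 : q.coeff (n+1) = 1 := by rw [← hn]; exact hq
    rw [h2, C_1, one_mul] at h1
    linear_combination -h1
  refine ⟨2 + H0, by omega, ?_⟩
  intro a
  induction a with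
  | zero =>
    refine ⟨fun s e => if s = 0 ∧ e = 0 then 1 else 0, ?_, ?_, ?_⟩
    · intro s e; dsimp only; split_ifs <;> simp
    · intro s e hs; simp; omega
    · intro d _
      rw [Finset.sum_eq_single 0]
      · rw [Finset.sum_eq_single 0]
        · simp
        · intro b _ hb; simp [hb]
        · simp
      · intro b _ hb; simp [hb]
      · simp
  | succ a ih =>
    obtain ⟨ρ, h1, h2, h3⟩ := ih
    refine ⟨fun s e => (if e = 0 then 0 else ρ s (e-1)) - q.coeff e * (if e < n + 1 then 1 else 0) * ρ s n + (if e = 0 ∧ s ≠ 0 then ρ (s-1) n else 0), ?_, ?_, ?_⟩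
    · intro s e
      have b1 : |(if e = 0 then 0 else ρ s (e-1))| ≤ (2+H0)^a := by
        split_ifs
        · simp; positivity
        · exact h1 _ _
      have b3 : |(if e = 0 ∧ s ≠ 0 then ρ (s-1) n else 0)| ≤ (2+H0)^a := by
        split_ifs
        · exact h1 _ _
        · simp; positivity
      have b2 : |q.coeff e * (if e < n + 1 then 1 else 0) * ρ s n| ≤ H0 * (2+H0)^a := by
        rw [abs_mul]
        refine mul_le_mul ?_ (h1 _ _) (abs_nonneg _) hH0nn
        split_ifs with he
        · rw [mul_one]
          exact Finset.single_le_sum (f := fun e => |q.coeff e|) (fun _ _ => abs_nonneg _) (Finset.mem_range.2 he)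
        · simpa using hH0nn
      calc _ ≤ |(if e = 0 then 0 else ρ s (e-1))| + |q.coeff e * (if e < n + 1 then 1 else 0) * ρ s n| + |(if e = 0 ∧ s ≠ 0 then ρ (s-1) n else 0)| :=
            (abs_add_le _ _).trans (by gcongr; exact abs_sub _ _)
        _ ≤ _ := by rw [pow_succ]; linarith
    · intro s e hs
      simp only
      rw [h2 s _ (by omega), h2 s n (by omega)]
      have : ρ (s-1) n = 0 := h2 _ _ (by omega)
      rw [this]; simp
    · intro d hd
      obtain ⟨d, rfl⟩ : ∃ d', d = d' + 1 := ⟨d - 1, by omega⟩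
      have hd : a ≤ d := by omega
      rw [pow_succ, h3 (d+1) (by omega), Finset.sum_mul]
      have step : ∀ s, q ^ s * (∑ e ∈ Finset.range (n + 1), C (ρ s e) * X ^ e) * X =
          q ^ s * ∑ e ∈ Finset.range (n+1), C ((if e = 0 then 0 else ρ s (e-1)) - q.coeff e * (if e < n + 1 then 1 else 0) * ρ s n) * X ^ e
          + q ^ (s+1) * C (ρ s n) := by
        intro s
        have e1 : (∑ e ∈ Finset.range (n + 1), C (ρ s e) * X ^ e) * X = ∑ e ∈ Finset.range n, C (ρ s e) * X ^ (e+1) + C (ρ s n) * X ^ (n+1) := by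
          rw [Finset.sum_range_succ, add_mul, Finset.sum_mul]
          congr 1
          · refine Finset.sum_congr rfl fun e _ => by rw [pow_succ]; ring
          · rw [pow_succ]; ring
        have e2 : ∑ e ∈ Finset.range (n+1), C ((if e = 0 then 0 else ρ s (e-1)) - q.coeff e * (if e < n + 1 then 1 else 0) * ρ s n) * X ^ e
          = ∑ e ∈ Finset.range n, C (ρ s e) * X ^ (e+1) - C (ρ s n) * ∑ e ∈ Finset.range (n+1), C (q.coeff e) * X ^ e := by
          simp only [map_sub, sub_mul, Finset.sum_sub_distrib]
          congr 1
          · rw [Finset.sum_range_succ']; simp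
          · rw [Finset.mul_sum]
            refine Finset.sum_congr rfl fun e he => ?_
            rw [if_pos (Finset.mem_range.1 he)]
            simp only [map_mul, mul_one]; ring
        rw [mul_assoc, e1, e2, hXn]; ring
      simp_rw [step]
      rw [Finset.sum_add_distrib]
      have e5 : ∑ s ∈ Finset.range (d+1+1), q ^ (s+1) * C (ρ s n) = ∑ s ∈ Finset.range (d+1+1), q ^ s * C (if s ≠ 0 then ρ (s-1) n else 0) := by
        rw [Finset.sum_range_succ, h2 (d+1) n (by omega)]
        conv_rhs => rw [Finset.sum_range_succ']
        simp
      rw [e5, ← Finset.sum_add_distrib]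
      refine Finset.sum_congr rfl fun s _ => ?_
      rw [← mul_add]
      congr 1
      simp only [map_add, add_mul, Finset.sum_add_distrib]
      congr 1
      rw [Finset.sum_eq_single 0]
      · by_cases hs : s = 0 <;> simp [hs]
      · intro b _ hb; simp [hb]
      · simp
end MZ
end

section
open Polynomial NumberField
open Polynomial
namespace MZ
section
attribute [local instance] Matrix.seminormedAddCommGroup Matrix.normedAddCommGroup
lemma siegel {m n : Type} [Fintype m] [Fintype n] (A : Matrix m n ℤ) (B : ℝ) (hB : 1 ≤ B)
    (hA : ∀ i j, |(A i j : ℝ)| ≤ B) (κ : ℝ) (hκ : 0 ≤ κ)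
    (hmn : Fintype.card m < Fintype.card n)
    (hc : (Fintype.card m : ℝ) ≤ κ * ((Fintype.card n : ℝ) - Fintype.card m)) :
    ∃ t : n → ℤ, t ≠ 0 ∧ (∀ i, ∑ j, A i j * t j = 0) ∧ ∀ j, |(t j : ℝ)| ≤ (Fintype.card n * B) ^ κ := by
  have hn : (1:ℝ) ≤ Fintype.card n := by
    exact_mod_cast (Nat.succ_le_of_lt ((Nat.zero_le _).trans_lt hmn))
  have hbase : 1 ≤ (Fintype.card n * B : ℝ) := one_le_mul_of_one_le_of_one_le hn hB
  by_cases hm : 0 < Fintype.card m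
  · obtain ⟨t, ht, h1, h2⟩ := Int.Matrix.exists_ne_zero_int_vec_norm_le A hmn hm
    refine ⟨t, ht, fun i => congrFun h1 i, fun j => ?_⟩
    have h3 : |(t j : ℝ)| ≤ ‖t‖ := by
      have := norm_le_pi_norm t j
      rwa [Int.norm_eq_abs] at this
    refine h3.trans (h2.trans ?_)
    have h4 : ‖A‖ ≤ B := by
      rw [Matrix.norm_le_iff (by linarith)]
      intro i j; rw [Int.norm_eq_abs]; exact hA i j
    have h5 : (Fintype.card n * max 1 ‖A‖ : ℝ) ≤ Fintype.card n * B := by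
      gcongr; exact max_le hB h4
    have h6 : (Fintype.card m : ℝ) / (Fintype.card n - Fintype.card m) ≤ κ := by
      rw [div_le_iff₀]; · exact hc
      · have : (Fintype.card m : ℝ) < Fintype.card n := by exact_mod_cast hmn
        linarith
    have h7 : (0:ℝ) ≤ (Fintype.card m : ℝ) / (Fintype.card n - Fintype.card m) := by
      apply div_nonneg (by positivity)
      have : (Fintype.card m : ℝ) < Fintype.card n := by exact_mod_cast hmn
      linarith
    calc _ ≤ (Fintype.card n * B : ℝ) ^ ((Fintype.card m : ℝ) / (Fintype.card n - Fintype.card m)) :=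
          Real.rpow_le_rpow (by positivity) h5 h7
      _ ≤ _ := Real.rpow_le_rpow_of_exponent_le hbase h6
  · have : IsEmpty m := Fintype.card_eq_zero_iff.1 (by omega)
    have hne : Nonempty n := Fintype.card_pos_iff.1 (by omega)
    refine ⟨fun _ => 1, ?_, fun i => this.elim i, fun j => ?_⟩
    · intro h; have := congrFun h hne.some; simp at this
    · simp; exact Real.one_le_rpow hbase hκ
end

lemma triangle_count (A B : ℝ) (hA : 0 < A) (hB : 1 ≤ B) (S : Finset (ℕ × ℕ))
    (hS : ∀ q ∈ S, (q.1 : ℝ) / A + q.2 / B < 1) : (S.card : ℝ) ≤ A * B / 2 + 2 * A + B + 1 := by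
  classical
  set T := ⌊B⌋₊ with hT
  have hT1 : (T : ℝ) ≤ B := Nat.floor_le (by linarith)
  have hT2 : B < T + 1 := Nat.lt_floor_add_one B
  have hB0 : 0 < B := by linarith
  have hmaps : ∀ q ∈ S, q.2 ∈ Finset.range (T + 1) := by
    intro q hq
    have h1 := hS q hq
    have h2 : 0 ≤ (q.1 : ℝ) / A := by positivity
    have h3 : (q.2 : ℝ) / B < 1 := by linarith
    rw [div_lt_one hB0] at h3
    rw [Finset.mem_range, Nat.lt_succ_iff]
    exact Nat.le_floor h3.le
  have h1 := Finset.card_eq_sum_card_fiberwise hmaps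
  have h2 : ∀ t ∈ Finset.range (T+1), ((S.filter (fun q => q.2 = t)).card : ℝ) ≤ A * (1 - t / B) + 1 := by
    intro t ht
    have ht' : (t : ℝ) ≤ T := by exact_mod_cast Nat.lt_succ_iff.1 (Finset.mem_range.1 ht)
    have h0 : 0 ≤ A * (1 - t / B) := by
      apply mul_nonneg hA.le
      rw [sub_nonneg, div_le_one hB0]; linarith
    have h3 : (S.filter (fun q => q.2 = t)).card ≤ ((Finset.range (⌊A * (1 - t / B)⌋₊ + 1)).card) := by
      apply Finset.card_le_card_of_injOn (fun q => q.1)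
      · intro q hq
        have hq' := Finset.mem_filter.1 hq
        have h4 := hS q hq'.1
        rw [hq'.2] at h4
        have h5 : (q.1 : ℝ) ≤ A * (1 - t / B) := by
          have : (q.1 : ℝ) / A ≤ 1 - t / B := by linarith
          rw [div_le_iff₀ hA] at this; linarith
        simp only [Finset.coe_range, Set.mem_Iio]
        exact Nat.lt_succ_iff.2 (Nat.le_floor h5)
      · intro q hq q' hq' h
        have e1 := (Finset.mem_filter.1 hq).2
        have e2 := (Finset.mem_filter.1 hq').2
        exact Prod.ext h (e1.trans e2.symm)
    rw [Finset.card_range] at h3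
    have h4 : ((S.filter (fun q => q.2 = t)).card : ℝ) ≤ (⌊A * (1 - t / B)⌋₊ : ℝ) + 1 := by exact_mod_cast h3
    linarith [Nat.floor_le h0]
  have h3 : (S.card : ℝ) ≤ ∑ t ∈ Finset.range (T+1), (A * (1 - t / B) + 1) := by
    rw [h1]; push_cast; exact Finset.sum_le_sum h2
  refine h3.trans ?_
  have h4 : ∑ t ∈ Finset.range (T+1), (A * (1 - t / B) + 1) = (T + 1) * (A + 1) - A / B * (T * (T + 1) / 2) := by
    have hg : ∑ t ∈ Finset.range (T+1), (t : ℝ) = T * (T + 1) / 2 := by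
      have := Finset.sum_range_id_mul_two (T+1)
      have h5 : ((∑ t ∈ Finset.range (T+1), t : ℕ) : ℝ) * 2 = (T + 1) * T := by
        have h6 : ((∑ t ∈ Finset.range (T+1), t) * 2 : ℕ) = (T+1) * T := by simpa using this
        exact_mod_cast h6
      push_cast at h5; linarith
    rw [← hg, Finset.mul_sum]
    have : ((T:ℝ) + 1) * (A + 1) = ∑ t ∈ Finset.range (T+1), (A + 1) := by simp; ring
    rw [this, ← Finset.sum_sub_distrib]
    refine Finset.sum_congr rfl fun t _ => by ring
  rw [h4]
  have h5 : A / B * (T * (T + 1) / 2) ≥ A / B * ((B - 1) * (T + 1) / 2) := by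
    gcongr; linarith
  have h6 : A / B * ((B - 1) * (T + 1) / 2) = (T + 1) * (A / 2) - (T + 1) * (A / B / 2) := by field_simp
  have h7 : A / B ≤ A := div_le_self hA.le hB
  have h8 : A / B * B = A := by field_simp
  have h9 : 0 < A / B := by positivity
  nlinarith
end MZ
end

section
open Polynomial NumberField
open Polynomial
namespace MZ

lemma aux_identity {K : Type} [CommRing K] (d1 d2 n1 n2 : ℕ) (Q1 Q2 : ℤ[X]) (ρ1 ρ2 : ℕ → ℕ → ℕ → ℤ)
    (h1 : ∀ a ≤ d1, (X : ℤ[X]) ^ a = ∑ s ∈ Finset.range (d1 + 1), Q1 ^ s * ∑ e ∈ Finset.range n1, C (ρ1 a s e) * X ^ e)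
    (h2 : ∀ a ≤ d2, (X : ℤ[X]) ^ a = ∑ s ∈ Finset.range (d2 + 1), Q2 ^ s * ∑ e ∈ Finset.range n2, C (ρ2 a s e) * X ^ e)
    (p : ℕ → ℕ → ℤ) (y : K) :
    ∑ a ∈ Finset.range (d1+1), C (∑ b ∈ Finset.range (d2+1), (p a b : K) * y ^ b) * X ^ a
     = ∑ s ∈ Finset.range (d1+1), ∑ t ∈ Finset.range (d2+1), (Q1.map (Int.castRingHom K)) ^ s * C ((aeval y Q2) ^ t) *
        ∑ e ∈ Finset.range n1, ∑ f ∈ Finset.range n2,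
          C (((∑ a ∈ Finset.range (d1+1), ∑ b ∈ Finset.range (d2+1), p a b * (ρ1 a s e * ρ2 b t f) : ℤ) : K) * y ^ f) * X ^ e := by
  have h1' : ∀ a ≤ d1, (X : K[X]) ^ a = ∑ s ∈ Finset.range (d1 + 1), (Q1.map (Int.castRingHom K)) ^ s * ∑ e ∈ Finset.range n1, C (ρ1 a s e : K) * X ^ e := by
    intro a ha
    have := congrArg (Polynomial.map (Int.castRingHom K)) (h1 a ha)
    simpa [Polynomial.map_sum] using this
  have h2' : ∀ b ≤ d2, y ^ b = ∑ t ∈ Finset.range (d2 + 1), (aeval y Q2) ^ t * ∑ f ∈ Finset.range n2, (ρ2 b t f : K) * y ^ f := by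
    intro b hb
    have := congrArg (aeval y) (h2 b hb)
    simpa using this
  have key : ∀ a ≤ d1, ∀ b ≤ d2, C ((p a b : K) * y ^ b) * X ^ a =
     ∑ s ∈ Finset.range (d1+1), ∑ t ∈ Finset.range (d2+1), ∑ e ∈ Finset.range n1, ∑ f ∈ Finset.range n2,
       (Q1.map (Int.castRingHom K)) ^ s * C ((aeval y Q2) ^ t) * (C ((p a b * (ρ1 a s e * ρ2 b t f) : K) * y ^ f) * X ^ e) := by
    intro a ha b hb
    rw [h2' b hb, h1' a ha]
    simp only [Finset.mul_sum, Finset.sum_mul, map_sum]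
    refine Finset.sum_congr rfl fun s _ => ?_
    rw [Finset.sum_comm]
    refine Finset.sum_congr rfl fun t _ => Finset.sum_congr rfl fun e _ => Finset.sum_congr rfl fun f _ => ?_
    simp only [map_mul]
    ring
  have hL : ∑ a ∈ Finset.range (d1+1), C (∑ b ∈ Finset.range (d2+1), (p a b : K) * y ^ b) * X ^ a
    = ∑ a ∈ Finset.range (d1+1), ∑ b ∈ Finset.range (d2+1), ∑ s ∈ Finset.range (d1+1), ∑ t ∈ Finset.range (d2+1), ∑ e ∈ Finset.range n1, ∑ f ∈ Finset.range n2,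
       (Q1.map (Int.castRingHom K)) ^ s * C ((aeval y Q2) ^ t) * (C ((p a b * (ρ1 a s e * ρ2 b t f) : K) * y ^ f) * X ^ e) := by
    refine Finset.sum_congr rfl fun a ha => ?_
    rw [map_sum, Finset.sum_mul]
    refine Finset.sum_congr rfl fun b hb => ?_
    exact key a (by simpa [Nat.lt_succ_iff] using ha) b (by simpa [Nat.lt_succ_iff] using hb)
  rw [hL]
  have hsw := Finset.sum_comm (s := Finset.range (d1+1) ×ˢ Finset.range (d2+1))
    (t := Finset.range (d1+1) ×ˢ (Finset.range (d2+1) ×ˢ (Finset.range n1 ×ˢ Finset.range n2)))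
    (f := fun x w => (Q1.map (Int.castRingHom K)) ^ w.1 * C ((aeval y Q2) ^ w.2.1) * (C ((p x.1 x.2 * (ρ1 x.1 w.1 w.2.2.1 * ρ2 x.2 w.2.1 w.2.2.2) : K) * y ^ w.2.2.2) * X ^ w.2.2.1))
  simp only [Finset.sum_product] at hsw
  rw [hsw]
  refine Finset.sum_congr rfl fun s _ => Finset.sum_congr rfl fun t _ => ?_
  rw [Finset.mul_sum]
  refine Finset.sum_congr rfl fun e _ => ?_
  rw [Finset.mul_sum]
  refine Finset.sum_congr rfl fun f _ => ?_
  push_cast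
  simp only [Finset.sum_mul, Finset.mul_sum, map_sum]

set_option maxHeartbeats 2000000 in
lemma aux_poly {ι : Type} [Fintype ι] [DecidableEq ι] (Q : ι → ℤ[X]) (hQ : ∀ i, (Q i).Monic) (hn : ∀ i, 1 ≤ (Q i).natDegree)
    (m : ι → ℝ) (hm : ∀ i, 0 < m i) (Pr : Finset (ι × ι)) (θ : ℝ) (hθ0 : 0 < θ)
    (hθ : θ ^ 2 * ∑ q ∈ Pr, ((Q q.1).natDegree : ℝ) * (Q q.2).natDegree * (m q.1 * m q.2) < 2) :
    ∃ d2 : ℕ, 1 ≤ d2 ∧ ∃ Cc : ℝ, 1 ≤ Cc ∧ ∀ d1 : ℕ, d2 ≤ d1 → ∃ p : ℕ → ℕ → ℤ,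
      (∃ a ≤ d1, ∃ b ≤ d2, p a b ≠ 0) ∧ (∀ a b, |(p a b : ℝ)| ≤ Cc ^ d1) ∧
      ∀ q ∈ Pr, ∃ r : ℕ → ℕ → ℕ → ℕ → ℤ, (∀ s t e f, |(r s t e f : ℝ)| ≤ Cc ^ d1) ∧
        (∀ s t e f, s ≤ d1 → t ≤ d2 → e < (Q q.1).natDegree → f < (Q q.2).natDegree →
            (s : ℝ) / (m q.1 * d1) + t / (m q.2 * d2) < θ → r s t e f = 0) ∧
        ∀ (K : Type) [CommRing K] (y : K),
          ∑ a ∈ Finset.range (d1+1), C (∑ b ∈ Finset.range (d2+1), (p a b : K) * y ^ b) * X ^ a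
          = ∑ s ∈ Finset.range (d1+1), ∑ t ∈ Finset.range (d2+1), ((Q q.1).map (Int.castRingHom K)) ^ s * C ((aeval y (Q q.2)) ^ t) *
            ∑ e ∈ Finset.range (Q q.1).natDegree, ∑ f ∈ Finset.range (Q q.2).natDegree,
              C ((r s t e f : K) * y ^ f) * X ^ e := by
  classical
  have hex := fun i => base_expand (Q i) (hQ i) ((Q i).natDegree - 1) (by have := hn i; omega)
  choose H' hH1' hex using hex
  choose ρ hρ1 hρ2 hρ3 using hex
  have hnn : ∀ i, (Q i).natDegree - 1 + 1 = (Q i).natDegree := fun i => by have := hn i; omega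
  simp only [hnn] at hρ3
  set H : ℝ := 1 + ∑ i, (H' i : ℝ) with hH
  have hH0 : ∀ i, (1:ℝ) ≤ H' i := fun i => by exact_mod_cast hH1' i
  have hHle : ∀ i, (H' i : ℝ) ≤ H := by
    intro i
    have := Finset.single_le_sum (f := fun i => (H' i : ℝ)) (fun i _ => by have := hH0 i; linarith) (Finset.mem_univ i)
    linarith
  have hH1 : 1 ≤ H := by
    have : 0 ≤ ∑ i, (H' i : ℝ) := Finset.sum_nonneg fun i _ => by have := hH0 i; linarith
    linarith
  have hρb : ∀ i a d s e, a ≤ d → |(ρ i a s e : ℝ)| ≤ H ^ d := by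
    intro i a d s e had
    have h1 : |(ρ i a s e : ℝ)| ≤ (H' i : ℝ) ^ a := by exact_mod_cast hρ1 i a s e
    have := hH0 i
    exact h1.trans ((pow_le_pow_left₀ (by linarith) (hHle i) a).trans (pow_le_pow_right₀ hH1 had))
  set nn : ι × ι → ℝ := fun q => ((Q q.1).natDegree : ℝ) * (Q q.2).natDegree with hnn'
  have hnn0 : ∀ q, 0 ≤ nn q := fun q => by simp only [hnn']; positivity
  set Sg := ∑ q ∈ Pr, nn q * (m q.1 * m q.2) with hSg
  set W := ∑ q ∈ Pr, nn q * (2 * θ * m q.1 + θ * m q.2 + 1) with hW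
  have hW0 : 0 ≤ W := Finset.sum_nonneg fun q _ => by
    have := hm q.1; have := hm q.2; have := hnn0 q; positivity
  set ε := (2 - θ ^ 2 * Sg) / 4 with hε
  have hε0 : 0 < ε := by rw [hε]; linarith
  obtain ⟨d2, hd2⟩ := exists_nat_ge (W / ε + 1 + ∑ i, 1 / (θ * m i))
  have hsum0 : 0 ≤ ∑ i, 1 / (θ * m i) := Finset.sum_nonneg fun i _ => by have := hm i; positivity
  have hWε : 0 ≤ W / ε := by positivity
  have hd21 : (1:ℝ) ≤ d2 := by linarith
  have hd2W : W ≤ ε * d2 := by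
    have : W / ε ≤ d2 := by linarith
    rw [div_le_iff₀ hε0] at this; linarith
  have hd2m : ∀ i, 1 ≤ θ * m i * d2 := by
    intro i
    have h1 := Finset.single_le_sum (f := fun i => 1 / (θ * m i)) (fun i _ => by have := hm i; positivity) (Finset.mem_univ i)
    have h2 : 1 / (θ * m i) ≤ d2 := by linarith
    have := hm i
    rw [div_le_iff₀ (by positivity)] at h2; linarith
  set C0 : ℝ := (4 * H ^ 2) ^ (1 / ε) with hC0
  have hC01 : 1 ≤ C0 := Real.one_le_rpow (by nlinarith) (by positivity)
  refine ⟨d2, by exact_mod_cast hd21, 4 * H ^ 2 * C0, ?_, ?_⟩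
  · have : 1 ≤ 4 * H ^ 2 := by nlinarith
    exact one_le_mul_of_one_le_of_one_le this hC01
  intro d1 hd1
  have hd1' : (d2:ℝ) ≤ d1 := by exact_mod_cast hd1
  have hd11 : (1:ℝ) ≤ d1 := by linarith
  set Tri : ι × ι → Finset (ℕ × ℕ) := fun q => (Finset.range (d1+1) ×ˢ Finset.range (d2+1)).filter
    (fun st => (st.1 : ℝ) / (m q.1 * d1) + st.2 / (m q.2 * d2) < θ) with hTri
  set Cd : Finset ((ι × ι) × (ℕ × ℕ) × (ℕ × ℕ)) := Pr.biUnion (fun q => {q} ×ˢ (Tri q ×ˢ (Finset.range (Q q.1).natDegree ×ˢ Finset.range (Q q.2).natDegree))) with hCd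
  have hTric : ∀ q, ((Tri q).card : ℝ) ≤ (θ * m q.1 * d1) * (θ * m q.2 * d2) / 2 + 2 * (θ * m q.1 * d1) + (θ * m q.2 * d2) + 1 := by
    intro q
    have h1 := hm q.1
    have h2 := hm q.2
    apply triangle_count _ _ (by positivity) (hd2m _)
    intro st hst
    have h3 := (Finset.mem_filter.1 hst).2
    have e : (st.1 : ℝ) / (θ * m q.1 * d1) + st.2 / (θ * m q.2 * d2) = ((st.1 : ℝ) / (m q.1 * d1) + st.2 / (m q.2 * d2)) / θ := by
      field_simp
    rw [e, div_lt_one hθ0]; exact h3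
  have hCdc : (Cd.card : ℝ) ≤ (1 - ε) * (d1 * d2) := by
    have h1 : (Cd.card : ℝ) ≤ ∑ q ∈ Pr, ((Tri q).card * nn q : ℝ) := by
      have : Cd.card ≤ ∑ q ∈ Pr, (Tri q).card * ((Q q.1).natDegree * (Q q.2).natDegree) := by
        refine Finset.card_biUnion_le.trans (le_of_eq ?_)
        refine Finset.sum_congr rfl fun q _ => by simp [Finset.card_product]
      have h2 : (Cd.card : ℝ) ≤ ((∑ q ∈ Pr, (Tri q).card * ((Q q.1).natDegree * (Q q.2).natDegree) : ℕ) : ℝ) := by exact_mod_cast this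
      push_cast at h2
      exact h2
    have h2 : ∑ q ∈ Pr, ((Tri q).card * nn q : ℝ) ≤ ∑ q ∈ Pr, (θ ^ 2 / 2 * (d1 * d2) * (nn q * (m q.1 * m q.2)) + d1 * (nn q * (2 * θ * m q.1 + θ * m q.2 + 1))) := by
      refine Finset.sum_le_sum fun q _ => ?_
      have h3 := hTric q
      have h5 := hm q.2
      calc ((Tri q).card * nn q : ℝ) ≤ ((θ * m q.1 * d1) * (θ * m q.2 * d2) / 2 + 2 * (θ * m q.1 * d1) + (θ * m q.2 * d1) + d1) * nn q := by
            apply mul_le_mul_of_nonneg_right _ (hnn0 q)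
            have : θ * m q.2 * d2 ≤ θ * m q.2 * d1 := by gcongr
            linarith
        _ = _ := by ring
    rw [Finset.sum_add_distrib, ← Finset.mul_sum, ← Finset.mul_sum, ← hSg, ← hW] at h2
    have h3 : θ ^ 2 * Sg = 2 - 4 * ε := by rw [hε]; ring
    have h4 : (d1:ℝ) * W ≤ d1 * (ε * d2) := by gcongr
    have e : θ ^ 2 / 2 * (d1 * d2) * Sg = (1 - 2 * ε) * (d1 * d2 : ℝ) := by
      linear_combination (d1 * d2 / 2 : ℝ) * h3
    linarith
  have hd12 : (1:ℝ) ≤ d1 * d2 := one_le_mul_of_one_le_of_one_le hd11 hd21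
  have hcN : (Fintype.card (Fin (d1+1) × Fin (d2+1)) : ℝ) = (d1+1) * (d2+1) := by simp
  have hNge : (d1 * d2 : ℝ) ≤ (d1+1) * (d2+1) := by nlinarith
  have hcC : (Fintype.card Cd : ℝ) = Cd.card := by simp
  let A : Matrix Cd (Fin (d1+1) × Fin (d2+1)) ℤ := fun c x => ρ c.1.1.1 x.1 c.1.2.1.1 c.1.2.2.1 * ρ c.1.1.2 x.2 c.1.2.1.2 c.1.2.2.2
  have hHd : H ^ d1 * H ^ d2 ≤ (H ^ 2) ^ d1 := by
    rw [← pow_mul, ← pow_add]; exact pow_le_pow_right₀ hH1 (by omega)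
  obtain ⟨t, ht0, ht1, ht2⟩ := siegel A ((H ^ 2) ^ d1) (one_le_pow₀ (one_le_pow₀ hH1))
    (by
      intro c x
      simp only [A]
      push_cast
      rw [abs_mul]
      refine le_trans ?_ hHd
      exact mul_le_mul (hρb _ _ _ _ _ (Nat.lt_succ_iff.1 x.1.2)) (hρb _ _ _ _ _ (Nat.lt_succ_iff.1 x.2.2)) (abs_nonneg _) (by positivity))
    (1/ε) (by positivity)
    (by
      have : (Fintype.card Cd : ℝ) < Fintype.card (Fin (d1+1) × Fin (d2+1)) := by
        rw [hcC, hcN]; nlinarith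
      exact_mod_cast this)
    (by
      rw [hcC, hcN, div_mul_eq_mul_div, one_mul, le_div_iff₀ hε0]
      have h5 : ε ≤ 1 := by
        have : 0 ≤ Sg := Finset.sum_nonneg fun q _ => by
          have := hm q.1; have := hm q.2; have := hnn0 q; positivity
        rw [hε]; nlinarith [mul_nonneg (sq_nonneg θ) this]
      have h6 : (Cd.card : ℝ) * ε ≤ (1 - ε) * (d1 * d2) * ε := by gcongr
      have h7 : (1 - ε) * (d1 * d2) * ε ≤ 1 * (d1 * d2) * ε := by gcongr; linarith
      nlinarith)
  have hNp : ((d1+1) * (d2+1) : ℝ) ≤ 4 ^ d1 := by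
    have h1 : ((d1:ℝ)+1) ≤ 2 ^ d1 := by
      have := Nat.lt_two_pow_self (n := d1)
      exact_mod_cast this
    have h2 : ((d2:ℝ)+1) ≤ 2 ^ d1 := le_trans (by linarith) h1
    calc ((d1+1) * (d2+1) : ℝ) ≤ 2 ^ d1 * 2 ^ d1 := by gcongr
      _ = 4 ^ d1 := by rw [← mul_pow]; norm_num
  have htb : ∀ x, |(t x : ℝ)| ≤ C0 ^ d1 := by
    intro x
    refine (ht2 x).trans ?_
    rw [hcN]
    calc (((d1+1) * (d2+1) : ℝ) * (H ^ 2) ^ d1) ^ (1/ε) ≤ (4 ^ d1 * (H^2) ^ d1) ^ (1/ε) := by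
          apply Real.rpow_le_rpow (by positivity) _ (by positivity)
          gcongr
      _ = C0 ^ d1 := by
          rw [← mul_pow, hC0]
          have hG : (0:ℝ) ≤ 4 * H ^ 2 := by positivity
          generalize 4 * H ^ 2 = G at hG
          rw [← Real.rpow_natCast, ← Real.rpow_natCast, ← Real.rpow_mul hG, ← Real.rpow_mul hG, mul_comm]
  let p : ℕ → ℕ → ℤ := fun a b => if h : a < d1 + 1 ∧ b < d2 + 1 then t (⟨a, h.1⟩, ⟨b, h.2⟩) else 0
  have hpb : ∀ a b, |(p a b : ℝ)| ≤ C0 ^ d1 := by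
    intro a b
    simp only [p]
    split_ifs
    · exact htb _
    · simp; positivity
  have hC0le : C0 ^ d1 ≤ (4 * H ^ 2 * C0) ^ d1 := by
    have hG : 1 ≤ 4 * H ^ 2 := by
      have := one_le_pow₀ hH1 (n := 2)
      linarith
    exact pow_le_pow_left₀ (by linarith) (le_mul_of_one_le_left (by linarith) hG) _
  refine ⟨p, ?_, fun a b => (hpb a b).trans hC0le, ?_⟩
  · obtain ⟨x, hx⟩ := Function.ne_iff.1 ht0
    refine ⟨x.1, Nat.lt_succ_iff.1 x.1.2, x.2, Nat.lt_succ_iff.1 x.2.2, ?_⟩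
    simp only [p]
    rw [dif_pos ⟨x.1.2, x.2.2⟩]
    exact hx
  intro q hq
  refine ⟨fun s t e f => ∑ a ∈ Finset.range (d1+1), ∑ b ∈ Finset.range (d2+1), p a b * (ρ q.1 a s e * ρ q.2 b t f), ?_, ?_, ?_⟩
  · intro s t e f
    push_cast
    have : ∀ a ∈ Finset.range (d1+1), ∀ b ∈ Finset.range (d2+1), |(p a b * (ρ q.1 a s e * ρ q.2 b t f) : ℝ)| ≤ C0 ^ d1 * (H^2)^d1 := by
      intro a ha b hb
      rw [abs_mul, abs_mul]
      apply mul_le_mul (hpb a b) _ (by positivity) (by positivity)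
      refine le_trans ?_ hHd
      exact mul_le_mul (hρb _ _ _ _ _ (by simpa [Nat.lt_succ_iff] using ha)) (hρb _ _ _ _ _ (by simpa [Nat.lt_succ_iff] using hb)) (abs_nonneg _) (by positivity)
    calc |∑ a ∈ Finset.range (d1+1), ∑ b ∈ Finset.range (d2+1), (p a b * (ρ q.1 a s e * ρ q.2 b t f) : ℝ)|
        ≤ ∑ a ∈ Finset.range (d1+1), ∑ b ∈ Finset.range (d2+1), C0 ^ d1 * (H^2)^d1 := by
          refine (Finset.abs_sum_le_sum_abs _ _).trans (Finset.sum_le_sum fun a ha => ?_)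
          exact (Finset.abs_sum_le_sum_abs _ _).trans (Finset.sum_le_sum fun b hb => this a ha b hb)
      _ = ((d1+1) * (d2+1)) * (C0 ^ d1 * (H^2)^d1) := by simp; ring
      _ ≤ 4 ^ d1 * (C0 ^ d1 * (H^2)^d1) := by gcongr
      _ = _ := by rw [mul_pow, mul_pow]; ring
  · intro s u e f hs hu he hf hlt
    have hc : (q, (s, u), (e, f)) ∈ Cd := by
      rw [hCd, Finset.mem_biUnion]
      refine ⟨q, hq, ?_⟩
      simp only [Finset.mem_product, Finset.mem_singleton, Finset.mem_range, hTri, Finset.mem_filter]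
      exact ⟨trivial, ⟨⟨⟨by omega, by omega⟩, hlt⟩, he, hf⟩⟩
    have h1 := ht1 ⟨_, hc⟩
    rw [Fintype.sum_prod_type] at h1
    rw [← h1]
    simp only [A]
    rw [← Fin.sum_univ_eq_sum_range (fun a => ∑ b ∈ Finset.range (d2+1), p a b * (ρ q.1 a s e * ρ q.2 b u f))]
    refine Finset.sum_congr rfl fun a _ => ?_
    rw [← Fin.sum_univ_eq_sum_range (fun b => p a b * (ρ q.1 a s e * ρ q.2 b u f))]
    refine Finset.sum_congr rfl fun b _ => ?_
    simp only [p]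
    rw [dif_pos ⟨a.2, b.2⟩]; ring
  · intro K _ y
    exact aux_identity d1 d2 _ _ (Q q.1) (Q q.2) (ρ q.1) (ρ q.2) (fun a ha => hρ3 q.1 a d1 ha) (fun a ha => hρ3 q.2 a d2 ha) p y
end MZ
end

section
open Polynomial NumberField
open Polynomial
namespace MZ

lemma fin_step {K : Type} [Field K] (f : AbsoluteValue K ℝ) (hf : ∀ a b, f (a + b) ≤ max (f a) (f b))
    (x : K) (V : K[X]) (c : ℝ) (h : ∀ k, f (((X - C x) * V).coeff k) ≤ c) (k : ℕ) :
    f (V.coeff k) ≤ c / max 1 (f x) := by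
  have hc0 : 0 ≤ c := (f.nonneg _).trans (h 0)
  have hk : ∀ k, ((X - C x) * V).coeff (k+1) = V.coeff k - x * V.coeff (k+1) := by
    intro k; simp [sub_mul, coeff_X_mul]
  have h0 : ((X - C x) * V).coeff 0 = - (x * V.coeff 0) := by
    simp [sub_mul]
  have hsub : ∀ a b, f (a - b) ≤ max (f a) (f b) := by
    intro a b; rw [sub_eq_add_neg]; simpa using hf a (-b)
  rcases le_total (f x) 1 with hx | hx
  · rw [max_eq_left hx, div_one]
    have key : ∀ j k, V.natDegree < k + j → f (V.coeff k) ≤ c := by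
      intro j
      induction j with
      | zero => intro k hk; rw [coeff_eq_zero_of_natDegree_lt (by simpa using hk)]; simpa using hc0
      | succ j ih =>
        intro k hkj
        have h1 := ih (k+1) (by omega)
        have h2 := h (k+1)
        rw [hk] at h2
        have e : V.coeff k = (V.coeff k - x * V.coeff (k+1)) + x * V.coeff (k+1) := by ring
        rw [e]
        refine (hf _ _).trans (max_le h2 ?_)
        rw [map_mul]
        exact (mul_le_of_le_one_left (f.nonneg _) hx).trans h1
    exact key (V.natDegree + 1) k (by omega)
  · rw [max_eq_right hx]
    have hx0 : 0 < f x := by linarith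
    induction k with
    | zero =>
      have h2 := h 0
      rw [h0, AbsoluteValue.map_neg, map_mul] at h2
      rw [le_div_iff₀ hx0]; linarith
    | succ k ih =>
      have h2 := h (k+1)
      rw [hk] at h2
      rw [le_div_iff₀ hx0, mul_comm, ← map_mul]
      have e : x * V.coeff (k+1) = V.coeff k - (V.coeff k - x * V.coeff (k+1)) := by ring
      rw [e]
      exact (hsub _ _).trans (max_le (ih.trans (div_le_self hc0 hx)) h2)

lemma fin_steps {K : Type} [Field K] (f : AbsoluteValue K ℝ) (hf : ∀ a b, f (a + b) ≤ max (f a) (f b))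
    (x : K) (V : K[X]) (e : ℕ) : ∀ (c : ℝ) (_ : ∀ k, f (((X - C x) ^ e * V).coeff k) ≤ c) (k : ℕ),
    f (V.coeff k) ≤ c / max 1 (f x) ^ e := by
  induction e with
  | zero => intro c h k; simpa using h k
  | succ e ih =>
    intro c h k
    have h1 := ih (c / max 1 (f x)) (fun k => fin_step f hf x _ c (by rw [← mul_assoc, ← pow_succ']; exact h) k) k
    rwa [div_div, ← pow_succ'] at h1

open NumberField in
lemma order_bound {K : Type} [Field K] [NumberField K] (F : Finset (FinitePlace K)) (x : K) (W : ℤ[X]) (hW : W ≠ 0)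
    (e : ℕ) (h : (X - C x) ^ e ∣ W.map (Int.castRingHom K)) (B : ℝ) (hB : W.sum (fun _ a => |(a:ℝ)|) ≤ B) :
    e * ∑ w : Wp K F, Real.posLog (ab w x) ≤ Module.finrank ℚ K * Real.log B := by
  obtain ⟨V, hV⟩ := h
  have hlc : V.leadingCoeff = (W.leadingCoeff : K) := by
    have := congrArg leadingCoeff hV
    rw [leadingCoeff_mul, leadingCoeff_pow, leadingCoeff_X_sub_C, one_pow, one_mul, leadingCoeff_map_of_injective] at this
    · simpa using this.symm
    · exact (Int.cast_injective : Function.Injective (Int.cast : ℤ → K))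
  have hlW : W.leadingCoeff ≠ 0 := by simpa using hW
  have hl0 : V.leadingCoeff ≠ 0 := by rw [hlc]; exact_mod_cast hlW
  have key : ∀ w : Wp K F, e * Real.posLog (ab w x) ≤ dd w * Real.log B - Real.log (ab w (W.leadingCoeff : K)) := by
    rintro (σ | v)
    · simp only [ab_inl, dd_inl, Nat.cast_one, one_mul]
      have h1 := congrArg (Polynomial.map σ) hV
      have h2 : (W.map (Int.castRingHom K)).map σ = W.map (Int.castRingHom ℂ) := by
        rw [Polynomial.map_map]; congr 1; exact RingHom.ext_int _ _
      rw [h2, Polynomial.map_mul, Polynomial.map_pow, Polynomial.map_sub, map_X, map_C] at h1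
      have h3 := congrArg mahlerMeasure h1
      rw [mahlerMeasure_mul] at h3
      have hpow : ∀ e : ℕ, ((X - C (σ x)) ^ e).mahlerMeasure = (max 1 ‖σ x‖) ^ e := by
        intro e
        induction e with
        | zero => simp
        | succ e ih => rw [pow_succ, mahlerMeasure_mul, ih, mahlerMeasure_X_sub_C, pow_succ]
      rw [hpow] at h3
      have h4 := leadingCoeff_le_mahlerMeasure (V.map σ)
      rw [leadingCoeff_map] at h4
      have h5 : (W.map (Int.castRingHom ℂ)).mahlerMeasure ≤ B := by
        refine le_trans (le_trans (mahlerMeasure_le_sum_norm_coeff _) (le_of_eq ?_)) hB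
        rw [Polynomial.sum_over_range _ (by simp), Polynomial.sum_over_range _ (by simp)]
        rw [natDegree_map_eq_of_injective (Int.cast_injective : Function.Injective (Int.cast : ℤ → ℂ))]
        simp
      have h6 : (max 1 ‖σ x‖) ^ e * ‖σ V.leadingCoeff‖ ≤ B := by
        refine le_trans ?_ h5
        rw [h3]
        gcongr
      have hpos : 0 < ‖σ V.leadingCoeff‖ := by simpa using hl0
      have h7 := Real.log_le_log (by positivity) h6
      rw [Real.log_mul (by positivity) hpos.ne', Real.log_pow] at h7
      rw [Real.posLog_eq_log_max_one (norm_nonneg _), ← hlc]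
      linarith
    · simp only [ab_inr, dd_inr, Nat.cast_zero, zero_mul, zero_sub]
      have h1 := fin_steps v.1.1 (fun a b => FinitePlace.add_le v.1 a b) x V e 1 (by
        intro k; rw [← hV, coeff_map]
        exact fp_int_le v.1 _) V.natDegree
      have hm : (1:ℝ) ≤ max 1 (v.1 x) := le_max_left _ _
      have hpos : 0 < v.1 (V.leadingCoeff) := FinitePlace.pos_iff.2 hl0
      have h2 : v.1 (V.leadingCoeff) ≤ 1 / max 1 (v.1 x) ^ e := h1
      have h7 := Real.log_le_log hpos h2
      rw [one_div, Real.log_inv, Real.log_pow] at h7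
      rw [Real.posLog_eq_log_max_one (apply_nonneg _ _), ← hlc]
      linarith
  rw [Finset.mul_sum]
  refine (Finset.sum_le_sum fun w _ => key w).trans ?_
  rw [Finset.sum_sub_distrib, ← Finset.sum_mul]
  have h1 := int_PF (F := F) W.leadingCoeff hlW
  have h2 : ((∑ w : Wp K F, (dd w : ℝ))) = Module.finrank ℚ K := by
    have := sum_dd (F := F); exact_mod_cast this
  rw [h2]; linarith

end MZ
end

section
open Polynomial NumberField
open Polynomial
namespace MZ

noncomputable def l1 (W : ℤ[X]) : ℝ := W.sum (fun _ a => |(a:ℝ)|)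

lemma l1_eq (W : ℤ[X]) (N : ℕ) (h : W.natDegree < N) : l1 W = ∑ i ∈ Finset.range N, |(W.coeff i : ℝ)| := by
  rw [l1, Polynomial.sum_over_range' _ (by simp) N h]

lemma l1_nonneg (W : ℤ[X]) : 0 ≤ l1 W := by
  rw [l1, Polynomial.sum_def]; exact Finset.sum_nonneg fun _ _ => abs_nonneg _

lemma l1_add (A B : ℤ[X]) : l1 (A + B) ≤ l1 A + l1 B := by
  set N := max A.natDegree B.natDegree + 1
  have h := natDegree_add_le A B
  rw [l1_eq _ N (by omega), l1_eq A N (by omega), l1_eq B N (by omega), ← Finset.sum_add_distrib]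
  refine Finset.sum_le_sum fun i _ => ?_
  simpa using abs_add_le _ _

lemma l1_sum {ι : Type*} (s : Finset ι) (f : ι → ℤ[X]) : l1 (∑ i ∈ s, f i) ≤ ∑ i ∈ s, l1 (f i) := by
  classical
  induction s using Finset.induction_on with
  | empty => simp [l1]
  | insert a s ha ih =>
    rw [Finset.sum_insert ha, Finset.sum_insert ha]
    exact (l1_add _ _).trans (by linarith)

lemma l1_neg (A : ℤ[X]) : l1 (-A) = l1 A := by
  rw [l1_eq _ (A.natDegree+1) (by simp), l1_eq A _ (Nat.lt_succ_self _)]; simp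

lemma l1_C_mul (c : ℤ) (B : ℤ[X]) : l1 (C c * B) = |(c:ℝ)| * l1 B := by
  rw [l1_eq _ (B.natDegree+1) (by have := natDegree_C_mul_le c B; omega), l1_eq B _ (Nat.lt_succ_self _), Finset.mul_sum]
  simp [abs_mul]

lemma l1_X_pow_mul (n : ℕ) (B : ℤ[X]) : l1 (X ^ n * B) = l1 B := by
  induction n with
  | zero => simp
  | succ n ih =>
    rw [← ih, pow_succ', mul_assoc]
    generalize X ^ n * B = A
    rw [l1_eq _ (A.natDegree+1+1) (by have := natDegree_mul_le (p := (X:ℤ[X])) (q := A); rw [natDegree_X] at this; omega), l1_eq A _ (Nat.lt_succ_self _), Finset.sum_range_succ']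
    simp [coeff_X_mul]

lemma l1_mul (A B : ℤ[X]) : l1 (A * B) ≤ l1 A * l1 B := by
  rw [l1_eq A _ (Nat.lt_succ_self _), Finset.sum_mul]
  conv_lhs => rw [A.as_sum_range_C_mul_X_pow, Finset.sum_mul]
  refine (l1_sum _ _).trans (Finset.sum_le_sum fun i _ => ?_)
  rw [mul_assoc, l1_C_mul, l1_X_pow_mul]

lemma l1_prod {ι : Type*} (s : Finset ι) (f : ι → ℤ[X]) : l1 (∏ i ∈ s, f i) ≤ ∏ i ∈ s, l1 (f i) := by
  classical
  induction s using Finset.induction_on with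
  | empty => 
    simp only [Finset.prod_empty]
    rw [l1_eq _ 1 (by simp)]; simp
  | insert a s ha ih =>
    rw [Finset.prod_insert ha, Finset.prod_insert ha]
    exact (l1_mul _ _).trans (mul_le_mul_of_nonneg_left ih (l1_nonneg _))

lemma l1_det {n : ℕ} (M : Matrix (Fin n) (Fin n) ℤ[X]) (B : ℝ) (hM : ∀ i j, l1 (M i j) ≤ B) :
    l1 M.det ≤ n.factorial * B ^ n := by
  rw [Matrix.det_apply]
  refine (l1_sum _ _).trans ?_
  have : ∀ σ ∈ (Finset.univ : Finset (Equiv.Perm (Fin n))), l1 (Equiv.Perm.sign σ • ∏ i, M (σ i) i) ≤ B ^ n := by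
    intro σ _
    have h : l1 (Equiv.Perm.sign σ • ∏ i, M (σ i) i) = l1 (∏ i, M (σ i) i) := by
      rcases Int.units_eq_one_or (Equiv.Perm.sign σ) with h | h <;> rw [h]
      · simp
      · rw [← l1_neg]; simp
    rw [h]
    refine (l1_prod _ _).trans ?_
    refine (Finset.prod_le_prod (fun i _ => l1_nonneg _) fun i _ => hM (σ i) i).trans ?_
    simp
  refine (Finset.sum_le_card_nsmul _ _ _ this).trans ?_
  simp [Fintype.card_perm]

lemma l1_derivative (A : ℤ[X]) (d : ℕ) (h : A.natDegree ≤ d) : l1 (derivative A) ≤ d * l1 A := by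
  have h1 := natDegree_derivative_le A
  rw [l1_eq (derivative A) (d + 1) (by omega), l1_eq A (d+1+1) (by omega), Finset.sum_range_succ' _ (d+1), mul_add, Finset.mul_sum]
  have h2 : 0 ≤ (d:ℝ) * |(A.coeff 0 : ℝ)| := by positivity
  have : ∑ i ∈ Finset.range (d+1), |((derivative A).coeff i : ℝ)| ≤ ∑ i ∈ Finset.range (d+1), (d:ℝ) * |(A.coeff (i+1) : ℝ)| := by
    refine Finset.sum_le_sum fun i hi => ?_
    rw [coeff_derivative]
    push_cast
    rw [abs_mul, mul_comm]
    rcases Nat.lt_or_ge i d with hid | hid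
    · have : |((i:ℝ)+1)| ≤ d := by rw [abs_of_nonneg (by positivity)]; exact_mod_cast hid
      gcongr
    · rw [coeff_eq_zero_of_natDegree_lt (by omega)]; simp
  linarith

lemma l1_iter (A : ℤ[X]) (d : ℕ) (h : A.natDegree ≤ d) (j : ℕ) : l1 (derivative^[j] A) ≤ d ^ j * l1 A := by
  induction j with
  | zero => simp
  | succ j ih =>
    rw [Function.iterate_succ_apply']
    refine (l1_derivative _ d ((natDegree_iterate_derivative A j).trans (by omega))).trans ?_
    rw [pow_succ', mul_assoc]
    gcongr

lemma wronskian_ne_zero {k : Type} [Field k] [CharZero k] {r : ℕ} (U : Fin r → k[X]) (hU : LinearIndependent k U) :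
    (Matrix.of fun (j q : Fin r) => derivative^[(j:ℕ)] (U q)).det ≠ 0 := by
  classical
  intro hdet
  obtain ⟨c, hc0, hc⟩ := Matrix.exists_vecMul_eq_zero_iff.2 hdet
  have hc' : ∀ q, ∑ j, c j * derivative^[(j:ℕ)] (U q) = 0 := by
    intro q
    have := congrFun hc q
    simpa [Matrix.vecMul, dotProduct] using this
  obtain ⟨J, hJ, hJmax⟩ : ∃ J, c J ≠ 0 ∧ ∀ j, J < j → c j = 0 := by
    obtain ⟨j0, hj0⟩ := Function.ne_iff.1 hc0
    have hne : (Finset.univ.filter fun j => c j ≠ 0).Nonempty := ⟨j0, by simpa using hj0⟩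
    refine ⟨_, (Finset.mem_filter.1 (Finset.max'_mem _ hne)).2, fun j hj => ?_⟩
    by_contra h
    exact absurd (Finset.le_max' _ j (by simpa using h)) (not_le.2 hj)
  obtain ⟨x0, hx0⟩ : ∃ x, (c J).eval x ≠ 0 := by
    by_contra hh; push Not at hh
    exact hJ (Polynomial.funext (by simpa using hh))
  let T : (Fin r → k) →ₗ[k] (Fin (J:ℕ) → k) :=
    { toFun := fun v j => ∑ q, v q * (derivative^[(j:ℕ)] (U q)).eval x0
      map_add' := by intro v w; ext j; simp [add_mul, Finset.sum_add_distrib]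
      map_smul' := by intro a v; ext j; simp [Finset.mul_sum, mul_assoc] }
  obtain ⟨v, hv, hv0⟩ : ∃ v, T v = 0 ∧ v ≠ 0 := by
    have h := LinearMap.ker_ne_bot_of_finrank_lt (f := T) (by simp)
    obtain ⟨v, hv, hv0⟩ := Submodule.exists_mem_ne_zero_of_ne_bot h
    exact ⟨v, hv, hv0⟩
  set f := ∑ q, v q • U q with hf
  have hf0 : f ≠ 0 := by
    intro h
    have := Fintype.linearIndependent_iff.1 hU v h
    exact hv0 (funext this)
  have hdf : ∀ j, derivative^[j] f = ∑ q, v q • derivative^[j] (U q) := by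
    intro j; rw [hf, iterate_derivative_sum]; simp
  have hord : ∀ j, j < (J:ℕ) → (derivative^[j] f).eval x0 = 0 := by
    intro j hj
    have h := congrFun hv ⟨j, hj⟩
    rw [hdf, eval_finsetSum]
    simpa [T] using h
  have hLf : ∑ j, c j * derivative^[(j:ℕ)] f = 0 := by
    simp only [hdf, Finset.mul_sum]
    rw [Finset.sum_comm]
    refine Finset.sum_eq_zero fun q _ => ?_
    simp only [mul_smul_comm, ← Finset.smul_sum, hc' q, smul_zero]
  set N := rootMultiplicity x0 f with hN
  have hder : ∀ j, j ≤ (J:ℕ) → rootMultiplicity x0 (derivative^[j] f) = N - j ∧ j ≤ N ∧ derivative^[j] f ≠ 0 := by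
    intro j
    induction j with
    | zero => intro _; exact ⟨rfl, Nat.zero_le _, hf0⟩
    | succ j ih =>
      intro hj
      obtain ⟨h1, h2, h3⟩ := ih (by omega)
      have hroot : (derivative^[j] f).IsRoot x0 := hord j (by omega)
      have h4 := derivative_rootMultiplicity_of_root hroot
      have h5 := (rootMultiplicity_pos h3).2 hroot
      rw [Function.iterate_succ_apply']
      refine ⟨by rw [h4, h1]; omega, by omega, ?_⟩
      intro h6
      have h7 := natDegree_eq_zero_of_derivative_eq_zero h6
      rw [eq_C_of_natDegree_eq_zero h7] at hroot h3
      simp at hroot h3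
      exact h3 hroot
  obtain ⟨h1, h2, h3⟩ := hder J le_rfl
  have hdvd : (X - C x0) ^ (N - J + 1) ∣ c J * derivative^[(J:ℕ)] f := by
    have : c J * derivative^[(J:ℕ)] f = - ∑ j ∈ Finset.univ.erase J, c j * derivative^[(j:ℕ)] f := by
      rw [← Finset.add_sum_erase _ _ (Finset.mem_univ J)] at hLf
      exact eq_neg_of_add_eq_zero_left hLf
    rw [this, dvd_neg]
    refine Finset.dvd_sum fun j hj => ?_
    rcases lt_or_ge J j with hJj | hJj
    · rw [hJmax j hJj, zero_mul]; exact dvd_zero _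
    · have hlt : j < J := lt_of_le_of_ne hJj (Finset.ne_of_mem_erase hj)
      have hlt' : (j:ℕ) < J := hlt
      have h4 := (hder j hlt'.le).1
      refine Dvd.dvd.mul_left ?_ _
      refine (pow_dvd_pow _ ?_).trans (pow_rootMultiplicity_dvd (derivative^[(j:ℕ)] f) x0)
      rw [h4]; omega
  have hcop : IsCoprime ((X - C x0) ^ (N - J + 1)) (c J) := by
    apply IsCoprime.pow_left
    rw [(irreducible_X_sub_C x0).coprime_iff_not_dvd, dvd_iff_isRoot]
    exact hx0
  have h5 := hcop.dvd_of_dvd_mul_left hdvd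
  have h6 := (le_rootMultiplicity_iff h3).2 h5
  omega

end MZ
end

section
open Polynomial NumberField
open Polynomial
namespace MZ
open NumberField in
lemma zero_est {K : Type} [Field K] [NumberField K] (F : Finset (FinitePlace K)) (α β : K) (d1 d2 : ℕ) (p : ℕ → ℕ → ℤ)
    (B : ℝ) (hB : 1 ≤ B) (hp : ∀ a b, |(p a b : ℝ)| ≤ B) (hp0 : ∃ a ≤ d1, ∃ b ≤ d2, p a b ≠ 0)
    (hβ : Module.finrank ℚ K * Real.log ((d2 + 1) * B) < ∑ w : Wp K F, Real.posLog (ab w β))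
    (G : K[X]) (hG : G = ∑ a ∈ Finset.range (d1+1), C (∑ b ∈ Finset.range (d2+1), (p a b : K) * β ^ b) * X ^ a) :
    G ≠ 0 ∧ ∀ E : ℕ, (X - C α) ^ E ∣ G → ((E:ℝ) - d2) * ∑ w : Wp K F, Real.posLog (ab w α) ≤
      Module.finrank ℚ K * Real.log ((d2+1).factorial * ((d1+1 : ℝ) ^ (d2+1) * ((d1+1) * B)) ^ (d2+1)) := by
  classical
  have hG0 : G ≠ 0 := by
    intro h0
    obtain ⟨a, ha, b, hb, hab⟩ := hp0
    have h1 : ∑ b ∈ Finset.range (d2+1), (p a b : K) * β ^ b = 0 := by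
      have := congrArg (fun P => coeff P a) (hG.symm.trans h0)
      rw [finset_sum_coeff] at this
      simp only [coeff_C_mul, coeff_X_pow] at this
      simpa [Nat.lt_succ_iff, ha, -map_sum] using this
    set W : ℤ[X] := ∑ b ∈ Finset.range (d2+1), C (p a b) * X ^ b with hW
    have hWc : W.coeff b = p a b := by simp [hW, coeff_X_pow, Nat.lt_succ_iff, hb]
    have hW0 : W ≠ 0 := by intro h; rw [h] at hWc; simp at hWc; exact hab hWc.symm
    have h2 : (X - C β) ^ 1 ∣ W.map (Int.castRingHom K) := by
      rw [pow_one, dvd_iff_isRoot, IsRoot.def, hW]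
      simpa [Polynomial.map_sum, eval_finsetSum] using h1
    have h3 := order_bound F β W hW0 1 h2 ((d2+1) * B) (by
      change l1 W ≤ _
      rw [hW]
      refine (l1_sum _ _).trans ?_
      refine (Finset.sum_le_card_nsmul _ _ B fun b _ => ?_).trans (by simp)
      rw [l1_C_mul]
      have : l1 ((X:ℤ[X]) ^ b) = 1 := by
        have := l1_X_pow_mul b 1
        rw [mul_one] at this
        rw [this, l1_eq _ 1 (by simp)]; simp
      rw [this, mul_one]; exact hp a b)
    simp only [Nat.cast_one, one_mul] at h3
    linarith
  refine ⟨hG0, fun E hE => ?_⟩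
  set A : Fin (d2+1) → ℤ[X] := fun b => ∑ a ∈ Finset.range (d1+1), C (p a b) * X ^ a with hA
  have hAdeg : ∀ b, (A b).natDegree ≤ d1 := by
    intro b
    refine natDegree_sum_le_of_forall_le _ _ fun a ha => ?_
    exact (natDegree_C_mul_X_pow_le _ _).trans (by simpa [Nat.lt_succ_iff] using ha)
  have hAl1 : ∀ b, l1 (A b) ≤ (d1+1) * B := by
    intro b
    rw [hA]
    refine (l1_sum _ _).trans ?_
    refine (Finset.sum_le_card_nsmul _ _ B fun a _ => ?_).trans (by simp)
    rw [l1_C_mul]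
    have : l1 ((X:ℤ[X]) ^ a) = 1 := by
      have := l1_X_pow_mul a 1
      rw [mul_one] at this
      rw [this, l1_eq _ 1 (by simp)]; simp
    rw [this, mul_one]; exact hp a b
  have hGA : G = ∑ b : Fin (d2+1), C (β ^ (b:ℕ)) * (A b).map (Int.castRingHom K) := by
    have hs := Fin.sum_univ_eq_sum_range (fun b : ℕ => C (β ^ b) * (∑ a ∈ Finset.range (d1+1), C (p a b) * X ^ a).map (Int.castRingHom K)) (d2+1)
    refine Eq.trans ?_ hs.symm
    rw [hG]
    simp only [map_sum, Finset.sum_mul, Polynomial.map_sum, Finset.mul_sum]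
    rw [Finset.sum_comm]
    refine Finset.sum_congr rfl fun b _ => Finset.sum_congr rfl fun a _ => ?_
    simp; ring
  obtain ⟨κ, a, ha, hspan, hli⟩ := exists_linearIndependent' ℚ (fun b => (A b).map (Int.castRingHom ℚ))
  haveI : Fintype κ := Fintype.ofInjective a ha
  set r := Fintype.card κ with hr
  have hrle : r ≤ d2 + 1 := by simpa using Fintype.card_le_of_injective a ha
  let eq := Fintype.equivFin κ
  have hcoef : ∀ b, ∃ μ : κ → ℚ, ∑ q, μ q • (A (a q)).map (Int.castRingHom ℚ) = (A b).map (Int.castRingHom ℚ) := by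
    intro b
    have : (A b).map (Int.castRingHom ℚ) ∈ Submodule.span ℚ (Set.range ((fun b => (A b).map (Int.castRingHom ℚ)) ∘ a)) := by
      rw [hspan]; exact Submodule.subset_span ⟨b, rfl⟩
    rw [Submodule.mem_span_range_iff_exists_fun] at this
    exact this
  choose μ hμ using hcoef
  have hmapQ : ∀ b, ((A b).map (Int.castRingHom ℚ)).map (algebraMap ℚ K) = (A b).map (Int.castRingHom K) := by
    intro b; rw [Polynomial.map_map]; congr 1; exact RingHom.ext_int _ _
  set v : κ → K := fun q => ∑ b : Fin (d2+1), β ^ (b:ℕ) * (μ b q : K) with hv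
  have hGv : G = ∑ q, C (v q) * (A (a q)).map (Int.castRingHom K) := by
    rw [hGA]
    simp only [hv, map_sum, Finset.sum_mul]
    rw [Finset.sum_comm]
    refine Finset.sum_congr rfl fun b _ => ?_
    rw [← hmapQ, ← hμ, Polynomial.map_sum, Finset.mul_sum]
    refine Finset.sum_congr rfl fun q _ => ?_
    rw [smul_eq_C_mul, Polynomial.map_mul, hmapQ, map_C, map_mul, mul_assoc]
    simp
  obtain ⟨q0, hq0⟩ : ∃ q, v q ≠ 0 := by
    by_contra h; push Not at h
    exact hG0 (by rw [hGv]; simp [h])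
  have hr1 : 1 ≤ r := Fintype.card_pos_iff.2 ⟨q0⟩
  set M : Matrix (Fin r) (Fin r) ℤ[X] := Matrix.of fun j q => derivative^[(j:ℕ)] (A (a (eq.symm q))) with hM
  set W := M.det with hW
  have hW0 : W ≠ 0 := by
    have h := wronskian_ne_zero (fun q : Fin r => (A (a (eq.symm q))).map (Int.castRingHom ℚ)) (hli.comp _ eq.symm.injective)
    intro h0
    apply h
    have h1 := RingHom.map_det (Polynomial.mapRingHom (Int.castRingHom ℚ)) M
    rw [← hW, h0, map_zero] at h1
    rw [h1]
    congr 1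
    ext1 j q
    simp [hM, iterate_derivative_map]
  have hWl1 : l1 W ≤ (d2+1).factorial * ((d1+1 : ℝ) ^ (d2+1) * ((d1+1) * B)) ^ (d2+1) := by
    have h0 : (1:ℝ) ≤ (d1+1 : ℝ) := by have : (0:ℝ) ≤ d1 := Nat.cast_nonneg _; linarith
    have h1 : (1:ℝ) ≤ (d1+1 : ℝ) ^ (d2+1) * ((d1+1) * B) := by
      refine one_le_mul_of_one_le_of_one_le (one_le_pow₀ h0) (one_le_mul_of_one_le_of_one_le h0 hB)
    refine (l1_det M ((d1+1 : ℝ) ^ (d2+1) * ((d1+1) * B)) ?_).trans ?_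
    · intro j q
      simp only [hM, Matrix.of_apply]
      refine (l1_iter _ d1 (hAdeg _) _).trans ?_
      refine mul_le_mul ?_ (hAl1 _) (l1_nonneg _) (by positivity)
      calc (d1:ℝ) ^ (j:ℕ) ≤ (d1+1:ℝ) ^ (j:ℕ) := by gcongr; linarith
        _ ≤ _ := pow_le_pow_right₀ h0 (by have := j.2; omega)
    · refine mul_le_mul ?_ (pow_le_pow_right₀ h1 hrle) (by positivity) (by positivity)
      exact_mod_cast Nat.factorial_le hrle
  have hdvd : (X - C α) ^ (E - (r - 1)) ∣ W.map (Int.castRingHom K) := by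
    set MK : Matrix (Fin r) (Fin r) K[X] := (Polynomial.mapRingHom (Int.castRingHom K)).mapMatrix M with hMK
    have hdet : MK.det = W.map (Int.castRingHom K) := by
      rw [hMK, ← RingHom.map_det]; rfl
    have hmv : MK.mulVec (fun q => C (v (eq.symm q))) = fun j : Fin r => derivative^[(j:ℕ)] G := by
      ext1 j
      rw [hGv, iterate_derivative_sum]
      simp only [Matrix.mulVec, dotProduct]
      rw [← Equiv.sum_comp eq.symm]
      refine Finset.sum_congr rfl fun q _ => ?_
      rw [iterate_derivative_C_mul, iterate_derivative_map, mul_comm]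
      simp [hMK, hM]
    have h1 := congrArg (MK.adjugate.mulVec) hmv
    rw [Matrix.mulVec_mulVec, Matrix.adjugate_mul, Matrix.smul_mulVec, Matrix.one_mulVec] at h1
    have h2 := congrFun h1 (eq q0)
    simp only [Pi.smul_apply, Equiv.symm_apply_apply, smul_eq_mul, hdet] at h2
    have h3 : (X - C α) ^ (E - (r - 1)) ∣ W.map (Int.castRingHom K) * C (v q0) := by
      rw [h2]
      simp only [Matrix.mulVec, dotProduct]
      refine Finset.dvd_sum fun j _ => Dvd.dvd.mul_left ?_ _
      refine (pow_dvd_pow _ ?_).trans (pow_sub_dvd_iterate_derivative_of_pow_dvd (j:ℕ) hE)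
      have := j.2; omega
    have hu : IsUnit (C (v q0)) := isUnit_C.2 (isUnit_iff_ne_zero.2 hq0)
    exact hu.dvd_mul_right.1 h3
  have hob := order_bound F α W hW0 _ hdvd _ hWl1
  refine le_trans ?_ hob
  refine mul_le_mul_of_nonneg_right ?_ (Finset.sum_nonneg fun w _ => Real.posLog_nonneg)
  have : E ≤ (E - (r-1)) + d2 := by omega
  have : (E:ℝ) ≤ ((E - (r-1) : ℕ) : ℝ) + d2 := by exact_mod_cast this
  linarith

end MZ
end

section
open Polynomial NumberField
open Polynomial
namespace MZ
open NumberField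

section
variable {K : Type} [Field K] [NumberField K] {F : Finset (FinitePlace K)}

lemma eval_bound (w : Wp K F) (x : K) (W : ℤ[X]) (n : ℕ) (hn : W.natDegree ≤ n) (H : ℝ) (hH : ∀ k, |(W.coeff k : ℝ)| ≤ H) :
    ab w (aeval x W) ≤ ((n + 1) * H) ^ dd w * (max 1 (ab w x)) ^ n := by
  have hH0 : 0 ≤ H := (abs_nonneg _).trans (hH 0)
  rw [aeval_eq_sum_range' (Nat.lt_succ_of_le hn), mul_pow, mul_assoc]
  have h := ab_sum_le w (Finset.range (n+1)) (fun i => W.coeff i • x ^ i) (H ^ dd w * (max 1 (ab w x)) ^ n) (by positivity) (by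
    intro i hi
    rw [zsmul_eq_mul, map_mul, map_pow]
    refine mul_le_mul ((ab_int_le w _).trans (pow_le_pow_left₀ (abs_nonneg _) (hH i) _)) ?_ (by positivity) (by positivity)
    exact (pow_le_pow_left₀ (AbsoluteValue.nonneg _ _) (le_max_right 1 _) i).trans (pow_le_pow_right₀ (le_max_left _ _) (by simpa [Nat.lt_succ_iff] using hi)))
  simpa using h

lemma mul_phi (w : Wp K F) (U V : K[X]) (n s s' : ℕ) (A B q : ℝ) (hA : 0 ≤ A) (hB : 0 ≤ B) (hq0 : 0 ≤ q) (hq : q ≤ 1)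
    (hV : V.natDegree ≤ n) (hUb : ∀ k, ab w (U.coeff k) ≤ A * q ^ (s - k)) (hVb : ∀ k, ab w (V.coeff k) ≤ B * q ^ (s' - k)) (k : ℕ) :
    ab w ((U * V).coeff k) ≤ ((n + 1 : ℝ) ^ dd w * B * A) * q ^ ((s + s') - k) := by
  have e : (U * V).coeff k = ∑ m ∈ Finset.range (n+1), (if m ≤ k then U.coeff (k - m) * V.coeff m else 0) := by
    conv_lhs => rw [V.as_sum_range' (n+1) (Nat.lt_succ_of_le hV), Finset.mul_sum, finset_sum_coeff]
    refine Finset.sum_congr rfl fun m _ => ?_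
    rw [← C_mul_X_pow_eq_monomial, ← mul_assoc, coeff_mul_X_pow']
    simp
  rw [e]
  have h := ab_sum_le w (Finset.range (n+1)) (fun m => if m ≤ k then U.coeff (k - m) * V.coeff m else 0) (B * A * q ^ ((s + s') - k)) (by positivity) (by
    intro m _
    split_ifs with hmk
    · rw [map_mul]
      calc ab w (U.coeff (k-m)) * ab w (V.coeff m) ≤ (A * q ^ (s - (k-m))) * (B * q ^ (s' - m)) :=
            mul_le_mul (hUb _) (hVb _) (AbsoluteValue.nonneg _ _) (by positivity)
        _ = B * A * q ^ ((s - (k-m)) + (s' - m)) := by rw [pow_add]; ring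
        _ ≤ _ := by
            refine mul_le_mul_of_nonneg_left (pow_le_pow_of_le_one hq0 hq (by omega)) (by positivity)
    · simp; positivity)
  refine h.trans (le_of_eq ?_)
  simp; ring

lemma pow_phi (w : Wp K F) (V : K[X]) (n s' : ℕ) (B q : ℝ) (hB : 0 ≤ B) (hq0 : 0 ≤ q) (hq : q ≤ 1)
    (hV : V.natDegree ≤ n) (hVb : ∀ k, ab w (V.coeff k) ≤ B * q ^ (s' - k)) (U : K[X]) (A : ℝ) (hA : 0 ≤ A) (s0 : ℕ)
    (hUb : ∀ k, ab w (U.coeff k) ≤ A * q ^ (s0 - k)) (s k : ℕ) :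
    ab w ((U * V ^ s).coeff k) ≤ ((n + 1 : ℝ) ^ dd w * B) ^ s * A * q ^ ((s0 + s * s') - k) := by
  induction s generalizing k with
  | zero => simpa using hUb k
  | succ s ih =>
    rw [pow_succ, ← mul_assoc]
    have h := mul_phi w (U * V ^ s) V n (s0 + s * s') s' (((n + 1 : ℝ) ^ dd w * B) ^ s * A) B q (by positivity) hB hq0 hq hV ih hVb k
    refine h.trans (le_of_eq ?_)
    rw [show s0 + (s+1) * s' = s0 + s * s' + s' by ring]
    ring

lemma taylor_coeff_bound (Q : ℤ[X]) (R : ℝ) (hR : 1 ≤ R) : ∃ B : ℝ, 1 ≤ B ∧ ∀ (K : Type) [Field K] [NumberField K] (F : Finset (FinitePlace K))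
    (w : Wp K F) (x : K), ab w x ≤ R ^ dd w → ∀ m, ab w ((taylor x (Q.map (Int.castRingHom K))).coeff m) ≤ B ^ dd w := by
  set n := Q.natDegree with hn
  have hex : ∀ m, ∃ H : ℝ, 0 ≤ H ∧ ∀ k, |((hasseDeriv m Q).coeff k : ℝ)| ≤ H := by
    intro m
    refine ⟨∑ k ∈ Finset.range ((hasseDeriv m Q).natDegree + 1), |((hasseDeriv m Q).coeff k : ℝ)|, Finset.sum_nonneg fun _ _ => abs_nonneg _, fun k => ?_⟩
    by_cases hk : k < (hasseDeriv m Q).natDegree + 1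
    · exact Finset.single_le_sum (f := fun k => |((hasseDeriv m Q).coeff k : ℝ)|) (fun _ _ => abs_nonneg _) (Finset.mem_range.2 hk)
    · rw [coeff_eq_zero_of_natDegree_lt (by omega)]; simp; exact Finset.sum_nonneg fun _ _ => abs_nonneg _
  choose H hH0 hH using hex
  have hS : 0 ≤ ∑ m ∈ Finset.range (n+1), H m := Finset.sum_nonneg fun _ _ => hH0 _
  refine ⟨(n+1) * (1 + ∑ m ∈ Finset.range (n+1), H m) * R ^ n, ?_, ?_⟩
  · have h0 : (1:ℝ) ≤ n + 1 := by have : (0:ℝ) ≤ n := Nat.cast_nonneg _; linarith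
    exact one_le_mul_of_one_le_of_one_le (one_le_mul_of_one_le_of_one_le h0 (by linarith)) (one_le_pow₀ hR)
  intro K _ _ F w x hx m
  have hpos : 0 ≤ (n+1) * (1 + ∑ m ∈ Finset.range (n+1), H m) * R ^ n := by positivity
  rw [taylor_coeff]
  have e : (hasseDeriv m (Q.map (Int.castRingHom K))) = (hasseDeriv m Q).map (Int.castRingHom K) := by
    ext k; simp [hasseDeriv_coeff]
  rw [e]
  have e2 : eval x ((hasseDeriv m Q).map (Int.castRingHom K)) = aeval x (hasseDeriv m Q) := by
    rw [eval_map, aeval_def]; rfl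
  rw [e2]
  by_cases hm : m < n + 1
  · refine (eval_bound w x (hasseDeriv m Q) n ((natDegree_hasseDeriv_le Q m).trans (by omega)) (1 + ∑ m ∈ Finset.range (n+1), H m) (fun k => (hH m k).trans ?_)).trans ?_
    · have := Finset.single_le_sum (f := H) (fun _ _ => hH0 _) (Finset.mem_range.2 hm)
      linarith
    · rw [mul_pow _ (R^n)]
      refine mul_le_mul_of_nonneg_left ?_ (by positivity)
      rw [← pow_mul, mul_comm, pow_mul]
      refine pow_le_pow_left₀ (by positivity) (max_le (one_le_pow₀ hR) hx) _
  · have : hasseDeriv m Q = 0 := hasseDeriv_eq_zero_of_lt_natDegree _ _ (by omega)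
    rw [this]; simp; positivity

noncomputable def GG (p : ℕ → ℕ → ℤ) (d1 d2 : ℕ) (y : K) : K[X] :=
  ∑ a ∈ Finset.range (d1+1), C (∑ b ∈ Finset.range (d2+1), (p a b : K) * y ^ b) * X ^ a

lemma triv_bound (w : Wp K F) (p : ℕ → ℕ → ℤ) (d1 d2 : ℕ) (hd : d2 ≤ d1) (x y : K) (B : ℝ) (hp : ∀ a b, |(p a b : ℝ)| ≤ B) (a : ℕ) :
    ab w ((taylor x (GG p d1 d2 y)).coeff a) ≤ (8 ^ d1 * B) ^ dd w * max 1 (ab w x) ^ d1 * max 1 (ab w y) ^ d2 := by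
  have hB0 : 0 ≤ B := (abs_nonneg _).trans (hp 0 0)
  have e : (taylor x (GG p d1 d2 y)).coeff a = ∑ c ∈ Finset.range (d1+1) ×ˢ Finset.range (d2+1),
      (p c.1 c.2 : K) * y ^ c.2 * (x ^ (c.1 - a) * (c.1.choose a : K)) := by
    rw [GG, map_sum, finset_sum_coeff, Finset.sum_product]
    refine Finset.sum_congr rfl fun i _ => ?_
    rw [taylor_mul, taylor_C, taylor_pow, taylor_X, coeff_C_mul, coeff_X_add_C_pow, Finset.sum_mul]
  rw [e]
  have h := ab_sum_le w (Finset.range (d1+1) ×ˢ Finset.range (d2+1)) (fun c => (p c.1 c.2 : K) * y ^ c.2 * (x ^ (c.1 - a) * (c.1.choose a : K)))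
    (B ^ dd w * (2 ^ d1) ^ dd w * max 1 (ab w x) ^ d1 * max 1 (ab w y) ^ d2) (by positivity) (by
    intro c hc
    simp only [Finset.mem_product, Finset.mem_range, Nat.lt_succ_iff] at hc
    simp only [map_mul, map_pow]
    have h1 : ab w (p c.1 c.2 : K) ≤ B ^ dd w := (ab_int_le w _).trans (pow_le_pow_left₀ (abs_nonneg _) (hp _ _) _)
    have h2 : ab w (c.1.choose a : K) ≤ (2 ^ d1) ^ dd w := by
      have := ab_int_le w (c.1.choose a : ℤ)
      push_cast at this
      refine this.trans (pow_le_pow_left₀ (abs_nonneg _) ?_ _)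
      rw [abs_of_nonneg (by positivity)]
      exact_mod_cast (Nat.choose_le_two_pow c.1 a).trans (Nat.pow_le_pow_right (by norm_num) hc.1)
    have h3 : ab w y ^ c.2 ≤ max 1 (ab w y) ^ d2 :=
      (pow_le_pow_left₀ (AbsoluteValue.nonneg _ _) (le_max_right 1 _) _).trans (pow_le_pow_right₀ (le_max_left _ _) hc.2)
    have h4 : ab w x ^ (c.1 - a) ≤ max 1 (ab w x) ^ d1 :=
      (pow_le_pow_left₀ (AbsoluteValue.nonneg _ _) (le_max_right 1 _) _).trans (pow_le_pow_right₀ (le_max_left _ _) (by omega))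
    calc _ ≤ (B ^ dd w * max 1 (ab w y) ^ d2) * (max 1 (ab w x) ^ d1 * (2 ^ d1) ^ dd w) := by gcongr
      _ = _ := by ring)
  refine h.trans ?_
  rw [mul_pow (8 ^ d1 : ℝ) B]
  have h8 : (8:ℝ) ^ d1 = 4 ^ d1 * 2 ^ d1 := by rw [← mul_pow]; norm_num
  have h4 : (((Finset.range (d1+1) ×ˢ Finset.range (d2+1)).card : ℕ) : ℝ) ≤ 4 ^ d1 := by
    have h1 : d1 + 1 ≤ 2 ^ d1 := Nat.lt_two_pow_self
    have h2 : (d1 + 1) * (d2 + 1) ≤ 2 ^ d1 * 2 ^ d1 := Nat.mul_le_mul h1 (by omega)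
    rw [← mul_pow] at h2
    simp only [Finset.card_product, Finset.card_range]
    exact_mod_cast h2
  rw [h8, mul_pow (4 ^ d1 : ℝ) (2 ^ d1)]
  calc _ ≤ (4 ^ d1 : ℝ) ^ dd w * (B ^ dd w * (2 ^ d1) ^ dd w * max 1 (ab w x) ^ d1 * max 1 (ab w y) ^ d2) := by gcongr
    _ = _ := by ring

end

lemma linked_bound (Q1 Q2 : ℤ[X]) (hn1 : 1 ≤ Q1.natDegree) (hn2 : 1 ≤ Q2.natDegree) (R : ℝ) (hR : 1 ≤ R) : ∃ M : ℝ, 1 ≤ M ∧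
    ∀ (K : Type) [Field K] [NumberField K] (F : Finset (FinitePlace K)) (w : Wp K F) (p : ℕ → ℕ → ℤ) (d1 d2 : ℕ) (_ : d2 ≤ d1) (_ : 1 ≤ d1) (x y : K)
      (r : ℕ → ℕ → ℕ → ℕ → ℤ) (B : ℝ) (_ : ∀ s t e f, |(r s t e f : ℝ)| ≤ B)
      (_ : GG p d1 d2 y = ∑ s ∈ Finset.range (d1+1), ∑ t ∈ Finset.range (d2+1), (Q1.map (Int.castRingHom K)) ^ s * C ((aeval y Q2) ^ t) *
            ∑ e ∈ Finset.range Q1.natDegree, ∑ f ∈ Finset.range Q2.natDegree, C ((r s t e f : K) * y ^ f) * X ^ e)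
      (_ : ab w x ≤ R ^ dd w) (_ : ab w y ≤ R ^ dd w) (_ : ab w (aeval x Q1) ≤ 1) (a : ℕ) (Y : ℝ) (_ : 0 ≤ Y)
      (_ : ∀ s t, s ≤ d1 → t ≤ d2 → (∃ e f, e < Q1.natDegree ∧ f < Q2.natDegree ∧ r s t e f ≠ 0) → ab w (aeval x Q1) ^ (s - a) * ab w (aeval y Q2) ^ t ≤ Y),
      ab w ((taylor x (GG p d1 d2 y)).coeff a) ≤ (M ^ d1 * B) ^ dd w * Y := by
  obtain ⟨B1, hB1, hT⟩ := taylor_coeff_bound Q1 R hR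
  set n1 := Q1.natDegree with hn1'
  set n2 := Q2.natDegree with hn2'
  have hn1r : (1:ℝ) ≤ n1 := by exact_mod_cast hn1
  have hn2r : (1:ℝ) ≤ n2 := by exact_mod_cast hn2
  refine ⟨(4 * n1 * n2) * (((n1 + 1) * B1) * ((2 * R) ^ n1 * R ^ n2)), ?_, ?_⟩
  · have h1 : (1:ℝ) ≤ R ^ n2 := one_le_pow₀ hR
    have h2 : (1:ℝ) ≤ (2 * R) ^ n1 := one_le_pow₀ (by linarith)
    have h3 : (1:ℝ) ≤ (n1 + 1) * B1 := one_le_mul_of_one_le_of_one_le (by linarith) hB1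
    have h4 : (1:ℝ) ≤ 4 * n1 * n2 := one_le_mul_of_one_le_of_one_le (by linarith) hn2r
    exact one_le_mul_of_one_le_of_one_le h4 (one_le_mul_of_one_le_of_one_le h3 (one_le_mul_of_one_le_of_one_le h2 h1))
  intro K _ _ F w p d1 d2 hd hd1 x y r B hr hG hx hy hq1 a Y hY0 hY
  have hB0 : 0 ≤ B := (abs_nonneg _).trans (hr 0 0 0 0)
  set q := ab w (aeval x Q1) with hq
  have hq0 : 0 ≤ q := AbsoluteValue.nonneg _ _
  have e : (taylor x (GG p d1 d2 y)).coeff a = ∑ c ∈ (Finset.range (d1+1) ×ˢ Finset.range (d2+1)) ×ˢ (Finset.range n1 ×ˢ Finset.range n2),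
      ((aeval y Q2) ^ c.1.2 * ((r c.1.1 c.1.2 c.2.1 c.2.2 : K) * y ^ c.2.2)) * (((X + C x) ^ c.2.1 * (taylor x (Q1.map (Int.castRingHom K))) ^ c.1.1).coeff a) := by
    rw [hG, Finset.sum_product, Finset.sum_product, map_sum, finset_sum_coeff]
    refine Finset.sum_congr rfl fun s _ => ?_
    rw [map_sum, finset_sum_coeff]
    refine Finset.sum_congr rfl fun t _ => ?_
    rw [Finset.sum_product, Finset.mul_sum, map_sum, finset_sum_coeff]
    refine Finset.sum_congr rfl fun e _ => ?_
    rw [Finset.mul_sum, map_sum, finset_sum_coeff]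
    refine Finset.sum_congr rfl fun f _ => ?_
    rw [taylor_mul, taylor_mul, taylor_mul, taylor_C, taylor_C, taylor_pow, taylor_pow, taylor_X, ← coeff_C_mul]
    congr 1; simp only [map_mul]; ring
  rw [e]
  have hterm : ∀ e, e < n1 → ∀ s, ab w (((X + C x) ^ e * (taylor x (Q1.map (Int.castRingHom K))) ^ s).coeff a) ≤
      ((n1 + 1 : ℝ) ^ dd w * B1 ^ dd w) ^ s * ((2 * R) ^ n1) ^ dd w * q ^ (s - a) := by
    intro e he s
    have h1 : ∀ k, ab w (((X + C x) ^ e).coeff k) ≤ ((2 * R) ^ n1) ^ dd w * q ^ (0 - k) := by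
      intro k
      rw [coeff_X_add_C_pow, map_mul, map_pow, Nat.zero_sub, pow_zero, mul_one]
      have h2 : ab w (e.choose k : K) ≤ (2 ^ n1) ^ dd w := by
        have := ab_int_le w (e.choose k : ℤ)
        push_cast at this
        refine this.trans (pow_le_pow_left₀ (abs_nonneg _) ?_ _)
        rw [abs_of_nonneg (by positivity)]
        exact_mod_cast (Nat.choose_le_two_pow e k).trans (Nat.pow_le_pow_right (by norm_num) he.le)
      have h3 : ab w x ^ (e - k) ≤ (R ^ n1) ^ dd w := by
        rw [← pow_mul, mul_comm, pow_mul]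
        exact (pow_le_pow_left₀ (AbsoluteValue.nonneg _ _) hx _).trans (pow_le_pow_right₀ (one_le_pow₀ hR) (by omega))
      rw [mul_pow, mul_pow, mul_comm]
      gcongr
    have h2 := pow_phi w (taylor x (Q1.map (Int.castRingHom K))) n1 1 (B1 ^ dd w) q (by positivity) hq0 hq1 (by
      rw [natDegree_taylor]; exact natDegree_map_le) (by
      intro k
      rcases Nat.eq_zero_or_pos k with rfl | hk
      · rw [taylor_coeff_zero, eval_map]
        have : eval₂ (Int.castRingHom K) x Q1 = aeval x Q1 := by rw [aeval_def]; rfl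
        rw [this, ← hq]; simp
        exact le_mul_of_one_le_left hq0 (one_le_pow₀ hB1)
      · rw [show 1 - k = 0 by omega, pow_zero, mul_one]; exact hT K F w x hx k) _ _ (by positivity) 0 h1 s a
    simpa using h2
  have h := ab_sum_le w ((Finset.range (d1+1) ×ˢ Finset.range (d2+1)) ×ˢ (Finset.range n1 ×ˢ Finset.range n2))
    (fun c => ((aeval y Q2) ^ c.1.2 * ((r c.1.1 c.1.2 c.2.1 c.2.2 : K) * y ^ c.2.2)) * (((X + C x) ^ c.2.1 * (taylor x (Q1.map (Int.castRingHom K))) ^ c.1.1).coeff a))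
    (((((n1 + 1) * B1) * ((2 * R) ^ n1 * R ^ n2)) ^ d1 * B) ^ dd w * Y) (by positivity) (by
    intro c hc
    simp only [Finset.mem_product, Finset.mem_range, Nat.lt_succ_iff] at hc
    by_cases hr0 : r c.1.1 c.1.2 c.2.1 c.2.2 = 0
    · rw [hr0]; simp; positivity
    have h1 := hY c.1.1 c.1.2 hc.1.1 hc.1.2 ⟨_, _, hc.2.1, hc.2.2, hr0⟩
    have h2 := hterm c.2.1 hc.2.1 c.1.1
    have h3 : ab w (r c.1.1 c.1.2 c.2.1 c.2.2 : K) ≤ B ^ dd w := (ab_int_le w _).trans (pow_le_pow_left₀ (abs_nonneg _) (hr _ _ _ _) _)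
    have h4 : ab w y ^ c.2.2 ≤ (R ^ n2) ^ dd w := by
      rw [← pow_mul, mul_comm, pow_mul]
      exact (pow_le_pow_left₀ (AbsoluteValue.nonneg _ _) hy _).trans (pow_le_pow_right₀ (one_le_pow₀ hR) hc.2.2.le)
    have h5 : ((n1 + 1 : ℝ) ^ dd w * B1 ^ dd w) ^ c.1.1 ≤ (((n1 + 1) * B1) ^ d1) ^ dd w := by
      rw [← mul_pow, ← pow_mul, ← pow_mul, mul_comm (dd w)]
      exact pow_le_pow_right₀ (one_le_mul_of_one_le_of_one_le (by linarith) hB1) (Nat.mul_le_mul_right _ hc.1.1)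
    have h6 : (2 * R) ^ n1 * R ^ n2 ≤ ((2 * R) ^ n1 * R ^ n2) ^ d1 :=
      le_self_pow₀ (one_le_mul_of_one_le_of_one_le (one_le_pow₀ (by linarith)) (one_le_pow₀ hR)) (by omega)
    simp only [map_mul, map_pow]
    calc ab w (aeval y Q2) ^ c.1.2 * (ab w (r c.1.1 c.1.2 c.2.1 c.2.2 : K) * ab w y ^ c.2.2) * ab w (((X + C x) ^ c.2.1 * (taylor x (Q1.map (Int.castRingHom K))) ^ c.1.1).coeff a)
        ≤ ab w (aeval y Q2) ^ c.1.2 * (B ^ dd w * (R ^ n2) ^ dd w) * ((((n1 + 1) * B1) ^ d1) ^ dd w * ((2 * R) ^ n1) ^ dd w * q ^ (c.1.1 - a)) := by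
          refine mul_le_mul (by gcongr) (h2.trans (by gcongr)) (AbsoluteValue.nonneg _ _) (by positivity)
      _ = (((n1+1) * B1) ^ d1 * ((2 * R) ^ n1 * R ^ n2) * B) ^ dd w * (q ^ (c.1.1 - a) * ab w (aeval y Q2) ^ c.1.2) := by
          simp only [mul_pow]; ring
      _ ≤ (((n1+1) * B1) ^ d1 * ((2 * R) ^ n1 * R ^ n2) ^ d1 * B) ^ dd w * Y := by gcongr
      _ = _ := by rw [← mul_pow])
  refine h.trans ?_
  have h4 : ((((Finset.range (d1+1) ×ˢ Finset.range (d2+1)) ×ˢ (Finset.range n1 ×ˢ Finset.range n2)).card : ℕ) : ℝ) ≤ (4 * n1 * n2) ^ d1 := by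
    have h1 : d1 + 1 ≤ 2 ^ d1 := Nat.lt_two_pow_self
    have h2 : (d1 + 1) * (d2 + 1) ≤ 2 ^ d1 * 2 ^ d1 := Nat.mul_le_mul h1 (by omega)
    rw [← mul_pow] at h2
    simp only [Finset.card_product, Finset.card_range]
    have h3 : n1 * n2 ≤ (n1 * n2) ^ d1 := Nat.le_self_pow (by omega) _
    have h4 := Nat.mul_le_mul h2 h3
    rw [← mul_pow] at h4
    rw [mul_assoc (4:ℝ)]
    exact_mod_cast h4
  have e3 : ((4 * n1 * n2) * (((n1 + 1) * B1) * ((2 * R) ^ n1 * R ^ n2))) ^ d1 * B = (4 * n1 * n2 : ℝ) ^ d1 * ((((n1 + 1) * B1) * ((2 * R) ^ n1 * R ^ n2)) ^ d1 * B) := by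
    rw [mul_pow (4 * n1 * n2 : ℝ)]; ring
  rw [e3, mul_pow ((4 * n1 * n2 : ℝ) ^ d1), mul_assoc (((4 * n1 * n2 : ℝ) ^ d1) ^ dd w)]
  exact mul_le_mul_of_nonneg_right (pow_le_pow_left₀ (Nat.cast_nonneg _) h4 _) (by positivity)

end MZ
end

section
open Polynomial NumberField
open Polynomial
namespace MZ
open NumberField

section
variable {K : Type} [Field K] [NumberField K] {F : Finset (FinitePlace K)}

noncomputable def nu (w : Wp K F) (n : ℤ) : ℝ := dd w * Real.log |(n:ℝ)| - Real.log (ab w (n : K))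

lemma nu_nonneg (w : Wp K F) (n : ℤ) (hn : n ≠ 0) : 0 ≤ nu w n := by
  have hnK : (n : K) ≠ 0 := by exact_mod_cast hn
  have h := Real.log_le_log ((ab w).pos hnK) (ab_int_le w n)
  rw [Real.log_pow] at h
  unfold nu; linarith

lemma sum_ddr : ∑ w : Wp K F, (dd w : ℝ) = Module.finrank ℚ K := by
  have := sum_dd (F := F); exact_mod_cast this

lemma nu_sum_le (n : ℤ) (hn : n ≠ 0) : ∑ w : Wp K F, nu w n ≤ Module.finrank ℚ K * Real.log |(n:ℝ)| := by
  unfold nu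
  rw [Finset.sum_sub_distrib, ← Finset.sum_mul, sum_ddr]
  have := int_PF (F := F) n hn
  linarith

lemma nu_sum_eq (n : ℤ) (hn : Good F (n : K)) : ∑ w : Wp K F, nu w n = Module.finrank ℚ K * Real.log |(n:ℝ)| := by
  unfold nu
  rw [Finset.sum_sub_distrib, ← Finset.sum_mul, sum_ddr, PF _ hn]
  ring

lemma nu_inl (σ : K →+* ℂ) (n : ℤ) : nu (F := F) (.inl σ) n = 0 := by
  simp [nu]

end

lemma val_bound (W : ℤ[X]) (R : ℝ) (hR : 1 ≤ R) : ∃ B : ℝ, 1 ≤ B ∧ ∀ (K : Type) [Field K] [NumberField K] (F : Finset (FinitePlace K))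
    (w : Wp K F) (x : K), ab w x ≤ R ^ dd w → ab w (aeval x W) ≤ B ^ dd w := by
  obtain ⟨B, hB, h⟩ := taylor_coeff_bound W R hR
  refine ⟨B, hB, fun K _ _ F w x hx => ?_⟩
  have := h K F w x hx 0
  rwa [taylor_coeff_zero, eval_map, show eval₂ (Int.castRingHom K) x W = aeval x W by rw [aeval_def]; rfl] at this

lemma large_bound (W : ℤ[X]) (hW : W.Monic) : ∃ R : ℝ, 1 ≤ R ∧ ∃ C : ℝ, 0 ≤ C ∧ ∀ (K : Type) [Field K] [NumberField K] (F : Finset (FinitePlace K))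
    (w : Wp K F) (x : K), R ^ dd w < ab w x → |Real.log (ab w (aeval x W)) - W.natDegree * Real.posLog (ab w x)| ≤ C * dd w := by
  set n := W.natDegree with hn
  obtain ⟨H, hH1, hH⟩ : ∃ H : ℝ, 1 ≤ H ∧ ∀ k, |(W.coeff k : ℝ)| ≤ H := by
    refine ⟨1 + l1 W, by have := l1_nonneg W; linarith, fun k => ?_⟩
    by_cases hk : k < W.natDegree + 1
    · rw [l1_eq W _ (Nat.lt_succ_self _)]
      have := Finset.single_le_sum (f := fun k => |(W.coeff k : ℝ)|) (fun _ _ => abs_nonneg _) (Finset.mem_range.2 hk)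
      linarith
    · rw [coeff_eq_zero_of_natDegree_lt (by omega)]; have := l1_nonneg W; simp; linarith
  have h0 : (1:ℝ) ≤ n + 1 := by have : (0:ℝ) ≤ n := Nat.cast_nonneg _; linarith
  have h1H : 1 ≤ (n + 1) * H := one_le_mul_of_one_le_of_one_le h0 hH1
  refine ⟨2 * ((n+1) * H), by linarith, Real.log (2 * ((n+1) * H)), Real.log_nonneg (by linarith), ?_⟩
  intro K _ _ F w x hx
  set y := ab w x with hy
  have hy1 : 1 < y := lt_of_le_of_lt (one_le_pow₀ (by linarith)) hx
  have hup := eval_bound w x W n le_rfl H hH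
  rw [← hy, max_eq_right hy1.le] at hup
  have hpl : Real.posLog y = Real.log y := by rw [Real.posLog_eq_log]; rw [abs_of_pos (by linarith)]; exact hy1.le
  rw [hpl]
  have hlow : y ^ n ≤ 2 ^ dd w * ab w (aeval x W) := by
    rcases Nat.eq_zero_or_pos n with hn0 | hn0
    · have : W = 1 := by
        have h1 := eq_C_of_natDegree_eq_zero (hn.symm.trans hn0)
        have h2 : W.coeff 0 = 1 := by
          have := hW.coeff_natDegree
          rwa [← hn, hn0] at this
        rw [h1, h2, C_1]
      rw [hn0, this]; simp; exact one_le_pow₀ (by norm_num)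
    have hdeg : (X ^ n - W).natDegree ≤ n - 1 := by
      have h2 : (X ^ n - W).degree < (n : WithBot ℕ) := by
        have h3 : ((X:ℤ[X]) ^ n).degree = W.degree := by rw [degree_X_pow, degree_eq_natDegree hW.ne_zero]
        have := degree_sub_lt h3 (by simp) (by simp [hW.leadingCoeff])
        rwa [degree_X_pow] at this
      by_cases hz : X ^ n - W = 0
      · rw [hz]; simp
      have := (natDegree_lt_iff_degree_lt hz).2 h2
      omega
    have hco : ∀ k, |((X ^ n - W).coeff k : ℝ)| ≤ H := by
      intro k
      rw [coeff_sub, coeff_X_pow]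
      by_cases hk : k = n
      · rw [if_pos hk, hk, hn, hW.coeff_natDegree]; simp; linarith
      · rw [if_neg hk]; simpa using hH k
    have h3 := eval_bound w x (X ^ n - W) (n-1) hdeg H hco
    rw [← hy, max_eq_right hy1.le] at h3
    by_contra hcon
    push Not at hcon
    have e : x ^ n = aeval x W + aeval x (X ^ n - W) := by simp
    have h4 : ab w (aeval x W) ≤ y ^ n / 2 ^ dd w := by rw [le_div_iff₀ (by positivity)]; linarith
    have h5 : ab w (aeval x W) < y ^ n / 2 ^ dd w := by rw [lt_div_iff₀ (by positivity)]; linarith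
    have h6 : ab w (aeval x (X ^ n - W)) < y ^ n / 2 ^ dd w := by
      rw [lt_div_iff₀ (by positivity)]
      calc ab w (aeval x (X ^ n - W)) * 2 ^ dd w ≤ ((((n - 1 : ℕ) + 1 : ℝ) * H) ^ dd w * y ^ (n-1)) * 2 ^ dd w := by gcongr
        _ ≤ ((((n + 1 : ℝ)) * H) ^ dd w * y ^ (n-1)) * 2 ^ dd w := by
            gcongr
            omega
        _ = (2 * ((n+1) * H)) ^ dd w * y ^ (n-1) := by rw [mul_pow 2]; ring
        _ < y * y ^ (n-1) := by gcongr
        _ = y ^ n := by rw [← pow_succ']; congr 1; omega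
    have h7 := ab_add_le w _ _ _ (le_max_left (ab w (aeval x W)) (ab w (aeval x (X ^ n - W)))) (le_max_right _ _)
    rw [← e, map_pow, ← hy] at h7
    have h8 : max (ab w (aeval x W)) (ab w (aeval x (X ^ n - W))) < y ^ n / 2 ^ dd w := max_lt h5 h6
    rw [lt_div_iff₀ (by positivity)] at h8
    linarith
  have hpos : 0 < ab w (aeval x W) := by
    by_contra h
    have h1 : ab w (aeval x W) = 0 := le_antisymm (not_lt.1 h) (AbsoluteValue.nonneg _ _)
    rw [h1, mul_zero] at hlow
    have : 0 < y ^ n := by positivity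
    linarith
  have l1 := Real.log_le_log (by positivity) hlow
  have l2 := Real.log_le_log hpos hup
  rw [Real.log_mul (by positivity) hpos.ne', Real.log_pow, Real.log_pow] at l1
  rw [Real.log_mul (by positivity) (by positivity), Real.log_pow, Real.log_pow] at l2
  have l3 : Real.log 2 ≤ Real.log (2 * ((n+1) * H)) := Real.log_le_log (by norm_num) (by linarith)
  have l4 : Real.log ((n+1) * H) ≤ Real.log (2 * ((n+1) * H)) := Real.log_le_log (by linarith) (by linarith)
  have hd0 : (0:ℝ) ≤ dd w := Nat.cast_nonneg _
  have l5 := mul_le_mul_of_nonneg_left l3 hd0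
  have l6 := mul_le_mul_of_nonneg_left l4 hd0
  rw [abs_le]; constructor <;> linarith

noncomputable def er {ι : Type} [Fintype ι] (Rr : ι → ι → ℤ) {K : Type} [Field K] [NumberField K] {F : Finset (FinitePlace K)} (w : Wp K F) : ℝ :=
  dd w + ∑ i, ∑ j, nu w (Rr i j)

lemma local_lemma {ι : Type} [Fintype ι] [DecidableEq ι] [Nonempty ι] (Q : ι → ℤ[X]) (hQ : ∀ i, (Q i).Monic)
    (Rr : ι → ι → ℤ) (hR0 : ∀ i j, Rr i j ≠ 0) (hRr : ∀ i j, i ≠ j → ∃ A B : ℤ[X], A * Q i + B * Q j = C (Rr i j)) :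
    ∃ C : ℝ, 1 ≤ C ∧ ∀ (K : Type) [Field K] [NumberField K] (F : Finset (FinitePlace K)) (w : Wp K F) (x : K), (∀ i, aeval x (Q i) ≠ 0) →
      ∃ i0 : ι, ∃ lam : ℝ, 0 ≤ lam ∧ (∀ i, |Real.log (ab w (aeval x (Q i))) - (Q i).natDegree * Real.posLog (ab w x) + (if i = i0 then lam else 0)| ≤ C * er Rr w) ∧
        (lam = 0 ∨ (lam = - Real.log (ab w (aeval x (Q i0))) ∧ Real.posLog (ab w x) ≤ C * dd w)) := by
  choose R1 hR1 C1 hC1 hlarge using fun i => large_bound (Q i) (hQ i)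
  set R := 1 + ∑ i, R1 i with hR
  have hR1le : ∀ i, R1 i ≤ R := by
    intro i
    have := Finset.single_le_sum (f := R1) (fun i _ => by have := hR1 i; linarith) (Finset.mem_univ i)
    linarith
  have hRge : 1 ≤ R := by
    have : 0 ≤ ∑ i, R1 i := Finset.sum_nonneg fun i _ => by have := hR1 i; linarith
    linarith
  choose B hB1 hB using fun i => val_bound (Q i) R hRge
  have hM : ∀ i j, ∃ M : ℝ, 1 ≤ M ∧ (i ≠ j → ∀ (K : Type) [Field K] [NumberField K] (F : Finset (FinitePlace K)) (w : Wp K F) (x : K), ab w x ≤ R ^ dd w →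
      ab w (Rr i j : K) ≤ M ^ dd w * max (ab w (aeval x (Q i))) (ab w (aeval x (Q j)))) := by
    intro i j
    by_cases hij : i = j
    · exact ⟨1, le_rfl, fun h => absurd hij h⟩
    obtain ⟨A, A', hA⟩ := hRr i j hij
    obtain ⟨b, hb1, hb⟩ := val_bound A R hRge
    obtain ⟨b', hb1', hb'⟩ := val_bound A' R hRge
    refine ⟨2 * (b * b'), by nlinarith, fun _ K _ _ F w x hx => ?_⟩
    have e : (Rr i j : K) = aeval x A * aeval x (Q i) + aeval x A' * aeval x (Q j) := by
      have := congrArg (aeval x) hA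
      simpa using this.symm
    rw [e, mul_pow, mul_assoc]
    have hbb : b ≤ b * b' := le_mul_of_one_le_right (by linarith) hb1'
    have hbb' : b' ≤ b * b' := le_mul_of_one_le_left (by linarith) hb1
    apply ab_add_le
    · rw [map_mul]
      refine mul_le_mul ((hb K F w x hx).trans (pow_le_pow_left₀ (by linarith) hbb _)) (le_max_left _ _) (AbsoluteValue.nonneg _ _) (by positivity)
    · rw [map_mul]
      refine mul_le_mul ((hb' K F w x hx).trans (pow_le_pow_left₀ (by linarith) hbb' _)) (le_max_right _ _) (AbsoluteValue.nonneg _ _) (by positivity)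
  choose M hM1 hM using hM
  set C := 1 + ∑ i, C1 i + ∑ i, Real.log (B i) + ∑ i, ∑ j, Real.log (M i j) + Real.log R + ∑ i, ((Q i).natDegree : ℝ) * Real.log R with hC
  have s1 : ∀ i, C1 i ≤ ∑ i, C1 i := fun i => Finset.single_le_sum (f := C1) (fun i _ => hC1 i) (Finset.mem_univ i)
  have s2 : ∀ i, Real.log (B i) ≤ ∑ i, Real.log (B i) := fun i => Finset.single_le_sum (f := fun i => Real.log (B i)) (fun i _ => Real.log_nonneg (hB1 i)) (Finset.mem_univ i)
  have s3 : ∀ i j, Real.log (M i j) ≤ ∑ i, ∑ j, Real.log (M i j) := fun i j =>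
    (Finset.single_le_sum (f := fun j => Real.log (M i j)) (fun j _ => Real.log_nonneg (hM1 i j)) (Finset.mem_univ j)).trans
    (Finset.single_le_sum (f := fun i => ∑ j, Real.log (M i j)) (fun i _ => Finset.sum_nonneg fun j _ => Real.log_nonneg (hM1 i j)) (Finset.mem_univ i))
  have hlR := Real.log_nonneg hRge
  have s4 : ∀ i, ((Q i).natDegree : ℝ) * Real.log R ≤ ∑ i, ((Q i).natDegree : ℝ) * Real.log R := fun i =>
    Finset.single_le_sum (f := fun i => ((Q i).natDegree : ℝ) * Real.log R) (fun i _ => by positivity) (Finset.mem_univ i)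
  have t1 : 0 ≤ ∑ i, C1 i := Finset.sum_nonneg fun i _ => hC1 i
  have t2 : 0 ≤ ∑ i, Real.log (B i) := Finset.sum_nonneg fun i _ => Real.log_nonneg (hB1 i)
  have t3 : 0 ≤ ∑ i, ∑ j, Real.log (M i j) := Finset.sum_nonneg fun i _ => Finset.sum_nonneg fun j _ => Real.log_nonneg (hM1 i j)
  have t4 : 0 ≤ ∑ i, ((Q i).natDegree : ℝ) * Real.log R := Finset.sum_nonneg fun i _ => by positivity
  have hCge : 1 ≤ C := by linarith
  refine ⟨C, hCge, fun K _ _ F w x hx0 => ?_⟩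
  have hd0 : (0:ℝ) ≤ dd w := Nat.cast_nonneg _
  have her : (dd w : ℝ) ≤ er Rr w := by
    have : 0 ≤ ∑ i, ∑ j, nu w (Rr i j) := Finset.sum_nonneg fun i _ => Finset.sum_nonneg fun j _ => nu_nonneg w _ (hR0 i j)
    unfold er; linarith
  have hern : ∀ i j, dd w + nu w (Rr i j) ≤ er Rr w := by
    intro i j
    have : nu w (Rr i j) ≤ ∑ i, ∑ j, nu w (Rr i j) :=
      (Finset.single_le_sum (f := fun j => nu w (Rr i j)) (fun j _ => nu_nonneg w _ (hR0 i j)) (Finset.mem_univ j)).trans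
      (Finset.single_le_sum (f := fun i => ∑ j, nu w (Rr i j)) (fun i _ => Finset.sum_nonneg fun j _ => nu_nonneg w _ (hR0 i j)) (Finset.mem_univ i))
    unfold er; linarith
  have hCe : C * dd w ≤ C * er Rr w := mul_le_mul_of_nonneg_left her (by linarith)
  by_cases hbig : R ^ dd w < ab w x
  · refine ⟨Classical.arbitrary ι, 0, le_rfl, fun i => ?_, Or.inl rfl⟩
    have h := hlarge i K F w x (lt_of_le_of_lt (pow_le_pow_left₀ (by linarith [hR1 i]) (hR1le i) _) hbig)
    have h2 : C1 i * dd w ≤ C * dd w := mul_le_mul_of_nonneg_right (by linarith [s1 i]) hd0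
    simp only [ite_self, add_zero]
    linarith
  · push Not at hbig
    have ha : Real.posLog (ab w x) ≤ dd w * Real.log R := by
      rw [Real.posLog_eq_log_max_one (AbsoluteValue.nonneg _ _), ← Real.log_pow]
      exact Real.log_le_log (by positivity) (max_le (one_le_pow₀ hRge) hbig)
    have ha0 : 0 ≤ Real.posLog (ab w x) := Real.posLog_nonneg
    have hpos : ∀ i, 0 < ab w (aeval x (Q i)) := fun i => (ab w).pos (hx0 i)
    have hup : ∀ i, Real.log (ab w (aeval x (Q i))) ≤ dd w * Real.log (B i) := by
      intro i
      rw [← Real.log_pow]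
      exact Real.log_le_log (hpos i) (hB i K F w x hbig)
    have hna : ∀ i, ((Q i).natDegree : ℝ) * Real.posLog (ab w x) ≤ dd w * ((Q i).natDegree * Real.log R) := by
      intro i
      calc ((Q i).natDegree : ℝ) * Real.posLog (ab w x) ≤ (Q i).natDegree * (dd w * Real.log R) := by gcongr
        _ = _ := by ring
    obtain ⟨i0, hi0⟩ := Finite.exists_min (fun i => ab w (aeval x (Q i)))
    have hlow : ∀ i, i ≠ i0 → - (C * er Rr w) ≤ Real.log (ab w (aeval x (Q i))) - (Q i).natDegree * Real.posLog (ab w x) := by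
      intro i hi
      have h1 := hM i i0 hi K F w x hbig
      rw [max_eq_left (hi0 i)] at h1
      have hRK : ((Rr i i0 : ℤ) : K) ≠ 0 := by exact_mod_cast hR0 i i0
      have hM0 : 0 < M i i0 := by linarith [hM1 i i0]
      have h2 := Real.log_le_log ((ab w).pos hRK) h1
      rw [Real.log_mul (by positivity) (hpos i).ne', Real.log_pow] at h2
      have h3 : Real.log (ab w (Rr i i0 : K)) = dd w * Real.log |(Rr i i0 : ℝ)| - nu w (Rr i i0) := by unfold nu; ring
      have h4 : 0 ≤ dd w * Real.log |(Rr i i0 : ℝ)| := by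
        refine mul_nonneg hd0 (Real.log_nonneg ?_)
        exact_mod_cast Int.one_le_abs (hR0 i i0)
      have h5 := mul_le_mul_of_nonneg_left (s3 i i0) hd0
      have h6 := mul_le_mul_of_nonneg_left (s4 i) hd0
      have h7 := hna i
      have h8 := hern i i0
      have h9 := nu_nonneg w _ (hR0 i i0)
      have h10 : C * (dd w + nu w (Rr i i0)) ≤ C * er Rr w := mul_le_mul_of_nonneg_left h8 (by linarith)
      have h11 : nu w (Rr i i0) ≤ C * nu w (Rr i i0) := le_mul_of_one_le_left h9 hCge
      have h12 : dd w * (∑ i, ∑ j, Real.log (M i j) + ∑ i, ((Q i).natDegree : ℝ) * Real.log R) ≤ dd w * C := by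
        refine mul_le_mul_of_nonneg_left ?_ hd0
        linarith
      linarith
    have hupC : ∀ i, Real.log (ab w (aeval x (Q i))) - (Q i).natDegree * Real.posLog (ab w x) ≤ C * er Rr w := by
      intro i
      have h1 := mul_le_mul_of_nonneg_left (s2 i) hd0
      have h2 : dd w * ∑ i, Real.log (B i) ≤ dd w * C := mul_le_mul_of_nonneg_left (by linarith) hd0
      have h3 : 0 ≤ ((Q i).natDegree : ℝ) * Real.posLog (ab w x) := by positivity
      have := hup i
      linarith
    have hnaC : ∀ i, ((Q i).natDegree : ℝ) * Real.posLog (ab w x) ≤ C * er Rr w := by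
      intro i
      have h6 := mul_le_mul_of_nonneg_left (s4 i) hd0
      have h2 : dd w * ∑ i, ((Q i).natDegree : ℝ) * Real.log R ≤ dd w * C := mul_le_mul_of_nonneg_left (by linarith) hd0
      have := hna i
      linarith
    by_cases h1 : 1 ≤ ab w (aeval x (Q i0))
    · refine ⟨i0, 0, le_rfl, fun i => ?_, Or.inl rfl⟩
      simp only [ite_self, add_zero]
      rw [abs_le]
      refine ⟨?_, hupC i⟩
      by_cases hi : i = i0
      · have := Real.log_nonneg h1
        rw [hi]
        have := hnaC i0
        linarith
      · exact hlow i hi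
    · push Not at h1
      refine ⟨i0, - Real.log (ab w (aeval x (Q i0))), ?_, fun i => ?_, Or.inr ⟨rfl, ?_⟩⟩
      · have := Real.log_nonpos (hpos i0).le h1.le
        linarith
      · by_cases hi : i = i0
        · rw [if_pos hi, hi]
          have := hnaC i0
          have h3 : 0 ≤ ((Q i0).natDegree : ℝ) * Real.posLog (ab w x) := by positivity
          rw [abs_le]; constructor <;> linarith
        · rw [if_neg hi, add_zero, abs_le]; exact ⟨hlow i hi, hupC i⟩
      · refine ha.trans ?_
        rw [mul_comm]
        exact mul_le_mul_of_nonneg_right (by linarith) hd0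

end MZ
end

section
open Polynomial NumberField
open Polynomial
namespace MZ
open NumberField

section
variable {K : Type} [Field K] [NumberField K] {F : Finset (FinitePlace K)} {J : Type} [Fintype J]

noncomputable def del (p : J → ℕ) (w : Wp K F) : Option J → ℝ
  | none => dd w
  | some j => nu w (p j) / Real.log (p j)

lemma del_nonneg (p : J → ℕ) (hp : ∀ j, (p j).Prime) (w : Wp K F) (v : Option J) : 0 ≤ del p w v := by
  cases v with
  | none => simp [del]
  | some j =>
    refine div_nonneg (nu_nonneg w _ ?_) (Real.log_nonneg ?_)
    · exact_mod_cast (hp j).ne_zero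
    · exact_mod_cast (hp j).one_lt.le

lemma del_sum (p : J → ℕ) (hp : ∀ j, (p j).Prime) (hF : ∀ j, Good F ((p j : ℕ) : K)) (v : Option J) :
    ∑ w : Wp K F, del p w v = Module.finrank ℚ K := by
  cases v with
  | none => exact sum_ddr
  | some j =>
    have h1 : 0 < Real.log (p j) := Real.log_pos (by exact_mod_cast (hp j).one_lt)
    simp only [del]
    rw [← Finset.sum_div, nu_sum_eq, div_eq_iff h1.ne']
    · simp
    · simpa using hF j

lemma exists_vv (p : J → ℕ) (hp : ∀ j, (p j).Prime) (hinj : Function.Injective p) :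
    ∃ vv : Wp K F → Option J, ∀ w v, v ≠ vv w → del p w v = 0 := by
  suffices h : ∀ w : Wp K F, ∃ v0 : Option J, ∀ v, v ≠ v0 → del p w v = 0 by
    choose vv hvv using h
    exact ⟨vv, hvv⟩
  rintro (σ | u)
  · refine ⟨none, fun v hv => ?_⟩
    cases v with
    | none => exact absurd rfl hv
    | some j => simp [del, nu_inl]
  · have key : ∀ j, del p (Sum.inr u : Wp K F) (some j) ≠ 0 → u.1 ((p j : ℕ) : K) < 1 := by
      intro j hj
      have h1 := fp_int_le u.1 (p j)
      refine lt_of_le_of_ne (by simpa using h1) fun h => hj ?_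
      simp [del, nu, h]
    by_cases hex : ∃ j, del p (Sum.inr u : Wp K F) (some j) ≠ 0
    · obtain ⟨j, hj⟩ := hex
      refine ⟨some j, fun v hv => ?_⟩
      cases v with
      | none => simp [del]
      | some i =>
        by_contra hi
        have h1 := key j hj
        have h2 := key i hi
        have hij : p i ≠ p j := fun h => hv (by rw [hinj h])
        have hc : IsCoprime (p i : ℤ) (p j : ℤ) := Nat.isCoprime_iff_coprime.2 ((Nat.coprime_primes (hp i) (hp j)).2 hij)
        obtain ⟨a, b, hab⟩ := hc
        have e : (1 : K) = (a : K) * (p i : K) + (b : K) * (p j : K) := by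
          have := congrArg (Int.cast : ℤ → K) hab
          push_cast at this; exact this.symm
        have h3 := FinitePlace.add_le u.1 ((a : K) * (p i : K)) ((b : K) * (p j : K))
        rw [← e, map_one, map_mul, map_mul] at h3
        have h4 := fp_int_le u.1 a
        have h5 := fp_int_le u.1 b
        have h6 : u.1 (a : K) * u.1 (p i : K) < 1 := by
          calc _ ≤ 1 * u.1 (p i : K) := mul_le_mul_of_nonneg_right h4 (apply_nonneg _ _)
            _ < 1 := by linarith
        have h7 : u.1 (b : K) * u.1 (p j : K) < 1 := by
          calc _ ≤ 1 * u.1 (p j : K) := mul_le_mul_of_nonneg_right h5 (apply_nonneg _ _)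
            _ < 1 := by linarith
        have := max_lt h6 h7
        linarith
    · push Not at hex
      refine ⟨none, fun v hv => ?_⟩
      cases v with
      | none => exact absurd rfl hv
      | some j => exact hex j

end

def Exc {ι J : Type} [Fintype ι] [Fintype J] (Q : ι → ℤ[X]) (p : J → ℕ) (α : ℂ) (κ : ι → ℂ) (A : J → ℂ) : Prop :=
  IsAlgebraic ℚ α ∧ (∀ i, aeval α (Q i) ≠ 0) ∧ (∃ i j, κ i = 1 ∧ κ j = Complex.I) ∧ (∀ i, ‖κ i‖ ≤ 2) ∧
  ∑ i, ((Q i).natDegree : ℂ) * κ i = 0 ∧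
  ∀ (K : Type) [Field K] [NumberField K] (x : K) (f : K →+* ℂ), f x = α → ∀ w : AbsoluteValue K ℝ,
    ∑ i, κ i * (Real.log (w (aeval x (Q i))) : ℂ) + ∑ j, A j * (Real.log (w ((p j : ℕ) : K)) : ℂ) = 0

noncomputable def cc {J : Type} [Fintype J] (p : J → ℕ) (A : J → ℂ) : Option J → ℂ
  | none => ∑ j, A j * (Real.log (p j) : ℂ)
  | some j => - (A j * (Real.log (p j) : ℂ))

lemma cc_sum {J : Type} [Fintype J] (p : J → ℕ) (A : J → ℂ) : ∑ v, cc p A v = 0 := by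
  rw [Fintype.sum_option]
  simp [cc]

lemma er_nonneg {ι : Type} [Fintype ι] (Rr : ι → ι → ℤ) (hR0 : ∀ i j, Rr i j ≠ 0) {K : Type} [Field K] [NumberField K] {F : Finset (FinitePlace K)} (w : Wp K F) :
    (dd w : ℝ) ≤ er Rr w := by
  have : 0 ≤ ∑ i, ∑ j, nu w (Rr i j) := Finset.sum_nonneg fun i _ => Finset.sum_nonneg fun j _ => nu_nonneg w _ (hR0 i j)
  unfold er; linarith

lemma er_sum {ι : Type} [Fintype ι] (Rr : ι → ι → ℤ) (hR0 : ∀ i j, Rr i j ≠ 0) : ∃ C : ℝ, 1 ≤ C ∧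
    ∀ (K : Type) [Field K] [NumberField K] (F : Finset (FinitePlace K)), ∑ w : Wp K F, er Rr w ≤ C * Module.finrank ℚ K := by
  refine ⟨1 + ∑ i, ∑ j, Real.log |(Rr i j : ℝ)|, ?_, fun K _ _ F => ?_⟩
  · have : 0 ≤ ∑ i, ∑ j, Real.log |(Rr i j : ℝ)| := Finset.sum_nonneg fun i _ => Finset.sum_nonneg fun j _ =>
      Real.log_nonneg (by exact_mod_cast Int.one_le_abs (hR0 i j))
    linarith
  · unfold er
    rw [Finset.sum_add_distrib, sum_ddr, Finset.sum_comm, add_mul, one_mul]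
    refine add_le_add le_rfl ?_
    rw [Finset.sum_mul]
    refine Finset.sum_le_sum fun i _ => ?_
    rw [Finset.sum_comm, Finset.sum_mul]
    refine Finset.sum_le_sum fun j _ => ?_
    rw [mul_comm]
    exact nu_sum_le _ (hR0 i j)

lemma local_data {ι J : Type} [Fintype ι] [DecidableEq ι] [Nonempty ι] [Fintype J] (Q : ι → ℤ[X]) (hQ : ∀ i, (Q i).Monic)
    (p : J → ℕ) (hp : ∀ j, (p j).Prime)
    (Rr : ι → ι → ℤ) (hR0 : ∀ i j, Rr i j ≠ 0) (hRr : ∀ i j, i ≠ j → ∃ A B : ℤ[X], A * Q i + B * Q j = C (Rr i j)) :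
    ∃ C : ℝ, 1 ≤ C ∧ ∀ (α : ℂ) (κ : ι → ℂ) (A : J → ℂ), Exc Q p α κ A →
      ∀ (K : Type) [Field K] [NumberField K] (F : Finset (FinitePlace K)) (x : K) (f : K →+* ℂ), f x = α →
      (∀ i, Good F (aeval x (Q i))) →
      ∀ vv : Wp K F → Option J, (∀ w v, v ≠ vv w → del p w v = 0) →
      ∃ (i0 : Wp K F → ι) (lam : Wp K F → ℝ), (∀ w, 0 ≤ lam w) ∧
        (∀ w, ‖κ (i0 w) * (lam w : ℂ) - (del p w (vv w) : ℂ) * cc p A (vv w)‖ ≤ C * er Rr w) ∧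
        (∀ i, |(Q i).natDegree * (∑ w : Wp K F, Real.posLog (ab w x)) - ∑ w : Wp K F, if i0 w = i then lam w else 0| ≤ C * Module.finrank ℚ K) ∧
        (∀ w, lam w = 0 ∨ (lam w = - Real.log (ab w (aeval x (Q (i0 w)))) ∧ Real.posLog (ab w x) ≤ C * dd w)) := by
  obtain ⟨C1, hC1, hloc⟩ := local_lemma Q hQ Rr hR0 hRr
  obtain ⟨C2, hC2, hers⟩ := er_sum Rr hR0
  set N : ℝ := ((Fintype.card ι : ℕ) : ℝ) with hN
  have hN0 : (0:ℝ) ≤ N := Nat.cast_nonneg _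
  refine ⟨2 * N * C1 + C1 * C2, by nlinarith [mul_nonneg hN0 (by linarith : 0 ≤ C1)], ?_⟩
  intro α κ A hE K _ _ F x f hfx hG vv hvv
  obtain ⟨hA1, hA2, hA3, hκ, hnκ, hrel⟩ := hE
  choose i0 lam hl0 hl1 hl2 using fun w : Wp K F => hloc K F w x (fun i => (hG i).1)
  have he0 : ∀ w : Wp K F, 0 ≤ er Rr w := fun w => le_trans (Nat.cast_nonneg _) (er_nonneg Rr hR0 w)
  refine ⟨i0, lam, hl0, fun w => ?_, fun i => ?_, fun w => ?_⟩
  · have h1 := hrel K x f hfx (ab w)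
    have h2 : ∑ j, A j * (Real.log (ab w ((p j : ℕ) : K)) : ℂ) = (del p w (vv w) : ℂ) * cc p A (vv w) := by
      have e1 : ∑ v, (del p w v : ℂ) * cc p A v = (del p w (vv w) : ℂ) * cc p A (vv w) := by
        refine Finset.sum_eq_single _ (fun v _ hv => ?_) (by simp)
        rw [hvv w v hv]; simp
      rw [← e1, Fintype.sum_option]
      simp only [del, cc]
      rw [Finset.mul_sum, ← Finset.sum_add_distrib]
      refine Finset.sum_congr rfl fun j _ => ?_
      have h3 : (Real.log (p j) : ℂ) ≠ 0 := by
        have : 0 < Real.log (p j) := Real.log_pos (by exact_mod_cast (hp j).one_lt)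
        exact_mod_cast this.ne'
      have h4 : Real.log (ab w ((p j : ℕ) : K)) = dd w * Real.log (p j) - nu w (p j) := by
        unfold nu; simp
      rw [h4]
      generalize Real.log (p j) = L at h3 ⊢
      push_cast
      field_simp
      ring
    rw [h2] at h1
    set g : ι → ℝ := fun i => Real.log (ab w (aeval x (Q i))) - (Q i).natDegree * Real.posLog (ab w x) + (if i = i0 w then lam w else 0) with hg
    have h3 : κ (i0 w) * (lam w : ℂ) - (del p w (vv w) : ℂ) * cc p A (vv w) = ∑ i, κ i * (g i : ℂ) := by
      have e1 : ∑ i, κ i * (g i : ℂ) = ∑ i, κ i * (Real.log (ab w (aeval x (Q i))) : ℂ) - (∑ i, ((Q i).natDegree : ℂ) * κ i) * (Real.posLog (ab w x) : ℂ)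
          + ∑ i, (if i = i0 w then κ i * (lam w : ℂ) else 0) := by
        rw [Finset.sum_mul, ← Finset.sum_sub_distrib, ← Finset.sum_add_distrib]
        refine Finset.sum_congr rfl fun i _ => ?_
        simp only [hg]
        split_ifs <;> push_cast <;> ring
      rw [e1, hnκ, Finset.sum_ite_eq' Finset.univ (i0 w), if_pos (Finset.mem_univ _), eq_neg_of_add_eq_zero_left h1]
      ring
    rw [h3]
    calc ‖∑ i, κ i * (g i : ℂ)‖ ≤ ∑ i, ‖κ i * (g i : ℂ)‖ := norm_sum_le _ _
      _ ≤ ∑ i : ι, 2 * (C1 * er Rr w) := by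
          refine Finset.sum_le_sum fun i _ => ?_
          rw [norm_mul, Complex.norm_real, Real.norm_eq_abs]
          exact mul_le_mul (hκ i) (hl1 w i) (abs_nonneg _) (by norm_num)
      _ = 2 * N * C1 * er Rr w := by rw [Finset.sum_const, Finset.card_univ, nsmul_eq_mul, ← hN]; ring
      _ ≤ _ := by
          refine mul_le_mul_of_nonneg_right ?_ (he0 w)
          nlinarith
  · have h1 := PF _ (hG i)
    have h2 : (Q i).natDegree * (∑ w : Wp K F, Real.posLog (ab w x)) - (∑ w : Wp K F, if i0 w = i then lam w else 0)
        = - ∑ w : Wp K F, (Real.log (ab w (aeval x (Q i))) - (Q i).natDegree * Real.posLog (ab w x) + (if i = i0 w then lam w else 0)) := by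
      rw [Finset.sum_add_distrib, Finset.sum_sub_distrib, h1, Finset.mul_sum]
      simp only [eq_comm (a := i)]
      ring
    rw [h2, abs_neg]
    calc _ ≤ ∑ w : Wp K F, |Real.log (ab w (aeval x (Q i))) - (Q i).natDegree * Real.posLog (ab w x) + (if i = i0 w then lam w else 0)| := Finset.abs_sum_le_sum_abs _ _
      _ ≤ ∑ w : Wp K F, C1 * er Rr w := Finset.sum_le_sum fun w _ => hl1 w i
      _ = C1 * ∑ w : Wp K F, er Rr w := by rw [Finset.mul_sum]
      _ ≤ C1 * (C2 * Module.finrank ℚ K) := mul_le_mul_of_nonneg_left (hers K F) (by linarith)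
      _ ≤ _ := by
          rw [← mul_assoc]
          refine mul_le_mul_of_nonneg_right ?_ (Nat.cast_nonneg _)
          nlinarith [mul_nonneg hN0 (by linarith : 0 ≤ C1)]
  · rcases hl2 w with h | ⟨h, h'⟩
    · exact Or.inl h
    · refine Or.inr ⟨h, h'.trans (mul_le_mul_of_nonneg_right ?_ (Nat.cast_nonneg _))⟩
      nlinarith [mul_nonneg hN0 (by linarith : 0 ≤ C1)]

end MZ
end

section
open Polynomial NumberField
open Polynomial
namespace MZ

def RayEq (c κ : ℂ) : Prop := c ≠ 0 ∧ κ ≠ 0 ∧ c * (‖κ‖ : ℂ) = κ * (‖c‖ : ℂ)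

lemma RayEq.symm {a b : ℂ} (h : RayEq a b) : RayEq b a := ⟨h.2.1, h.1, h.2.2.symm⟩

lemma RayEq.trans {a b c : ℂ} (h : RayEq a b) (h' : RayEq b c) : RayEq a c := by
  obtain ⟨ha, hb, e⟩ := h
  obtain ⟨_, hc, e'⟩ := h'
  refine ⟨ha, hc, ?_⟩
  have hb' : (‖b‖ : ℂ) ≠ 0 := by exact_mod_cast (norm_ne_zero_iff.2 hb)
  apply mul_right_cancel₀ hb'
  calc a * ‖c‖ * ‖b‖ = (a * ‖b‖) * ‖c‖ := by ring
    _ = (b * ‖c‖) * ‖a‖ := by rw [e]; ring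
    _ = _ := by rw [e']; ring

lemma ray_dist {c κ : ℂ} (h : RayEq c κ) (l t : ℝ) : ‖κ * (l : ℂ) - (t : ℂ) * c‖ = |l * ‖κ‖ - t * ‖c‖| := by
  obtain ⟨hc, hκ, e⟩ := h
  have hk : 0 < ‖κ‖ := norm_pos_iff.2 hκ
  have hk' : (‖κ‖ : ℂ) ≠ 0 := by exact_mod_cast hk.ne'
  have e2 : κ * (l : ℂ) - (t : ℂ) * c = κ * (((l * ‖κ‖ - t * ‖c‖) / ‖κ‖ : ℝ) : ℂ) := by
    push_cast
    field_simp
    linear_combination (-(t:ℂ)) * e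
  rw [e2, norm_mul, Complex.norm_real, Real.norm_eq_abs, abs_div, abs_of_pos hk]
  field_simp

lemma nonray {c κ : ℂ} (h : ¬ RayEq c κ) : ∃ C : ℝ, 1 ≤ C ∧ ∀ l t : ℝ, 0 ≤ l → 0 ≤ t →
    l * ‖κ‖ ≤ C * ‖κ * (l : ℂ) - (t : ℂ) * c‖ ∧ t * ‖c‖ ≤ C * ‖κ * (l : ℂ) - (t : ℂ) * c‖ := by
  by_cases hc : c = 0
  · refine ⟨1, le_rfl, fun l t hl ht => ?_⟩
    subst hc
    simp [abs_of_nonneg hl, mul_comm]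
    positivity
  by_cases hκ : κ = 0
  · refine ⟨1, le_rfl, fun l t hl ht => ?_⟩
    subst hκ
    simp [abs_of_nonneg ht]
    positivity
  have hk : 0 < ‖κ‖ := norm_pos_iff.2 hκ
  have hk' : (‖κ‖ : ℂ) ≠ 0 := by exact_mod_cast hk.ne'
  have hn : 0 < ‖c‖ := norm_pos_iff.2 hc
  have hn' : (‖c‖ : ℂ) ≠ 0 := by exact_mod_cast hn.ne'
  set u : ℂ := κ / ‖κ‖ with hu
  set v : ℂ := c / ‖c‖ with hv
  have hu1 : ‖u‖ = 1 := by rw [hu, norm_div, Complex.norm_real, norm_norm, div_self hk.ne']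
  have hv1 : ‖v‖ = 1 := by rw [hv, norm_div, Complex.norm_real, norm_norm, div_self hn.ne']
  have hd : 0 < ‖u - v‖ := by
    rw [norm_pos_iff, sub_ne_zero]
    intro e
    apply h
    refine ⟨hc, hκ, ?_⟩
    rw [hu, hv, div_eq_div_iff hk' hn'] at e
    exact e.symm
  refine ⟨1 + 2 / ‖u - v‖, by have : 0 ≤ 2 / ‖u - v‖ := by positivity
                              linarith, fun l t hl ht => ?_⟩
  set a := l * ‖κ‖ with ha
  set b := t * ‖c‖ with hb
  have ha0 : 0 ≤ a := by positivity
  have hb0 : 0 ≤ b := by positivity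
  have e : κ * (l : ℂ) - (t : ℂ) * c = a * u - b * v := by
    rw [ha, hb, hu, hv]; push_cast; field_simp
  rw [e]
  set z := (a : ℂ) * u - b * v with hz
  have h1 : |a - b| ≤ ‖z‖ := by
    have := abs_norm_sub_norm_le ((a : ℂ) * u) (b * v)
    rw [norm_mul, norm_mul, hu1, hv1, Complex.norm_real, Complex.norm_real, Real.norm_eq_abs, Real.norm_eq_abs, abs_of_nonneg ha0, abs_of_nonneg hb0, mul_one, mul_one] at this
    exact this
  have h2 : a * ‖u - v‖ ≤ 2 * ‖z‖ := by
    have e1 : (a : ℂ) * (u - v) = z - ((a - b : ℝ) : ℂ) * v := by rw [hz]; push_cast; ring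
    have := norm_sub_le z (((a - b : ℝ) : ℂ) * v)
    rw [← e1, norm_mul, norm_mul, hv1, Complex.norm_real, Complex.norm_real, Real.norm_eq_abs, Real.norm_eq_abs, abs_of_nonneg ha0] at this
    linarith
  have h3 : b * ‖u - v‖ ≤ 2 * ‖z‖ := by
    have e1 : (b : ℂ) * (u - v) = z - ((a - b : ℝ) : ℂ) * u := by rw [hz]; push_cast; ring
    have := norm_sub_le z (((a - b : ℝ) : ℂ) * u)
    rw [← e1, norm_mul, norm_mul, hu1, Complex.norm_real, Complex.norm_real, Real.norm_eq_abs, Real.norm_eq_abs, abs_of_nonneg hb0] at this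
    linarith
  have hz0 := norm_nonneg z
  rw [add_mul, one_mul, div_mul_eq_mul_div]
  constructor
  · have := (le_div_iff₀ hd).2 h2; linarith
  · have := (le_div_iff₀ hd).2 h3; linarith

lemma nonray_unif {ι V : Type} [Fintype ι] [Fintype V] (κ : ι → ℂ) (c : V → ℂ) : ∃ C : ℝ, 1 ≤ C ∧ ∀ i v, ¬ RayEq (c v) (κ i) → ∀ l t : ℝ, 0 ≤ l → 0 ≤ t →
    l * ‖κ i‖ ≤ C * ‖κ i * (l : ℂ) - (t : ℂ) * c v‖ ∧ t * ‖c v‖ ≤ C * ‖κ i * (l : ℂ) - (t : ℂ) * c v‖ := by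
  have : ∀ i v, ∃ C : ℝ, 1 ≤ C ∧ (¬ RayEq (c v) (κ i) → ∀ l t : ℝ, 0 ≤ l → 0 ≤ t →
    l * ‖κ i‖ ≤ C * ‖κ i * (l : ℂ) - (t : ℂ) * c v‖ ∧ t * ‖c v‖ ≤ C * ‖κ i * (l : ℂ) - (t : ℂ) * c v‖) := by
    intro i v
    by_cases h : RayEq (c v) (κ i)
    · exact ⟨1, le_rfl, fun h' => absurd h h'⟩
    · obtain ⟨C, hC, h2⟩ := nonray h
      exact ⟨C, hC, fun _ => h2⟩
  choose C hC h using this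
  have hle : ∀ i v, C i v ≤ 1 + ∑ i, ∑ v, C i v := by
    intro i v
    have h1 : C i v ≤ ∑ v, C i v := Finset.single_le_sum (f := fun v => C i v) (fun v _ => by linarith [hC i v]) (Finset.mem_univ v)
    have h2 : ∑ v, C i v ≤ ∑ i, ∑ v, C i v := Finset.single_le_sum (f := fun i => ∑ v, C i v) (fun i _ => Finset.sum_nonneg fun v _ => by linarith [hC i v]) (Finset.mem_univ i)
    linarith
  have h0 : 0 ≤ ∑ i, ∑ v, C i v := Finset.sum_nonneg fun i _ => Finset.sum_nonneg fun v _ => by linarith [hC i v]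
  refine ⟨1 + ∑ i, ∑ v, C i v, by linarith, fun i v hn l t hl ht => ?_⟩
  obtain ⟨h1, h2⟩ := h i v hn l t hl ht
  have h3 := mul_le_mul_of_nonneg_right (hle i v) (norm_nonneg (κ i * (l : ℂ) - (t : ℂ) * c v))
  exact ⟨h1.trans h3, h2.trans h3⟩

open Classical in
lemma gamma_lt {V : Type} [Fintype V] (c : V → ℂ) (hc0 : ∑ v, c v = 0) (hc1 : ∑ v, ‖c v‖ = 1)
    (h1 : ∃ v, RayEq (c v) 1) (hI : ∃ v, RayEq (c v) Complex.I) (κ : ℂ) (hκ : κ ≠ 0) :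
    ∑ v, (if RayEq (c v) κ then ‖c v‖ else 0) < 1 / 2 := by
  have hk : 0 < ‖κ‖ := norm_pos_iff.2 hκ
  set φ : ℂ → ℝ := fun z => (z * (starRingEnd ℂ) κ).re with hφ
  have hs : ∑ v, φ (c v) = 0 := by
    have : ∑ v, φ (c v) = ((∑ v, c v) * (starRingEnd ℂ) κ).re := by
      rw [Finset.sum_mul, Complex.re_sum]
    rw [this, hc0]; simp
  have hray : ∀ z, RayEq z κ → φ z = ‖z‖ * ‖κ‖ := by
    rintro z ⟨hz, _, e⟩
    have hk' : (‖κ‖ : ℂ) ≠ 0 := by exact_mod_cast hk.ne'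
    have e2 : z * (starRingEnd ℂ) κ = ((‖z‖ * ‖κ‖ : ℝ) : ℂ) := by
      apply mul_right_cancel₀ hk'
      calc z * (starRingEnd ℂ) κ * ‖κ‖ = (z * ‖κ‖) * (starRingEnd ℂ) κ := by ring
        _ = (κ * (starRingEnd ℂ) κ) * ‖z‖ := by rw [e]; ring
        _ = _ := by rw [Complex.mul_conj, Complex.normSq_eq_norm_sq]; push_cast; ring
    simp only [hφ]; rw [e2, Complex.ofReal_re]
  have hge : ∀ z, - (‖z‖ * ‖κ‖) ≤ φ z := by
    intro z
    have := Complex.abs_re_le_norm (z * (starRingEnd ℂ) κ)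
    rw [norm_mul, Complex.norm_conj] at this
    exact (abs_le.1 this).1
  have hstrict : ∃ v, ¬ RayEq (c v) κ ∧ - (‖c v‖ * ‖κ‖) < φ (c v) := by
    have hns : ‖κ‖ ^ 2 = κ.re ^ 2 + κ.im ^ 2 := by
      rw [← Complex.normSq_eq_norm_sq, Complex.normSq_apply]; ring
    by_cases him : κ.im = 0
    · obtain ⟨v, hv⟩ := hI
      refine ⟨v, fun h => ?_, ?_⟩
      · have := (hv.symm.trans h).2.2
        have := congrArg Complex.im this
        simp [him] at this
        exact hκ this
      · have e := hv.2.2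
        simp only [Complex.norm_I, Complex.ofReal_one, mul_one] at e
        have hn : 0 < ‖c v‖ := norm_pos_iff.2 hv.1
        have : φ (c v) = 0 := by
          simp only [hφ]; rw [e]; simp [him]
        rw [this]; have := mul_pos hn hk; linarith
    · obtain ⟨v, hv⟩ := h1
      refine ⟨v, fun h => ?_, ?_⟩
      · have := (hv.symm.trans h).2.2
        have := congrArg Complex.im this
        simp at this
        exact him this.symm
      · have e := hv.2.2
        simp only [norm_one, Complex.ofReal_one, mul_one, one_mul] at e
        have hn : 0 < ‖c v‖ := norm_pos_iff.2 hv.1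
        have : φ (c v) = ‖c v‖ * κ.re := by
          simp only [hφ]; rw [e]; simp
        rw [this]
        have h5 : - ‖κ‖ < κ.re := by
          by_contra hcon
          push Not at hcon
          have : 0 < κ.im ^ 2 := by positivity
          nlinarith
        nlinarith
  obtain ⟨v0, hv0, hlt⟩ := hstrict
  have hsum : ∑ v, ((if RayEq (c v) κ then 2 * (‖c v‖ * ‖κ‖) else 0) - ‖c v‖ * ‖κ‖) < ∑ v, φ (c v) := by
    apply Finset.sum_lt_sum
    · intro v _
      split_ifs with h
      · rw [hray _ h]; linarith
      · have := hge (c v); linarith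
    · exact ⟨v0, Finset.mem_univ _, by rw [if_neg hv0]; linarith⟩
  rw [hs, Finset.sum_sub_distrib, ← Finset.sum_mul, hc1] at hsum
  have e : ∑ v, (if RayEq (c v) κ then 2 * (‖c v‖ * ‖κ‖) else 0) = 2 * ‖κ‖ * ∑ v, (if RayEq (c v) κ then ‖c v‖ else 0) := by
    rw [Finset.mul_sum]
    refine Finset.sum_congr rfl fun v _ => ?_
    split_ifs <;> ring
  rw [e] at hsum
  nlinarith

open Classical in
lemma geometry {ι V : Type} [Fintype ι] [Fintype V] (n : ι → ℝ) (hn : ∀ i, 0 < n i) (κ : ι → ℂ) (c : V → ℂ)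
    (hc0 : ∑ v, c v = 0) (hc1 : ∑ v, ‖c v‖ = 1) (i1 i2 : ι) (h1 : κ i1 = 1) (h2 : κ i2 = Complex.I) :
    ∃ x θ : ℝ, 0 ≤ x ∧ 0 < θ ∧ 2 * x < θ ∧
      θ ^ 2 * ∑ q ∈ (Finset.univ : Finset (ι × ι)).filter (fun q => RayEq (κ q.1) (κ q.2)), n q.1 * n q.2 * (‖κ q.1‖ * ‖κ q.2‖) < 2 ∧
      ∃ i, κ i ≠ 0 ∧ ∑ v, (if RayEq (c v) (κ i) then ‖c v‖ else 0) ≤ x * ∑ j, (if RayEq (κ j) (κ i) then n j * ‖κ j‖ else 0) := by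
  set γ : ι → ℝ := fun i => ∑ v, (if RayEq (c v) (κ i) then ‖c v‖ else 0) with hγ
  set M : ι → ℝ := fun i => ∑ j, (if RayEq (κ j) (κ i) then n j * ‖κ j‖ else 0) with hM
  set S := ∑ q ∈ (Finset.univ : Finset (ι × ι)).filter (fun q => RayEq (κ q.1) (κ q.2)), n q.1 * n q.2 * (‖κ q.1‖ * ‖κ q.2‖) with hS
  have hγ0 : ∀ i, 0 ≤ γ i := fun i => Finset.sum_nonneg fun v _ => by split_ifs <;> positivity
  have hrefl : ∀ i, κ i ≠ 0 → RayEq (κ i) (κ i) := fun i hi => ⟨hi, hi, rfl⟩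
  have hMterm : ∀ i j, 0 ≤ (if RayEq (κ j) (κ i) then n j * ‖κ j‖ else 0) := fun i j => by
    have := hn j
    split_ifs <;> positivity
  have hMpos : ∀ i, κ i ≠ 0 → 0 < M i := by
    intro i hi
    have := Finset.single_le_sum (f := fun j => (if RayEq (κ j) (κ i) then n j * ‖κ j‖ else 0)) (fun j _ => hMterm i j) (Finset.mem_univ i)
    simp only [if_pos (hrefl i hi)] at this
    have h3 : 0 < n i * ‖κ i‖ := mul_pos (hn i) (norm_pos_iff.2 hi)
    linarith
  obtain ⟨i, hi, hmin⟩ := Finset.exists_min_image (Finset.univ.filter fun i => κ i ≠ 0) (fun i => γ i / M i) ⟨i1, by simp [h1]⟩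
  simp only [Finset.mem_filter, Finset.mem_univ, true_and] at hi hmin
  set x := γ i / M i with hx
  have hx0 : 0 ≤ x := div_nonneg (hγ0 i) (hMpos i hi).le
  have hxM : ∀ j, κ j ≠ 0 → x * M j ≤ γ j := fun j hj => by
    have := hmin j hj
    rwa [le_div_iff₀ (hMpos j hj)] at this
  have hmain : (2 * x) ^ 2 * S < 2 := by
    rcases hx0.eq_or_lt with h0 | hxp
    · rw [← h0]; simp
    have hray : ∀ j, κ j ≠ 0 → ∃ v, RayEq (c v) (κ j) := by
      intro j hj
      by_contra hcon
      push Not at hcon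
      have : γ j = 0 := Finset.sum_eq_zero fun v _ => if_neg (hcon v)
      have h3 := hxM j hj
      have h4 := mul_pos hxp (hMpos j hj)
      linarith
    have hr1 : ∃ v, RayEq (c v) 1 := by have := hray i1 (by simp [h1]); rwa [h1] at this
    have hrI : ∃ v, RayEq (c v) Complex.I := by have := hray i2 (by simp [h2]); rwa [h2] at this
    have hγlt : ∀ j, κ j ≠ 0 → γ j < 1 / 2 := fun j hj => gamma_lt c hc0 hc1 hr1 hrI (κ j) hj
    set Mv : V → ℝ := fun v => ∑ j, (if RayEq (c v) (κ j) then n j * ‖κ j‖ else 0) with hMv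
    have hMvlt : ∀ v, x * Mv v < 1 / 2 := by
      intro v
      by_cases hex : ∃ j, RayEq (c v) (κ j)
      · obtain ⟨j, hj⟩ := hex
        have : Mv v ≤ M j := by
          refine Finset.sum_le_sum fun k _ => ?_
          by_cases hk : RayEq (c v) (κ k)
          · rw [if_pos hk, if_pos (hk.symm.trans hj)]
          · rw [if_neg hk]; exact hMterm j k
        have h3 := hxM j hj.2.1
        have h4 := hγlt j hj.2.1
        have := mul_le_mul_of_nonneg_left this hxp.le
        linarith
      · push Not at hex
        have : Mv v = 0 := Finset.sum_eq_zero fun j _ => if_neg (hex j)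
        rw [this]; norm_num
    have hSe : S = ∑ j, n j * ‖κ j‖ * M j := by
      rw [hS, Finset.sum_filter, ← Finset.univ_product_univ, Finset.sum_product, Finset.sum_comm]
      refine Finset.sum_congr rfl fun j _ => ?_
      rw [hM, Finset.mul_sum]
      refine Finset.sum_congr rfl fun k _ => ?_
      split_ifs <;> ring
    have hxS : x * S ≤ ∑ v, ‖c v‖ * Mv v := by
      calc x * S = ∑ j, n j * ‖κ j‖ * (x * M j) := by
            rw [hSe, Finset.mul_sum]; exact Finset.sum_congr rfl fun j _ => by ring
        _ ≤ ∑ j, n j * ‖κ j‖ * γ j := by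
            refine Finset.sum_le_sum fun j _ => ?_
            by_cases hj : κ j = 0
            · simp [hj]
            · exact mul_le_mul_of_nonneg_left (hxM j hj) (mul_nonneg (hn j).le (norm_nonneg _))
        _ = ∑ v, ‖c v‖ * Mv v := by
            simp only [hγ, hMv, Finset.mul_sum]
            rw [Finset.sum_comm]
            refine Finset.sum_congr rfl fun v _ => Finset.sum_congr rfl fun j _ => ?_
            split_ifs <;> ring
    have hlt : ∑ v, ‖c v‖ * (x * Mv v) < ∑ v, ‖c v‖ * (1 / 2) := by
      apply Finset.sum_lt_sum
      · intro v _
        exact mul_le_mul_of_nonneg_left (hMvlt v).le (norm_nonneg _)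
      · obtain ⟨v, hv⟩ := hr1
        exact ⟨v, Finset.mem_univ _, mul_lt_mul_of_pos_left (hMvlt v) (norm_pos_iff.2 hv.1)⟩
    rw [← Finset.sum_mul, hc1] at hlt
    have e : ∑ v, ‖c v‖ * (x * Mv v) = x * ∑ v, ‖c v‖ * Mv v := by
      rw [Finset.mul_sum]; exact Finset.sum_congr rfl fun v _ => by ring
    rw [e] at hlt
    have := mul_le_mul_of_nonneg_left hxS hxp.le
    nlinarith
  obtain ⟨θ, hθ1, hθ2⟩ : ∃ θ, 2 * x < θ ∧ θ ^ 2 * S < 2 := by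
    have hcont : ContinuousAt (fun θ : ℝ => θ ^ 2 * S) (2 * x) := by fun_prop
    have h3 : ∀ᶠ θ in nhdsWithin (2 * x) (Set.Ioi (2 * x)), θ ^ 2 * S < 2 :=
      (hcont.eventually_lt continuousAt_const hmain).filter_mono nhdsWithin_le_nhds
    obtain ⟨θ, h4, h5⟩ := (h3.and self_mem_nhdsWithin).exists
    exact ⟨θ, h5, h4⟩
  refine ⟨x, θ, hx0, by linarith, hθ1, hθ2, i, hi, ?_⟩
  have : γ i = x * M i := by rw [hx, div_mul_cancel₀ _ (hMpos i hi).ne']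
  exact this.le

end MZ
end

section
open Polynomial NumberField
open Polynomial
namespace MZ
open NumberField

lemma del_vv_sum {K : Type} [Field K] [NumberField K] {F : Finset (FinitePlace K)} {J : Type} [Fintype J]
    (p : J → ℕ) (hp : ∀ j, (p j).Prime) (hF : ∀ j, Good F ((p j : ℕ) : K))
    (vv : Wp K F → Option J) (hvv : ∀ w v, v ≠ vv w → del p w v = 0) (g : Option J → ℝ) :
    ∑ w : Wp K F, del p w (vv w) * g (vv w) = Module.finrank ℚ K * ∑ v, g v := by
  have h1 : ∀ w : Wp K F, del p w (vv w) * g (vv w) = ∑ v, del p w v * g v := by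
    intro w
    symm
    refine Finset.sum_eq_single (vv w) (fun v _ hv => ?_) (fun h => absurd (Finset.mem_univ _) h)
    rw [hvv w v hv, zero_mul]
  simp only [h1]
  rw [Finset.sum_comm, Finset.mul_sum]
  refine Finset.sum_congr rfl fun v _ => ?_
  rw [← Finset.sum_mul, del_sum p hp hF]

structure Dat {ι J : Type} [DecidableEq ι] [Fintype J] (Q : ι → ℤ[X]) (p : J → ℕ) (κ : ι → ℂ) (c : Option J → ℂ) (C0 ε : ℝ)
    {K : Type} [Field K] [NumberField K] {F : Finset (FinitePlace K)} (vv : Wp K F → Option J) (x : K) (η : ℝ)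
    (i0 : Wp K F → ι) (lam E : Wp K F → ℝ) : Prop where
  lam0 : ∀ w, 0 ≤ lam w
  E0 : ∀ w, (dd w : ℝ) ≤ E w
  near : ∀ w, ‖κ (i0 w) * (lam w : ℂ) - ((del p w (vv w) * η : ℝ) : ℂ) * c (vv w)‖ ≤ E w
  Esum : ∑ w, E w ≤ ε * Module.finrank ℚ K * η
  pf : ∀ i, |(Q i).natDegree * (∑ w : Wp K F, Real.posLog (ab w x)) - ∑ w : Wp K F, if i0 w = i then lam w else 0| ≤ ε * Module.finrank ℚ K * η
  alt : ∀ w, lam w = 0 ∨ (lam w = - Real.log (ab w (aeval x (Q (i0 w)))) ∧ Real.posLog (ab w x) ≤ C0 * dd w)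

lemma sum_lam {ι W : Type} [Fintype ι] [DecidableEq ι] [Fintype W] (i0 : W → ι) (lam : W → ℝ) :
    ∑ i, ∑ w, (if i0 w = i then lam w else 0) = ∑ w, lam w := by
  rw [Finset.sum_comm]
  exact Finset.sum_congr rfl fun w _ => by simp

set_option maxHeartbeats 1000000 in
lemma datum {ι J : Type} [Fintype ι] [DecidableEq ι] [Nonempty ι] [Fintype J] (Q : ι → ℤ[X]) (hQ : ∀ i, (Q i).Monic) (hQn : ∀ i, 1 ≤ (Q i).natDegree)
    (p : J → ℕ) (hp : ∀ j, (p j).Prime)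
    (Rr : ι → ι → ℤ) (hR0 : ∀ i j, Rr i j ≠ 0) (hRr : ∀ i j, i ≠ j → ∃ A B : ℤ[X], A * Q i + B * Q j = C (Rr i j)) :
    ∃ C0 : ℝ, 1 ≤ C0 ∧
      (∀ (α : ℂ) (κ' : ι → ℂ) (A : J → ℂ), Exc Q p α κ' A → ∀ (K : Type) [Field K] [NumberField K] (F : Finset (FinitePlace K)) (x : K) (f : K →+* ℂ), f x = α →
        (∀ i, Good F (aeval x (Q i))) → (∀ j, Good F ((p j : ℕ) : K)) → ∀ vv : Wp K F → Option J, (∀ w v, v ≠ vv w → del p w v = 0) →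
        ∑ w : Wp K F, Real.posLog (ab w x) ≤ (C0 + ∑ v, ‖cc p A v‖) * Module.finrank ℚ K) ∧
      ∀ (κ : ι → ℂ) (c : Option J → ℂ) (ε : ℝ), 0 < ε → ∃ δ : ℝ, 0 < δ ∧ ∃ B : ℝ, ∀ (α : ℂ) (κ' : ι → ℂ) (A : J → ℂ), Exc Q p α κ' A → ∀ η : ℝ, η = ∑ v, ‖cc p A v‖ → B ≤ η →
      (∀ i, ‖κ i - κ' i‖ ≤ δ) → (∀ v, ‖cc p A v - (η : ℂ) * c v‖ ≤ δ * η) →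
      ∀ (K : Type) [Field K] [NumberField K] (F : Finset (FinitePlace K)) (x : K) (f : K →+* ℂ), f x = α →
        (∀ i, Good F (aeval x (Q i))) → (∀ j, Good F ((p j : ℕ) : K)) → ∀ vv : Wp K F → Option J, (∀ w v, v ≠ vv w → del p w v = 0) →
        ∃ (i0 : Wp K F → ι) (lam E : Wp K F → ℝ), Dat Q p κ c C0 ε vv x η i0 lam E := by
  obtain ⟨C1, hC1, hloc⟩ := local_data Q hQ p hp Rr hR0 hRr
  obtain ⟨C2, hC2, hers⟩ := er_sum Rr hR0
  have hC12 : 1 ≤ C1 * C2 := one_le_mul_of_one_le_of_one_le hC1 hC2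
  have hH : ∀ (α : ℂ) (κ' : ι → ℂ) (A : J → ℂ), Exc Q p α κ' A → ∀ (K : Type) [Field K] [NumberField K] (F : Finset (FinitePlace K)) (x : K) (f : K →+* ℂ), f x = α →
        (∀ i, Good F (aeval x (Q i))) → (∀ j, Good F ((p j : ℕ) : K)) → ∀ vv : Wp K F → Option J, (∀ w v, v ≠ vv w → del p w v = 0) →
        ∑ w : Wp K F, Real.posLog (ab w x) ≤ (C1 + C1 * C2 + ∑ v, ‖cc p A v‖) * Module.finrank ℚ K := by
    intro α κ' A hE K _ _ F x f hfx hG hGp vv hvv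
    obtain ⟨i0, lam, hl0, hl1, hl2, hl3⟩ := hloc α κ' A hE K F x f hfx hG vv hvv
    obtain ⟨_, _, ⟨i1, _, hi1, _⟩, _, _, _⟩ := hE
    have h1 := (abs_le.1 (hl2 i1)).2
    have h2 : ∑ w : Wp K F, (if i0 w = i1 then lam w else 0) ≤ ∑ w : Wp K F, (del p w (vv w) * ‖cc p A (vv w)‖ + C1 * er Rr w) := by
      refine Finset.sum_le_sum fun w _ => ?_
      have hd := del_nonneg p hp w (vv w)
      have he : 0 ≤ er Rr w := le_trans (Nat.cast_nonneg _) (er_nonneg Rr hR0 w)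
      split_ifs with h
      · have h3 := hl1 w
        rw [h, hi1, one_mul] at h3
        have h4 := norm_sub_norm_le (lam w : ℂ) ((del p w (vv w) : ℂ) * cc p A (vv w))
        rw [norm_mul, Complex.norm_real, Complex.norm_real, Real.norm_eq_abs, Real.norm_eq_abs, abs_of_nonneg hd, abs_of_nonneg (hl0 w)] at h4
        linarith
      · positivity
    rw [Finset.sum_add_distrib, del_vv_sum p hp hGp vv hvv (fun v => ‖cc p A v‖), ← Finset.mul_sum] at h2
    have h3 := mul_le_mul_of_nonneg_left (hers K F) (by linarith : 0 ≤ C1)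
    have h4 : (0:ℝ) ≤ ∑ w : Wp K F, Real.posLog (ab w x) := Finset.sum_nonneg fun w _ => Real.posLog_nonneg
    have h5 : (1:ℝ) ≤ (Q i1).natDegree := by exact_mod_cast hQn i1
    nlinarith
  refine ⟨C1 + C1 * C2, by linarith, hH, ?_⟩
  intro κ c ε hε
  set N : ℝ := ((Fintype.card ι : ℕ) : ℝ) with hN
  have hN0 : 0 ≤ N := Nat.cast_nonneg _
  set S : ℝ := ∑ i, ((Q i).natDegree : ℝ) with hS
  have hS0 : 0 ≤ S := Finset.sum_nonneg fun i _ => Nat.cast_nonneg _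
  set V : ℝ := ∑ _v : Option J, (1:ℝ) with hV
  have hV0 : 0 ≤ V := Finset.sum_nonneg fun i _ => by norm_num
  set C5 := S * (C1 + C1 * C2 + 1) + N * C1 with hC5
  have hC50 : 0 ≤ C5 := by positivity
  set δ := ε / (2 * (C5 + V + 1)) with hδ
  have hδ0 : 0 < δ := by positivity
  refine ⟨δ, hδ0, max 1 (2 * (C1 * C2 + C1) / ε), ?_⟩
  intro α κ' A hE η hη hB hκ hc K _ _ F x f hfx hG hGp vv hvv
  have hη1 : 1 ≤ η := (le_max_left _ _).trans hB
  have hη2 : 2 * (C1 * C2 + C1) ≤ ε * η := by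
    have := (le_max_right _ _).trans hB
    rw [div_le_iff₀ hε] at this; linarith
  have hHx := hH α κ' A hE K F x f hfx hG hGp vv hvv
  obtain ⟨i0, lam, hl0, hl1, hl2, hl3⟩ := hloc α κ' A hE K F x f hfx hG vv hvv
  set D : ℝ := ((Module.finrank ℚ K : ℕ) : ℝ) with hD
  have hD0 : 0 ≤ D := Nat.cast_nonneg _
  rw [← hη] at hHx
  set H := ∑ w : Wp K F, Real.posLog (ab w x) with hHd
  have hlamsum : ∑ w, lam w ≤ C5 * D * η := by
    rw [← sum_lam i0 lam]
    calc ∑ i, ∑ w, (if i0 w = i then lam w else 0) ≤ ∑ i, ((Q i).natDegree * H + C1 * D) := by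
          refine Finset.sum_le_sum fun i _ => ?_
          have := (abs_le.1 (hl2 i)).1
          linarith
      _ = S * H + N * (C1 * D) := by
          rw [Finset.sum_add_distrib, ← Finset.sum_mul, Finset.sum_const, Finset.card_univ, nsmul_eq_mul]
      _ ≤ S * ((C1 + C1 * C2 + 1) * D * η) + N * (C1 * D * η) := by
          refine add_le_add (mul_le_mul_of_nonneg_left ?_ hS0) (mul_le_mul_of_nonneg_left ?_ hN0)
          · refine hHx.trans ?_
            have : (C1 + C1 * C2 + η) ≤ (C1 + C1 * C2 + 1) * η := by nlinarith
            calc _ ≤ (C1 + C1 * C2 + 1) * η * D := mul_le_mul_of_nonneg_right this hD0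
              _ = _ := by ring
          · exact le_mul_of_one_le_right (by positivity) hη1
      _ = _ := by rw [hC5]; ring
  have hdl := del_vv_sum p hp hGp vv hvv (fun _ => 1)
  simp only [mul_one] at hdl
  refine ⟨i0, lam, fun w => C1 * er Rr w + δ * lam w + δ * (del p w (vv w) * η), hl0, fun w => ?_, fun w => ?_, ?_, fun i => ?_, fun w => ?_⟩
  · have h1 := er_nonneg Rr hR0 w
    have h2 := hl0 w
    have h3 := del_nonneg p hp w (vv w)
    have h4 : er Rr w ≤ C1 * er Rr w := le_mul_of_one_le_left (le_trans (Nat.cast_nonneg _) h1) hC1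
    have h5 : 0 ≤ δ * lam w := by positivity
    have h6 : 0 ≤ δ * (del p w (vv w) * η) := by positivity
    linarith
  · have h1 := hl1 w
    have hd := del_nonneg p hp w (vv w)
    have e : κ (i0 w) * (lam w : ℂ) - ((del p w (vv w) * η : ℝ) : ℂ) * c (vv w) =
        (κ' (i0 w) * (lam w : ℂ) - (del p w (vv w) : ℂ) * cc p A (vv w)) + ((κ (i0 w) - κ' (i0 w)) * (lam w : ℂ) + (del p w (vv w) : ℂ) * (cc p A (vv w) - η * c (vv w))) := by
      push_cast; ring
    rw [e]
    refine (norm_add_le _ _).trans ?_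
    have h2 := norm_add_le ((κ (i0 w) - κ' (i0 w)) * (lam w : ℂ)) ((del p w (vv w) : ℂ) * (cc p A (vv w) - η * c (vv w)))
    rw [norm_mul, norm_mul, Complex.norm_real, Complex.norm_real, Real.norm_eq_abs, Real.norm_eq_abs, abs_of_nonneg hd, abs_of_nonneg (hl0 w)] at h2
    have h3 := mul_le_mul_of_nonneg_right (hκ (i0 w)) (hl0 w)
    have h4 := mul_le_mul_of_nonneg_left (hc (vv w)) hd
    linarith
  · rw [Finset.sum_add_distrib, Finset.sum_add_distrib, ← Finset.mul_sum, ← Finset.mul_sum, ← Finset.mul_sum, ← Finset.sum_mul, hdl, ← hD, ← hV]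
    have h1 := mul_le_mul_of_nonneg_left (hers K F) (by linarith : 0 ≤ C1)
    have h2 := mul_le_mul_of_nonneg_left hlamsum hδ0.le
    have h3 : C1 * (C2 * D) ≤ ε * η / 2 * D := by
      rw [← mul_assoc]; exact mul_le_mul_of_nonneg_right (by linarith) hD0
    have h4 : δ * (C5 + V) ≤ ε / 2 := by
      rw [hδ, div_mul_eq_mul_div, div_le_div_iff₀ (by positivity) (by norm_num)]
      nlinarith
    have h5 : δ * (C5 + V) * (D * η) ≤ ε / 2 * (D * η) := mul_le_mul_of_nonneg_right h4 (by positivity)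
    linarith
  · refine (hl2 i).trans ?_
    have : C1 ≤ ε * η := by linarith
    have := mul_le_mul_of_nonneg_right this hD0
    linarith
  · rcases hl3 w with h | ⟨h, h'⟩
    · exact Or.inl h
    · exact Or.inr ⟨h, h'.trans (mul_le_mul_of_nonneg_right (by linarith) (Nat.cast_nonneg _))⟩

open Classical in
lemma dat_upper {ι J : Type} [Fintype ι] [Fintype J] (Q : ι → ℤ[X]) (hQn : ∀ i, 1 ≤ (Q i).natDegree)
    (p : J → ℕ) (hp : ∀ j, (p j).Prime) (κ : ι → ℂ) (hκ : ∀ i, ‖κ i‖ ≤ 2) (c : Option J → ℂ) (x : ℝ) (i : ι) (hi : κ i ≠ 0)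
    (hix : ∑ v, (if RayEq (c v) (κ i) then ‖c v‖ else 0) ≤ x * ∑ j, (if RayEq (κ j) (κ i) then ((Q j).natDegree : ℝ) * ‖κ j‖ else 0)) (C0 : ℝ) :
    ∃ C3 : ℝ, 1 ≤ C3 ∧ ∀ (ε : ℝ), 0 ≤ ε → ∀ (K : Type) [Field K] [NumberField K] (F : Finset (FinitePlace K)) (vv : Wp K F → Option J) (α : K) (η : ℝ) (i0 : Wp K F → ι) (lam E : Wp K F → ℝ),
      0 ≤ η → (∀ w v, v ≠ vv w → del p w v = 0) → (∀ j, Good F ((p j : ℕ) : K)) → Dat Q p κ c C0 ε vv α η i0 lam E →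
      ∑ w : Wp K F, Real.posLog (ab w α) ≤ (x + C3 * ε) * (Module.finrank ℚ K * η) := by
  obtain ⟨Cs, hCs, hnon⟩ := nonray_unif κ c
  set N : ℝ := ((Fintype.card ι : ℕ) : ℝ) with hN
  have hN0 : 0 ≤ N := Nat.cast_nonneg _
  set M := ∑ j, (if RayEq (κ j) (κ i) then ((Q j).natDegree : ℝ) * ‖κ j‖ else 0) with hM
  have hM0 : 0 < M := by
    have := Finset.single_le_sum (f := fun j => (if RayEq (κ j) (κ i) then ((Q j).natDegree : ℝ) * ‖κ j‖ else 0)) (fun j _ => by split_ifs <;> positivity) (Finset.mem_univ i)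
    simp only [if_pos (show RayEq (κ i) (κ i) from ⟨hi, hi, rfl⟩)] at this
    have h3 : 0 < ((Q i).natDegree : ℝ) * ‖κ i‖ := mul_pos (by exact_mod_cast hQn i) (norm_pos_iff.2 hi)
    linarith
  refine ⟨1 + (Cs + 2 * N) / M, by have : 0 ≤ (Cs + 2 * N) / M := by positivity
                                   linarith, ?_⟩
  intro ε hε K _ _ F vv α η i0 lam E hη hvv hGp hd
  set D : ℝ := ((Module.finrank ℚ K : ℕ) : ℝ) with hD
  have hD0 : 0 ≤ D := Nat.cast_nonneg _
  set H := ∑ w : Wp K F, Real.posLog (ab w α) with hHd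
  have hE0 : ∀ w, 0 ≤ E w := fun w => le_trans (Nat.cast_nonneg _) (hd.E0 w)
  have h1 : M * H ≤ ∑ j, ((if RayEq (κ j) (κ i) then ‖κ j‖ * ∑ w : Wp K F, (if i0 w = j then lam w else 0) else 0) + 2 * (ε * D * η)) := by
    rw [hM, Finset.sum_mul]
    refine Finset.sum_le_sum fun j _ => ?_
    have hp := hd.pf j
    have h2 := (abs_le.1 hp).2
    have h3 : 0 ≤ ε * D * η := by positivity
    split_ifs with h
    · have h4 := mul_le_mul_of_nonneg_left h2 (norm_nonneg (κ j))
      have h5 := mul_le_mul_of_nonneg_right (hκ j) h3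
      calc _ = ‖κ j‖ * ((Q j).natDegree * H) := by ring
        _ ≤ _ := by nlinarith
    · simp; exact h3
  have h2 : ∑ j, (if RayEq (κ j) (κ i) then ‖κ j‖ * ∑ w : Wp K F, (if i0 w = j then lam w else 0) else 0) ≤ ∑ w : Wp K F, (del p w (vv w) * (η * (if RayEq (c (vv w)) (κ i) then ‖c (vv w)‖ else 0)) + Cs * E w) := by
    have e : ∑ j, (if RayEq (κ j) (κ i) then ‖κ j‖ * ∑ w : Wp K F, (if i0 w = j then lam w else 0) else 0) = ∑ w : Wp K F, (if RayEq (κ (i0 w)) (κ i) then ‖κ (i0 w)‖ * lam w else 0) := by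
      have e1 : ∀ j, (if RayEq (κ j) (κ i) then ‖κ j‖ * ∑ w : Wp K F, (if i0 w = j then lam w else 0) else 0) = ∑ w : Wp K F, (if i0 w = j then (if RayEq (κ j) (κ i) then ‖κ j‖ * lam w else 0) else 0) := by
        intro j
        split_ifs with h
        · rw [Finset.mul_sum]; exact Finset.sum_congr rfl fun w _ => by split_ifs <;> simp
        · simp
      rw [Finset.sum_congr rfl fun j _ => e1 j, Finset.sum_comm]
      exact Finset.sum_congr rfl fun w _ => by rw [Finset.sum_ite_eq Finset.univ (i0 w)]; simp
    rw [e]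
    refine Finset.sum_le_sum fun w _ => ?_
    have hdn := del_nonneg p hp w (vv w)
    have hnear := hd.near w
    have hE := hE0 w
    have hEC : E w ≤ Cs * E w := le_mul_of_one_le_left hE hCs
    by_cases hr : RayEq (κ (i0 w)) (κ i)
    · rw [if_pos hr]
      by_cases hv : RayEq (c (vv w)) (κ (i0 w))
      · rw [if_pos (hv.trans hr)]
        rw [ray_dist hv] at hnear
        have := (abs_le.1 hnear).2
        nlinarith
      · have := (hnon (i0 w) (vv w) hv (lam w) (del p w (vv w) * η) (hd.lam0 w) (by positivity)).1
        have h3 := mul_le_mul_of_nonneg_left hnear (by linarith : 0 ≤ Cs)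
        have h4 : 0 ≤ del p w (vv w) * (η * (if RayEq (c (vv w)) (κ i) then ‖c (vv w)‖ else 0)) := by
          split_ifs <;> positivity
        linarith
    · rw [if_neg hr]
      have h4 : 0 ≤ del p w (vv w) * (η * (if RayEq (c (vv w)) (κ i) then ‖c (vv w)‖ else 0)) := by
          split_ifs <;> positivity
      linarith
  rw [Finset.sum_add_distrib, del_vv_sum p hp hGp vv hvv (fun v => η * (if RayEq (c v) (κ i) then ‖c v‖ else 0)), ← Finset.mul_sum, ← Finset.mul_sum] at h2
  rw [Finset.sum_add_distrib, Finset.sum_const, Finset.card_univ, nsmul_eq_mul] at h1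
  have h3 := mul_le_mul_of_nonneg_left hd.Esum (by linarith : 0 ≤ Cs)
  have h4 := mul_le_mul_of_nonneg_left hix (by positivity : 0 ≤ D * η)
  have h5 : M * H ≤ M * ((x + (1 + (Cs + 2 * N) / M) * ε) * (D * η)) := by
    have e : M * ((x + (1 + (Cs + 2 * N) / M) * ε) * (D * η)) = x * M * (D * η) + M * ε * (D * η) + (Cs + 2 * N) * ε * (D * η) := by
      field_simp; ring
    rw [e]
    have : 0 ≤ M * ε * (D * η) := by positivity
    nlinarith
  exact le_of_mul_le_mul_left h5 hM0

lemma dat_lower {ι J : Type} [Fintype ι] [DecidableEq ι] [Fintype J] (Q : ι → ℤ[X])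
    (p : J → ℕ) (hp : ∀ j, (p j).Prime) (κ : ι → ℂ) (hκ : ∀ i, ‖κ i‖ ≤ 2) (c : Option J → ℂ) (hc1 : ∑ v, ‖c v‖ = 1) (C0 : ℝ) :
    ∃ C4 : ℝ, 1 ≤ C4 ∧ ∃ ε0 : ℝ, 0 < ε0 ∧ ∀ (ε : ℝ), 0 ≤ ε → ε ≤ ε0 → ∀ (K : Type) [Field K] [NumberField K] (F : Finset (FinitePlace K)) (vv : Wp K F → Option J) (α : K) (η : ℝ) (i0 : Wp K F → ι) (lam E : Wp K F → ℝ),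
      0 ≤ η → (∀ w v, v ≠ vv w → del p w v = 0) → (∀ j, Good F ((p j : ℕ) : K)) → Dat Q p κ c C0 ε vv α η i0 lam E →
      Module.finrank ℚ K * η ≤ C4 * ∑ w : Wp K F, Real.posLog (ab w α) ∧
      ∑ w, lam w ≤ C4 * (∑ w : Wp K F, Real.posLog (ab w α) + Module.finrank ℚ K * η) := by
  set N : ℝ := ((Fintype.card ι : ℕ) : ℝ) with hN
  have hN0 : 0 ≤ N := Nat.cast_nonneg _
  set S : ℝ := ∑ i, ((Q i).natDegree : ℝ) with hS
  have hS0 : 0 ≤ S := Finset.sum_nonneg fun i _ => Nat.cast_nonneg _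
  refine ⟨1 + 4 * S, by linarith, 1 / (2 + 4 * N), by positivity, ?_⟩
  intro ε hε hε0 K _ _ F vv α η i0 lam E hη hvv hGp hd
  set D : ℝ := ((Module.finrank ℚ K : ℕ) : ℝ) with hD
  have hD0 : 0 ≤ D := Nat.cast_nonneg _
  set H := ∑ w : Wp K F, Real.posLog (ab w α) with hHd
  have hH0 : 0 ≤ H := Finset.sum_nonneg fun w _ => Real.posLog_nonneg
  rw [le_div_iff₀ (by positivity)] at hε0
  have hDη : 0 ≤ D * η := by positivity
  have hlam : ∑ w, lam w ≤ S * H + N * (ε * D * η) := by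
    rw [← sum_lam i0 lam]
    calc ∑ i, ∑ w, (if i0 w = i then lam w else 0) ≤ ∑ i, ((Q i).natDegree * H + ε * D * η) := by
          refine Finset.sum_le_sum fun i _ => ?_
          have := (abs_le.1 (hd.pf i)).1
          linarith
      _ = _ := by
          rw [Finset.sum_add_distrib, ← Finset.sum_mul, Finset.sum_const, Finset.card_univ, nsmul_eq_mul]
  have h1 : D * η ≤ 2 * ∑ w, lam w + ∑ w, E w := by
    have e := del_vv_sum p hp hGp vv hvv (fun v => η * ‖c v‖)
    rw [← Finset.mul_sum, hc1, mul_one] at e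
    rw [hD, ← e, Finset.mul_sum, ← Finset.sum_add_distrib]
    refine Finset.sum_le_sum fun w _ => ?_
    have hdn := del_nonneg p hp w (vv w)
    have h2 := norm_sub_norm_le (((del p w (vv w) * η : ℝ) : ℂ) * c (vv w)) (κ (i0 w) * (lam w : ℂ))
    rw [norm_sub_rev] at h2
    have h3 := hd.near w
    rw [norm_mul, norm_mul, Complex.norm_real, Complex.norm_real, Real.norm_eq_abs, Real.norm_eq_abs, abs_of_nonneg (hd.lam0 w), abs_of_nonneg (by positivity)] at h2
    have h4 := mul_le_mul_of_nonneg_right (hκ (i0 w)) (hd.lam0 w)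
    linarith
  have h2 := hd.Esum
  have h3 : ε * (2 + 4 * N) * (D * η) ≤ 1 * (D * η) := mul_le_mul_of_nonneg_right hε0 hDη
  constructor
  · nlinarith
  · have h6 : 0 ≤ S * (D * η) := by positivity
    have h7 : 0 ≤ S * H := by positivity
    have h8 : 0 ≤ ε * (D * η) := by positivity
    nlinarith

end MZ
end

section
open Polynomial NumberField
open Polynomial
namespace MZ
open NumberField

lemma le_exp_pow_of_posLog {y C : ℝ} {d : ℕ} (hy : 0 ≤ y) (h : Real.posLog y ≤ C * d) : y ≤ Real.exp C ^ d := by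
  rw [Real.posLog_eq_log_max_one hy] at h
  have h1 : (0:ℝ) < max 1 y := by positivity
  have h2 := (Real.log_le_iff_le_exp h1).1 h
  rw [← Real.exp_nat_mul, mul_comm]
  exact (le_max_right _ _).trans h2

lemma st_ineq (θ m m' d1 d2 s t g g' E E' lam lam' L : ℝ) (hm : 0 < m) (hm' : 0 < m') (hd1 : 0 < d1) (hd2 : 0 < d2)
    (hs0 : 0 ≤ s) (ht0 : 0 ≤ t) (hs : s ≤ d1) (ht : t ≤ d2) (hg : 0 ≤ g) (hE : 0 ≤ E) (hE' : 0 ≤ E')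
    (hgg : d1 * g ≤ d2 * g') (h1 : g - lam * m ≤ E) (h2 : g' - lam' * m' ≤ E') (hL : 1 / m ≤ L) (hL' : 1 / m' ≤ L)
    (hst : θ ≤ s / (m * d1) + t / (m' * d2)) : θ * (d1 * g) - L * (d1 * E + d2 * E') ≤ s * lam + t * lam' := by
  have a1 : (g - E) / m ≤ lam := by rw [div_le_iff₀ hm]; linarith
  have a2 : (g' - E') / m' ≤ lam' := by rw [div_le_iff₀ hm']; linarith
  have b1 := mul_le_mul_of_nonneg_left a1 hs0
  have b2 := mul_le_mul_of_nonneg_left a2 ht0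
  have c1 : s * ((g - E) / m) = s / (m * d1) * (d1 * g) - s * E * (1 / m) := by field_simp
  have c2 : t * ((g' - E') / m') = t / (m' * d2) * (d2 * g') - t * E' * (1 / m') := by field_simp
  have e1 : s * E * (1 / m) ≤ d1 * E * L := by gcongr
  have e2 : t * E' * (1 / m') ≤ d2 * E' * L := by gcongr
  have f1 : t / (m' * d2) * (d1 * g) ≤ t / (m' * d2) * (d2 * g') := by gcongr
  have f2 : θ * (d1 * g) ≤ (s / (m * d1) + t / (m' * d2)) * (d1 * g) := by gcongr
  nlinarith

set_option maxHeartbeats 1000000 in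
lemma place_est {ι J : Type} [Fintype ι] [Fintype J] (Q : ι → ℤ[X]) (hn : ∀ i, 1 ≤ (Q i).natDegree) (κ : ι → ℂ) (c : Option J → ℂ)
    (C0 θ : ℝ) (hC0 : 1 ≤ C0) (hθ : 0 < θ) (m : ι → ℝ) (hm : ∀ i, 0 < m i) (hmκ : ∀ i, κ i ≠ 0 → m i = ‖κ i‖) (Cc : ℝ) (hCc : 1 ≤ Cc) :
    ∃ C' : ℝ, 1 ≤ C' ∧ ∀ (K : Type) [Field K] [NumberField K] (F : Finset (FinitePlace K)) (w : Wp K F) (x y : K) (P : ℕ → ℕ → ℤ) (d1 d2 : ℕ),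
      d2 ≤ d1 → 1 ≤ d2 → (∀ a b, |(P a b : ℝ)| ≤ Cc ^ d1) →
      (∀ i j, RayEq (κ i) (κ j) → ∃ r : ℕ → ℕ → ℕ → ℕ → ℤ, (∀ s t e f, |(r s t e f : ℝ)| ≤ Cc ^ d1) ∧
        (∀ s t e f, s ≤ d1 → t ≤ d2 → e < (Q i).natDegree → f < (Q j).natDegree →
            (s : ℝ) / (m i * d1) + t / (m j * d2) < θ → r s t e f = 0) ∧
        GG P d1 d2 y = ∑ s ∈ Finset.range (d1+1), ∑ t ∈ Finset.range (d2+1), ((Q i).map (Int.castRingHom K)) ^ s * C ((aeval y (Q j)) ^ t) *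
            ∑ e ∈ Finset.range (Q i).natDegree, ∑ f ∈ Finset.range (Q j).natDegree,
              C ((r s t e f : K) * y ^ f) * X ^ e) →
      ∀ a : ℕ, (taylor x (GG P d1 d2 y)).coeff a ≠ 0 →
      (∀ i, aeval x (Q i) ≠ 0) → (∀ i, aeval y (Q i) ≠ 0) →
      ∀ (i j : ι) (v : Option J) (lam lam' E E' s1 s2 : ℝ), 0 ≤ lam → 0 ≤ lam' → 0 ≤ E → 0 ≤ E' → 0 ≤ s1 → 0 ≤ s2 → d1 * s1 ≤ d2 * s2 →
      ‖κ i * (lam : ℂ) - (s1 : ℂ) * c v‖ ≤ E → ‖κ j * (lam' : ℂ) - (s2 : ℂ) * c v‖ ≤ E' →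
      (lam = 0 ∨ (lam = - Real.log (ab w (aeval x (Q i))) ∧ Real.posLog (ab w x) ≤ C0 * dd w)) →
      (lam' = 0 ∨ (lam' = - Real.log (ab w (aeval y (Q j))) ∧ Real.posLog (ab w y) ≤ C0 * dd w)) →
      Real.log (ab w ((taylor x (GG P d1 d2 y)).coeff a)) ≤ d1 * Real.posLog (ab w x) + d2 * Real.posLog (ab w y) + C' * (d1 * dd w)
        - θ * (d1 * (s1 * ‖c v‖)) + C' * (d1 * E + d2 * E') + a * lam := by
  obtain ⟨Cs, hCs, hnon⟩ := nonray_unif κ c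
  choose M hM1 hM using fun i j => linked_bound (Q i) (Q j) (hn i) (hn j) (Real.exp C0) (Real.one_le_exp (by linarith))
  set L := ∑ i, 1 / m i with hL
  have hLi : ∀ i, 1 / m i ≤ L := fun i => Finset.single_le_sum (f := fun i => 1 / m i) (fun i _ => by have := hm i; positivity) (Finset.mem_univ i)
  have hL0 : 0 ≤ L := Finset.sum_nonneg fun i _ => by have := hm i; positivity
  set LM := ∑ i, ∑ j, Real.log (M i j) with hLM
  have hLMi : ∀ i j, Real.log (M i j) ≤ LM := fun i j =>
    (Finset.single_le_sum (f := fun j => Real.log (M i j)) (fun j _ => Real.log_nonneg (hM1 i j)) (Finset.mem_univ j)).trans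
    (Finset.single_le_sum (f := fun i => ∑ j, Real.log (M i j)) (fun i _ => Finset.sum_nonneg fun j _ => Real.log_nonneg (hM1 i j)) (Finset.mem_univ i))
  have hLM0 : 0 ≤ LM := Finset.sum_nonneg fun i _ => Finset.sum_nonneg fun j _ => Real.log_nonneg (hM1 i j)
  have hlc : 0 ≤ Real.log Cc := Real.log_nonneg hCc
  have hl8 : 0 ≤ Real.log 8 := Real.log_nonneg (by norm_num)
  have hθC : 0 ≤ θ * Cs := by positivity
  set C' := 1 + Real.log 8 + Real.log Cc + LM + θ * Cs + L with hC'
  refine ⟨C', by linarith, ?_⟩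
  intro K _ _ F w x y P d1 d2 hd12 hd2 hP hr a hξ hx0 hy0 i j v lam lam' E E' s1 s2 hlam hlam' hE hE' hs1 hs2 hss hnear hnear' halt halt'
  have hd2r : (0:ℝ) < d2 := by exact_mod_cast hd2
  have hd1r : (0:ℝ) < d1 := by exact_mod_cast lt_of_lt_of_le hd2 hd12
  have hd1' : 1 ≤ d1 := hd2.trans hd12
  set ξ := (taylor x (GG P d1 d2 y)).coeff a with hξd
  have hdd : (0:ℝ) ≤ dd w := Nat.cast_nonneg _
  have hξpos : 0 < ab w ξ := (ab w).pos hξ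
  have hax : 0 ≤ Real.posLog (ab w x) := Real.posLog_nonneg
  have hay : 0 ≤ Real.posLog (ab w y) := Real.posLog_nonneg
  have hc0 := norm_nonneg (c v)
  have hEE : 0 ≤ d1 * E + d2 * E' := by positivity
  have htriv : θ * (d1 * (s1 * ‖c v‖)) ≤ θ * Cs * (d1 * E + d2 * E') → Real.log (ab w ξ) ≤ d1 * Real.posLog (ab w x) + d2 * Real.posLog (ab w y) + C' * (d1 * dd w)
        - θ * (d1 * (s1 * ‖c v‖)) + C' * (d1 * E + d2 * E') + a * lam := by
    intro hs
    have h1 := Real.log_le_log hξpos (triv_bound w P d1 d2 hd12 x y (Cc ^ d1) hP a)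
    rw [Real.log_mul (by positivity) (by positivity), Real.log_mul (by positivity) (by positivity), Real.log_pow, Real.log_mul (by positivity) (by positivity),
      Real.log_pow, Real.log_pow, Real.log_pow, Real.log_pow, ← Real.posLog_eq_log_max_one (AbsoluteValue.nonneg _ _), ← Real.posLog_eq_log_max_one (AbsoluteValue.nonneg _ _)] at h1
    have h2 : dd w * (d1 * Real.log 8 + d1 * Real.log Cc) ≤ C' * (d1 * dd w) := by
      calc dd w * (d1 * Real.log 8 + d1 * Real.log Cc) = (Real.log 8 + Real.log Cc) * (d1 * dd w) := by ring
        _ ≤ _ := mul_le_mul_of_nonneg_right (by linarith) (by positivity)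
    have h3 : θ * Cs * (d1 * E + d2 * E') ≤ C' * (d1 * E + d2 * E') := mul_le_mul_of_nonneg_right (by linarith) hEE
    have h4 : 0 ≤ a * lam := by positivity
    linarith
  have hA : s1 * ‖c v‖ ≤ Cs * E → θ * (d1 * (s1 * ‖c v‖)) ≤ θ * Cs * (d1 * E + d2 * E') := by
    intro h
    have h1 : d1 * (s1 * ‖c v‖) ≤ d1 * (Cs * E) := mul_le_mul_of_nonneg_left h hd1r.le
    have h2 : 0 ≤ Cs * (d2 * E') := by positivity
    have h3 : d1 * (s1 * ‖c v‖) ≤ Cs * (d1 * E + d2 * E') := by linarith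
    have := mul_le_mul_of_nonneg_left h3 hθ.le
    linarith
  have hgg : d1 * (s1 * ‖c v‖) ≤ d2 * (s2 * ‖c v‖) := by
    rw [← mul_assoc, ← mul_assoc]; exact mul_le_mul_of_nonneg_right hss hc0
  have hB : s2 * ‖c v‖ ≤ Cs * E' → θ * (d1 * (s1 * ‖c v‖)) ≤ θ * Cs * (d1 * E + d2 * E') := by
    intro h
    have h1 : d2 * (s2 * ‖c v‖) ≤ d2 * (Cs * E') := mul_le_mul_of_nonneg_left h hd2r.le
    have h2 : 0 ≤ Cs * (d1 * E) := by positivity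
    have h3 : d1 * (s1 * ‖c v‖) ≤ Cs * (d1 * E + d2 * E') := by linarith
    have := mul_le_mul_of_nonneg_left h3 hθ.le
    linarith
  have hE1 : E ≤ Cs * E := le_mul_of_one_le_left hE hCs
  have hE1' : E' ≤ Cs * E' := le_mul_of_one_le_left hE' hCs
  by_cases hri : RayEq (c v) (κ i)
  swap
  · refine htriv (hA ?_)
    have := (hnon i v hri lam s1 hlam hs1).2
    exact this.trans (mul_le_mul_of_nonneg_left hnear (by linarith))
  by_cases hrj : RayEq (c v) (κ j)
  swap
  · refine htriv (hB ?_)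
    have := (hnon j v hrj lam' s2 hlam' hs2).2
    exact this.trans (mul_le_mul_of_nonneg_left hnear' (by linarith))
  rw [ray_dist hri] at hnear
  rw [ray_dist hrj] at hnear'
  have hn1 := (abs_le.1 hnear).1
  have hn2 := (abs_le.1 hnear').1
  rcases halt with h0 | ⟨hl, hax'⟩
  · refine htriv (hA ?_)
    rw [h0] at hn1; linarith
  rcases halt' with h0 | ⟨hl', hay'⟩
  · refine htriv (hB ?_)
    rw [h0] at hn2; linarith
  obtain ⟨r, hrB, hr0, hrG⟩ := hr i j (hri.symm.trans hrj)
  have hq : ab w (aeval x (Q i)) = Real.exp (-lam) := by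
    rw [hl, neg_neg, Real.exp_log ((ab w).pos (hx0 i))]
  have hq' : ab w (aeval y (Q j)) = Real.exp (-lam') := by
    rw [hl', neg_neg, Real.exp_log ((ab w).pos (hy0 j))]
  have hbd := hM i j K F w P d1 d2 hd12 hd1' x y r (Cc ^ d1) hrB hrG (le_exp_pow_of_posLog (AbsoluteValue.nonneg _ _) hax') (le_exp_pow_of_posLog (AbsoluteValue.nonneg _ _) hay')
    (by rw [hq]; exact Real.exp_le_one_iff.2 (by linarith)) a (Real.exp (-(θ * (d1 * (s1 * ‖c v‖))) + L * (d1 * E + d2 * E') + a * lam)) (Real.exp_pos _).le (by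
      intro s t hs ht hne
      obtain ⟨e, f, he, hf, hne⟩ := hne
      have hst : θ ≤ (s : ℝ) / (m i * d1) + t / (m j * d2) := by
        by_contra hcon
        push Not at hcon
        exact hne (hr0 s t e f hs ht he hf hcon)
      rw [hq, hq', ← Real.exp_nat_mul, ← Real.exp_nat_mul, ← Real.exp_add, Real.exp_le_exp]
      have hsa : (s : ℝ) - a ≤ ((s - a : ℕ) : ℝ) := by
        have : s ≤ (s - a) + a := by omega
        have : (s : ℝ) ≤ ((s - a : ℕ) : ℝ) + a := by exact_mod_cast this
        linarith
      have h5 := st_ineq θ (m i) (m j) d1 d2 s t (s1 * ‖c v‖) (s2 * ‖c v‖) E E' lam lam' L (hm i) (hm j) hd1r hd2r (Nat.cast_nonneg _) (Nat.cast_nonneg _)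
        (by exact_mod_cast hs) (by exact_mod_cast ht) (by positivity) hE hE' hgg (by rw [hmκ i hri.2.1]; linarith) (by rw [hmκ j hrj.2.1]; linarith) (hLi i) (hLi j) hst
      have h6 := mul_le_mul_of_nonneg_right hsa hlam
      linarith)
  have hMpos : 0 < M i j := by linarith [hM1 i j]
  have h1 := Real.log_le_log hξpos hbd
  rw [Real.log_mul (by positivity) (by positivity), Real.log_pow, Real.log_mul (by positivity) (by positivity), Real.log_pow, Real.log_pow, Real.log_exp] at h1
  have h2 : dd w * (d1 * Real.log (M i j) + d1 * Real.log Cc) ≤ C' * (d1 * dd w) := by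
    calc dd w * (d1 * Real.log (M i j) + d1 * Real.log Cc) = (Real.log (M i j) + Real.log Cc) * (d1 * dd w) := by ring
      _ ≤ _ := mul_le_mul_of_nonneg_right (by linarith [hLMi i j]) (by positivity)
  have h3 : L * (d1 * E + d2 * E') ≤ C' * (d1 * E + d2 * E') := mul_le_mul_of_nonneg_right (by linarith) hEE
  have h4 : 0 ≤ d1 * Real.posLog (ab w x) + d2 * Real.posLog (ab w y) := by positivity
  linarith

end MZ
end

section
open Polynomial NumberField
open Polynomial
namespace MZ
open NumberField

lemma two_field (α β : ℂ) (hα : IsAlgebraic ℚ α) (hβ : IsAlgebraic ℚ β) :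
    ∃ (K : Type) (_ : Field K) (_ : NumberField K) (f : K →+* ℂ) (x y : K), f x = α ∧ f y = β := by
  have : FiniteDimensional ℚ (IntermediateField.adjoin ℚ ({α, β} : Set ℂ)) := by
    apply IntermediateField.finiteDimensional_adjoin
    intro z hz
    rcases hz with rfl | hz
    · exact hα.isIntegral
    · rw [Set.mem_singleton_iff] at hz; subst hz; exact hβ.isIntegral
  refine ⟨IntermediateField.adjoin ℚ ({α, β} : Set ℂ), inferInstance, { }, (IntermediateField.val _).toRingHom,
    ⟨α, IntermediateField.subset_adjoin _ _ (by simp)⟩, ⟨β, IntermediateField.subset_adjoin _ _ (by simp)⟩, rfl, rfl⟩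

lemma log_fact_bound (d2 : ℕ) (Cc : ℝ) (hCc : 1 ≤ Cc) : ∃ K2 : ℝ, 0 ≤ K2 ∧ ∀ d1 : ℕ, 1 ≤ d1 →
    Real.log ((d2+1).factorial * ((d1+1 : ℝ) ^ (d2+1) * ((d1+1) * Cc ^ d1)) ^ (d2+1)) ≤ K2 * d1 := by
  have hf : (1:ℝ) ≤ (d2+1).factorial := by exact_mod_cast Nat.one_le_iff_ne_zero.2 (Nat.factorial_ne_zero _)
  have hl := Real.log_nonneg hf
  have hlc := Real.log_nonneg hCc
  refine ⟨Real.log (d2+1).factorial + (d2+1) * ((d2+1) + 1 + Real.log Cc), by positivity, fun d1 hd1 => ?_⟩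
  have h1 : (1:ℝ) ≤ d1 := by exact_mod_cast hd1
  have hl1 : Real.log ((d1:ℝ)+1) ≤ d1 := by
    have := Real.log_le_sub_one_of_pos (show (0:ℝ) < d1 + 1 by linarith)
    linarith
  rw [Real.log_mul (by positivity) (by positivity), Real.log_pow, Real.log_mul (by positivity) (by positivity), Real.log_mul (by positivity) (by positivity), Real.log_pow, Real.log_pow]
  push_cast
  have h2 : Real.log (d2+1).factorial ≤ Real.log (d2+1).factorial * d1 := le_mul_of_one_le_right hl h1
  have h3 : ((d2:ℝ)+1) * (((d2:ℝ)+1) * Real.log ((d1:ℝ)+1) + (Real.log ((d1:ℝ)+1) + d1 * Real.log Cc)) ≤ (d2+1) * (((d2:ℝ)+1) * d1 + (d1 + d1 * Real.log Cc)) := by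
    gcongr
  nlinarith

lemma final_num (x θ ε C3 C4 C' Hα Hβ ηα ηβ D d1 d2 a SL SE SE' : ℝ) (hx : 0 ≤ x) (hε0 : 0 < ε) (hε1 : ε ≤ 1) (hC3 : 1 ≤ C3) (hC4 : 1 ≤ C4) (hC' : 1 ≤ C')
    (hεZ : ε * (2 * (3 * C3 + x + 1 + 3 * C' + C4 * (x + C3 + 1))) ≤ θ - 2 * x) (hxθ : 2 * x < θ) (hD : 0 < D) (hd1 : 0 < d1) (hd2 : 0 < d2) (hη : 0 < ηα)
    (h1 : Hα ≤ (x + C3 * ε) * (D * ηα)) (h2 : Hβ ≤ (x + C3 * ε) * (D * ηβ)) (h3 : d2 * ηβ ≤ (1 + ε) * (d1 * ηα)) (h4 : C' ≤ ε * ηα)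
    (ha : a ≤ ε * d1) (hSL0 : 0 ≤ SL) (hSL : SL ≤ C4 * (Hα + D * ηα)) (hSE : SE ≤ ε * D * ηα) (hSE' : SE' ≤ ε * D * ηβ)
    (hfin : 0 ≤ d1 * Hα + d2 * Hβ + C' * (d1 * D) - θ * (d1 * (D * ηα)) + C' * (d1 * SE + d2 * SE') + a * SL) : False := by
  set T := d1 * (D * ηα) with hT
  have hT0 : 0 < T := by positivity
  have e1 : d1 * Hα ≤ (x + C3 * ε) * T := by
    have := mul_le_mul_of_nonneg_left h1 hd1.le
    linarith
  have hDη : D * (d2 * ηβ) ≤ (1 + ε) * T := by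
    have := mul_le_mul_of_nonneg_left h3 hD.le
    linarith
  have hxc : 0 ≤ x + C3 * ε := by positivity
  have e2 : d2 * Hβ ≤ (x + C3 * ε) * ((1 + ε) * T) := by
    have h5 := mul_le_mul_of_nonneg_left h2 hd2.le
    have h6 := mul_le_mul_of_nonneg_left hDη hxc
    linarith
  have e3 : C' * (d1 * D) ≤ ε * T := by
    have := mul_le_mul_of_nonneg_right h4 (by positivity : 0 ≤ d1 * D)
    linarith
  have e4 : d1 * SE + d2 * SE' ≤ ε * T + ε * ((1 + ε) * T) := by
    have h5 := mul_le_mul_of_nonneg_left hSE hd1.le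
    have h6 := mul_le_mul_of_nonneg_left hSE' hd2.le
    have h7 := mul_le_mul_of_nonneg_left hDη hε0.le
    linarith
  have e5 : a * SL ≤ ε * (C4 * ((x + C3 * ε + 1) * T)) := by
    have h5 : SL ≤ C4 * ((x + C3 * ε) * (D * ηα) + D * ηα) := hSL.trans (mul_le_mul_of_nonneg_left (by linarith) (by linarith))
    calc a * SL ≤ ε * d1 * SL := mul_le_mul_of_nonneg_right ha hSL0
      _ ≤ ε * d1 * (C4 * ((x + C3 * ε) * (D * ηα) + D * ηα)) := mul_le_mul_of_nonneg_left h5 (by positivity)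
      _ = _ := by rw [hT]; ring
  have e6 := mul_le_mul_of_nonneg_left e4 (by linarith : 0 ≤ C')
  set B := (x + C3 * ε) + (x + C3 * ε) * (1 + ε) + ε - θ + C' * (ε + ε * (1 + ε)) + ε * (C4 * (x + C3 * ε + 1)) with hB
  have hBT : 0 ≤ B * T := by rw [hB]; linarith
  have hee : ε * ε ≤ ε := by nlinarith
  have hBn : B < 0 := by
    have f1 : C3 * (ε * ε) ≤ C3 * ε := mul_le_mul_of_nonneg_left hee (by linarith)
    have f2 : C' * (ε * ε) ≤ C' * ε := mul_le_mul_of_nonneg_left hee (by linarith)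
    have f3 : C4 * C3 * (ε * ε) ≤ C4 * C3 * ε := mul_le_mul_of_nonneg_left hee (by positivity)
    rw [hB]; nlinarith
  nlinarith

lemma gg_integral {K : Type} [Field K] [NumberField K] (v : FinitePlace K) (x y : K) (hx : v x ≤ 1) (hy : v y ≤ 1) (P : ℕ → ℕ → ℤ) (d1 d2 a : ℕ) :
    v ((taylor x (GG P d1 d2 y)).coeff a) ≤ 1 := by
  have h := triv_bound (F := {v}) (Sum.inr ⟨v, Finset.mem_singleton_self v⟩) P (max d1 d2) d2 (le_max_right _ _) x y (1 + ∑ a ∈ Finset.range (max d1 d2+1), ∑ b ∈ Finset.range (d2+1), |(P a b : ℝ)|)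
  have e : (taylor x (GG P d1 d2 y)).coeff a = ∑ c ∈ Finset.range (d1+1) ×ˢ Finset.range (d2+1),
      (P c.1 c.2 : K) * y ^ c.2 * (x ^ (c.1 - a) * (c.1.choose a : K)) := by
    rw [GG, map_sum, finset_sum_coeff, Finset.sum_product]
    refine Finset.sum_congr rfl fun i _ => ?_
    rw [taylor_mul, taylor_C, taylor_pow, taylor_X, coeff_C_mul, coeff_X_add_C_pow, Finset.sum_mul]
  have h2 := ab_sum_le (F := {v}) (Sum.inr ⟨v, Finset.mem_singleton_self v⟩) (Finset.range (d1+1) ×ˢ Finset.range (d2+1)) (fun c => (P c.1 c.2 : K) * y ^ c.2 * (x ^ (c.1 - a) * (c.1.choose a : K))) 1 (by norm_num) (by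
    intro c _
    simp only [ab_inr, map_mul, map_pow]
    have h3 : v (P c.1 c.2 : K) ≤ 1 := fp_int_le v _
    have h4 : v (c.1.choose a : K) ≤ 1 := by simpa using fp_int_le v (c.1.choose a : ℤ)
    have h5 : v y ^ c.2 ≤ 1 := pow_le_one₀ (apply_nonneg _ _) hy
    have h6 : v x ^ (c.1 - a) ≤ 1 := pow_le_one₀ (apply_nonneg _ _) hx
    refine mul_le_one₀ (mul_le_one₀ h3 (by positivity) h5) (by positivity) (mul_le_one₀ h6 (apply_nonneg _ _) h4))
  rw [e]
  simpa using h2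

open Classical in
set_option maxHeartbeats 2000000 in
lemma two_points {ι J : Type} [Fintype ι] [Fintype J] (Q : ι → ℤ[X]) (hQ : ∀ i, (Q i).Monic) (hn : ∀ i, 1 ≤ (Q i).natDegree)
    (p : J → ℕ) (hp : ∀ j, (p j).Prime) (hinj : Function.Injective p) (κ : ι → ℂ) (hκ : ∀ i, ‖κ i‖ ≤ 2) (c : Option J → ℂ)
    (hc0 : ∑ v, c v = 0) (hc1 : ∑ v, ‖c v‖ = 1) (i1 i2 : ι) (h1 : κ i1 = 1) (h2 : κ i2 = Complex.I) (C0 : ℝ) (hC0 : 1 ≤ C0)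
    (hsup : ∀ ε : ℝ, 0 < ε → ∀ B : ℝ, ∃ (α : ℂ) (η : ℝ), B ≤ η ∧ IsAlgebraic ℚ α ∧ (∀ i, aeval α (Q i) ≠ 0) ∧
      ∀ (K : Type) [Field K] [NumberField K] (F : Finset (FinitePlace K)) (x : K) (f : K →+* ℂ), f x = α →
        (∀ i, Good F (aeval x (Q i))) → (∀ j, Good F ((p j : ℕ) : K)) → ∀ vv : Wp K F → Option J, (∀ w v, v ≠ vv w → del p w v = 0) →
        ∃ (i0 : Wp K F → ι) (lam E : Wp K F → ℝ), Dat Q p κ c C0 ε vv x η i0 lam E) : False := by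
  obtain ⟨x, θ, hx0, hθ0, hxθ, hθS, i, hi, hix⟩ := geometry (fun i => ((Q i).natDegree : ℝ)) (fun i => by exact_mod_cast hn i) κ c hc0 hc1 i1 i2 h1 h2
  set m : ι → ℝ := fun i => if κ i = 0 then 1 else ‖κ i‖ with hm
  have hm0 : ∀ i, 0 < m i := by
    intro i
    simp only [hm]
    split_ifs with h
    · norm_num
    · exact norm_pos_iff.2 h
  have hmκ : ∀ i, κ i ≠ 0 → m i = ‖κ i‖ := fun i hi => if_neg hi
  set Pr := (Finset.univ : Finset (ι × ι)).filter (fun q => RayEq (κ q.1) (κ q.2)) with hPr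
  obtain ⟨d2, hd2, Cc, hCc, haux⟩ := aux_poly Q hQ hn m hm0 Pr θ hθ0 (by
    refine lt_of_eq_of_lt ?_ hθS
    congr 1
    refine Finset.sum_congr rfl fun q hq => ?_
    have hq := (Finset.mem_filter.1 hq).2
    rw [hmκ _ hq.1, hmκ _ hq.2.1])
  obtain ⟨C', hC', hplace⟩ := place_est (J := J) Q hn κ c C0 θ hC0 hθ0 m hm0 hmκ Cc hCc
  obtain ⟨C3, hC3, hupper⟩ := dat_upper Q hn p hp κ hκ c x i hi hix C0
  obtain ⟨C4, hC4, ε0, hε00, hlower⟩ := dat_lower Q p hp κ hκ c hc1 C0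
  obtain ⟨K2, hK2, hlogf⟩ := log_fact_bound d2 Cc hCc
  set Z := 3 * C3 + x + 1 + 3 * C' + C4 * (x + C3 + 1) with hZ
  have hZ0 : 0 < Z := by positivity
  set ε := min (min 1 ε0) ((θ - 2 * x) / (2 * Z)) with hεd
  have hε : 0 < ε := lt_min (lt_min one_pos hε00) (div_pos (by linarith) (by positivity))
  have hε1 : ε ≤ 1 := (min_le_left _ _).trans (min_le_left _ _)
  have hε2 : ε ≤ ε0 := (min_le_left _ _).trans (min_le_right _ _)
  have hε3 : ε * (2 * Z) ≤ θ - 2 * x := by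
    have : ε ≤ (θ - 2 * x) / (2 * Z) := min_le_right _ _
    rwa [le_div_iff₀ (by positivity)] at this
  have hlc := Real.log_nonneg hCc
  have hd2r : (1:ℝ) ≤ d2 := by exact_mod_cast hd2
  obtain ⟨α, ηα, hηα, halgα, hQα, hdatα⟩ := hsup ε hε (1 + C' / ε + 2 * C4 * d2 * Real.log Cc + 2 * C4 * K2 / ε)
  have q1 : 0 ≤ C' / ε := by positivity
  have q2 : 0 ≤ 2 * C4 * d2 * Real.log Cc := by positivity
  have q3 : 0 ≤ 2 * C4 * K2 / ε := by positivity
  have hηα1 : 1 ≤ ηα := by linarith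
  have hηα2 : C' ≤ ε * ηα := by
    have : C' / ε ≤ ηα := by linarith
    rw [div_le_iff₀ hε] at this; linarith
  have hηα3 : 2 * C4 * d2 * Real.log Cc ≤ ηα := by linarith
  have hηα4 : 2 * C4 * K2 ≤ ε * ηα := by
    have : 2 * C4 * K2 / ε ≤ ηα := by linarith
    rw [div_le_iff₀ hε] at this; linarith
  set N0 := 2 * d2 / ε + 1 / ε + d2 with hN0
  have hN00 : 0 ≤ N0 := by positivity
  have hld : 0 ≤ Real.log ((d2:ℝ) + 1) := Real.log_nonneg (by linarith)
  obtain ⟨β, ηβ, hηβ, halgβ, hQβ, hdatβ⟩ := hsup ε hε (1 + ηα * (N0 + 1) + 2 * C4 * Real.log ((d2:ℝ) + 1))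
  have q4 : 0 ≤ ηα * (N0 + 1) := by positivity
  have q5 : 0 ≤ 2 * C4 * Real.log ((d2:ℝ) + 1) := by positivity
  have hηβ1 : 1 ≤ ηβ := by linarith
  have hηβ2 : ηα * (N0 + 1) ≤ ηβ := by linarith
  have hηβ3 : 2 * C4 * Real.log ((d2:ℝ) + 1) < ηβ := by linarith
  set d1 := ⌊(d2:ℝ) * ηβ / ηα⌋₊ with hd1
  have hηα0 : 0 < ηα := by linarith
  have hd1le : (d1:ℝ) * ηα ≤ d2 * ηβ := by
    have := Nat.floor_le (show 0 ≤ (d2:ℝ) * ηβ / ηα by positivity)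
    rwa [le_div_iff₀ hηα0] at this
  have hd1lt : (d2:ℝ) * ηβ < (d1 + 1) * ηα := by
    have := Nat.lt_floor_add_one ((d2:ℝ) * ηβ / ηα)
    rwa [div_lt_iff₀ hηα0] at this
  have hd1N : N0 ≤ d1 := by
    have h3 : ηα * (N0 + 1) ≤ d2 * ηβ := hηβ2.trans (le_mul_of_one_le_left (by linarith) hd2r)
    have h4 : ηα * (N0 + 1) < ηα * (d1 + 1) := by linarith
    have := lt_of_mul_lt_mul_left h4 hηα0.le
    linarith
  have r1 : 0 ≤ 2 * d2 / ε := by positivity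
  have r2 : 0 ≤ 1 / ε := by positivity
  have hd12 : d2 ≤ d1 := by
    have : (d2:ℝ) ≤ d1 := by linarith
    exact_mod_cast this
  have hd1ε : 1 ≤ ε * d1 := by
    have : 1 / ε ≤ d1 := by linarith
    rw [div_le_iff₀ hε] at this; linarith
  have hd1ε2 : 2 * d2 ≤ ε * d1 := by
    have : 2 * d2 / ε ≤ (d1:ℝ) := by linarith
    rw [div_le_iff₀ hε] at this; linarith
  have hd1' : 1 ≤ d1 := hd2.trans hd12
  have hd1r : (0:ℝ) < d1 := by exact_mod_cast hd1'
  have hd2ηβ : d2 * ηβ ≤ (1 + ε) * (d1 * ηα) := by nlinarith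
  obtain ⟨K, _, _, f, xα, yβ, hfx, hfy⟩ := two_field α β halgα halgβ
  have hQx : ∀ i, aeval xα (Q i) ≠ 0 := by
    intro i h
    apply hQα i
    have := congrArg f h
    rw [map_zero, aeval_def, hom_eval₂, hfx] at this
    rw [aeval_def, ← this]; congr 1
    exact RingHom.ext_int _ _
  have hQy : ∀ i, aeval yβ (Q i) ≠ 0 := by
    intro i h
    apply hQβ i
    have := congrArg f h
    rw [map_zero, aeval_def, hom_eval₂, hfy] at this
    rw [aeval_def, ← this]; congr 1
    exact RingHom.ext_int _ _
  obtain ⟨F, hF⟩ := exists_good (({xα, yβ} : Finset K) ∪ Finset.univ.image (fun i => aeval xα (Q i)) ∪ Finset.univ.image (fun i => aeval yβ (Q i)) ∪ Finset.univ.image (fun j => ((p j : ℕ) : K)))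
  have hFx : ∀ i, Good F (aeval xα (Q i)) := fun i => hF _ (by simp) (hQx i)
  have hFy : ∀ i, Good F (aeval yβ (Q i)) := fun i => hF _ (by simp) (hQy i)
  have hFp : ∀ j, Good F ((p j : ℕ) : K) := fun j => hF _ (by simp) (by exact_mod_cast (hp j).ne_zero)
  have hvx : ∀ v : FinitePlace K, v ∉ F → v xα ≤ 1 := by
    intro v hv
    by_cases h : xα = 0
    · rw [h, map_zero]; norm_num
    · exact ((hF xα (by simp) h).2 v hv).le
  have hvy : ∀ v : FinitePlace K, v ∉ F → v yβ ≤ 1 := by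
    intro v hv
    by_cases h : yβ = 0
    · rw [h, map_zero]; norm_num
    · exact ((hF yβ (by simp) h).2 v hv).le
  obtain ⟨vv, hvv⟩ := exists_vv (K := K) (F := F) p hp hinj
  obtain ⟨i0, lam, E, hA⟩ := hdatα K F xα f hfx hFx hFp vv hvv
  obtain ⟨j0, lam', E', hB⟩ := hdatβ K F yβ f hfy hFy hFp vv hvv
  set D : ℝ := ((Module.finrank ℚ K : ℕ) : ℝ) with hD
  have hD0 : 0 < D := by
    have : 0 < Module.finrank ℚ K := Module.finrank_pos
    rw [hD]; exact Nat.cast_pos.2 this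
  have hUA := hupper ε hε.le K F vv xα ηα i0 lam E hηα0.le hvv hFp hA
  have hUB := hupper ε hε.le K F vv yβ ηβ j0 lam' E' (by linarith) hvv hFp hB
  obtain ⟨hLA, hSL⟩ := hlower ε hε.le hε2 K F vv xα ηα i0 lam E hηα0.le hvv hFp hA
  obtain ⟨hLB, _⟩ := hlower ε hε.le hε2 K F vv yβ ηβ j0 lam' E' (by linarith) hvv hFp hB
  rw [← hD] at hUA hUB hLA hLB hSL
  set Hα := ∑ w : Wp K F, Real.posLog (ab w xα) with hHα
  set Hβ := ∑ w : Wp K F, Real.posLog (ab w yβ) with hHβ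
  obtain ⟨P, hP0, hPB, hPr⟩ := haux d1 hd12
  have hC1 : 1 ≤ Cc ^ d1 := one_le_pow₀ hCc
  have hzero := zero_est F xα yβ d1 d2 P (Cc ^ d1) hC1 hPB hP0 (by
    rw [← hD, ← hHβ, Real.log_mul (by positivity) (by positivity), Real.log_pow]
    have h3 : C4 * (Real.log ((d2:ℝ) + 1) + d1 * Real.log Cc) < ηβ := by
      have h4 : 2 * C4 * (d1 * Real.log Cc) * ηα ≤ ηβ * ηα := by
        calc 2 * C4 * (d1 * Real.log Cc) * ηα = 2 * C4 * Real.log Cc * (d1 * ηα) := by ring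
          _ ≤ 2 * C4 * Real.log Cc * (d2 * ηβ) := mul_le_mul_of_nonneg_left hd1le (by positivity)
          _ = (2 * C4 * d2 * Real.log Cc) * ηβ := by ring
          _ ≤ ηα * ηβ := mul_le_mul_of_nonneg_right hηα3 (by linarith)
          _ = _ := by ring
      have := le_of_mul_le_mul_right h4 hηα0
      linarith
    have h5 : C4 * (D * (Real.log ((d2:ℝ) + 1) + d1 * Real.log Cc)) < C4 * Hβ := by
      calc _ = D * (C4 * (Real.log ((d2:ℝ) + 1) + d1 * Real.log Cc)) := by ring
        _ < D * ηβ := mul_lt_mul_of_pos_left h3 hD0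
        _ ≤ _ := hLB
    exact lt_of_mul_lt_mul_left h5 (by linarith)) (GG P d1 d2 yβ) rfl
  obtain ⟨hG0, hGE⟩ := hzero
  set a := (GG P d1 d2 yβ).rootMultiplicity xα with ha
  have haε : (a : ℝ) ≤ ε * d1 := by
    have h3 := hGE a (pow_rootMultiplicity_dvd _ _)
    rw [← hD, ← hHα] at h3
    have h4 := mul_le_mul_of_nonneg_left (hlogf d1 hd1') hD0.le
    have h5 := h3.trans h4
    by_cases had : (a:ℝ) ≤ d2
    · linarith
    push Not at had
    have h6 : ((a:ℝ) - d2) * (D * ηα) ≤ ((a:ℝ) - d2) * (C4 * Hα) := mul_le_mul_of_nonneg_left hLA (by linarith)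
    have h7 := mul_le_mul_of_nonneg_left h5 (by linarith : 0 ≤ C4)
    have h8 : D * (((a:ℝ) - d2) * ηα) ≤ D * (C4 * K2 * d1) := by linarith
    have h9 := le_of_mul_le_mul_left h8 hD0
    have h10 : C4 * K2 * d1 ≤ ε * ηα / 2 * d1 := mul_le_mul_of_nonneg_right (by linarith) hd1r.le
    have h11 : ((a:ℝ) - d2) * ηα ≤ (ε * d1 / 2) * ηα := by linarith
    have := le_of_mul_le_mul_right h11 hηα0
    linarith
  have hξ : (taylor xα (GG P d1 d2 yβ)).coeff a ≠ 0 := by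
    intro h0
    obtain ⟨q, hq, hqn⟩ := exists_eq_pow_rootMultiplicity_mul_and_not_dvd (GG P d1 d2 yβ) hG0 xα
    rw [← ha] at hq
    apply hqn
    rw [dvd_iff_isRoot, IsRoot.def]
    have e : taylor xα (X - C xα) = X := by simp
    rw [hq, taylor_mul, taylor_pow, e, coeff_X_pow_mul', if_pos le_rfl, Nat.sub_self, taylor_coeff_zero] at h0
    exact h0
  have hPF := PF_ineq (F := F) _ hξ (fun v hv => gg_integral v xα yβ (hvx v hv) (hvy v hv) P d1 d2 a)
  have hsum := hPF.trans (Finset.sum_le_sum fun w (_ : w ∈ Finset.univ) => hplace K F w xα yβ P d1 d2 hd12 hd2 hPB (by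
    intro i j hij
    obtain ⟨r, hr1, hr2, hr3⟩ := hPr (i, j) (Finset.mem_filter.2 ⟨Finset.mem_univ _, hij⟩)
    exact ⟨r, hr1, hr2, hr3 K yβ⟩) a hξ hQx hQy (i0 w) (j0 w) (vv w) (lam w) (lam' w) (E w) (E' w) (del p w (vv w) * ηα) (del p w (vv w) * ηβ)
    (hA.lam0 w) (hB.lam0 w) (le_trans (Nat.cast_nonneg _) (hA.E0 w)) (le_trans (Nat.cast_nonneg _) (hB.E0 w))
    (mul_nonneg (del_nonneg p hp w _) hηα0.le) (mul_nonneg (del_nonneg p hp w _) (by linarith)) (by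
      have := mul_le_mul_of_nonneg_left hd1le (del_nonneg p hp w (vv w))
      linarith) (hA.near w) (hB.near w) (hA.alt w) (hB.alt w))
  have hcs : ∑ w : Wp K F, (del p w (vv w) * ηα * ‖c (vv w)‖) = D * ηα := by
    have := del_vv_sum p hp hFp vv hvv (fun v => ηα * ‖c v‖)
    rw [← Finset.mul_sum, hc1, mul_one] at this
    rw [hD, ← this]
    exact Finset.sum_congr rfl fun w _ => by ring
  simp only [Finset.sum_add_distrib, Finset.sum_sub_distrib, ← Finset.mul_sum] at hsum
  rw [hcs, sum_ddr, ← hD, ← hHα, ← hHβ] at hsum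
  exact final_num x θ ε C3 C4 C' Hα Hβ ηα ηβ D d1 d2 a (∑ w, lam w) (∑ w, E w) (∑ w, E' w) hx0 hε hε1 hC3 hC4 hC' hε3 hxθ hD0 hd1r (by linarith) hηα0
    hUA hUB hd2ηβ hηα2 haε (Finset.sum_nonneg fun w _ => hA.lam0 w) hSL hA.Esum hB.Esum hsum

end MZ
end

section
open Polynomial NumberField
namespace MZ

lemma exists_bez {ι : Type} (Q : ι → ℤ[X]) (hQ : ∀ i, (Q i).Monic) (hirr : ∀ i, Irreducible (Q i)) (hinj : Function.Injective Q) :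
    ∃ Rr : ι → ι → ℤ, (∀ i j, Rr i j ≠ 0) ∧ ∀ i j, i ≠ j → ∃ A B : ℤ[X], A * Q i + B * Q j = C (Rr i j) := by
  have key : ∀ i j, ∃ r : ℤ, r ≠ 0 ∧ (i ≠ j → ∃ A B : ℤ[X], A * Q i + B * Q j = C r) := by
    intro i j
    by_cases hij : i = j
    · exact ⟨1, one_ne_zero, fun h => absurd hij h⟩
    have hi : Irreducible ((Q i).map (algebraMap ℤ ℚ)) := ((hQ i).irreducible_iff_irreducible_map_fraction_map).1 (hirr i)
    have hj : Irreducible ((Q j).map (algebraMap ℤ ℚ)) := ((hQ j).irreducible_iff_irreducible_map_fraction_map).1 (hirr j)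
    have hcop : IsCoprime ((Q i).map (algebraMap ℤ ℚ)) ((Q j).map (algebraMap ℤ ℚ)) := by
      rw [hi.coprime_iff_not_dvd]
      intro hd
      have h1 := (hi.associated_of_dvd hj hd)
      have h2 := eq_of_monic_of_associated ((hQ i).map _) ((hQ j).map _) h1
      exact hij (hinj (map_injective _ (algebraMap ℤ ℚ).injective_int h2))
    obtain ⟨a, b, hab⟩ := hcop
    obtain ⟨r1, hr1, h1⟩ := IsLocalization.integerNormalization_spec (nonZeroDivisors ℤ) a
    obtain ⟨r2, hr2, h2⟩ := IsLocalization.integerNormalization_spec (nonZeroDivisors ℤ) b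
    set a' := IsLocalization.integerNormalization (nonZeroDivisors ℤ) a
    set b' := IsLocalization.integerNormalization (nonZeroDivisors ℤ) b
    have h1' : a'.map (algebraMap ℤ ℚ) = C (r1:ℚ) * a := by
      rw [h1, zsmul_eq_mul]; simp
    have h2' : b'.map (algebraMap ℤ ℚ) = C (r2:ℚ) * b := by
      rw [h2, zsmul_eq_mul]; simp
    refine ⟨r1 * r2, mul_ne_zero (nonZeroDivisors.ne_zero hr1) (nonZeroDivisors.ne_zero hr2), fun _ => ⟨C r2 * a', C r1 * b', ?_⟩⟩
    apply map_injective _ (algebraMap ℤ ℚ).injective_int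
    simp only [Polynomial.map_add, Polynomial.map_mul, h1', h2', map_C, eq_intCast (algebraMap ℤ ℚ), Int.cast_mul, C_mul]
    linear_combination (C (r1:ℚ) * C (r2:ℚ)) * hab
  choose Rr h0 h1 using key
  exact ⟨Rr, h0, h1⟩

lemma eta_bounded {ι J : Type} [Fintype ι] [Fintype J] (Q : ι → ℤ[X]) (hQ : ∀ i, (Q i).Monic) (hn : ∀ i, 1 ≤ (Q i).natDegree)
    (hirr : ∀ i, Irreducible (Q i)) (hQinj : Function.Injective Q)
    (p : J → ℕ) (hp : ∀ j, (p j).Prime) (hinj : Function.Injective p) :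
    ∃ H : ℝ, 1 ≤ H ∧ ∀ (α : ℂ) (κ : ι → ℂ) (A : J → ℂ), Exc Q p α κ A → ∑ v, ‖cc p A v‖ ≤ H ∧
      ∀ (K : Type) [Field K] [NumberField K] (F : Finset (FinitePlace K)) (x : K) (f : K →+* ℂ), f x = α →
        (∀ i, Good F (aeval x (Q i))) → (∀ j, Good F ((p j : ℕ) : K)) → ∑ w : Wp K F, Real.posLog (ab w x) ≤ H * Module.finrank ℚ K := by
  classical
  rcases isEmpty_or_nonempty ι with hemp | hne
  · refine ⟨1, le_rfl, fun α κ A h => ?_⟩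
    obtain ⟨_, _, ⟨i, _⟩, _⟩ := h
    exact hemp.elim i
  obtain ⟨Rr, hR0, hRr⟩ := exists_bez Q hQ hirr hQinj
  obtain ⟨C0, hC0, hht, hdat⟩ := datum Q hQ hn p hp Rr hR0 hRr
  suffices h : ∃ H : ℝ, ∀ (α : ℂ) (κ : ι → ℂ) (A : J → ℂ), Exc Q p α κ A → ∑ v, ‖cc p A v‖ ≤ H by
    obtain ⟨H, hH⟩ := h
    refine ⟨C0 + max H 0, by have := le_max_right H 0; linarith, fun α κ A hE => ⟨?_, ?_⟩⟩
    · have := hH α κ A hE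
      have := le_max_left H 0; linarith
    · intro K _ _ F x f hfx hG hGp
      obtain ⟨vv, hvv⟩ := exists_vv (K := K) (F := F) p hp hinj
      refine (hht α κ A hE K F x f hfx hG hGp vv hvv).trans ?_
      refine mul_le_mul_of_nonneg_right ?_ (Nat.cast_nonneg _)
      have := hH α κ A hE
      have := le_max_left H 0; linarith
  by_contra hcon
  push Not at hcon
  have hseq : ∀ n : ℕ, ∃ (α : ℂ) (κ : ι → ℂ) (A : J → ℂ), Exc Q p α κ A ∧ (n:ℝ) < ∑ v, ‖cc p A v‖ := by
    intro n
    obtain ⟨α, κ, A, h1, h2⟩ := hcon n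
    exact ⟨α, κ, A, h1, h2⟩
  choose α κ A hE hη using hseq
  set η : ℕ → ℝ := fun n => ∑ v, ‖cc p (A n) v‖ with hηd
  have hη0 : ∀ n, 0 < η n := fun n => lt_of_le_of_lt (Nat.cast_nonneg n) (hη n)
  set S : Set ((ι → ℂ) × (Option J → ℂ)) := {q | (∑ v, q.2 v = 0 ∧ ∑ v, ‖q.2 v‖ = 1) ∧ (∃ i j, q.1 i = 1 ∧ q.1 j = Complex.I) ∧ ∀ i, ‖q.1 i‖ ≤ 2} with hS
  have hSc : IsClosed S := by
    refine IsClosed.inter (IsClosed.inter (isClosed_eq (by fun_prop) (by fun_prop)) (isClosed_eq (by fun_prop) (by fun_prop))) (IsClosed.inter ?_ ?_)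
    · have : {q : (ι → ℂ) × (Option J → ℂ) | ∃ i j, q.1 i = 1 ∧ q.1 j = Complex.I} = ⋃ i, ⋃ j, {q | q.1 i = 1 ∧ q.1 j = Complex.I} := by
        ext q; simp
      change IsClosed {q : (ι → ℂ) × (Option J → ℂ) | ∃ i j, q.1 i = 1 ∧ q.1 j = Complex.I}
      rw [this]
      refine isClosed_iUnion_of_finite fun i => isClosed_iUnion_of_finite fun j => ?_
      exact IsClosed.inter (isClosed_eq (by fun_prop) (by fun_prop)) (isClosed_eq (by fun_prop) (by fun_prop))
    · change IsClosed {q : (ι → ℂ) × (Option J → ℂ) | ∀ i, ‖q.1 i‖ ≤ 2}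
      rw [Set.setOf_forall]
      exact isClosed_iInter fun i => isClosed_le (by fun_prop) (by fun_prop)
  have hScpt : IsCompact S := by
    refine (isCompact_closedBall (0 : (ι → ℂ) × (Option J → ℂ)) 2).of_isClosed_subset hSc ?_
    intro q hq
    rw [mem_closedBall_zero_iff, Prod.norm_def]
    refine max_le ((pi_norm_le_iff_of_nonneg (by norm_num)).2 hq.2.2) ((pi_norm_le_iff_of_nonneg (by norm_num)).2 fun v => ?_)
    have := Finset.single_le_sum (f := fun v => ‖q.2 v‖) (fun v _ => norm_nonneg _) (Finset.mem_univ v)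
    rw [hq.1.2] at this
    linarith
  set s : ℕ → (ι → ℂ) × (Option J → ℂ) := fun n => (κ n, fun v => cc p (A n) v / (η n : ℂ)) with hs
  have hsS : ∀ n, s n ∈ S := by
    intro n
    obtain ⟨_, _, h3, h4, _, _⟩ := hE n
    refine ⟨⟨?_, ?_⟩, h3, h4⟩
    · simp only [hs]
      rw [← Finset.sum_div, cc_sum, zero_div]
    · simp only [hs, norm_div, Complex.norm_real, Real.norm_eq_abs, abs_of_pos (hη0 n)]
      rw [← Finset.sum_div]
      exact div_self (hη0 n).ne'
  obtain ⟨⟨κ0, c0⟩, ⟨⟨hc0, hc1⟩, ⟨i1, i2, h1, h2⟩, hκ2⟩, φ, hφ, hlim⟩ := hScpt.tendsto_subseq hsS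
  refine two_points Q hQ hn p hp hinj κ0 hκ2 c0 hc0 hc1 i1 i2 h1 h2 C0 hC0 ?_
  intro ε hε B
  obtain ⟨δ, hδ, B', hB'⟩ := hdat κ0 c0 ε hε
  have hev := (Metric.tendsto_atTop.1 hlim) δ hδ
  obtain ⟨N, hN⟩ := hev
  obtain ⟨M, hM⟩ := exists_nat_ge (max B B')
  set n := φ (max N M) with hnd
  have hnM : (M:ℝ) ≤ n := by
    have : max N M ≤ n := hφ.id_le _
    exact_mod_cast (le_max_right N M).trans this
  have hdist := hN (max N M) (le_max_left _ _)
  simp only [Function.comp] at hdist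
  rw [← hnd, dist_eq_norm, Prod.norm_def, max_lt_iff] at hdist
  refine ⟨α n, η n, (le_max_left B B').trans (hM.trans (hnM.trans (hη n).le)), (hE n).1, (hE n).2.1, ?_⟩
  refine hB' (α n) (κ n) (A n) (hE n) (η n) rfl ((le_max_right B B').trans (hM.trans (hnM.trans (hη n).le))) ?_ ?_
  · intro i
    have := (norm_le_pi_norm (s n - (κ0, c0)).1 i).trans hdist.1.le
    rw [norm_sub_rev]; exact this
  · intro v
    have := (norm_le_pi_norm (s n - (κ0, c0)).2 v).trans hdist.2.le
    have e : cc p (A n) v - (η n : ℂ) * c0 v = (η n : ℂ) * (cc p (A n) v / (η n : ℂ) - c0 v) := by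
      have : (η n : ℂ) ≠ 0 := by exact_mod_cast (hη0 n).ne'
      field_simp
    rw [e, norm_mul, Complex.norm_real, Real.norm_eq_abs, abs_of_pos (hη0 n), mul_comm]
    exact mul_le_mul_of_nonneg_right this (hη0 n).le

end MZ
end

section
open Polynomial NumberField
namespace MZ

def TwoRel {ι J : Type} [Fintype ι] [Fintype J] (Q : ι → ℤ[X]) (p : J → ℕ) (α : ℂ) : Prop :=
  IsAlgebraic ℚ α ∧ (∀ i, aeval α (Q i) ≠ 0) ∧ ∃ (k l : ι → ℤ) (k' l' : J → ℤ), (∃ i j, k i * l j - k j * l i ≠ 0) ∧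
    (∑ i, ((Q i).natDegree : ℤ) * k i = 0 ∧ ∑ i, ((Q i).natDegree : ℤ) * l i = 0) ∧
    (∏ i, (aeval α (Q i)) ^ k i) * ∏ j, (p j : ℂ) ^ k' j = 1 ∧ (∏ i, (aeval α (Q i)) ^ l i) * ∏ j, (p j : ℂ) ^ l' j = 1

lemma aeval_emb {K : Type} [Field K] (f : K →+* ℂ) (x : K) (W : ℤ[X]) : f (aeval x W) = aeval (f x) W := by
  rw [aeval_def, hom_eval₂, aeval_def]; congr 1
  exact RingHom.ext_int _ _

lemma rel_pull {ι J : Type} [Fintype ι] [Fintype J] (Q : ι → ℤ[X]) (p : J → ℕ) {K : Type} [Field K] (f : K →+* ℂ) (x : K) (k : ι → ℤ) (k' : J → ℤ) :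
    (∏ i, (aeval (f x) (Q i)) ^ k i) * ∏ j, (p j : ℂ) ^ k' j = 1 ↔ (∏ i, (aeval x (Q i)) ^ k i) * ∏ j, ((p j : ℕ) : K) ^ k' j = 1 := by
  rw [← f.injective.eq_iff]
  simp [aeval_emb, map_zpow₀]

lemma log_rel {ι J : Type} [Fintype ι] [Fintype J] {K : Type} [Field K] (w : AbsoluteValue K ℝ) (q : ι → K) (hq : ∀ i, q i ≠ 0) (r : J → K) (hr : ∀ j, r j ≠ 0) (k : ι → ℤ) (k' : J → ℤ) :
    Real.log (w ((∏ i, q i ^ k i) * ∏ j, r j ^ k' j)) = ∑ i, (k i : ℝ) * Real.log (w (q i)) + ∑ j, (k' j : ℝ) * Real.log (w (r j)) := by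
  have h1 : ∀ i, w (q i) ^ k i ≠ 0 := fun i => zpow_ne_zero _ (w.ne_zero (hq i))
  have h2 : ∀ j, w (r j) ^ k' j ≠ 0 := fun j => zpow_ne_zero _ (w.ne_zero (hr j))
  rw [map_mul, map_prod, map_prod]
  simp only [map_zpow₀]
  rw [Real.log_mul (Finset.prod_ne_zero_iff.2 fun i _ => h1 i) (Finset.prod_ne_zero_iff.2 fun i _ => h2 i), Real.log_prod (fun i _ => h1 i), Real.log_prod (fun i _ => h2 i)]
  simp [Real.log_zpow]

lemma exc_of_rel {ι J : Type} [Fintype ι] [Fintype J] (Q : ι → ℤ[X]) (p : J → ℕ) (hp : ∀ j, (p j).Prime) (α : ℂ) (h : TwoRel Q p α) :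
    ∃ (u v : ι → ℝ) (a b : J → ℝ) (i j : ι), u i = 1 ∧ u j = 0 ∧ v i = 0 ∧ v j = 1 ∧ (∀ i, |u i| ≤ 1) ∧ (∀ i, |v i| ≤ 1) ∧
      Exc Q p α (fun i => (u i : ℂ) + Complex.I * v i) (fun j => (a j : ℂ) + Complex.I * b j) ∧
      ∀ (K : Type) [Field K] [NumberField K] (x : K) (f : K →+* ℂ), f x = α → ∀ w : AbsoluteValue K ℝ,
        ∑ i, u i * Real.log (w (aeval x (Q i))) + ∑ j, a j * Real.log (w ((p j : ℕ) : K)) = 0 ∧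
        ∑ i, v i * Real.log (w (aeval x (Q i))) + ∑ j, b j * Real.log (w ((p j : ℕ) : K)) = 0 := by
  obtain ⟨halg, hQα, k, l, k', l', ⟨i', j', hij'⟩, ⟨hdk, hdl⟩, hk, hl⟩ := h
  obtain ⟨⟨i, j⟩, -, hmax⟩ := Finset.exists_max_image (Finset.univ : Finset (ι × ι)) (fun q => |k q.1 * l q.2 - k q.2 * l q.1|) ⟨(i', j'), Finset.mem_univ _⟩
  have hmax : ∀ a b, |k a * l b - k b * l a| ≤ |k i * l j - k j * l i| := fun a b => hmax (a, b) (Finset.mem_univ _)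
  have hΔ : k i * l j - k j * l i ≠ 0 := by
    intro h0
    have := hmax i' j'
    rw [h0, abs_zero] at this
    exact hij' (abs_eq_zero.1 (le_antisymm this (abs_nonneg _)))
  set Δ : ℝ := (k i : ℝ) * l j - k j * l i with hΔd
  have hΔr : Δ ≠ 0 := by rw [hΔd]; exact_mod_cast hΔ
  have hmaxr : ∀ a b, |(k a : ℝ) * l b - k b * l a| ≤ |Δ| := by
    intro a b; rw [hΔd]; exact_mod_cast hmax a b
  set u : ι → ℝ := fun m => (l j * k m - k j * l m) / Δ with hu
  set v : ι → ℝ := fun m => (k i * l m - l i * k m) / Δ with hv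
  set a : J → ℝ := fun m => (l j * k' m - k j * l' m) / Δ with ha
  set b : J → ℝ := fun m => (k i * l' m - l i * k' m) / Δ with hb
  have hu1 : ∀ m, |u m| ≤ 1 := by
    intro m
    simp only [hu]
    rw [abs_div, div_le_one (abs_pos.2 hΔr), mul_comm (l j : ℝ)]
    exact hmaxr m j
  have hv1 : ∀ m, |v m| ≤ 1 := by
    intro m
    simp only [hv]
    rw [abs_div, div_le_one (abs_pos.2 hΔr), mul_comm (l i : ℝ)]
    exact hmaxr i m
  have key : ∀ (K : Type) [Field K] [NumberField K] (x : K) (f : K →+* ℂ), f x = α → ∀ w : AbsoluteValue K ℝ,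
        ∑ i, u i * Real.log (w (aeval x (Q i))) + ∑ j, a j * Real.log (w ((p j : ℕ) : K)) = 0 ∧
        ∑ i, v i * Real.log (w (aeval x (Q i))) + ∑ j, b j * Real.log (w ((p j : ℕ) : K)) = 0 := by
    intro K _ _ x f hfx w
    rw [← hfx, rel_pull] at hk hl
    have hQx : ∀ i, aeval x (Q i) ≠ 0 := by
      intro i h0
      apply hQα i
      rw [← hfx, ← aeval_emb, h0, map_zero]
    have hpx : ∀ j, ((p j : ℕ) : K) ≠ 0 := fun j => by exact_mod_cast (hp j).ne_zero
    have e1 := log_rel w (fun i => aeval x (Q i)) hQx (fun j => ((p j : ℕ) : K)) hpx k k'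
    have e2 := log_rel w (fun i => aeval x (Q i)) hQx (fun j => ((p j : ℕ) : K)) hpx l l'
    simp only [hk, hl, map_one, Real.log_one] at e1 e2
    constructor
    · have : ∑ i, u i * Real.log (w (aeval x (Q i))) + ∑ j, a j * Real.log (w ((p j : ℕ) : K)) =
        (l j / Δ) * (∑ i, (k i : ℝ) * Real.log (w (aeval x (Q i))) + ∑ j, (k' j : ℝ) * Real.log (w ((p j : ℕ) : K))) -
        (k j / Δ) * (∑ i, (l i : ℝ) * Real.log (w (aeval x (Q i))) + ∑ j, (l' j : ℝ) * Real.log (w ((p j : ℕ) : K))) := by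
        simp only [mul_add, Finset.mul_sum]
        rw [add_sub_add_comm, ← Finset.sum_sub_distrib, ← Finset.sum_sub_distrib]
        congr 1 <;> refine Finset.sum_congr rfl fun m _ => ?_ <;> simp only [hu, ha] <;> ring
      rw [this, ← e1, ← e2]; ring
    · have : ∑ i, v i * Real.log (w (aeval x (Q i))) + ∑ j, b j * Real.log (w ((p j : ℕ) : K)) =
        (k i / Δ) * (∑ i, (l i : ℝ) * Real.log (w (aeval x (Q i))) + ∑ j, (l' j : ℝ) * Real.log (w ((p j : ℕ) : K))) -
        (l i / Δ) * (∑ i, (k i : ℝ) * Real.log (w (aeval x (Q i))) + ∑ j, (k' j : ℝ) * Real.log (w ((p j : ℕ) : K))) := by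
        simp only [mul_add, Finset.mul_sum]
        rw [add_sub_add_comm, ← Finset.sum_sub_distrib, ← Finset.sum_sub_distrib]
        congr 1 <;> refine Finset.sum_congr rfl fun m _ => ?_ <;> simp only [hv, hb] <;> ring
      rw [this, ← e1, ← e2]; ring
  have hui : u i = 1 := by
    simp only [hu]; rw [div_eq_one_iff_eq hΔr, hΔd]; ring
  have huj : u j = 0 := by
    simp only [hu]; rw [div_eq_zero_iff]; left; ring
  have hvi : v i = 0 := by
    simp only [hv]; rw [div_eq_zero_iff]; left; ring
  have hvj : v j = 1 := by
    simp only [hv]; rw [div_eq_one_iff_eq hΔr, hΔd]; ring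
  refine ⟨u, v, a, b, i, j, hui, huj, hvi, hvj, hu1, hv1, ⟨halg, hQα, ⟨i, j, ?_, ?_⟩, ?_, ?_, ?_⟩, key⟩
  · simp [hui, hvi]
  · simp [huj, hvj]
  · intro m
    refine (norm_add_le _ _).trans ?_
    rw [norm_mul, Complex.norm_I, one_mul, Complex.norm_real, Complex.norm_real, Real.norm_eq_abs, Real.norm_eq_abs]
    linarith [hu1 m, hv1 m]
  · have d1 : ∑ m, ((Q m).natDegree : ℝ) * u m = 0 := by
      have : ∑ m, ((Q m).natDegree : ℝ) * u m = (l j / Δ) * (∑ m, ((Q m).natDegree : ℝ) * k m) - (k j / Δ) * (∑ m, ((Q m).natDegree : ℝ) * l m) := by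
        simp only [Finset.mul_sum]
        rw [← Finset.sum_sub_distrib]
        refine Finset.sum_congr rfl fun m _ => ?_
        simp only [hu]; ring
      rw [this, show ∑ m, ((Q m).natDegree : ℝ) * k m = 0 by exact_mod_cast hdk, show ∑ m, ((Q m).natDegree : ℝ) * l m = 0 by exact_mod_cast hdl]
      ring
    have d2 : ∑ m, ((Q m).natDegree : ℝ) * v m = 0 := by
      have : ∑ m, ((Q m).natDegree : ℝ) * v m = (k i / Δ) * (∑ m, ((Q m).natDegree : ℝ) * l m) - (l i / Δ) * (∑ m, ((Q m).natDegree : ℝ) * k m) := by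
        simp only [Finset.mul_sum]
        rw [← Finset.sum_sub_distrib]
        refine Finset.sum_congr rfl fun m _ => ?_
        simp only [hv]; ring
      rw [this, show ∑ m, ((Q m).natDegree : ℝ) * k m = 0 by exact_mod_cast hdk, show ∑ m, ((Q m).natDegree : ℝ) * l m = 0 by exact_mod_cast hdl]
      ring
    have d1' : ∑ m, ((Q m).natDegree : ℂ) * (u m : ℂ) = 0 := by exact_mod_cast congrArg (fun r : ℝ => (r : ℂ)) d1
    have d2' : ∑ m, ((Q m).natDegree : ℂ) * (v m : ℂ) = 0 := by exact_mod_cast congrArg (fun r : ℝ => (r : ℂ)) d2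
    have : ∑ m, ((Q m).natDegree : ℂ) * ((u m : ℂ) + Complex.I * v m) = ∑ m, ((Q m).natDegree : ℂ) * (u m : ℂ) + Complex.I * ∑ m, ((Q m).natDegree : ℂ) * (v m : ℂ) := by
      rw [Finset.mul_sum, ← Finset.sum_add_distrib]
      exact Finset.sum_congr rfl fun m _ => by ring
    rw [this, d1', d2']; ring
  · intro K _ _ x f hfx w
    obtain ⟨e1, e2⟩ := key K x f hfx w
    have e1' := congrArg (fun r : ℝ => (r : ℂ)) e1
    have e2' := congrArg (fun r : ℝ => (r : ℂ)) e2
    push_cast at e1' e2'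
    have : ∑ i, ((u i : ℂ) + Complex.I * v i) * (Real.log (w (aeval x (Q i))) : ℂ) + ∑ j, ((a j : ℂ) + Complex.I * b j) * (Real.log (w ((p j : ℕ) : K)) : ℂ)
      = (∑ i, (u i : ℂ) * (Real.log (w (aeval x (Q i))) : ℂ) + ∑ j, (a j : ℂ) * (Real.log (w ((p j : ℕ) : K)) : ℂ)) +
        Complex.I * (∑ i, (v i : ℂ) * (Real.log (w (aeval x (Q i))) : ℂ) + ∑ j, (b j : ℂ) * (Real.log (w ((p j : ℕ) : K)) : ℂ)) := by
      simp only [add_mul, Finset.sum_add_distrib, mul_add, Finset.mul_sum, mul_assoc]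
      ring
    rw [this, e1', e2']; ring

lemma logsum_bound (W : ℤ[X]) : ∃ B : ℝ, 0 ≤ B ∧ ∀ (K : Type) [Field K] [NumberField K] (F : Finset (FinitePlace K)) (x : K), Good F (aeval x W) →
    ∑ w : Wp K F, |Real.log (ab w (aeval x W))| ≤ B * (Module.finrank ℚ K + ∑ w : Wp K F, Real.posLog (ab w x)) := by
  obtain ⟨H, hH1, hH⟩ : ∃ H : ℝ, 1 ≤ H ∧ ∀ k, |(W.coeff k : ℝ)| ≤ H := by
    refine ⟨1 + ∑ k ∈ W.support, |(W.coeff k : ℝ)|, ?_, fun k => ?_⟩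
    · have : 0 ≤ ∑ k ∈ W.support, |(W.coeff k : ℝ)| := Finset.sum_nonneg fun _ _ => abs_nonneg _
      linarith
    · have h0 : 0 ≤ ∑ k ∈ W.support, |(W.coeff k : ℝ)| := Finset.sum_nonneg fun _ _ => abs_nonneg _
      by_cases hk : k ∈ W.support
      · have := Finset.single_le_sum (f := fun k => |(W.coeff k : ℝ)|) (fun k _ => abs_nonneg _) hk
        linarith
      · rw [notMem_support_iff.1 hk]; simp; linarith
  set n := W.natDegree
  have hl : 0 ≤ Real.log ((n + 1) * H) := Real.log_nonneg (one_le_mul_of_one_le_of_one_le (by linarith [Nat.cast_nonneg (α := ℝ) n]) hH1)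
  refine ⟨2 * (Real.log ((n + 1) * H) + n), by positivity, fun K _ _ F x hG => ?_⟩
  have hPF := PF _ hG
  have h1 : ∀ w : Wp K F, |Real.log (ab w (aeval x W))| ≤ 2 * (Real.log ((n + 1) * H) * dd w + n * Real.posLog (ab w x)) - Real.log (ab w (aeval x W)) := by
    intro w
    have h2 := eval_bound w x W n le_rfl H hH
    have h3 : Real.log (ab w (aeval x W)) ≤ Real.log ((n + 1) * H) * dd w + n * Real.posLog (ab w x) := by
      refine (Real.log_le_log ((ab w).pos hG.1) h2).trans ?_
      rw [Real.log_mul (by positivity) (by positivity), Real.log_pow, Real.log_pow, Real.posLog_eq_log_max_one ((ab w).nonneg x)]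
      linarith
    have h4 : 0 ≤ Real.log ((n + 1) * H) * dd w + n * Real.posLog (ab w x) := by
      have := Real.posLog_nonneg (x := ab w x)
      positivity
    rcases abs_cases (Real.log (ab w (aeval x W))) with ⟨h, _⟩ | ⟨h, _⟩ <;> rw [h] <;> linarith
  refine (Finset.sum_le_sum fun w _ => h1 w).trans ?_
  rw [Finset.sum_sub_distrib, hPF, sub_zero, ← Finset.mul_sum, Finset.sum_add_distrib, ← Finset.mul_sum, ← Finset.mul_sum, sum_ddr]
  have h5 : 0 ≤ ∑ w : Wp K F, Real.posLog (ab w x) := Finset.sum_nonneg fun w _ => Real.posLog_nonneg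
  have h6 : (0:ℝ) ≤ Module.finrank ℚ K := Nat.cast_nonneg _
  have h7 : (0:ℝ) ≤ n := Nat.cast_nonneg _
  nlinarith [mul_nonneg hl h5, mul_nonneg h7 h6]

lemma dirichlet {M : Type} [Fintype M] (θ : M → ℝ) (N : ℕ) (hN : 0 < N) :
    ∃ (q : ℕ) (z : M → ℤ), 0 < q ∧ q ≤ N ^ Fintype.card M ∧ (∀ m, |(z m : ℝ) - q * θ m| ≤ 1 / N) ∧
      (∀ m, θ m = 0 → z m = 0) ∧ (∀ m, θ m = 1 → z m = q) := by
  classical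
  have hNr : (0:ℝ) < N := by exact_mod_cast hN
  set g : ℕ → (M → Fin N) := fun q m => ⟨⌊(N:ℝ) * Int.fract (q * θ m)⌋₊, by
    rw [Nat.floor_lt (by have := Int.fract_nonneg ((q:ℝ) * θ m); positivity)]
    have := Int.fract_lt_one ((q:ℝ) * θ m)
    nlinarith⟩ with hg
  obtain ⟨q1, h1, q2, h2, hne, heq⟩ := Finset.exists_ne_map_eq_of_card_lt_of_maps_to (s := Finset.range (N ^ Fintype.card M + 1)) (t := (Finset.univ : Finset (M → Fin N))) (f := g)
    (by simp) (fun _ _ => Finset.mem_univ _)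
  wlog hlt : q2 < q1 generalizing q1 q2
  · exact this q2 h2 q1 h1 hne.symm heq.symm (lt_of_le_of_ne (not_lt.1 hlt) hne)
  refine ⟨q1 - q2, fun m => ⌊(q1:ℝ) * θ m⌋ - ⌊(q2:ℝ) * θ m⌋, by omega, ?_, ?_, ?_, ?_⟩
  · have := Finset.mem_range.1 h1; omega
  · intro m
    have h3 := congrArg (fun t => ((t m : Fin N) : ℕ)) heq
    simp only [hg] at h3
    have a1 := Nat.floor_le (show 0 ≤ (N:ℝ) * Int.fract (q1 * θ m) by have := Int.fract_nonneg ((q1:ℝ) * θ m); positivity)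
    have a2 := Nat.lt_floor_add_one ((N:ℝ) * Int.fract (q1 * θ m))
    have b1 := Nat.floor_le (show 0 ≤ (N:ℝ) * Int.fract (q2 * θ m) by have := Int.fract_nonneg ((q2:ℝ) * θ m); positivity)
    have b2 := Nat.lt_floor_add_one ((N:ℝ) * Int.fract (q2 * θ m))
    rw [h3] at a1 a2
    have e1 := Int.floor_add_fract ((q1:ℝ) * θ m)
    have e2 := Int.floor_add_fract ((q2:ℝ) * θ m)
    push_cast [Nat.cast_sub hlt.le]
    have e3 : ((⌊(q1:ℝ) * θ m⌋ : ℝ) - ⌊(q2:ℝ) * θ m⌋ - (q1 - q2) * θ m) = Int.fract ((q2:ℝ) * θ m) - Int.fract ((q1:ℝ) * θ m) := by linarith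
    rw [e3, le_div_iff₀ hNr, ← abs_of_pos hNr, ← abs_mul, abs_le]
    constructor <;> nlinarith
  · intro m hm; simp [hm]
  · intro m hm
    simp only [hm, mul_one, Int.floor_natCast]
    push_cast [Nat.cast_sub hlt.le]; ring

end MZ
end

section
open Polynomial NumberField
namespace MZ

lemma one_rel {M : Type} [Fintype M] {K : Type} [Field K] [NumberField K] {F : Finset (FinitePlace K)} (y : M → K) (hy : ∀ m, Good F (y m)) (B : ℝ)
    (hB : ∀ m, ∑ w : Wp K F, |Real.log (ab w (y m))| ≤ B * Module.finrank ℚ K) (θ : M → ℝ)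
    (hθ : ∀ w : AbsoluteValue K ℝ, ∑ m, θ m * Real.log (w (y m)) = 0) (q N : ℕ) (z : M → ℤ) (hz : ∀ m, |(z m : ℝ) - q * θ m| ≤ 1 / N)
    (hN : 16 * (Fintype.card M * B) * (Module.finrank ℚ K : ℝ) ^ 3 < N * Real.log 2) :
    ∃ ω : ℕ, 0 < ω ∧ ω ≤ 2 * Module.finrank ℚ K ^ 2 ∧ ∏ m, y m ^ (ω * z m) = 1 := by
  have hDn : 0 < Module.finrank ℚ K := Module.finrank_pos
  set D : ℝ := ((Module.finrank ℚ K : ℕ) : ℝ) with hD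
  have hD0 : 0 < D := by rw [hD]; exact Nat.cast_pos.2 hDn
  have hl2 : 0 < Real.log 2 := Real.log_pos one_lt_two
  have hy0 : ∀ m, y m ^ z m ≠ 0 := fun m => zpow_ne_zero _ (hy m).1
  have hG : Good F (∏ m, y m ^ z m) := by
    refine ⟨Finset.prod_ne_zero_iff.2 fun m _ => hy0 m, fun v hv => ?_⟩
    rw [map_prod]
    refine Finset.prod_eq_one fun m _ => ?_
    rw [map_zpow₀, (hy m).2 v hv, one_zpow]
  have hlog : ∀ w : Wp K F, Real.log (ab w (∏ m, y m ^ z m)) = ∑ m, ((z m : ℝ) - q * θ m) * Real.log (ab w (y m)) := by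
    intro w
    rw [map_prod, Real.log_prod (fun m _ => (ab w).ne_zero (hy0 m))]
    have h0 : ∑ m, q * (θ m * Real.log (ab w (y m))) = 0 := by rw [← Finset.mul_sum, hθ, mul_zero]
    rw [← sub_zero (∑ m, Real.log (ab w (y m ^ z m))), ← h0, ← Finset.sum_sub_distrib]
    refine Finset.sum_congr rfl fun m _ => ?_
    rw [map_zpow₀, Real.log_zpow]; ring
  by_cases hM : B < 0
  · have hMe : IsEmpty M := by
      by_contra h
      rw [not_isEmpty_iff] at h
      obtain ⟨m⟩ := h
      have h1 := hB m
      have : 0 ≤ ∑ w : Wp K F, |Real.log (ab w (y m))| := Finset.sum_nonneg fun _ _ => abs_nonneg _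
      nlinarith
    exact ⟨1, one_pos, by nlinarith, by simp⟩
  push Not at hM
  have hN0 : (0:ℝ) < N := by
    have h0 : 0 ≤ 16 * (Fintype.card M * B) * D ^ 3 := by positivity
    by_contra h
    push Not at h
    nlinarith
  have hsum : ∑ w : Wp K F, Real.posLog (ab w (∏ m, y m ^ z m)) ≤ 1 / N * (Fintype.card M * (B * D)) := by
    calc ∑ w : Wp K F, Real.posLog (ab w (∏ m, y m ^ z m)) ≤ ∑ w : Wp K F, ∑ m, 1 / N * |Real.log (ab w (y m))| := by
          refine Finset.sum_le_sum fun w _ => ?_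
          have h1 : Real.posLog (ab w (∏ m, y m ^ z m)) ≤ |Real.log (ab w (∏ m, y m ^ z m))| :=
            max_le (abs_nonneg _) (le_abs_self _)
          refine h1.trans ?_
          rw [hlog]
          refine (Finset.abs_sum_le_sum_abs _ _).trans (Finset.sum_le_sum fun m _ => ?_)
          rw [abs_mul]
          exact mul_le_mul_of_nonneg_right (hz m) (abs_nonneg _)
      _ = 1 / N * ∑ m, ∑ w : Wp K F, |Real.log (ab w (y m))| := by
          rw [Finset.sum_comm, Finset.mul_sum]
          exact Finset.sum_congr rfl fun m _ => by rw [Finset.mul_sum]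
      _ ≤ _ := by
          refine mul_le_mul_of_nonneg_left ?_ (by positivity)
          refine (Finset.sum_le_sum fun m _ => hB m).trans ?_
          rw [Finset.sum_const, Finset.card_univ, nsmul_eq_mul]
  obtain ⟨ω, h1, h2, h3⟩ := lehmer F _ hG (by
    refine lt_of_le_of_lt hsum ?_
    rw [← hD, lt_div_iff₀ (by positivity), one_div, mul_assoc, inv_mul_lt_iff₀ hN0]
    calc _ = 16 * (Fintype.card M * B) * D ^ 3 := by ring
      _ < _ := hN)
  refine ⟨ω, h1, h2, ?_⟩
  rw [← h3, ← Finset.prod_pow]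
  refine Finset.prod_congr rfl fun m _ => ?_
  rw [mul_comm, zpow_mul, zpow_natCast]

set_option maxHeartbeats 1000000 in
lemma small_rel {ι J : Type} [Fintype ι] [Fintype J] (Q : ι → ℤ[X]) (hQ : ∀ i, (Q i).Monic) (hn : ∀ i, 1 ≤ (Q i).natDegree)
    (hirr : ∀ i, Irreducible (Q i)) (hQinj : Function.Injective Q)
    (p : J → ℕ) (hp : ∀ j, (p j).Prime) (hinj : Function.Injective p) :
    ∃ (C : ℝ) (A : ℕ), 1 ≤ C ∧ 1 ≤ A ∧ ∀ α : ℂ, TwoRel Q p α → ∀ (K : Type) [Field K] [NumberField K] (x : K) (f : K →+* ℂ), f x = α →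
      (∃ (k l : ι → ℤ) (k' l' : J → ℤ), (∃ i j, k i * l j - k j * l i ≠ 0) ∧
        (∀ i, |(k i : ℝ)| ≤ C * (Module.finrank ℚ K : ℝ) ^ A) ∧ (∀ i, |(l i : ℝ)| ≤ C * (Module.finrank ℚ K : ℝ) ^ A) ∧
        (∀ i, |(k' i : ℝ)| ≤ C * (Module.finrank ℚ K : ℝ) ^ A) ∧ (∀ i, |(l' i : ℝ)| ≤ C * (Module.finrank ℚ K : ℝ) ^ A) ∧
        (∏ i, (aeval x (Q i)) ^ k i) * ∏ j, ((p j : ℕ) : K) ^ k' j = 1 ∧ (∏ i, (aeval x (Q i)) ^ l i) * ∏ j, ((p j : ℕ) : K) ^ l' j = 1) ∧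
      ∑ σ : K →+* ℂ, (Real.posLog ‖σ x‖ + ∑ i, |Real.log ‖σ (aeval x (Q i))‖|) ≤ C * Module.finrank ℚ K := by
  obtain ⟨H, hH1, hH⟩ := eta_bounded Q hQ hn hirr hQinj p hp hinj
  set W : ι ⊕ J → ℤ[X] := Sum.elim Q (fun j => C ((p j : ℕ) : ℤ)) with hW
  choose B hB0 hB using fun m => logsum_bound (W m)
  set B1 : ℝ := (∑ m, B m) * (1 + H) with hB1
  have hBs : ∀ m, B m ≤ ∑ m, B m := fun m => Finset.single_le_sum (fun m _ => hB0 m) (Finset.mem_univ m)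
  have hB10 : 0 ≤ B1 := mul_nonneg (Finset.sum_nonneg fun m _ => hB0 m) (by linarith)
  have hl2 : 0 < Real.log 2 := Real.log_pos one_lt_two
  set N1 : ℕ := ⌊16 * (Fintype.card (ι ⊕ J) * B1) / Real.log 2⌋₊ + 1 with hN1
  have hN1' : 16 * (Fintype.card (ι ⊕ J) * B1) < N1 * Real.log 2 := by
    rw [← div_lt_iff₀ hl2, hN1]; push_cast; exact Nat.lt_floor_add_one _
  set M := Fintype.card ((ι ⊕ J) ⊕ (ι ⊕ J)) with hM
  set H2 : ℝ := 1 + H / Real.log 2 with hH2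
  have hH20 : 1 ≤ H2 := by
    have : 0 ≤ H / Real.log 2 := by positivity
    linarith
  set C1 : ℝ := 2 * (H2 * (N1:ℝ) ^ M + 1) with hC1
  have hC11 : 1 ≤ C1 := by
    have : 0 ≤ H2 * (N1:ℝ) ^ M := by positivity
    linarith
  refine ⟨C1 + (H + Fintype.card ι * B1), 3 * M + 2, ?_, by omega, fun α hα K _ _ x f hfx => ?_⟩
  · have : 0 ≤ Fintype.card ι * B1 := by positivity
    linarith
  obtain ⟨u, v, a, b, i, j, hui, huj, hvi, hvj, hu1, hv1, hE, hrel⟩ := exc_of_rel Q p hp α hα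
  obtain ⟨hη, hht⟩ := hH α _ _ hE
  have hQx : ∀ i, aeval x (Q i) ≠ 0 := by
    intro i h0
    apply hα.2.1 i
    rw [← hfx, ← aeval_emb, h0, map_zero]
  have hpx : ∀ j, ((p j : ℕ) : K) ≠ 0 := fun j => by exact_mod_cast (hp j).ne_zero
  classical
  obtain ⟨F, hF⟩ := exists_good (Finset.univ.image (fun i => aeval x (Q i)) ∪ Finset.univ.image (fun j => ((p j : ℕ) : K)))
  have hFx : ∀ i, Good F (aeval x (Q i)) := fun i => hF _ (by simp) (hQx i)
  have hFp : ∀ j, Good F ((p j : ℕ) : K) := fun j => hF _ (by simp) (hpx j)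
  have hht := hht K F x f hfx hFx hFp
  have hDn : 0 < Module.finrank ℚ K := Module.finrank_pos
  set D : ℝ := ((Module.finrank ℚ K : ℕ) : ℝ) with hD
  have hD1 : 1 ≤ D := by rw [hD]; exact_mod_cast hDn
  have hp_ev : ∀ j, aeval x (C ((p j : ℕ) : ℤ)) = ((p j : ℕ) : K) := by intro j; simp
  have hGW : ∀ m, Good F (aeval x (W m)) := by
    rintro (i | j)
    · exact hFx i
    · simp only [hW, Sum.elim_inr, hp_ev]; exact hFp j
  have hBW : ∀ m, ∑ w : Wp K F, |Real.log (ab w (aeval x (W m)))| ≤ B1 * D := by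
    intro m
    refine (hB m K F x (hGW m)).trans ?_
    rw [hB1, mul_assoc]
    refine mul_le_mul (hBs m) ?_ ?_ (Finset.sum_nonneg fun m _ => hB0 m)
    · rw [← hD]; linarith
    · have := Finset.sum_nonneg fun w (_ : w ∈ (Finset.univ : Finset (Wp K F))) => Real.posLog_nonneg (x := ab w x)
      rw [← hD]; linarith
  constructor
  · -- relations
    set N : ℕ := N1 * Module.finrank ℚ K ^ 3 with hNd
    have hN0 : 0 < N := by positivity
    have hNr : 16 * (Fintype.card (ι ⊕ J) * B1) * D ^ 3 < N * Real.log 2 := by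
      rw [hNd]; push_cast; rw [← hD]
      have : 0 < D ^ 3 := by positivity
      nlinarith [mul_lt_mul_of_pos_right hN1' this]
    obtain ⟨q, z, hq0, hqN, hz, hz0, hz1⟩ := dirichlet (Sum.elim (Sum.elim u a) (Sum.elim v b)) N hN0
    have hab : ∀ j, |a j| ≤ H2 ∧ |b j| ≤ H2 := by
      intro j
      have h1 : ‖cc p (fun j => (a j : ℂ) + Complex.I * b j) (some j)‖ ≤ H :=
        (Finset.single_le_sum (f := fun v => ‖cc p (fun j => (a j : ℂ) + Complex.I * b j) v‖) (fun v _ => norm_nonneg _) (Finset.mem_univ (some j))).trans hη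
      simp only [cc, norm_neg, norm_mul, Complex.norm_real, Real.norm_eq_abs] at h1
      have hlp : Real.log 2 ≤ Real.log (p j) := Real.log_le_log (by norm_num) (by exact_mod_cast (hp j).two_le)
      rw [abs_of_nonneg (hl2.le.trans hlp)] at h1
      have h2 : ‖(a j : ℂ) + Complex.I * b j‖ ≤ H2 := by
        have : ‖(a j : ℂ) + Complex.I * b j‖ ≤ H / Real.log 2 := by
          rw [le_div_iff₀ hl2]
          exact (mul_le_mul_of_nonneg_left hlp (norm_nonneg _)).trans h1
        linarith
      have h3 := (Complex.abs_re_le_norm ((a j : ℂ) + Complex.I * b j)).trans h2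
      have h4 := (Complex.abs_im_le_norm ((a j : ℂ) + Complex.I * b j)).trans h2
      simp at h3 h4
      exact ⟨h3, h4⟩
    have hθ : ∀ m, |Sum.elim (Sum.elim u a) (Sum.elim v b) m| ≤ H2 := by
      rintro ((m | m) | (m | m))
      · exact (hu1 m).trans hH20
      · exact (hab m).1
      · exact (hv1 m).trans hH20
      · exact (hab m).2
    have hzb : ∀ m, |(z m : ℝ)| ≤ (H2 * (N1:ℝ) ^ M + 1) * D ^ (3 * M) := by
      intro m
      have h1 := hz m
      have h2 : (1:ℝ) / N ≤ 1 := by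
        rw [div_le_one (by exact_mod_cast hN0)]; exact_mod_cast hN0
      have h3 : |(z m : ℝ)| ≤ q * H2 + 1 := by
        have e : (z m : ℝ) = (z m - q * Sum.elim (Sum.elim u a) (Sum.elim v b) m) + q * Sum.elim (Sum.elim u a) (Sum.elim v b) m := by ring
        rw [e]
        refine (abs_add_le _ _).trans ?_
        rw [abs_mul, Nat.abs_cast]
        have := mul_le_mul_of_nonneg_left (hθ m) (Nat.cast_nonneg (α := ℝ) q)
        linarith
      have h4 : (q:ℝ) ≤ (N1:ℝ) ^ M * D ^ (3 * M) := by
        have : (q:ℝ) ≤ (N:ℝ) ^ M := by exact_mod_cast hqN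
        refine this.trans (le_of_eq ?_)
        rw [hNd]; push_cast; rw [← hD, mul_pow, ← pow_mul]
      have h5 : (1:ℝ) ≤ D ^ (3 * M) := one_le_pow₀ hD1
      nlinarith
    obtain ⟨ω1, ho1, ho1', hr1⟩ := one_rel (F := F) (fun m => aeval x (W m)) hGW B1 hBW (Sum.elim u a) (by
      intro w
      rw [Fintype.sum_sum_type]
      simpa [hW] using (hrel K x f hfx w).1) q N (fun m => z (Sum.inl m)) (fun m => hz (Sum.inl m)) (by rw [← hD]; exact hNr)
    obtain ⟨ω2, ho2, ho2', hr2⟩ := one_rel (F := F) (fun m => aeval x (W m)) hGW B1 hBW (Sum.elim v b) (by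
      intro w
      rw [Fintype.sum_sum_type]
      simpa [hW] using (hrel K x f hfx w).2) q N (fun m => z (Sum.inr m)) (fun m => hz (Sum.inr m)) (by rw [← hD]; exact hNr)
    have hfin : ∀ ω : ℕ, ω ≤ 2 * Module.finrank ℚ K ^ 2 → ∀ m, |(((ω:ℤ) * z m : ℤ) : ℝ)| ≤ (C1 + (H + Fintype.card ι * B1)) * D ^ (3 * M + 2) := by
      intro ω hω m
      push_cast
      rw [abs_mul, Nat.abs_cast]
      have hω' : (ω:ℝ) ≤ 2 * D ^ 2 := by rw [hD]; exact_mod_cast hω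
      have h6 : 0 ≤ H + Fintype.card ι * B1 := by positivity
      calc (ω:ℝ) * |(z m : ℝ)| ≤ (2 * D ^ 2) * ((H2 * (N1:ℝ) ^ M + 1) * D ^ (3 * M)) := mul_le_mul hω' (hzb m) (abs_nonneg _) (by positivity)
        _ = C1 * D ^ (3 * M + 2) := by rw [hC1]; ring
        _ ≤ _ := mul_le_mul_of_nonneg_right (by linarith) (by positivity)
    refine ⟨fun i => ω1 * z (.inl (.inl i)), fun i => ω2 * z (.inr (.inl i)), fun j => ω1 * z (.inl (.inr j)), fun j => ω2 * z (.inr (.inr j)),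
      ⟨i, j, ?_⟩, fun m => hfin ω1 ho1' _, fun m => hfin ω2 ho2' _, fun m => hfin ω1 ho1' _, fun m => hfin ω2 ho2' _, ?_, ?_⟩
    · beta_reduce
      rw [hz1 (.inl (.inl i)) hui, hz1 (.inr (.inl j)) hvj, hz0 (.inl (.inl j)) huj]
      have : (0:ℤ) < ω1 * q * (ω2 * q) := by positivity
      simp only [mul_zero, zero_mul, sub_zero]
      exact this.ne'
    · rw [Fintype.prod_sum_type] at hr1
      simpa [hW] using hr1
    · rw [Fintype.prod_sum_type] at hr2
      simpa [hW] using hr2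
  · have h1 : ∑ σ : K →+* ℂ, Real.posLog ‖σ x‖ ≤ H * D := by
      refine le_trans ?_ hht
      rw [Fintype.sum_sum_type]
      simp only [ab_inl]
      have : 0 ≤ ∑ v : {v : FinitePlace K // v ∈ F}, Real.posLog (ab (F := F) (.inr v) x) := Finset.sum_nonneg fun _ _ => Real.posLog_nonneg
      linarith
    have h2 : ∀ i, ∑ σ : K →+* ℂ, |Real.log ‖σ (aeval x (Q i))‖| ≤ B1 * D := by
      intro i
      refine le_trans ?_ (hBW (.inl i))
      rw [Fintype.sum_sum_type]
      simp only [ab_inl, hW, Sum.elim_inl]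
      have : 0 ≤ ∑ v : {v : FinitePlace K // v ∈ F}, |Real.log (ab (F := F) (.inr v) (aeval x (Q i)))| := Finset.sum_nonneg fun _ _ => abs_nonneg _
      linarith
    rw [Finset.sum_add_distrib, Finset.sum_comm]
    have h3 := Finset.sum_le_sum fun i (_ : i ∈ (Finset.univ : Finset ι)) => h2 i
    rw [Finset.sum_const, Finset.card_univ, nsmul_eq_mul] at h3
    have h4 : 0 ≤ C1 * D := by positivity
    linarith

end MZ
end

section
open Polynomial NumberField
namespace MZ

lemma one_field (α : ℂ) (hα : IsAlgebraic ℚ α) :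
    ∃ (K : Type) (_ : Field K) (_ : NumberField K) (f : K →+* ℂ) (x : K), f x = α ∧ ∀ g h : K →+* ℂ, g x = h x → g = h := by
  have hi := hα.isIntegral
  have : FiniteDimensional ℚ (IntermediateField.adjoin ℚ ({α} : Set ℂ)) := IntermediateField.adjoin.finiteDimensional hi
  refine ⟨IntermediateField.adjoin ℚ ({α} : Set ℂ), inferInstance, { }, (IntermediateField.val _).toRingHom,
    IntermediateField.AdjoinSimple.gen ℚ α, rfl, fun g h hgh => ?_⟩
  have := (IntermediateField.adjoin.powerBasis hi).algHom_ext (f := RingHom.equivRatAlgHom _ ℂ g) (g := RingHom.equivRatAlgHom _ ℂ h) hgh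
  exact (RingHom.equivRatAlgHom _ ℂ).injective this

lemma zpow_toNat {a : ℂ} (ha : a ≠ 0) (k : ℤ) : a ^ k * a ^ (-k).toNat = a ^ k.toNat := by
  rw [← zpow_natCast, ← zpow_natCast, ← zpow_add₀ ha]
  congr 1
  omega

lemma rel_finite {ι J : Type} [Fintype ι] [Fintype J] (Q : ι → ℂ[X]) (hroot : ∀ i, ∃ ρ, (Q i).eval ρ = 0)
    (hsep : ∀ i ρ, (Q i).eval ρ = 0 → ∀ j, j ≠ i → (Q j).eval ρ ≠ 0)
    (p : J → ℕ) (hp : ∀ j, 0 < p j) (k : ι → ℤ) (k' : J → ℤ) (hk : k ≠ 0) :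
    {z : ℂ | (∀ i, (Q i).eval z ≠ 0) ∧ MRel Q p k k' z}.Finite := by
  classical
  set P1 : ℂ[X] := (∏ i, Q i ^ (k i).toNat) * C (∏ j, (p j : ℂ) ^ (k' j).toNat) with hP1
  set P2 : ℂ[X] := (∏ i, Q i ^ (-k i).toNat) * C (∏ j, (p j : ℂ) ^ (-k' j).toNat) with hP2
  have hpc : ∀ j, (p j : ℂ) ≠ 0 := fun j => by exact_mod_cast (hp j).ne'
  have hne : P1 - P2 ≠ 0 := by
    intro h0
    obtain ⟨i, hi⟩ : ∃ i, k i ≠ 0 := by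
      by_contra h; push Not at h; exact hk (funext h)
    obtain ⟨ρ, hρ⟩ := hroot i
    have e := congrArg (eval ρ) (sub_eq_zero.1 h0)
    simp only [hP1, hP2, eval_mul, eval_prod, eval_pow, eval_C] at e
    have z1 : ∀ m : ι → ℕ, m i ≠ 0 → ∏ j, (eval ρ (Q j)) ^ m j = 0 := fun m hm =>
      Finset.prod_eq_zero (Finset.mem_univ i) (by rw [hρ, zero_pow hm])
    have z2 : ∀ m : ι → ℕ, m i = 0 → ∏ j, (eval ρ (Q j)) ^ m j ≠ 0 := by
      intro m hm
      refine Finset.prod_ne_zero_iff.2 fun j _ => ?_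
      by_cases hj : j = i
      · rw [hj, hm, pow_zero]; exact one_ne_zero
      · exact pow_ne_zero _ (hsep i ρ hρ j hj)
    have z3 : ∀ m : J → ℕ, ∏ j, (p j : ℂ) ^ m j ≠ 0 := fun m => Finset.prod_ne_zero_iff.2 fun j _ => pow_ne_zero _ (hpc j)
    rcases lt_or_gt_of_ne hi with h | h
    · have h1 := z1 (fun i => (-k i).toNat) (by omega)
      have h2 := z2 (fun i => (k i).toNat) (by omega)
      rw [h1, zero_mul] at e
      exact mul_ne_zero h2 (z3 _) e
    · have h1 := z1 (fun i => (k i).toNat) (by omega)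
      have h2 := z2 (fun i => (-k i).toNat) (by omega)
      rw [h1, zero_mul] at e
      exact mul_ne_zero h2 (z3 _) e.symm
  refine ((P1 - P2).roots.toFinset.finite_toSet).subset ?_
  rintro z ⟨hz, hrel⟩
  simp only [Finset.mem_coe, Multiset.mem_toFinset]
  rw [mem_roots hne, IsRoot.def, eval_sub, sub_eq_zero]
  simp only [hP1, hP2, eval_mul, eval_prod, eval_pow, eval_C]
  unfold MRel at hrel
  have e1 : ∏ i, (eval z (Q i)) ^ (k i).toNat = (∏ i, (eval z (Q i)) ^ k i) * ∏ i, (eval z (Q i)) ^ (-k i).toNat := by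
    rw [← Finset.prod_mul_distrib]
    exact Finset.prod_congr rfl fun i _ => (zpow_toNat (hz i) _).symm
  have e2 : ∏ j, (p j : ℂ) ^ (k' j).toNat = (∏ j, (p j : ℂ) ^ k' j) * ∏ j, (p j : ℂ) ^ (-k' j).toNat := by
    rw [← Finset.prod_mul_distrib]
    exact Finset.prod_congr rfl fun i _ => (zpow_toNat (hpc i) _).symm
  rw [e1, e2]
  linear_combination ((∏ i, (eval z (Q i)) ^ (-k i).toNat) * ∏ j, (p j : ℂ) ^ (-k' j).toNat) * hrel

set_option maxHeartbeats 1000000 in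
theorem main_finite {ι J : Type} [Fintype ι] [Fintype J] (Q : ι → ℤ[X]) (hQ : ∀ i, (Q i).Monic) (hn : ∀ i, 1 ≤ (Q i).natDegree)
    (hirr : ∀ i, Irreducible (Q i)) (hQinj : Function.Injective Q)
    (p : J → ℕ) (hp : ∀ j, (p j).Prime) (hinj : Function.Injective p) : {α : ℂ | TwoRel Q p α}.Finite := by
  classical
  obtain ⟨C1, A, hC1, hA, hsm⟩ := small_rel Q hQ hn hirr hQinj p hp hinj
  obtain ⟨Rr, hR0, hRr⟩ := exists_bez Q hQ hirr hQinj
  set Qc : ι → ℂ[X] := fun i => (Q i).map (Int.castRingHom ℂ) with hQc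
  have hev : ∀ i z, (Qc i).eval z = aeval z (Q i) := by
    intro i z; simp only [hQc]; rw [eval_map, aeval_def]; rfl
  have hroot : ∀ i, ∃ ρ, (Qc i).eval ρ = 0 := by
    intro i
    obtain ⟨ρ, h⟩ := IsAlgClosed.exists_root (Qc i) (by
      simp only [hQc]
      rw [degree_eq_natDegree ((hQ i).map _).ne_zero, (hQ i).natDegree_map]
      have := hn i
      exact_mod_cast (by omega : (Q i).natDegree ≠ 0))
    exact ⟨ρ, h⟩
  have hsep2 : ∀ i ρ, (Qc i).eval ρ = 0 → ∀ j, j ≠ i → (Qc j).eval ρ ≠ 0 := by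
    intro i ρ hi j hji hj
    obtain ⟨a, b, hab⟩ := hRr j i hji
    have := congrArg (aeval ρ) hab
    rw [hev] at hi hj
    rw [map_add, map_mul, map_mul, hi, hj, mul_zero, mul_zero, zero_add] at this
    simp at this
    exact hR0 j i (by exact_mod_cast this.symm)
  have hsep : ∀ i ρ, (Qc i).eval ρ = 0 → (derivative (Qc i)).eval ρ ≠ 0 ∧ ∀ j, j ≠ i → (Qc j).eval ρ ≠ 0 := by
    intro i ρ hi
    refine ⟨?_, hsep2 i ρ hi⟩
    have hirrQ : Irreducible ((Q i).map (algebraMap ℤ ℚ)) := ((hQ i).irreducible_iff_irreducible_map_fraction_map).1 (hirr i)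
    have h1 := hirrQ.separable.aeval_derivative_ne_zero (S := ℂ) (x := ρ) (by rw [aeval_map_algebraMap, ← hev, hi])
    intro h2
    apply h1
    rw [derivative_map, aeval_map_algebraMap, ← h2]
    simp only [hQc]
    rw [derivative_map, eval_map, aeval_def]; rfl
  set Ω : Set ℂ := {z | ‖z‖ ≤ Real.exp (2 * C1) ∧ ∀ i, Real.exp (-(2 * C1)) ≤ ‖(Qc i).eval z‖} with hΩ
  have hΩc : IsCompact Ω := by
    refine (isCompact_closedBall (0:ℂ) (Real.exp (2 * C1))).of_isClosed_subset ?_ ?_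
    · refine IsClosed.inter (isClosed_le continuous_norm continuous_const) ?_
      change IsClosed {z : ℂ | ∀ i, Real.exp (-(2 * C1)) ≤ ‖(Qc i).eval z‖}
      rw [Set.setOf_forall]
      exact isClosed_iInter fun i => isClosed_le (by fun_prop) ((Qc i).continuous.norm)
    · intro z hz; rw [mem_closedBall_zero_iff]; exact hz.1
  obtain ⟨C2, hC2, hcount⟩ := compact_count Qc hroot hsep p (fun j => (hp j).pos) Ω hΩc (fun z hz i h0 => by
    have := hz.2 i
    rw [h0, norm_zero] at this
    exact absurd (Real.exp_pos (-(2 * C1))) (not_lt.2 this)) (16 * A) (by omega)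
  have hMR : ∀ (K : Type) [Field K] (x : K) (σ : K →+* ℂ) (k : ι → ℤ) (k' : J → ℤ),
      (∏ i, (aeval x (Q i)) ^ k i) * ∏ j, ((p j : ℕ) : K) ^ k' j = 1 → MRel Qc p k k' (σ x) := by
    intro K _ x σ k k' h
    unfold MRel
    simp only [hev]
    exact (rel_pull Q p σ x k k').2 h
  set D0 : ℝ := (2 * (C2 * C1 ^ 2)) ^ 2 with hD0
  have hkey : ∀ α ∈ {α : ℂ | TwoRel Q p α}, ∃ (k : ι → ℤ) (k' : J → ℤ), k ≠ 0 ∧ (∀ i, |(k i : ℝ)| ≤ C1 * D0 ^ A) ∧ (∀ i, |(k' i : ℝ)| ≤ C1 * D0 ^ A) ∧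
      ((∀ i, (Qc i).eval α ≠ 0) ∧ MRel Qc p k k' α) := by
    intro α hα
    obtain ⟨K, _, _, f, x, hfx, hext⟩ := one_field α hα.1
    obtain ⟨⟨k, l, k', l', hmin, hk, hl, hk', hl', hr1, hr2⟩, hsum⟩ := hsm α hα K x f hfx
    have hDn : 0 < Module.finrank ℚ K := Module.finrank_pos
    set D : ℝ := ((Module.finrank ℚ K : ℕ) : ℝ) with hD
    have hD1 : 1 ≤ D := by rw [hD]; exact_mod_cast hDn
    have hQx : ∀ i, aeval x (Q i) ≠ 0 := by
      intro i h0
      apply hα.2.1 i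
      rw [← hfx, ← aeval_emb, h0, map_zero]
    set g : (K →+* ℂ) → ℝ := fun σ => Real.posLog ‖σ x‖ + ∑ i, |Real.log ‖σ (aeval x (Q i))‖| with hg
    have hg0 : ∀ σ, 0 ≤ g σ := fun σ => add_nonneg Real.posLog_nonneg (Finset.sum_nonneg fun _ _ => abs_nonneg _)
    set G := (Finset.univ : Finset (K →+* ℂ)).filter (fun σ => g σ ≤ 2 * C1) with hG
    have hcardG : D / 2 ≤ (G.card : ℝ) := by
      have h1 := Finset.card_filter_add_card_filter_not (s := (Finset.univ : Finset (K →+* ℂ))) (fun σ => g σ ≤ 2 * C1)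
      rw [Finset.card_univ, NumberField.Embeddings.card] at h1
      have h1' : (G.card : ℝ) + (((Finset.univ : Finset (K →+* ℂ)).filter (fun σ => ¬ g σ ≤ 2 * C1)).card : ℝ) = D := by
        rw [hD]; exact_mod_cast h1
      have h2 : (((Finset.univ : Finset (K →+* ℂ)).filter (fun σ => ¬ g σ ≤ 2 * C1)).card : ℝ) * (2 * C1) ≤ C1 * D := by
        refine le_trans ?_ hsum
        rw [← nsmul_eq_mul, ← Finset.sum_const]
        refine (Finset.sum_le_sum fun σ hσ => (not_le.1 (Finset.mem_filter.1 hσ).2).le).trans ?_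
        exact Finset.sum_le_sum_of_subset_of_nonneg (Finset.filter_subset _ _) fun σ _ _ => hg0 σ
      nlinarith
    set S := G.image (fun σ => σ x) with hS
    have hSc : S.card = G.card := Finset.card_image_of_injOn fun σ _ τ _ h => hext σ τ h
    have hτ1 : 1 ≤ C1 * Real.sqrt (Real.sqrt D) := one_le_mul_of_one_le_of_one_le hC1 (Real.one_le_sqrt.2 (Real.one_le_sqrt.2 hD1))
    have hsq : Real.sqrt (Real.sqrt D) ^ 4 = D := by
      rw [show Real.sqrt (Real.sqrt D) ^ 4 = (Real.sqrt (Real.sqrt D) ^ 2) ^ 2 by ring, Real.sq_sqrt (Real.sqrt_nonneg _), Real.sq_sqrt (by linarith)]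
    have hT1 : 1 ≤ C1 * D ^ A := one_le_mul_of_one_le_of_one_le hC1 (one_le_pow₀ hD1)
    have hcnt := hcount (C1 * D ^ A) hT1 k l k' l' hmin hk hl hk' hl' (C1 * Real.sqrt (Real.sqrt D)) hτ1 (by
      rw [mul_pow, mul_pow, show 16 * A = 4 * (4 * A) by ring, pow_mul (Real.sqrt (Real.sqrt D)), hsq, ← pow_mul, mul_comm A 4]
      exact mul_le_mul_of_nonneg_right (pow_le_pow_right₀ hC1 (by omega)) (by positivity)) S (by
      intro s hs
      obtain ⟨σ, hσ, rfl⟩ := Finset.mem_image.1 hs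
      have hσ := (Finset.mem_filter.1 hσ).2
      refine ⟨⟨?_, fun i => ?_⟩, hMR K x σ k k' hr1, hMR K x σ l l' hr2⟩
      · have h1 : Real.posLog ‖σ x‖ ≤ 2 * C1 := by
          have : 0 ≤ ∑ i, |Real.log ‖σ (aeval x (Q i))‖| := Finset.sum_nonneg fun _ _ => abs_nonneg _
          simp only [hg] at hσ; linarith
        rw [Real.posLog_eq_log_max_one (norm_nonneg _), Real.log_le_iff_le_exp (by positivity)] at h1
        exact (le_max_right _ _).trans h1
      · have h1 : |Real.log ‖σ (aeval x (Q i))‖| ≤ 2 * C1 := by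
          have h3 := Finset.single_le_sum (f := fun i => |Real.log ‖σ (aeval x (Q i))‖|) (fun i _ => abs_nonneg _) (Finset.mem_univ i)
          have h4 := Real.posLog_nonneg (x := ‖σ x‖)
          simp only [hg] at hσ; linarith
        rw [hev, ← aeval_emb, ← Real.le_log_iff_exp_le (norm_pos_iff.2 ((map_ne_zero σ).2 (hQx i)))]
        exact (abs_le.1 h1).1)
    rw [hSc, mul_pow, Real.sq_sqrt (Real.sqrt_nonneg _)] at hcnt
    have hDD : D ≤ D0 := by
      have h1 : D / 2 ≤ C2 * (C1 ^ 2 * Real.sqrt D) := hcardG.trans hcnt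
      have h2 : Real.sqrt D * Real.sqrt D = D := Real.mul_self_sqrt (by linarith)
      have h3 : 1 ≤ Real.sqrt D := Real.one_le_sqrt.2 hD1
      have h4 : Real.sqrt D ≤ 2 * (C2 * C1 ^ 2) := by
        have : Real.sqrt D * Real.sqrt D ≤ (2 * (C2 * C1 ^ 2)) * Real.sqrt D := by linarith
        exact le_of_mul_le_mul_right this (by linarith)
      rw [hD0, ← h2, ← sq]
      exact pow_le_pow_left₀ (by linarith) h4 2
    have hb : C1 * D ^ A ≤ C1 * D0 ^ A := mul_le_mul_of_nonneg_left (pow_le_pow_left₀ (by linarith) hDD A) (by linarith)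
    refine ⟨k, k', ?_, fun i => (hk i).trans hb, fun i => (hk' i).trans hb, fun i => by rw [hev]; exact hα.2.1 i, ?_⟩
    · rintro rfl
      obtain ⟨i, j, h⟩ := hmin
      simp at h
    · have := hMR K x f k k' hr1
      rwa [hfx] at this
  set T : ℤ := ⌊C1 * D0 ^ A⌋ with hT
  have hbox : ∀ n : ℤ, |(n:ℝ)| ≤ C1 * D0 ^ A → n ∈ Finset.Icc (-T) T := by
    intro n hn
    rw [Finset.mem_Icc, ← abs_le, hT, Int.le_floor]
    exact_mod_cast hn
  refine Set.Finite.subset (Set.Finite.biUnion (Set.toFinite (((Fintype.piFinset fun _ : ι => Finset.Icc (-T) T) ×ˢ (Fintype.piFinset fun _ : J => Finset.Icc (-T) T)).filter (fun q => q.1 ≠ 0) : Set ((ι → ℤ) × (J → ℤ))))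
    (t := fun q => {z : ℂ | (∀ i, (Qc i).eval z ≠ 0) ∧ MRel Qc p q.1 q.2 z}) ?_) ?_
  · intro q hq
    exact rel_finite Qc hroot hsep2 p (fun j => (hp j).pos) q.1 q.2 (Finset.mem_filter.1 hq).2
  · intro α hα
    obtain ⟨k, k', h0, h1, h2, h3⟩ := hkey α hα
    simp only [Set.mem_iUnion]
    refine ⟨(k, k'), ?_, h3⟩
    rw [Finset.mem_coe, Finset.mem_filter, Finset.mem_product]
    exact ⟨⟨Fintype.mem_piFinset.2 fun i => hbox _ (h1 i), Fintype.mem_piFinset.2 fun i => hbox _ (h2 i)⟩, h0⟩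

end MZ
end

section
open Polynomial NumberField
namespace MZ

noncomputable def PP {ι : Type} [Fintype ι] (f g : ι → ℤ[X]) (k : ι → ℤ) : ℤ[X] :=
  ∏ i, (f i ^ (k i).toNat * g i ^ (-k i).toNat)

noncomputable def FF {ι : Type} [Fintype ι] (f g : ι → ℤ[X]) (k : ι → ℤ) : ℤ[X] :=
  PP f g k - PP g f k

lemma rel_iff {ι : Type} [Fintype ι] {E : Type*} [Field E] (φ : ℤ[X] →+* E) (f g : ι → ℤ[X]) (k : ι → ℤ)
    (hf : ∀ i, φ (f i) ≠ 0) (hg : ∀ i, φ (g i) ≠ 0) :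
    ∏ i, (φ (f i) / φ (g i)) ^ k i = 1 ↔ φ (FF f g k) = 0 := by
  have h1 : φ (PP f g k) = (∏ i, (φ (f i) / φ (g i)) ^ k i) * φ (PP g f k) := by
    unfold PP
    rw [map_prod, map_prod, ← Finset.prod_mul_distrib]
    refine Finset.prod_congr rfl fun i _ => ?_
    simp only [map_mul, map_pow]
    have ha := hf i
    have hb := hg i
    set a := φ (f i)
    set b := φ (g i)
    set n := k i
    rcases le_total 0 n with h | h
    · obtain ⟨t, ht⟩ := Int.eq_ofNat_of_zero_le h
      rw [ht]
      simp only [Int.toNat_natCast, zpow_natCast, Int.toNat_neg_natCast, pow_zero, mul_one, div_pow]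
      field_simp
    · obtain ⟨t, ht⟩ := Int.eq_ofNat_of_zero_le (neg_nonneg.2 h)
      have ht' : n = -(t:ℤ) := by omega
      rw [ht']
      simp only [Int.toNat_natCast, neg_neg, zpow_natCast, Int.toNat_neg_natCast, pow_zero, one_mul, zpow_neg, div_pow]
      field_simp
  have h2 : φ (PP g f k) ≠ 0 := by
    unfold PP
    rw [map_prod]
    refine Finset.prod_ne_zero_iff.2 fun i _ => ?_
    simp only [map_mul, map_pow]
    exact mul_ne_zero (pow_ne_zero _ (hg i)) (pow_ne_zero _ (hf i))
  unfold FF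
  rw [map_sub, sub_eq_zero, h1]
  constructor
  · intro h; rw [h, one_mul]
  · intro h
    exact mul_right_cancel₀ h2 (by rw [h, one_mul])

lemma FF_ne_zero {m : ℕ} (f g : Fin m → ℤ[X]) (hf : ∀ i, f i ≠ 0) (hg : ∀ i, g i ≠ 0)
    (hindep : ∀ k : Fin m → ℤ,
      (∏ i, (algebraMap (Polynomial ℚ) (RatFunc ℚ) ((f i).map (Int.castRingHom ℚ)) /
        algebraMap (Polynomial ℚ) (RatFunc ℚ) ((g i).map (Int.castRingHom ℚ))) ^ (k i)) = 1 →
      k = 0) (k : Fin m → ℤ) (hk : k ≠ 0) : FF f g k ≠ 0 := by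
  set φ : ℤ[X] →+* RatFunc ℚ := (algebraMap (Polynomial ℚ) (RatFunc ℚ)).comp (mapRingHom (Int.castRingHom ℚ)) with hφ
  have hinj : Function.Injective φ := by
    rw [hφ, RingHom.coe_comp]
    exact (RatFunc.algebraMap_injective ℚ).comp (map_injective _ (RingHom.injective_int _))
  have h0 : ∀ h : ℤ[X], h ≠ 0 → φ h ≠ 0 := fun h hh => (map_ne_zero_iff φ hinj).2 hh
  intro h
  apply hk
  apply hindep
  exact (rel_iff φ f g k (fun i => h0 _ (hf i)) (fun i => h0 _ (hg i))).2 (by rw [h, map_zero])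

lemma hat_exists (h : ℤ[X]) (r c' : ℤ) (hr : h.eval r ≠ 0) :
    ∃ H : ℤ[X], H.Monic ∧ H.natDegree = h.natDegree ∧ ∀ α : ℂ, α ≠ r →
      aeval α h * (((h.eval r * c' : ℤ) : ℂ) / (α - r)) ^ h.natDegree = ((h.eval r : ℤ) : ℂ) * aeval (((h.eval r * c' : ℤ) : ℂ) / (α - r)) H := by
  set d := h.natDegree with hd
  set c := h.eval r with hc
  set T := taylor r h with hT
  have hT0 : T.coeff 0 = c := by rw [hT, taylor_coeff_zero]
  have hTd : T.natDegree = d := by rw [hT, natDegree_taylor]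
  set W : ℤ[X] := ∑ k ∈ Finset.range d, C (T.coeff (k+1) * (c * c') ^ k * c') * X ^ (d - 1 - k) with hW
  have hWd : W.degree < d := by
    refine (degree_sum_le _ _).trans_lt ?_
    rw [Finset.sup_lt_iff (WithBot.bot_lt_coe _)]
    intro k hk
    refine (degree_C_mul_X_pow_le _ _).trans_lt ?_
    rw [Finset.mem_range] at hk
    exact_mod_cast (by omega : d - 1 - k < d)
  refine ⟨X ^ d + W, monic_X_pow_add hWd, ?_, fun α hα => ?_⟩
  · rw [natDegree_add_eq_left_of_degree_lt, natDegree_X_pow]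
    rwa [degree_X_pow]
  · have hα' : α - r ≠ 0 := sub_ne_zero.2 hα
    set z : ℂ := ((c * c' : ℤ) : ℂ) / (α - r) with hz
    have hzr : (α - r) * z = c * c' := by rw [hz]; field_simp; push_cast; ring
    have h1 : aeval α h = ∑ k ∈ Finset.range (d+1), (T.coeff k : ℂ) * (α - r) ^ k := by
      have h2 : h = T.comp (X - C r) := by
        rw [hT, taylor_apply, comp_assoc]; simp
      rw [h2, aeval_comp, aeval_eq_sum_range' (n := d+1) (by omega)]
      simp
    rw [h1, Finset.sum_range_succ', hT0, hW]
    simp only [map_add, map_pow, aeval_X, map_sum, map_mul, aeval_C, add_mul, mul_add, Finset.sum_mul, Finset.mul_sum]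
    rw [add_comm]
    congr 1
    · simp
    · refine Finset.sum_congr rfl fun k hk => ?_
      rw [Finset.mem_range] at hk
      have : z ^ d = z ^ (k+1) * z ^ (d - 1 - k) := by rw [← pow_add]; congr 1; omega
      rw [this]
      have h3 : (α - r) ^ (k+1) * z ^ (k+1) = (c * c') ^ (k+1) := by rw [← mul_pow, hzr]
      simp only [algebraMap_int_eq, eq_intCast, Int.cast_mul, Int.cast_pow]
      linear_combination (T.coeff (k+1) : ℂ) * z ^ (d - 1 - k) * h3

lemma factor_family {σ : Type} [Fintype σ] (F : σ → ℤ[X]) (hF : ∀ s, (F s).Monic) :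
    ∃ (ι : Type) (_ : Fintype ι) (Q : ι → ℤ[X]) (a : σ → ι → ℕ), (∀ i, (Q i).Monic) ∧ (∀ i, 1 ≤ (Q i).natDegree) ∧
      (∀ i, Irreducible (Q i)) ∧ Function.Injective Q ∧ (∀ s, F s = ∏ i, Q i ^ a s i) ∧ ∀ i, Q i ∣ ∏ s, F s := by
  classical
  set G := ∏ s, F s with hG
  have hGm : G.Monic := monic_prod_of_monic _ _ fun s _ => hF s
  set S := (UniqueFactorizationMonoid.normalizedFactors G).toFinset with hS
  have hmon : ∀ q ∈ S, q.Monic := by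
    intro q hq
    rw [hS, Multiset.mem_toFinset] at hq
    have h1 := UniqueFactorizationMonoid.normalize_normalized_factor q hq
    have h2 := UniqueFactorizationMonoid.dvd_of_mem_normalizedFactors hq
    have h3 : IsUnit q.leadingCoeff := by
      obtain ⟨t, ht⟩ := h2
      have := congrArg leadingCoeff ht
      rw [leadingCoeff_mul, hGm.leadingCoeff] at this
      exact IsUnit.of_mul_eq_one _ this.symm
    have h4 : normalize q.leadingCoeff = q.leadingCoeff := by
      rw [← leadingCoeff_normalize, h1]
    rw [normalize_eq_one.2 h3] at h4
    exact h4.symm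
  have hirr : ∀ q ∈ S, Irreducible q := fun q hq =>
    UniqueFactorizationMonoid.irreducible_of_normalized_factor q (Multiset.mem_toFinset.1 hq)
  refine ⟨S, inferInstance, Subtype.val, fun s q => (UniqueFactorizationMonoid.normalizedFactors (F s)).count q.1,
    fun i => hmon _ i.2, fun i => ?_, fun i => hirr _ i.2, Subtype.val_injective, fun s => ?_, fun i => ?_⟩
  · by_contra hlt
    have h0 : i.1.natDegree = 0 := by omega
    have := (hmon _ i.2).natDegree_eq_zero.1 h0
    exact (hirr _ i.2).not_isUnit (by rw [this]; exact isUnit_one)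
  · have hsub : (UniqueFactorizationMonoid.normalizedFactors (F s)).toFinset ⊆ S := by
      refine Multiset.toFinset_subset.2 (Multiset.subset_of_le ?_)
      exact (UniqueFactorizationMonoid.dvd_iff_normalizedFactors_le_normalizedFactors (hF s).ne_zero hGm.ne_zero).1
        (Finset.dvd_prod_of_mem _ (Finset.mem_univ s))
    have h1 : (UniqueFactorizationMonoid.normalizedFactors (F s)).prod = F s := by
      refine eq_of_monic_of_associated ?_ (hF s) (UniqueFactorizationMonoid.prod_normalizedFactors (hF s).ne_zero)
      refine Multiset.prod_induction Monic _ (fun a b ha hb => ha.mul hb) monic_one fun q hq => hmon q ?_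
      exact hsub (Multiset.mem_toFinset.2 hq)
    conv_lhs => rw [← h1, Finset.prod_multiset_count_of_subset _ _ hsub]
    exact (Finset.prod_coe_sort S fun q => q ^ (UniqueFactorizationMonoid.normalizedFactors (F s)).count q).symm
  · exact UniqueFactorizationMonoid.dvd_of_mem_normalizedFactors (Multiset.mem_toFinset.1 i.2)

lemma int_family {σ : Type} [Fintype σ] (c : σ → ℤ) (hc : ∀ s, c s ≠ 0) :
    ∃ (J : Type) (_ : Fintype J) (p : J → ℕ) (b : σ → J → ℕ), (∀ j, (p j).Prime) ∧ Function.Injective p ∧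
      ∀ s, (c s) ^ 2 = (∏ j, (p j : ℤ) ^ b s j) ^ 2 := by
  classical
  set G := ∏ s, (c s).natAbs with hG
  have hG0 : G ≠ 0 := Finset.prod_ne_zero_iff.2 fun s _ => Int.natAbs_ne_zero.2 (hc s)
  refine ⟨G.primeFactors, inferInstance, Subtype.val, fun s q => (c s).natAbs.factorization q.1,
    fun j => Nat.prime_of_mem_primeFactors j.2, Subtype.val_injective, fun s => ?_⟩
  have h1 : (c s).natAbs = ∏ q ∈ G.primeFactors, q ^ (c s).natAbs.factorization q := by
    conv_lhs => rw [← Nat.prod_factorization_pow_eq_self (Int.natAbs_ne_zero.2 (hc s))]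
    refine Finsupp.prod_of_support_subset _ ?_ _ (by simp)
    rw [Nat.support_factorization]
    exact Nat.primeFactors_mono (Finset.dvd_prod_of_mem _ (Finset.mem_univ s)) hG0
  rw [Finset.prod_coe_sort G.primeFactors fun q => (q:ℤ) ^ (c s).natAbs.factorization q, ← Int.natAbs_sq, h1]
  push_cast
  rw [← h1]
end MZ
end

section
open Polynomial NumberField
namespace MZ

lemma red_coords1 {σ : Type} [Fintype σ] (h : σ → ℤ[X]) (hh : ∀ s, h s ≠ 0) :
    ∃ (r N : ℤ) (ι : Type) (_ : Fintype ι) (J : Type) (_ : Fintype J) (Q : ι → ℤ[X]) (p : J → ℕ) (E : σ → ι → ℤ) (B : σ → J → ℤ),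
      N ≠ 0 ∧ (∀ i, (Q i).Monic) ∧ (∀ i, 1 ≤ (Q i).natDegree) ∧ (∀ i, Irreducible (Q i)) ∧ Function.Injective Q ∧
      (∀ j, (p j).Prime) ∧ Function.Injective p ∧ (∀ s, ∑ i, ((Q i).natDegree : ℤ) * E s i = 0) ∧
      ∀ α : ℂ, α ≠ r → (∀ s, aeval α (h s) ≠ 0) → (∀ j, aeval ((N : ℂ) / (α - r)) (Q j) ≠ 0) ∧
        ∀ s, (aeval α (h s)) ^ 2 = (∏ j, (aeval ((N : ℂ) / (α - r)) (Q j)) ^ E s j) * ∏ j, (p j : ℂ) ^ B s j := by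
  classical
  obtain ⟨r, hr⟩ : ∃ r : ℤ, (∏ s, h s).eval r ≠ 0 := by
    by_contra hcon
    push Not at hcon
    exact (Finset.prod_ne_zero_iff.2 fun s _ => hh s) (Polynomial.funext (q := 0) (by simpa using hcon))
  rw [eval_prod] at hr
  have hr' : ∀ s, (h s).eval r ≠ 0 := fun s => Finset.prod_ne_zero_iff.1 hr s (Finset.mem_univ s)
  set N : ℤ := ∏ s, (h s).eval r with hN
  have hdv : ∀ s, ∃ c', N = (h s).eval r * c' := fun s => Finset.dvd_prod_of_mem _ (Finset.mem_univ s)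
  choose c' hc' using hdv
  choose H hHm hHd hHe using fun s => hat_exists (h s) r (c' s) (hr' s)
  obtain ⟨ι, _, Q, a, hQm, hQd, hQi, hQinj, hQa, hQdv⟩ := factor_family (σ := Option σ) (fun o => o.elim X H)
    (fun o => by cases o with
      | none => exact monic_X
      | some s => exact hHm s)
  obtain ⟨J, _, p, b, hp, hpinj, hb⟩ := int_family (fun s => (h s).eval r) hr'
  have hdeg : ∀ o : Option σ, ((o.elim X H : ℤ[X]).natDegree : ℤ) = ∑ i, ((Q i).natDegree : ℤ) * a o i := by
    intro o
    rw [hQa o, natDegree_prod_of_monic _ _ fun i _ => (hQm i).pow _]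
    push_cast
    refine Finset.sum_congr rfl fun i _ => ?_
    rw [(hQm i).natDegree_pow]
    push_cast
    ring
  refine ⟨r, N, ι, inferInstance, J, inferInstance, Q, p, fun s i => 2 * ((a (some s) i : ℤ) - (h s).natDegree * a none i),
    fun s j => 2 * (b s j : ℤ), hr, hQm, hQd, hQi, hQinj, hp, hpinj, fun s => ?_, fun α hα hne => ?_⟩
  · have h1 := hdeg none
    have h2 := hdeg (some s)
    simp only [Option.elim, natDegree_X, hHd] at h1 h2
    have : ∀ i, ((Q i).natDegree : ℤ) * (2 * ((a (some s) i : ℤ) - (h s).natDegree * a none i)) =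
      2 * (((Q i).natDegree : ℤ) * a (some s) i) - 2 * (h s).natDegree * (((Q i).natDegree : ℤ) * a none i) := fun i => by ring
    simp only [this, Finset.sum_sub_distrib, ← Finset.mul_sum]
    rw [← h1, ← h2]
    push_cast
    ring
  · have hα' : α - r ≠ 0 := sub_ne_zero.2 hα
    set z : ℂ := (N : ℂ) / (α - r) with hz
    have hz0 : z ≠ 0 := div_ne_zero (Int.cast_ne_zero.2 hr) hα'
    have hHz : ∀ s, aeval α (h s) * z ^ (h s).natDegree = (((h s).eval r : ℤ) : ℂ) * aeval z (H s) := by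
      intro s
      have := hHe s α hα
      rwa [← hc' s, ← hz] at this
    have hHne : ∀ s, aeval z (H s) ≠ 0 := by
      intro s h0
      have := hHz s
      rw [h0, mul_zero] at this
      exact mul_ne_zero (hne s) (pow_ne_zero _ hz0) this
    have hQne : ∀ j, aeval z (Q j) ≠ 0 := by
      intro j h0
      obtain ⟨t, ht⟩ := hQdv j
      have := congrArg (aeval z) ht
      rw [map_mul, h0, zero_mul, map_prod] at this
      refine Finset.prod_ne_zero_iff.2 (fun o _ => ?_) this
      cases o with
      | none => simpa using hz0
      | some s => exact hHne s
    refine ⟨hQne, fun s => ?_⟩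
    have e1 : aeval z (H s) = ∏ i, (aeval z (Q i)) ^ a (some s) i := by
      have := congrArg (aeval z) (hQa (some s))
      simpa [map_prod] using this
    have e2 : z = ∏ i, (aeval z (Q i)) ^ a none i := by
      have := congrArg (aeval z) (hQa none)
      simpa [map_prod] using this
    have e3 : (((h s).eval r : ℤ) : ℂ) ^ 2 = (∏ j, (p j : ℂ) ^ b s j) ^ 2 := by exact_mod_cast hb s
    have e4 : (∏ j, (p j : ℂ) ^ (2 * (b s j : ℤ))) = (∏ j, (p j : ℂ) ^ b s j) ^ 2 := by
      rw [← Finset.prod_pow]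
      refine Finset.prod_congr rfl fun j _ => ?_
      rw [mul_comm, zpow_mul, zpow_natCast]
      norm_cast
    have e5 : (∏ i, (aeval z (Q i)) ^ (2 * ((a (some s) i : ℤ) - (h s).natDegree * a none i))) * (z ^ (h s).natDegree) ^ 2 = aeval z (H s) ^ 2 := by
      have e6 : (z ^ (h s).natDegree) ^ 2 = ∏ i, (aeval z (Q i)) ^ (2 * ((h s).natDegree * a none i : ℤ)) := by
        conv_lhs => rw [e2]
        rw [← Finset.prod_pow, ← Finset.prod_pow]
        refine Finset.prod_congr rfl fun j _ => ?_
        rw [← pow_mul, ← pow_mul, ← zpow_natCast]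
        congr 1
        push_cast
        ring
      rw [e6, e1, ← Finset.prod_pow, ← Finset.prod_mul_distrib]
      refine Finset.prod_congr rfl fun j _ => ?_
      rw [← zpow_add₀ (hQne j), ← pow_mul, ← zpow_natCast]
      congr 1
      push_cast
      ring
    rw [e4, ← e3]
    have hzp : (z ^ (h s).natDegree) ^ 2 ≠ 0 := pow_ne_zero _ (pow_ne_zero _ hz0)
    apply mul_right_cancel₀ hzp
    rw [← mul_pow, hHz s, mul_pow, ← e5]
    ring

lemma red_coords {τ : Type} [Fintype τ] (f g : τ → ℤ[X]) (hf : ∀ s, f s ≠ 0) (hg : ∀ s, g s ≠ 0) :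
    ∃ (r N : ℤ) (ι : Type) (_ : Fintype ι) (J : Type) (_ : Fintype J) (Q : ι → ℤ[X]) (p : J → ℕ) (E : τ → ι → ℤ) (B : τ → J → ℤ),
      N ≠ 0 ∧ (∀ i, (Q i).Monic) ∧ (∀ i, 1 ≤ (Q i).natDegree) ∧ (∀ i, Irreducible (Q i)) ∧ Function.Injective Q ∧
      (∀ j, (p j).Prime) ∧ Function.Injective p ∧ (∀ s, ∑ i, ((Q i).natDegree : ℤ) * E s i = 0) ∧
      ∀ α : ℂ, α ≠ r → (∀ s, aeval α (f s) ≠ 0 ∧ aeval α (g s) ≠ 0) → (∀ j, aeval ((N : ℂ) / (α - r)) (Q j) ≠ 0) ∧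
        ∀ s, (aeval α (f s) / aeval α (g s)) ^ 2 = (∏ j, (aeval ((N : ℂ) / (α - r)) (Q j)) ^ E s j) * ∏ j, (p j : ℂ) ^ B s j := by
  obtain ⟨r, N, ι, i1, J, i2, Q, p, E, B, hN, hQm, hQd, hQi, hQinj, hp, hpinj, hE, h⟩ :=
    red_coords1 (σ := τ ⊕ τ) (Sum.elim f g) (by rintro (s | s); exacts [hf s, hg s])
  refine ⟨r, N, ι, i1, J, i2, Q, p, fun s i => E (Sum.inl s) i - E (Sum.inr s) i, fun s i => B (Sum.inl s) i - B (Sum.inr s) i,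
    hN, hQm, hQd, hQi, hQinj, hp, hpinj, fun s => ?_, fun α hα hne => ?_⟩
  · simp only [mul_sub, Finset.sum_sub_distrib, hE, sub_zero]
  · obtain ⟨h1, h2⟩ := h α hα (by rintro (s | s); exacts [(hne s).1, (hne s).2])
    refine ⟨h1, fun s => ?_⟩
    have hl := h2 (Sum.inl s)
    have hr := h2 (Sum.inr s)
    simp only [Sum.elim_inl, Sum.elim_inr] at hl hr
    rw [div_pow, hl, hr]
    simp only [fun j => zpow_sub₀ (h1 j), fun j => zpow_sub₀ (Nat.cast_ne_zero (R := ℂ).2 (hp j).ne_zero), Finset.prod_div_distrib]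
    rw [div_mul_div_comm]

lemma prod_swap {τ ι J : Type} [Fintype τ] [Fintype ι] [Fintype J] (q : ι → ℂ) (hq : ∀ i, q i ≠ 0) (p : J → ℂ) (hp : ∀ j, p j ≠ 0)
    (E : τ → ι → ℤ) (B : τ → J → ℤ) (x : τ → ℂ) (hx : ∀ s, x s ^ 2 = (∏ j, q j ^ E s j) * ∏ j, p j ^ B s j) (k : τ → ℤ) :
    (∏ s, x s ^ k s) ^ 2 = (∏ j, q j ^ (∑ s, k s * E s j)) * ∏ j, p j ^ (∑ s, k s * B s j) := by
  have h1 : ∀ {I : Type} [Fintype I] (q : I → ℂ) (_ : ∀ i, q i ≠ 0) (E : τ → I → ℤ),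
      ∏ s, (∏ j, q j ^ E s j) ^ k s = ∏ j, q j ^ (∑ s, k s * E s j) := by
    intro I _ q hq E
    simp only [← Finset.prod_zpow]
    rw [Finset.prod_comm]
    refine Finset.prod_congr rfl fun j _ => ?_
    classical
    have : ∀ S : Finset τ, ∏ s ∈ S, (q j ^ E s j) ^ k s = q j ^ ∑ s ∈ S, k s * E s j := by
      intro S
      induction S using Finset.induction_on with
      | empty => simp
      | insert a S ha ih => rw [Finset.prod_insert ha, Finset.sum_insert ha, ih, zpow_add₀ (hq j), ← zpow_mul, mul_comm (E a j)]
    exact this _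
  rw [← h1 q hq, ← h1 p hp, ← Finset.prod_mul_distrib, ← Finset.prod_pow]
  refine Finset.prod_congr rfl fun s _ => ?_
  rw [← mul_zpow, ← hx s, ← zpow_natCast, ← zpow_natCast, ← zpow_mul, ← zpow_mul, mul_comm]
end MZ
end

section
open Polynomial NumberField
namespace MZ

def EX {m : ℕ} (f g : Fin m → ℤ[X]) : Set ℂ :=
  {α | (∀ i, aeval α (f i) ≠ 0 ∧ aeval α (g i) ≠ 0) ∧ ∃ k l : Fin m → ℤ, LinearIndependent ℤ ![k, l] ∧
    aeval α (FF f g k) = 0 ∧ aeval α (FF f g l) = 0}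

lemma rel_iffC {m : ℕ} (f g : Fin m → ℤ[X]) (α : ℂ) (hα : ∀ i, aeval α (f i) ≠ 0 ∧ aeval α (g i) ≠ 0) (k : Fin m → ℤ) :
    ∏ i, (aeval α (f i) / aeval α (g i)) ^ k i = 1 ↔ aeval α (FF f g k) = 0 :=
  rel_iff (aeval α : ℤ[X] →ₐ[ℤ] ℂ).toRingHom f g k (fun i => (hα i).1) (fun i => (hα i).2)

lemma EX_finite {m : ℕ} (f g : Fin m → ℤ[X]) (hf : ∀ i, f i ≠ 0) (hg : ∀ i, g i ≠ 0)
    (hF : ∀ k : Fin m → ℤ, k ≠ 0 → FF f g k ≠ 0) : (EX f g).Finite := by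
  classical
  obtain ⟨r, N, ι, i1, J, i2, Q, p, E, B, hN, hQm, hQd, hQi, hQinj, hp, hpinj, hE, h⟩ := red_coords f g hf hg
  have hfin := main_finite Q hQm hQd hQi hQinj p hp hpinj
  have hp0 : ∀ j, (p j : ℂ) ≠ 0 := fun j => Nat.cast_ne_zero.2 (hp j).ne_zero
  have hsub : EX f g ⊆ {(r : ℂ)} ∪ ({(r : ℂ)}ᶜ ∩ (fun α : ℂ => (N : ℂ) / (α - r)) ⁻¹' {α : ℂ | TwoRel Q p α}) := by
    intro α hα
    by_cases hαr : α = r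
    · exact Or.inl hαr
    refine Or.inr ⟨hαr, ?_⟩
    obtain ⟨hne, k, l, hkl, hk, hl⟩ := hα
    obtain ⟨hQne, hsq⟩ := h α hαr hne
    have hk0 : k ≠ 0 := hkl.ne_zero 0
    have hαalg : IsAlgebraic ℚ α := by
      have h1 : IsAlgebraic ℤ α := ⟨FF f g k, hF k hk0, hk⟩
      exact h1.extendScalars (RingHom.injective_int (algebraMap ℤ ℚ))
    have hk1 := (rel_iffC f g α hne k).2 hk
    have hl1 := (rel_iffC f g α hne l).2 hl
    have hsw := fun k => prod_swap (fun j => aeval ((N : ℂ) / (α - r)) (Q j)) hQne (fun j => (p j : ℂ)) hp0 E B _ hsq k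
    refine ⟨?_, hQne, fun j => ∑ s, k s * E s j, fun j => ∑ s, l s * E s j, fun j => ∑ s, k s * B s j, fun j => ∑ s, l s * B s j,
      ?_, ⟨?_, ?_⟩, ?_, ?_⟩
    · have a1 : IsAlgebraic ℚ (N : ℂ) := isAlgebraic_int N
      have a2 : IsAlgebraic ℚ (r : ℂ) := isAlgebraic_int r
      change IsAlgebraic ℚ ((N : ℂ) / (α - r))
      rw [div_eq_mul_inv]
      exact a1.mul (hαalg.sub a2).inv
    · by_contra hcon
      push Not at hcon
      obtain ⟨x, y, hxy, hxy0⟩ : ∃ x y : ℤ, ¬ (x = 0 ∧ y = 0) ∧ ∀ j, x * (∑ s, k s * E s j) + y * (∑ s, l s * E s j) = 0 := by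
        by_cases hK : ∀ j, ∑ s, k s * E s j = 0
        · exact ⟨1, 0, by simp, fun j => by simp [hK j]⟩
        · push Not at hK
          obtain ⟨j0, hj0⟩ := hK
          refine ⟨∑ s, l s * E s j0, -∑ s, k s * E s j0, fun hc => hj0 (neg_eq_zero.1 hc.2), fun j => ?_⟩
          have := hcon j j0
          linear_combination this
      set n : Fin m → ℤ := x • k + y • l with hn
      have hn0 : n ≠ 0 := by
        intro h0
        exact hxy (LinearIndependent.pair_iff.1 hkl x y h0)
      have hnE : ∀ j, ∑ s, n s * E s j = 0 := by
        intro j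
        rw [← hxy0 j, Finset.mul_sum, Finset.mul_sum, ← Finset.sum_add_distrib]
        refine Finset.sum_congr rfl fun s _ => ?_
        simp [hn]; ring
      have hnα : ∏ i, (aeval α (f i) / aeval α (g i)) ^ n i = 1 := by
        have : ∀ i, (aeval α (f i) / aeval α (g i)) ^ n i =
            ((aeval α (f i) / aeval α (g i)) ^ k i) ^ x * ((aeval α (f i) / aeval α (g i)) ^ l i) ^ y := by
          intro i
          rw [← zpow_mul, ← zpow_mul, ← zpow_add₀ (div_ne_zero (hne i).1 (hne i).2)]
          congr 1
          simp [hn]; ring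
        simp only [this, Finset.prod_mul_distrib, Finset.prod_zpow]
        rw [hk1, hl1]; simp
      have hc := hsw n
      simp only [hnE, zpow_zero, Finset.prod_const_one, one_mul] at hc
      rw [hnα, one_pow] at hc
      set P : ℤ[X] := ((X - C r) * ∏ i, (f i * g i)) with hP
      have hP0 : P ≠ 0 := mul_ne_zero (X_sub_C_ne_zero r) (Finset.prod_ne_zero_iff.2 fun i _ => mul_ne_zero (hf i) (hg i))
      have hn2 : (2 • n : Fin m → ℤ) ≠ 0 := smul_ne_zero two_ne_zero hn0
      have hF2 := hF _ hn2
      have hall : ∀ β : ℂ, aeval β (FF f g (2 • n) * P) = 0 := by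
        intro β
        rw [map_mul]
        by_cases hβ : aeval β P = 0
        · rw [hβ, mul_zero]
        · rw [hP, map_mul, map_prod] at hβ
          have hβ1 := left_ne_zero_of_mul hβ
          have hβ2 := Finset.prod_ne_zero_iff.1 (right_ne_zero_of_mul hβ)
          have hβr : β ≠ r := by
            rintro rfl
            simp at hβ1
          have hβne : ∀ i, aeval β (f i) ≠ 0 ∧ aeval β (g i) ≠ 0 := fun i => by
            have := hβ2 i (Finset.mem_univ i)
            rw [map_mul] at this
            exact ⟨left_ne_zero_of_mul this, right_ne_zero_of_mul this⟩
          obtain ⟨hQβ, hsβ⟩ := h β hβr hβne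
          have hs2 := prod_swap (fun j => aeval ((N : ℂ) / (β - r)) (Q j)) hQβ (fun j => (p j : ℂ)) hp0 E B _ hsβ n
          simp only [hnE, zpow_zero, Finset.prod_const_one, one_mul] at hs2
          rw [← hc, ← Finset.prod_pow] at hs2
          rw [(rel_iffC f g β hβne (2 • n)).1, zero_mul]
          rw [← hs2]
          refine Finset.prod_congr rfl fun i _ => ?_
          rw [← zpow_natCast, ← zpow_mul]
          congr 1
          simp; ring
      have : (FF f g (2 • n) * P).map (algebraMap ℤ ℂ) = 0 := by
        refine Polynomial.funext fun β => ?_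
        rw [eval_map_algebraMap, hall β, eval_zero]
      rw [Polynomial.map_eq_zero_iff (RingHom.injective_int _)] at this
      exact mul_ne_zero hF2 hP0 this
    · simp only [Finset.mul_sum]
      rw [Finset.sum_comm]
      refine Finset.sum_eq_zero fun s _ => ?_
      rw [← mul_zero (k s), ← hE s, Finset.mul_sum]
      exact Finset.sum_congr rfl fun i _ => by ring
    · simp only [Finset.mul_sum]
      rw [Finset.sum_comm]
      refine Finset.sum_eq_zero fun s _ => ?_
      rw [← mul_zero (l s), ← hE s, Finset.mul_sum]
      exact Finset.sum_congr rfl fun i _ => by ring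
    · have := hsw k
      rw [hk1, one_pow] at this
      exact this.symm
    · have := hsw l
      rw [hl1, one_pow] at this
      exact this.symm
  refine Set.Finite.subset (Set.Finite.union (Set.finite_singleton _) ?_) hsub
  rw [Set.inter_comm]
  refine Set.Finite.of_finite_image (f := fun α : ℂ => (N : ℂ) / (α - r)) (hfin.subset ?_) ?_
  · rintro _ ⟨α, hα, rfl⟩
    exact hα.1
  · intro a ha b hb hab
    have ha' : a - r ≠ 0 := sub_ne_zero.2 ha.2
    have hb' : b - r ≠ 0 := sub_ne_zero.2 hb.2
    have hN' : (N : ℂ) ≠ 0 := Int.cast_ne_zero.2 hN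
    simp only at hab
    rw [div_eq_div_iff ha' hb'] at hab
    have := mul_left_cancel₀ hN' hab
    linear_combination -this
end MZ
end

section
open Polynomial NumberField
namespace MZ

noncomputable def MM (W : ℤ[X]) : ℝ := (W.map (Int.castRingHom ℂ)).mahlerMeasure

lemma MM_one_le {W : ℤ[X]} (h : W ≠ 0) : 1 ≤ MM W := one_le_mahlerMeasure_of_ne_zero h

lemma MM_mul (A B : ℤ[X]) : MM (A * B) = MM A * MM B := by
  unfold MM; rw [Polynomial.map_mul, mahlerMeasure_mul]

lemma MM_le_l1 (W : ℤ[X]) : MM W ≤ l1 W := by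
  refine (mahlerMeasure_le_sum_norm_coeff _).trans (le_of_eq ?_)
  rw [Polynomial.sum_over_range' _ (by simp) (W.natDegree + 1) (Nat.lt_succ_of_le natDegree_map_le),
    l1_eq W _ (Nat.lt_succ_self _)]
  refine Finset.sum_congr rfl fun i _ => ?_
  rw [coeff_map, eq_intCast, Complex.norm_intCast]

lemma norm_eval_le (W : ℤ[X]) (β : ℂ) :
    ‖(W.map (Int.castRingHom ℂ)).eval β‖ ≤ 2 ^ W.natDegree * MM W * max 1 ‖β‖ ^ W.natDegree := by
  have hd : (W.map (Int.castRingHom ℂ)).natDegree = W.natDegree := natDegree_map_eq_of_injective (RingHom.injective_int _) _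
  rw [eval_eq_sum_range, hd]
  refine (norm_sum_le _ _).trans ?_
  have h1 : ∀ i ∈ Finset.range (W.natDegree + 1), ‖(W.map (Int.castRingHom ℂ)).coeff i * β ^ i‖ ≤
      (W.natDegree.choose i : ℝ) * (MM W * max 1 ‖β‖ ^ W.natDegree) := by
    intro i hi
    rw [Finset.mem_range] at hi
    have h2 := norm_coeff_le_choose_mul_mahlerMeasure i (W.map (Int.castRingHom ℂ))
    rw [hd] at h2
    have h3 : ‖β‖ ^ i ≤ max 1 ‖β‖ ^ W.natDegree :=
      (pow_le_pow_left₀ (norm_nonneg _) (le_max_right 1 _) i).trans (pow_le_pow_right₀ (le_max_left _ _) (by omega))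
    rw [norm_mul, norm_pow, ← mul_assoc]
    exact mul_le_mul h2 h3 (by positivity) ((norm_nonneg _).trans h2)
  refine (Finset.sum_le_sum h1).trans (le_of_eq ?_)
  rw [← Finset.sum_mul, ← Nat.cast_sum, Nat.sum_range_choose]
  push_cast; ring

lemma res_bound (A B : ℤ[X]) :
    |((resultant A B : ℤ) : ℝ)| ≤ MM A ^ B.natDegree * (2 ^ B.natDegree * MM B) ^ A.natDegree := by
  have hi := RingHom.injective_int (Int.castRingHom ℂ)
  have hA : (A.map (Int.castRingHom ℂ)).natDegree = A.natDegree := natDegree_map_eq_of_injective hi _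
  have hB : (B.map (Int.castRingHom ℂ)).natDegree = B.natDegree := natDegree_map_eq_of_injective hi _
  have hsp : (A.map (Int.castRingHom ℂ)).Splits := IsAlgClosed.splits _
  have h1 := resultant_eq_prod_eval (A.map (Int.castRingHom ℂ)) (B.map (Int.castRingHom ℂ)) B.natDegree hB.le hsp
  rw [hA, resultant_map_map] at h1
  have h2 : |((resultant A B : ℤ) : ℝ)| = ‖(Int.castRingHom ℂ) (resultant A B)‖ := by
    rw [eq_intCast, Complex.norm_intCast]
  rw [h2, h1, norm_mul, norm_pow]
  have hMA : MM A = ‖(A.map (Int.castRingHom ℂ)).leadingCoeff‖ * ((A.map (Int.castRingHom ℂ)).roots.map (fun a => max 1 ‖a‖)).prod :=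
    mahlerMeasure_eq_leadingCoeff_mul_prod_roots _
  have hcard : Multiset.card (A.map (Int.castRingHom ℂ)).roots = A.natDegree := by
    rw [← hA]; exact hsp.natDegree_eq_card_roots.symm
  have hMB : 0 ≤ MM B := mahlerMeasure_nonneg _
  have key : ∀ s : Multiset ℂ, ‖(s.map (fun x => eval x (B.map (Int.castRingHom ℂ)))).prod‖ ≤
      (2 ^ B.natDegree * MM B) ^ Multiset.card s * ((s.map (fun a => max 1 ‖a‖)).prod) ^ B.natDegree := by
    intro s
    induction s using Multiset.induction_on with
    | empty => simp
    | cons a s ih =>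
      rw [Multiset.map_cons, Multiset.prod_cons, Multiset.map_cons, Multiset.prod_cons, Multiset.card_cons, norm_mul]
      refine (mul_le_mul (norm_eval_le B a) ih (norm_nonneg _) (by positivity)).trans (le_of_eq ?_)
      rw [mul_pow, pow_succ]; ring
  have := mul_le_mul_of_nonneg_left (key (A.map (Int.castRingHom ℂ)).roots)
    (pow_nonneg (norm_nonneg (A.map (Int.castRingHom ℂ)).leadingCoeff) B.natDegree)
  refine this.trans (le_of_eq ?_)
  rw [hcard, hMA, mul_pow]; ring

lemma isCoprime_of_isRelPrime_int (A B : ℤ[X]) (hA : A ≠ 0) (h : IsRelPrime A B) :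
    IsCoprime (A.map (Int.castRingHom ℚ)) (B.map (Int.castRingHom ℚ)) := by
  refine IsRelPrime.isCoprime fun d hdA hdB => ?_
  have hA' : A.map (Int.castRingHom ℚ) ≠ 0 := (Polynomial.map_ne_zero_iff (RingHom.injective_int _)).2 hA
  have hd0 : d ≠ 0 := ne_zero_of_dvd_ne_zero hA' hdA
  obtain ⟨b, hb⟩ := IsLocalization.integerNormalization_map_to_map (nonZeroDivisors ℤ) d
  set D := IsLocalization.integerNormalization (nonZeroDivisors ℤ) d with hD
  have hb0 : ((b : ℤ) : ℚ) ≠ 0 := Int.cast_ne_zero.2 (nonZeroDivisors.coe_ne_zero b)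
  have hb' : D.map (Int.castRingHom ℚ) = C ((b : ℤ) : ℚ) * d := by
    have : D.map (Int.castRingHom ℚ) = (b : ℤ) • d := hb
    rw [this, zsmul_eq_mul]; simp
  have hD0 : D ≠ 0 := by
    intro h0
    rw [h0, Polynomial.map_zero] at hb'
    exact mul_ne_zero (C_ne_zero.2 hb0) hd0 hb'.symm
  have hdv : D.primPart.map (Int.castRingHom ℚ) ∣ d := by
    have h1 : D.primPart.map (Int.castRingHom ℚ) ∣ D.map (Int.castRingHom ℚ) := Polynomial.map_dvd _ (primPart_dvd D)
    rw [hb'] at h1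
    exact (IsUnit.dvd_mul_left (isUnit_C.2 (isUnit_iff_ne_zero.2 hb0))).1 h1
  have hu : IsUnit D.primPart := h
    ((IsPrimitive.Int.dvd_iff_map_cast_dvd_map_cast _ _ D.isPrimitive_primPart).2 (hdv.trans hdA))
    ((IsPrimitive.Int.dvd_iff_map_cast_dvd_map_cast _ _ D.isPrimitive_primPart).2 (hdv.trans hdB))
  have hdeg : d.natDegree = 0 := by
    have h1 : (D.map (Int.castRingHom ℚ)).natDegree = d.natDegree := by rw [hb', natDegree_C_mul hb0]
    rw [← h1, natDegree_map_eq_of_injective (RingHom.injective_int _), ← natDegree_primPart]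
    exact natDegree_eq_zero_of_isUnit hu
  rw [eq_C_of_natDegree_eq_zero hdeg] at hd0 ⊢
  exact isUnit_C.2 (isUnit_iff_ne_zero.2 (C_ne_zero.1 hd0))

lemma primPart_dvd_pow (G B : ℤ[X]) (hG : G ≠ 0) (h : ∀ α : ℂ, aeval α G = 0 → aeval α B = 0) :
    ∃ e : ℕ, G.primPart ∣ B ^ e := by
  have hG' : G.map (Int.castRingHom ℂ) ≠ 0 := (Polynomial.map_ne_zero_iff (RingHom.injective_int _)).2 hG
  have hsp : (G.map (Int.castRingHom ℂ)).Splits := IsAlgClosed.splits _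
  have key : ∀ s : Multiset ℂ, (∀ a ∈ s, (B.map (Int.castRingHom ℂ)).eval a = 0) →
      (s.map (fun a => X - C a)).prod ∣ (B.map (Int.castRingHom ℂ)) ^ Multiset.card s := by
    intro s
    induction s using Multiset.induction_on with
    | empty => simp
    | cons a s ih =>
      intro hs
      rw [Multiset.map_cons, Multiset.prod_cons, Multiset.card_cons, pow_succ, mul_comm]
      exact mul_dvd_mul (ih fun b hb => hs b (Multiset.mem_cons_of_mem hb)) (dvd_iff_isRoot.2 (hs a (Multiset.mem_cons_self a s)))
  refine ⟨Multiset.card (G.map (Int.castRingHom ℂ)).roots, ?_⟩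
  have h1 : G.map (Int.castRingHom ℂ) ∣ (B.map (Int.castRingHom ℂ)) ^ Multiset.card (G.map (Int.castRingHom ℂ)).roots := by
    conv_lhs => rw [hsp.eq_prod_roots]
    refine (IsUnit.mul_left_dvd (isUnit_C.2 (isUnit_iff_ne_zero.2 (leadingCoeff_ne_zero.2 hG')))).2 (key _ fun a ha => ?_)
    have h2 := isRoot_of_mem_roots ha
    rw [IsRoot.def] at h2
    have h3 := h a (by rw [← h2, eval_map]; rfl)
    rw [← h3, eval_map]; rfl
  have h2 : G.primPart.map (Int.castRingHom ℂ) ∣ (B ^ Multiset.card (G.map (Int.castRingHom ℂ)).roots).map (Int.castRingHom ℂ) := by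
    rw [Polynomial.map_pow]
    exact (Polynomial.map_dvd _ (primPart_dvd G)).trans h1
  rw [IsPrimitive.Int.dvd_iff_map_cast_dvd_map_cast _ _ G.isPrimitive_primPart]
  rw [← Polynomial.map_dvd_map' (algebraMap ℚ ℂ), Polynomial.map_map, Polynomial.map_map]
  have : (algebraMap ℚ ℂ).comp (Int.castRingHom ℚ) = Int.castRingHom ℂ := RingHom.ext_int _ _
  rwa [this]

lemma modp_key (B U V : ℤ[X]) (hU : U ≠ 0) (hV : V ≠ 0)
    (hroot : ∀ α : ℂ, aeval α U = 0 → aeval α V = 0 → aeval α B = 0) :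
    ∃ R c : ℤ, R ≠ 0 ∧ c ≠ 0 ∧ |(c : ℝ)| ≤ l1 U ∧
      |(R : ℝ)| ≤ (l1 U) ^ (V.natDegree + 1) * (2 ^ V.natDegree * l1 V) ^ U.natDegree ∧
      ∀ (E : Type) [Field E] (φ : ℤ[X] →+* E), φ (C R) ≠ 0 → φ (C c) ≠ 0 → φ U = 0 → φ V = 0 → φ B = 0 := by
  obtain ⟨A1, A2, G, hrel, h1, h2⟩ := UniqueFactorizationMonoid.exists_reduced_factors U hU V
  have hG0 : G ≠ 0 := by rintro rfl; rw [zero_mul] at h1; exact hU h1.symm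
  have hA1 : A1 ≠ 0 := by rintro rfl; rw [mul_zero] at h1; exact hU h1.symm
  have hA2 : A2 ≠ 0 := by rintro rfl; rw [mul_zero] at h2; exact hV h2.symm
  obtain ⟨e, he⟩ := primPart_dvd_pow G B hG0 (fun α hα => hroot α (by rw [← h1, map_mul, hα, zero_mul]) (by rw [← h2, map_mul, hα, zero_mul]))
  have hcop := isCoprime_of_isRelPrime_int A1 A2 hA1 hrel
  have hi := RingHom.injective_int (Int.castRingHom ℚ)
  have hR0 : resultant A1 A2 ≠ 0 := by
    intro h0
    have := resultant_ne_zero _ _ hcop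
    rw [natDegree_map_eq_of_injective hi, natDegree_map_eq_of_injective hi, resultant_map_map, h0, map_zero] at this
    exact this rfl
  have hc0 : G.content ≠ 0 := by rwa [Ne, content_eq_zero_iff]
  have hM1 : MM A1 ≤ l1 U := by
    refine le_trans ?_ (MM_le_l1 U)
    rw [← h1, MM_mul]
    exact le_mul_of_one_le_left (by linarith [MM_one_le hA1]) (MM_one_le hG0)
  have hM2 : MM A2 ≤ l1 V := by
    refine le_trans ?_ (MM_le_l1 V)
    rw [← h2, MM_mul]
    exact le_mul_of_one_le_left (by linarith [MM_one_le hA2]) (MM_one_le hG0)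
  have hd1 : A1.natDegree ≤ U.natDegree := natDegree_le_of_dvd ⟨G, by rw [← h1, mul_comm]⟩ hU
  have hd2 : A2.natDegree ≤ V.natDegree := natDegree_le_of_dvd ⟨G, by rw [← h2, mul_comm]⟩ hV
  have hlU : 1 ≤ l1 U := (MM_one_le hA1).trans hM1
  have hlV : 1 ≤ l1 V := (MM_one_le hA2).trans hM2
  have h2V : 1 ≤ 2 ^ V.natDegree * l1 V := one_le_mul_of_one_le_of_one_le (one_le_pow₀ (by norm_num)) hlV
  have hfin : ∀ (E : Type) [Field E] (φ : ℤ[X] →+* E), φ (C G.content) ≠ 0 → φ G = 0 → φ B = 0 := by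
    intro E _ φ hc hG
    rw [G.eq_C_content_mul_primPart, map_mul] at hG
    have hp := (mul_eq_zero.1 hG).resolve_left hc
    obtain ⟨t, ht⟩ := he
    have := congrArg φ ht
    rw [map_mul, hp, zero_mul, map_pow] at this
    exact eq_zero_of_pow_eq_zero this
  have hcb : |(G.content : ℝ)| ≤ l1 U := by
    have hdvd : G.content ∣ U.leadingCoeff := by
      refine (content_dvd_coeff (p := G) G.natDegree).trans ?_
      rw [← h1, leadingCoeff_mul]; exact dvd_mul_right _ _
    have h3 : |G.content| ≤ |U.leadingCoeff| := Int.le_of_dvd (abs_pos.2 (leadingCoeff_ne_zero.2 hU)) (abs_dvd_abs _ _ |>.2 hdvd)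
    have h4 : |(U.leadingCoeff : ℝ)| ≤ l1 U := by
      rw [l1_eq U _ (Nat.lt_succ_self _)]
      exact Finset.single_le_sum (f := fun i => |(U.coeff i : ℝ)|) (fun _ _ => abs_nonneg _) (Finset.mem_range.2 (Nat.lt_succ_self _))
    refine le_trans ?_ h4
    exact_mod_cast h3
  by_cases hdeg : A1.natDegree ≠ 0 ∨ A2.natDegree ≠ 0
  · refine ⟨resultant A1 A2, G.content, hR0, hc0, hcb, ?_, ?_⟩
    · refine (res_bound A1 A2).trans ?_
      have hMM1 := MM_one_le hA1
      have hMM2 := MM_one_le hA2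
      have b1 : MM A1 ^ A2.natDegree ≤ l1 U ^ (V.natDegree + 1) :=
        (pow_le_pow_left₀ (by linarith) hM1 _).trans (pow_le_pow_right₀ hlU (by omega))
      have b2 : (2 ^ A2.natDegree * MM A2) ^ A1.natDegree ≤ (2 ^ V.natDegree * l1 V) ^ U.natDegree := by
        refine (pow_le_pow_left₀ (by positivity) ?_ _).trans (pow_le_pow_right₀ h2V hd1)
        exact mul_le_mul (pow_le_pow_right₀ (by norm_num) hd2) hM2 (by linarith) (by positivity)
      exact mul_le_mul b1 b2 (by positivity) (by positivity)
    · intro E _ φ hR hc hUφ hVφ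
      by_cases hGφ : φ G = 0
      · exact hfin E φ hc hGφ
      · rw [← h1, map_mul] at hUφ
        rw [← h2, map_mul] at hVφ
        have e1 := (mul_eq_zero.1 hUφ).resolve_left hGφ
        have e2 := (mul_eq_zero.1 hVφ).resolve_left hGφ
        obtain ⟨x, y, -, -, hxy⟩ := exists_mul_add_mul_eq_C_resultant A1 A2 le_rfl le_rfl hdeg
        refine absurd ?_ hR
        rw [← hxy, map_add, map_mul, map_mul, e1, e2]; ring
  · push Not at hdeg
    have hA1c := eq_C_of_natDegree_eq_zero hdeg.1
    refine ⟨A1.coeff 0, G.content, ?_, hc0, hcb, ?_, ?_⟩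
    · intro h0; rw [h0, C_0] at hA1c; exact hA1 hA1c
    · have b0 : |(A1.coeff 0 : ℝ)| ≤ MM A1 := by
        have := norm_coeff_le_choose_mul_mahlerMeasure 0 (A1.map (Int.castRingHom ℂ))
        rw [coeff_map, eq_intCast, Complex.norm_intCast] at this
        simpa [MM] using this
      have b1 : l1 U ≤ l1 U ^ (V.natDegree + 1) := le_self_pow₀ hlU (by omega)
      have b2 : 1 ≤ (2 ^ V.natDegree * l1 V) ^ U.natDegree := one_le_pow₀ h2V
      exact ((b0.trans hM1).trans b1).trans (le_mul_of_one_le_right (by positivity) b2)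
    · intro E _ φ hR hc hUφ hVφ
      by_cases hGφ : φ G = 0
      · exact hfin E φ hc hGφ
      · rw [← h1, map_mul] at hUφ
        have e1 := (mul_eq_zero.1 hUφ).resolve_left hGφ
        rw [hA1c] at e1
        exact absurd e1 hR
end MZ
end

section
open Polynomial NumberField
namespace MZ

lemma l1_pow (A : ℤ[X]) (n : ℕ) : l1 (A ^ n) ≤ l1 A ^ n := by
  have := l1_prod (Finset.range n) (fun _ => A)
  simpa using this

lemma PP_l1 {m : ℕ} (f g : Fin m → ℤ[X]) (k : Fin m → ℤ) (K : ℕ) (hk : ∀ i, |k i| ≤ (K : ℤ)) :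
    l1 (PP f g k) ≤ (∏ i, ((1 + l1 (f i)) * (1 + l1 (g i)))) ^ K := by
  refine (l1_prod _ _).trans ?_
  rw [← Finset.prod_pow]
  refine Finset.prod_le_prod (fun i _ => l1_nonneg _) fun i _ => ?_
  have ha := abs_le.1 (hk i)
  have h1 := l1_nonneg (f i)
  have h2 := l1_nonneg (g i)
  refine (l1_mul _ _).trans ?_
  rw [mul_pow]
  refine mul_le_mul ?_ ?_ (l1_nonneg _) (by positivity)
  · exact (l1_pow _ _).trans ((pow_le_pow_left₀ h1 (by linarith) _).trans (pow_le_pow_right₀ (by linarith) (by omega)))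
  · exact (l1_pow _ _).trans ((pow_le_pow_left₀ h2 (by linarith) _).trans (pow_le_pow_right₀ (by linarith) (by omega)))

lemma PP_deg {m : ℕ} (f g : Fin m → ℤ[X]) (k : Fin m → ℤ) (K : ℕ) (hk : ∀ i, |k i| ≤ (K : ℤ)) :
    (PP f g k).natDegree ≤ K * ∑ i, ((f i).natDegree + (g i).natDegree) := by
  refine (natDegree_prod_le _ _).trans ?_
  rw [Finset.mul_sum]
  refine Finset.sum_le_sum fun i _ => ?_
  have ha := abs_le.1 (hk i)
  refine natDegree_mul_le.trans ?_
  rw [mul_add]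
  exact add_le_add (natDegree_pow_le.trans (Nat.mul_le_mul_right _ (by omega))) (natDegree_pow_le.trans (Nat.mul_le_mul_right _ (by omega)))

lemma FF_l1 {m : ℕ} (f g : Fin m → ℤ[X]) (k : Fin m → ℤ) (K : ℕ) (hK : 1 ≤ K) (hk : ∀ i, |k i| ≤ (K : ℤ)) :
    l1 (FF f g k) ≤ (2 * ∏ i, ((1 + l1 (f i)) * (1 + l1 (g i)))) ^ K := by
  have h1 := PP_l1 f g k K hk
  have h2 := PP_l1 g f k K hk
  have h3 : ∏ i, ((1 + l1 (g i)) * (1 + l1 (f i))) = ∏ i, ((1 + l1 (f i)) * (1 + l1 (g i))) :=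
    Finset.prod_congr rfl fun i _ => mul_comm _ _
  rw [h3] at h2
  unfold FF
  rw [sub_eq_add_neg]
  refine (l1_add _ _).trans ?_
  rw [l1_neg, mul_pow]
  have h4 : (2:ℝ) ≤ 2 ^ K := le_self_pow₀ (by norm_num) (by omega)
  have h5 : 0 ≤ (∏ i, ((1 + l1 (f i)) * (1 + l1 (g i)))) ^ K := (l1_nonneg _).trans h1
  nlinarith

lemma FF_deg {m : ℕ} (f g : Fin m → ℤ[X]) (k : Fin m → ℤ) (K : ℕ) (hk : ∀ i, |k i| ≤ (K : ℤ)) :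
    (FF f g k).natDegree ≤ K * ∑ i, ((f i).natDegree + (g i).natDegree) := by
  have h1 := PP_deg f g k K hk
  have h2 := PP_deg g f k K hk
  have h3 : ∑ i, ((g i).natDegree + (f i).natDegree) = ∑ i, ((f i).natDegree + (g i).natDegree) :=
    Finset.sum_congr rfl fun i _ => add_comm _ _
  rw [h3] at h2
  exact (natDegree_sub_le _ _).trans (max_le h1 h2)

lemma exists_B {m : ℕ} (f g : Fin m → ℤ[X]) (hf : ∀ i, f i ≠ 0) (hg : ∀ i, g i ≠ 0)
    (hF : ∀ k : Fin m → ℤ, k ≠ 0 → FF f g k ≠ 0) :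
    ∃ B : ℤ[X], B ≠ 0 ∧ ∀ k l : Fin m → ℤ, LinearIndependent ℤ ![k, l] → ∀ α : ℂ, aeval α (FF f g k) = 0 → aeval α (FF f g l) = 0 →
      aeval α B = 0 := by
  classical
  have hfin := EX_finite f g hf hg hF
  have hq : ∀ α : ℂ, ∃ q : ℤ[X], q ≠ 0 ∧ (α ∈ EX f g → aeval α q = 0) := by
    intro α
    by_cases h : α ∈ EX f g
    · obtain ⟨-, k, l, hkl, hk, hl⟩ := h
      exact ⟨FF f g k, hF k (hkl.ne_zero 0), fun _ => hk⟩
    · exact ⟨1, one_ne_zero, fun h' => absurd h' h⟩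
  choose q hq0 hq1 using hq
  refine ⟨(∏ i, (f i * g i)) * ∏ α ∈ hfin.toFinset, q α, mul_ne_zero (Finset.prod_ne_zero_iff.2 fun i _ => mul_ne_zero (hf i) (hg i))
    (Finset.prod_ne_zero_iff.2 fun α _ => hq0 α), fun k l hkl α hk hl => ?_⟩
  rw [map_mul]
  by_cases h : ∀ i, aeval α (f i) ≠ 0 ∧ aeval α (g i) ≠ 0
  · have hα : α ∈ EX f g := ⟨h, k, l, hkl, hk, hl⟩
    rw [map_prod (aeval α) q, Finset.prod_eq_zero (hfin.mem_toFinset.2 hα) (hq1 α hα), mul_zero]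
  · have : ∃ i, aeval α (f i * g i) = 0 := by
      by_contra hcon
      push Not at hcon
      exact h fun i => by
        have := hcon i
        rw [map_mul] at this
        exact ⟨left_ne_zero_of_mul this, right_ne_zero_of_mul this⟩
    obtain ⟨i, hi⟩ := this
    rw [map_prod, Finset.prod_eq_zero (Finset.mem_univ i) hi, zero_mul]

lemma cast_ne_zero_of_lt (p : ℕ) (E : Type) [Field E] [CharP E p] (n : ℤ) (hn : n ≠ 0) (h : |(n : ℝ)| < p) : (n : E) ≠ 0 := by
  intro h0
  rw [CharP.intCast_eq_zero_iff E p] at h0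
  have h1 := Int.le_of_dvd (abs_pos.2 hn) ((dvd_abs _ _).2 h0)
  have h2 : |n| < (p : ℤ) := by exact_mod_cast h
  omega

lemma num_bound (Λ u v : ℝ) (hΛ : 2 ≤ Λ) (K L D a b : ℕ) (hK : 1 ≤ K) (hL : 1 ≤ L) (hu : 0 ≤ u) (hv : 0 ≤ v)
    (huK : u ≤ Λ ^ K) (hvL : v ≤ Λ ^ L) (ha : a ≤ K * D) (hb : b ≤ L * D) :
    u ^ (b + 1) * (2 ^ b * v) ^ a ≤ Λ ^ ((D + 1) ^ 2 * (K * L)) := by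
  have hΛ1 : 1 ≤ Λ := by linarith
  have a1 : u ^ (b + 1) ≤ Λ ^ (K * (L * D + 1)) := by
    rw [pow_mul]
    exact (pow_le_pow_left₀ hu huK _).trans (pow_le_pow_right₀ (one_le_pow₀ hΛ1) (by omega))
  have a3 : 2 ^ b * v ≤ Λ ^ (L * D + L) := by
    rw [pow_add]
    exact mul_le_mul ((pow_le_pow_left₀ (by norm_num) hΛ _).trans (pow_le_pow_right₀ hΛ1 hb)) hvL hv (by positivity)
  have a2 : (2 ^ b * v) ^ a ≤ Λ ^ ((L * D + L) * (K * D)) := by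
    rw [pow_mul]
    exact (pow_le_pow_left₀ (by positivity) a3 _).trans (pow_le_pow_right₀ (one_le_pow₀ hΛ1) ha)
  refine (mul_le_mul a1 a2 (by positivity) (by positivity)).trans ?_
  rw [← pow_add]
  refine pow_le_pow_right₀ hΛ1 ?_
  have h1 : K ≤ K * L := Nat.le_mul_of_pos_right _ hL
  nlinarith

lemma final_aux {m : ℕ} (f g : Fin m → ℤ[X]) (hf : ∀ i, f i ≠ 0) (hg : ∀ i, g i ≠ 0)
    (hF : ∀ k : Fin m → ℤ, k ≠ 0 → FF f g k ≠ 0) :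
    ∃ (c₁ : ℝ) (N : ℕ), ∀ K L : ℕ, 1 ≤ K → 1 ≤ L → ∀ (p : ℕ) (E : Type) [Field E] [CharP E p],
      Real.exp (c₁ * (K : ℝ) * (L : ℝ)) < (p : ℝ) → ∃ B : E[X], B ≠ 0 ∧ B.natDegree ≤ N ∧
      ∀ (α : E) (k l : Fin m → ℤ), LinearIndependent ℤ ![k, l] → (∀ i, |k i| ≤ (K : ℤ)) → (∀ i, |l i| ≤ (L : ℤ)) →
        eval₂RingHom (Int.castRingHom E) α (FF f g k) = 0 → eval₂RingHom (Int.castRingHom E) α (FF f g l) = 0 → B.eval α = 0 := by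
  obtain ⟨B, hB0, hB⟩ := exists_B f g hf hg hF
  set Λ : ℝ := 2 * ∏ i, ((1 + l1 (f i)) * (1 + l1 (g i))) with hΛ
  set D : ℕ := ∑ i, ((f i).natDegree + (g i).natDegree) with hD
  have hΛ1 : 1 ≤ Λ := by
    have : 1 ≤ ∏ i, ((1 + l1 (f i)) * (1 + l1 (g i))) := by
      refine Finset.prod_induction _ (fun x : ℝ => 1 ≤ x) (fun a b ha hb => one_le_mul_of_one_le_of_one_le ha hb) le_rfl fun i _ => ?_
      exact one_le_mul_of_one_le_of_one_le (by linarith [l1_nonneg (f i)]) (by linarith [l1_nonneg (g i)])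
    linarith
  have hΛ2 : 2 ≤ Λ := by
    have : 1 ≤ ∏ i, ((1 + l1 (f i)) * (1 + l1 (g i))) := by
      refine Finset.prod_induction _ (fun x : ℝ => 1 ≤ x) (fun a b ha hb => one_le_mul_of_one_le_of_one_le ha hb) le_rfl fun i _ => ?_
      exact one_le_mul_of_one_le_of_one_le (by linarith [l1_nonneg (f i)]) (by linarith [l1_nonneg (g i)])
    linarith
  set b : ℝ := |(B.leadingCoeff : ℝ)| + 1 with hb
  have hb1 : 1 ≤ b := by rw [hb]; linarith [abs_nonneg (B.leadingCoeff : ℝ)]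
  refine ⟨Real.log Λ * (D + 1) ^ 2 + Real.log b, B.natDegree, fun K L hK hL p E _ _ hp => ?_⟩
  have hKL : 1 ≤ K * L := Nat.mul_pos hK hL
  have hexp : Real.exp ((Real.log Λ * (D + 1) ^ 2 + Real.log b) * (K : ℝ) * (L : ℝ)) = Λ ^ ((D + 1) ^ 2 * (K * L)) * b ^ (K * L) := by
    rw [show (Real.log Λ * (D + 1) ^ 2 + Real.log b) * (K : ℝ) * (L : ℝ) =
      (((D + 1) ^ 2 * (K * L) : ℕ) : ℝ) * Real.log Λ + ((K * L : ℕ) : ℝ) * Real.log b by push_cast; ring,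
      Real.exp_add, Real.exp_nat_mul, Real.exp_nat_mul, Real.exp_log (by linarith), Real.exp_log (by linarith)]
  rw [hexp] at hp
  have hp1 : Λ ^ ((D + 1) ^ 2 * (K * L)) < p := lt_of_le_of_lt (le_mul_of_one_le_right (by positivity) (one_le_pow₀ hb1)) hp
  have hp2 : |(B.leadingCoeff : ℝ)| < p := by
    have h1 : b ≤ b ^ (K * L) := le_self_pow₀ hb1 (by omega)
    have h2 : b ^ (K * L) ≤ Λ ^ ((D + 1) ^ 2 * (K * L)) * b ^ (K * L) := le_mul_of_one_le_left (by positivity) (one_le_pow₀ hΛ1)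
    have h3 : |(B.leadingCoeff : ℝ)| < b := by rw [hb]; linarith
    linarith
  refine ⟨B.map (Int.castRingHom E), ?_, natDegree_map_le, fun α k l hkl hk hl hkα hlα => ?_⟩
  · intro h0
    have := congrArg (fun q => coeff q B.natDegree) h0
    simp only [coeff_map, coeff_zero, eq_intCast] at this
    exact cast_ne_zero_of_lt p E _ (leadingCoeff_ne_zero.2 hB0) hp2 this
  · have hk0 : k ≠ 0 := hkl.ne_zero 0
    have hl0 : l ≠ 0 := hkl.ne_zero 1
    obtain ⟨R, c, hR0, hc0, hcb, hRb, hkey⟩ := modp_key B _ _ (hF k hk0) (hF l hl0) (hB k l hkl)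
    have hUl := FF_l1 f g k K hK hk
    have hVl := FF_l1 f g l L hL hl
    have hUd := FF_deg f g k K hk
    have hVd := FF_deg f g l L hl
    rw [← hΛ] at hUl hVl
    rw [← hD] at hUd hVd
    have hcl : |(c : ℝ)| < p := by
      refine lt_of_le_of_lt (hcb.trans (hUl.trans (pow_le_pow_right₀ hΛ1 ?_))) hp1
      calc K = 1 * (K * 1) := by ring
        _ ≤ (D + 1) ^ 2 * (K * L) := Nat.mul_le_mul (Nat.one_le_pow _ _ (by omega)) (Nat.mul_le_mul_left _ hL)
    have hRl : |(R : ℝ)| < p := by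
      refine lt_of_le_of_lt (hRb.trans ?_) hp1
      exact num_bound Λ _ _ hΛ2 K L D _ _ hK hL (l1_nonneg _) (l1_nonneg _) hUl hVl hUd hVd
    have := hkey E (eval₂RingHom (Int.castRingHom E) α) (by simpa using cast_ne_zero_of_lt p E R hR0 hRl)
      (by simpa using cast_ne_zero_of_lt p E c hc0 hcl) hkα hlα
    rw [eval_map]
    exact this
end MZ
end

theorem stmt_12 (m : ℕ) (hm : 0 < m) (f g : Fin m → Polynomial ℤ)
    (hf : ∀ i, f i ≠ 0) (hg : ∀ i, g i ≠ 0) (hcop : ∀ i, IsRelPrime (f i) (g i))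
    -- `φᵢ = fᵢ/gᵢ ∈ ℚ(X)` are multiplicatively independent
    (hindep : ∀ k : Fin m → ℤ,
      (∏ i, (algebraMap (Polynomial ℚ) (RatFunc ℚ) ((f i).map (Int.castRingHom ℚ)) /
        algebraMap (Polynomial ℚ) (RatFunc ℚ) ((g i).map (Int.castRingHom ℚ))) ^ (k i)) = 1 →
      k = 0) :
    ∃ c₁ C : ℝ, ∀ K L : ℕ, 1 ≤ K → 1 ≤ L → ∀ (p : ℕ) (_ : Fact p.Prime),
      Real.exp (c₁ * (K : ℝ) * (L : ℝ)) < (p : ℝ) →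
      (depSet m f g K L p).Finite ∧ ((depSet m f g K L p).ncard : ℝ) ≤ C := by
  classical
  obtain ⟨c₁, N, h⟩ := MZ.final_aux f g hf hg (MZ.FF_ne_zero f g hf hg hindep)
  refine ⟨c₁, N, fun K L hK hL p hp hlt => ?_⟩
  obtain ⟨B, hB0, hBd, hB⟩ := h K L hK hL p (AlgebraicClosure (ZMod p)) hlt
  have hsub : depSet m f g K L p ⊆ (B.roots.toFinset : Set (AlgebraicClosure (ZMod p))) := by
    rintro α ⟨hne, k, l, hkl, hk, hl, hrk, hrl⟩
    rw [Finset.mem_coe, Multiset.mem_toFinset, mem_roots hB0]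
    exact hB α k l hkl hk hl
      ((MZ.rel_iff (eval₂RingHom (Int.castRingHom (AlgebraicClosure (ZMod p))) α) f g k (fun i => (hne i).1) (fun i => (hne i).2)).1 hrk)
      ((MZ.rel_iff (eval₂RingHom (Int.castRingHom (AlgebraicClosure (ZMod p))) α) f g l (fun i => (hne i).1) (fun i => (hne i).2)).1 hrl)
  refine ⟨(Finset.finite_toSet _).subset hsub, ?_⟩
  have h1 := Set.ncard_le_ncard hsub (Finset.finite_toSet _)
  rw [Set.ncard_coe_finset] at h1
  have h2 := (Multiset.toFinset_card_le B.roots).trans (card_roots' B)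
  exact_mod_cast h1.trans (h2.trans hBd)
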